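/- For every integer m ≥ 3, S(m) < (m − 1)·e^{m+1}. -/

import Mathlib

/-- The k-th prime, 1-indexed: `nthPrime 1 = 2`. -/
noncomputable def nthPrime (k : ℕ) : ℕ := Nat.nth Nat.Prime (k - 1)

/-- `IsS m S` says that `S` is the maximum of `{k*m - p_k : k ≥ 1}`. -/
def IsS (m : ℕ) (S : ℤ) : Prop :=
  IsGreatest {a : ℤ | ∃ k : ℕ, 0 < k ∧ a = (k : ℤ) * m - nthPrime k} S

section
open Complex Metric Set Filter Topology Function

namespace PNTB

lemma peel {g : ℂ → ℂ} (hg : Differentiable ℂ g) (a b : ℂ) (hb : g b ≠ 0) :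
    ∃ (n : ℕ) (h : ℂ → ℂ), Differentiable ℂ h ∧ h a ≠ 0 ∧ ∀ z, g z = (z - a) ^ n * h z := by
  obtain ⟨p, hp⟩ := hg.analyticAt a
  have hpne : p ≠ 0 := by
    intro h0
    have h1 : ∀ᶠ z in 𝓝 a, g z = 0 := hp.locally_zero_iff.2 h0
    have h2 : AnalyticOnNhd ℂ g univ := fun z _ => hg.analyticAt z
    have := h2.eqOn_zero_of_preconnected_of_eventuallyEq_zero isPreconnected_univ (mem_univ a) h1
    exact hb (this (mem_univ b))
  refine ⟨p.order, (swap dslope a)^[p.order] g, ?_, hp.iterate_dslope_fslope_ne_zero hpne, ?_⟩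
  · have : ∀ n : ℕ, Differentiable ℂ ((swap dslope a)^[n] g) := by
      intro n
      induction n with
      | zero => simpa using hg
      | succ n ih =>
        rw [iterate_succ_apply', ← differentiableOn_univ]
        exact (differentiableOn_dslope univ_mem).2 (differentiableOn_univ.2 ih)
    exact this _
  · intro z
    simpa using hp.eq_pow_order_mul_iterate_dslope z

lemma factor_finset {f : ℂ → ℂ} (hf : Differentiable ℂ f) (b : ℂ) (hb : f b ≠ 0) (S : Finset ℂ) :
    ∃ (l : List ℂ) (g : ℂ → ℂ), Differentiable ℂ g ∧ (∀ z ∈ S, g z ≠ 0) ∧ (∀ z ∈ l, z ∈ S) ∧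
      ∀ z, f z = (l.map (fun a => z - a)).prod * g z := by
  classical
  induction S using Finset.induction_on with
  | empty => exact ⟨[], f, hf, by simp, by simp, by simp⟩
  | insert a S ha ih =>
    obtain ⟨l, g, hg, hgS, hlS, hfac⟩ := ih
    have hgb : g b ≠ 0 := by
      intro h; apply hb; rw [hfac, h, mul_zero]
    obtain ⟨n, h, hh, hha, hgh⟩ := peel hg a b hgb
    refine ⟨List.replicate n a ++ l, h, hh, ?_, ?_, ?_⟩
    · intro z hz
      rcases Finset.mem_insert.1 hz with rfl | hz
      · exact hha
      · intro h0; exact hgS z hz (by rw [hgh, h0, mul_zero])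
    · intro z hz
      rcases List.mem_append.1 hz with hz | hz
      · rw [(List.mem_replicate.1 hz).2]; simp
      · exact Finset.mem_insert_of_mem (hlS z hz)
    · intro z
      rw [hfac, hgh]; simp; ring

lemma zeros_finite {f : ℂ → ℂ} (hf : Differentiable ℂ f) (b : ℂ) (hb : f b ≠ 0) (c : ℂ) (r : ℝ) :
    (closedBall c r ∩ {z | f z = 0}).Finite := by
  have h2 : AnalyticOnNhd ℂ f univ := fun z _ => hf.analyticAt z
  by_contra hinf
  obtain ⟨z, hz, hacc⟩ := Set.Infinite.exists_accPt_of_subset_isCompact hinf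
    (isCompact_closedBall c r) inter_subset_left
  have hfr : ∃ᶠ w in 𝓝[≠] z, f w = 0 := by
    have := accPt_iff_frequently_nhdsNE.1 hacc
    exact this.mono (fun w hw => hw.2)
  have := h2.eqOn_zero_of_preconnected_of_frequently_eq_zero isPreconnected_univ (mem_univ z) hfr
  exact hb (this (mem_univ b))

lemma log_exists {g : ℂ → ℂ} (hg : Differentiable ℂ g) (c : ℂ) (R : ℝ) (hR : 0 < R)
    (h0 : ∀ z ∈ ball c R, g z ≠ 0) :
    ∃ h : ℂ → ℂ, (∀ z ∈ ball c R, HasDerivAt h (deriv g z / g z) z) ∧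
      (∀ z ∈ ball c R, g z = exp (h z)) := by
  have hd : DifferentiableOn ℂ (fun z => deriv g z / g z) (ball c R) := by
    apply DifferentiableOn.div _ hg.differentiableOn h0
    exact (hg.contDiff (n := 2)).differentiable_deriv_two.differentiableOn
  obtain ⟨h, hc, hh⟩ := hd.isExactOn_ball.with_val_at c (log (g c))
  refine ⟨h, hh, ?_⟩
  have hder : ∀ z ∈ ball c R, HasDerivAt (fun z => g z * exp (-h z)) 0 z := by
    intro z hz
    have := (hg z).hasDerivAt.mul (hh z hz).neg.cexp
    refine this.congr_deriv ?_
    have := h0 z hz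
    simp only [Pi.neg_apply]
    field_simp
    ring
  have hconst : ∀ z ∈ ball c R, g z * exp (-h z) = g c * exp (-h c) := by
    intro z hz
    refine (convex_ball c R).is_const_of_fderivWithin_eq_zero (𝕜 := ℂ)
      (f := fun z => g z * exp (-h z)) ?_ ?_ hz (mem_ball_self hR)
    · intro w hw; exact (hder w hw).differentiableAt.differentiableWithinAt
    · intro w hw
      rw [fderivWithin_of_isOpen isOpen_ball hw]
      have h1 := (hder w hw).hasFDerivAt.fderiv
      rw [h1]; ext; simp
  intro z hz
  have h1 := hconst z hz
  rw [hc, exp_neg (log (g c)), exp_log (h0 c (mem_ball_self hR)),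
    mul_inv_cancel₀ (h0 c (mem_ball_self hR)), exp_neg] at h1
  have := exp_ne_zero (h z)
  field_simp at h1
  exact h1

lemma int_cos_log {g : ℂ → ℂ} (hg : Differentiable ℂ g) (c : ℂ) (r R : ℝ) (hr : 0 < r) (hrR : r < R)
    (h0 : ∀ z ∈ ball c R, g z ≠ 0) :
    ∫ θ in (0:ℝ)..2 * Real.pi, Real.cos θ * Real.log ‖g (circleMap c r θ)‖ =
      Real.pi * r * (deriv g c / g c).re := by
  obtain ⟨h, hh, hexp⟩ := log_exists hg c R (hr.trans hrR) h0
  have hdiff : DifferentiableOn ℂ h (ball c R) := fun z hz =>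
    (hh z hz).differentiableAt.differentiableWithinAt
  have hsub : closedBall c r ⊆ ball c R := closedBall_subset_ball hrR
  have hcR : ball c R ∈ 𝓝 c := ball_mem_nhds c (hr.trans hrR)
  have hcl : ∀ F : ℂ → ℂ, DifferentiableOn ℂ F (ball c R) → DiffContOnCl ℂ F (ball c |r|) := by
    intro F hF
    rw [abs_of_pos hr]
    apply DifferentiableOn.diffContOnCl
    rw [closure_ball c hr.ne']
    exact hF.mono hsub
  have e1 : Real.circleAverage (fun z => (z - c) * h z) c r = 0 := by
    rw [DiffContOnCl.circleAverage (hcl _ ?_)]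
    · simp
    · exact (differentiableOn_id.sub_const c).mul hdiff
  have e2 : Real.circleAverage (dslope h c) c r = deriv g c / g c := by
    rw [DiffContOnCl.circleAverage (hcl _ ?_)]
    · rw [dslope_same, (hh c (mem_of_mem_nhds hcR)).deriv]
    · exact (differentiableOn_dslope hcR).2 hdiff
  have hmem : ∀ θ, circleMap c r θ ∈ ball c R := fun θ =>
    hsub (circleMap_mem_closedBall c hr.le θ)
  have hcont : Continuous fun θ : ℝ => h (circleMap c r θ) := by
    have : ContinuousOn h (ball c R) := hdiff.continuousOn
    exact this.comp_continuous (continuous_circleMap c r) hmem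
  have hcp : Continuous fun θ : ℝ => exp (θ * I) * h (circleMap c r θ) :=
    (by fun_prop : Continuous fun θ : ℝ => exp (θ * I)).mul hcont
  have hcm : Continuous fun θ : ℝ => exp (-(θ * I)) * h (circleMap c r θ) :=
    (by fun_prop : Continuous fun θ : ℝ => exp (-(θ * I))).mul hcont
  rw [Real.circleAverage_def] at e1 e2
  have e1' : ∫ θ in (0:ℝ)..2 * Real.pi, exp (θ * I) * h (circleMap c r θ) = 0 := by
    have : ∀ θ : ℝ, (circleMap c r θ - c) * h (circleMap c r θ) =
        r * (exp (θ * I) * h (circleMap c r θ)) := by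
      intro θ; simp [circleMap]; ring
    simp only [this] at e1
    rw [intervalIntegral.integral_const_mul] at e1
    have hpi : (2 * Real.pi)⁻¹ ≠ 0 := by positivity
    rcases smul_eq_zero.1 e1 with h | h
    · exact absurd h hpi
    · rcases mul_eq_zero.1 h with h | h
      · exact absurd (by exact_mod_cast h) hr.ne'
      · exact h
  have e3 : ∫ θ in (0:ℝ)..2 * Real.pi, exp (-(θ * I)) = 0 := by
    have := integral_exp_mul_complex (a := 0) (b := 2 * Real.pi) (c := -I) (by simp)
    have h2 : ∀ θ : ℝ, exp (-(θ * I)) = exp (-I * θ) := by intro θ; congr 1; ring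
    simp only [h2, this]
    have : exp (-I * ((2 * Real.pi : ℝ) : ℂ)) = 1 := by
      have := exp_neg (2 * Real.pi * I)
      rw [exp_two_pi_mul_I, inv_one] at this
      rw [← this]; congr 1; push_cast; ring
    rw [this]; simp
  have e2' : ∫ θ in (0:ℝ)..2 * Real.pi, exp (-(θ * I)) * h (circleMap c r θ) =
      2 * Real.pi * r * (deriv g c / g c) := by
    have : ∀ θ : ℝ, dslope h c (circleMap c r θ) =
        (r:ℂ)⁻¹ * (exp (-(θ * I)) * h (circleMap c r θ) - exp (-(θ * I)) * h c) := by
      intro θ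
      rw [dslope_of_ne _ (by simp [hr.ne']), slope_def_field]
      have := exp_ne_zero (θ * I)
      have hrc : (r:ℂ) ≠ 0 := by exact_mod_cast hr.ne'
      have h1 : circleMap c r θ - c = r * exp (θ * I) := by simp [circleMap]
      rw [h1, exp_neg]
      field_simp
    simp only [this] at e2
    rw [intervalIntegral.integral_const_mul, intervalIntegral.integral_sub
      (hcm.intervalIntegrable _ _)
      ((by fun_prop : Continuous fun θ : ℝ => exp (-(θ * I)) * h c).intervalIntegrable _ _),
      intervalIntegral.integral_mul_const, e3] at e2
    rw [← e2]
    have hrc : (r:ℂ) ≠ 0 := by exact_mod_cast hr.ne'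
    have hp : (Real.pi : ℂ) ≠ 0 := by exact_mod_cast Real.pi_ne_zero
    rw [Complex.real_smul]
    push_cast
    generalize (∫ (θ : ℝ) in (0:ℝ)..2 * Real.pi, exp (-(θ * I)) * h (circleMap c r θ)) = J
    field_simp
    simp
  have key : ∀ θ : ℝ, Real.cos θ * Real.log ‖g (circleMap c r θ)‖ =
      (1/2) * (exp (θ * I) * h (circleMap c r θ) + exp (-(θ * I)) * h (circleMap c r θ)).re := by
    intro θ
    rw [hexp _ (hmem θ), norm_exp, Real.log_exp]
    have : -(θ * I : ℂ) = ((-θ : ℝ) : ℂ) * I := by push_cast; ring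
    rw [this, add_re, mul_re, mul_re, exp_ofReal_mul_I_re, exp_ofReal_mul_I_re, exp_ofReal_mul_I_im,
      exp_ofReal_mul_I_im]
    simp; ring
  simp only [key]
  rw [intervalIntegral.integral_const_mul]
  have hre : ∫ θ in (0:ℝ)..2 * Real.pi,
      (exp (θ * I) * h (circleMap c r θ) + exp (-(θ * I)) * h (circleMap c r θ)).re =
      (∫ θ in (0:ℝ)..2 * Real.pi,
      (exp (θ * I) * h (circleMap c r θ) + exp (-(θ * I)) * h (circleMap c r θ))).re := by
    have := reCLM.intervalIntegral_comp_comm (a := 0) (b := 2 * Real.pi) (μ := MeasureTheory.volume)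
      (f := fun θ : ℝ => exp (θ * I) * h (circleMap c r θ) + exp (-(θ * I)) * h (circleMap c r θ))
      ((hcp.add hcm).intervalIntegrable _ _)
    simpa using this
  rw [hre, intervalIntegral.integral_add
      (hcp.intervalIntegrable _ _)
      (hcm.intervalIntegrable _ _), e1', e2', zero_add]
  have : (2 * Real.pi * r * (deriv g c / g c) : ℂ) = ((2 * Real.pi * r : ℝ) : ℂ) * (deriv g c / g c) := by
    push_cast; ring
  rw [this, re_ofReal_mul]; ring


lemma norm_list_prod_aux (l : List ℂ) : (l.map (fun z => ‖z‖)).prod = ‖l.prod‖ := by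
  induction l with
  | nil => simp
  | cons a l ih => simp [ih]

/-- derivative of log of product -/
lemma logDeriv_list_prod (l : List (ℂ × ℂ)) (c : ℂ) (h : ∀ p ∈ l, p.1 + p.2 * c ≠ 0) :
    logDeriv (fun z => (l.map (fun p => p.1 + p.2 * z)).prod) c =
      (l.map (fun p => p.2 / (p.1 + p.2 * c))).sum := by
  induction l with
  | nil => simp [logDeriv_const]
  | cons p l ih =>
    have hl : ∀ p ∈ l, p.1 + p.2 * c ≠ 0 := fun q hq => h q (List.mem_cons_of_mem _ hq)
    have hp := h p List.mem_cons_self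
    have hprod : (l.map (fun p => p.1 + p.2 * c)).prod ≠ 0 := by
      rw [Ne, List.prod_eq_zero_iff]; intro hm
      obtain ⟨q, hq, hq0⟩ := List.mem_map.1 hm
      exact hl q hq hq0
    have hd : Differentiable ℂ (fun z => (l.map (fun p => p.1 + p.2 * z)).prod) := by
      clear ih hprod hl hp h
      induction l with
      | nil => simp
      | cons q l ih => simp only [List.map_cons, List.prod_cons]; fun_prop
    simp only [List.map_cons, List.prod_cons, List.sum_cons]
    rw [logDeriv_mul c hp hprod (by fun_prop) (hd c), ih hl]
    congr 1
    have : HasDerivAt (fun z => p.1 + p.2 * z) p.2 c := by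
      simpa using ((hasDerivAt_id c).const_mul p.2).const_add p.1
    rw [logDeriv_apply, this.deriv]

lemma list_diff (l : List (ℂ × ℂ)) :
    Differentiable ℂ (fun z => (l.map (fun p => p.1 + p.2 * z)).prod) := by
  induction l with
  | nil => simp
  | cons q l ih => simp only [List.map_cons, List.prod_cons]; fun_prop

lemma sphere_norm (c ρ : ℂ) (r θ : ℝ) (hr : 0 < r) :
    ‖circleMap c r θ - ρ‖ =
      ‖(r + (starRingEnd ℂ (ρ - c)) * c / r) + (-(starRingEnd ℂ (ρ - c)) / r) * circleMap c r θ‖ := by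
  have hrc : (r:ℂ) ≠ 0 := by exact_mod_cast hr.ne'
  have he : exp (θ * I) * starRingEnd ℂ (exp (θ * I)) = 1 := by
    rw [mul_conj, normSq_eq_norm_sq, norm_exp_ofReal_mul_I]; simp
  have hz : circleMap c r θ = c + r * exp (θ * I) := rfl
  have e : (r + (starRingEnd ℂ (ρ - c)) * c / r) + (-(starRingEnd ℂ (ρ - c)) / r) * circleMap c r θ
      = exp (θ * I) * starRingEnd ℂ (circleMap c r θ - ρ) := by
    rw [hz]
    simp only [map_sub, map_add, map_mul, conj_ofReal]
    field_simp
    linear_combination (-(r:ℂ)^2) * he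
  rw [e, norm_mul, norm_exp_ofReal_mul_I, one_mul, RCLike.norm_conj]

lemma blaschke {f : ℂ → ℂ} (hf : Differentiable ℂ f) (c : ℂ) (r : ℝ) (hr : 0 < r)
    (hs : ∀ z ∈ sphere c r, f z ≠ 0) (hc : f c ≠ 0)
    (hz : ∀ z ∈ ball c r, f z = 0 → z.re < c.re) :
    (∫ θ in (0:ℝ)..2 * Real.pi, Real.cos θ * Real.log ‖f (circleMap c r θ)‖) / (Real.pi * r) ≤
      (deriv f c / f c).re ∧
    ∀ ρ ∈ ball c r, f ρ = 0 → 
    (∫ θ in (0:ℝ)..2 * Real.pi, Real.cos θ * Real.log ‖f (circleMap c r θ)‖) / (Real.pi * r) +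
      (c.re - ρ.re) * (1 / ‖c - ρ‖ ^ 2 - 1 / r ^ 2) ≤ (deriv f c / f c).re := by
  have hrc : (r:ℂ) ≠ 0 := by exact_mod_cast hr.ne'
  have hfin := zeros_finite hf c hc c r
  obtain ⟨l, g, hg, hgS, hlS, hfac⟩ := factor_finset hf c hc hfin.toFinset
  have hlS' : ∀ a ∈ l, a ∈ ball c r ∧ f a = 0 := by
    intro a ha
    have := hlS a ha
    rw [Set.Finite.mem_toFinset] at this
    refine ⟨?_, this.2⟩
    have h1 : dist a c ≤ r := this.1
    rcases h1.lt_or_eq with h1 | h1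
    · exact h1
    · exact absurd this.2 (hs a h1)
  have hgne : ∀ z ∈ closedBall c r, g z ≠ 0 := by
    intro z hzb hz0
    have hfz : f z = 0 := by rw [hfac, hz0, mul_zero]
    exact hgS z (by rw [Set.Finite.mem_toFinset]; exact ⟨hzb, hfz⟩) hz0
  set w : ℂ → ℂ × ℂ := fun ρ => ((r + (starRingEnd ℂ (ρ - c)) * c / r), (-(starRingEnd ℂ (ρ - c)) / r))
    with hw
  set G : ℂ → ℂ := fun z => ((l.map w).map (fun p => p.1 + p.2 * z)).prod * g z with hG
  have hPd := list_diff (l.map w)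
  have hGd : Differentiable ℂ G := hPd.mul hg
  have hwz : ∀ ρ ∈ ball c r, ∀ z ∈ closedBall c r, (w ρ).1 + (w ρ).2 * z ≠ 0 := by
    intro ρ hρ z hz h0
    have e : (w ρ).1 + (w ρ).2 * z = r - (starRingEnd ℂ (ρ - c)) * (z - c) / r := by
      simp only [hw]; field_simp; ring
    rw [e, sub_eq_zero, eq_div_iff hrc] at h0
    have h1 : ‖(r:ℂ) * r‖ = ‖starRingEnd ℂ (ρ - c) * (z - c)‖ := by rw [h0]
    rw [norm_mul, norm_mul, RCLike.norm_conj] at h1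
    have h2 : ‖ρ - c‖ < r := by simpa [dist_eq_norm] using hρ
    have h3 : ‖z - c‖ ≤ r := by simpa [dist_eq_norm] using hz
    have h4 : ‖(r:ℂ)‖ = r := by simp [abs_of_pos hr]
    rw [h4] at h1
    nlinarith [norm_nonneg (ρ - c), norm_nonneg (z - c)]
  have hGne : ∀ z ∈ closedBall c r, G z ≠ 0 := by
    intro z hzb
    refine mul_ne_zero ?_ (hgne z hzb)
    rw [Ne, List.prod_eq_zero_iff]; intro hm
    obtain ⟨q, hq, hq0⟩ := List.mem_map.1 hm
    obtain ⟨ρ, hρ, rfl⟩ := List.mem_map.1 hq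
    exact hwz ρ (hlS' ρ hρ).1 z hzb hq0
  have hopen : IsOpen {z | G z ≠ 0} := isOpen_ne_fun hGd.continuous continuous_const
  obtain ⟨e, he, hsub⟩ := (isCompact_closedBall c r).exists_thickening_subset_open hopen hGne
  rw [thickening_closedBall he hr.le] at hsub
  have hI := int_cos_log hGd c r (e + r) hr (by linarith) hsub
  have hnorm : ∀ θ : ℝ, ‖f (circleMap c r θ)‖ = ‖G (circleMap c r θ)‖ := by
    intro θ
    rw [hfac, hG]
    simp only [norm_mul]
    congr 1
    rw [← norm_list_prod_aux, ← norm_list_prod_aux]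
    simp only [List.map_map]
    congr 1
    apply List.map_congr_left
    intro a _
    exact sphere_norm c a r θ hr
  simp only [hnorm]
  rw [hI]
  have hccl : c ∈ closedBall c r := mem_closedBall_self hr.le
  have e1 : deriv f c / f c = (l.map (fun ρ => 1 / (c - ρ))).sum + deriv g c / g c := by
    have hfe : f = fun z => ((l.map (fun ρ => ((-ρ, 1) : ℂ × ℂ))).map (fun p => p.1 + p.2 * z)).prod * g z := by
      ext z; rw [hfac]; congr 2; rw [List.map_map]; apply List.map_congr_left; intro a _; simp; ring
    have hne : ∀ p ∈ (l.map (fun ρ => ((-ρ, 1) : ℂ × ℂ))), p.1 + p.2 * c ≠ 0 := by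
      intro p hp h0
      obtain ⟨ρ, hρ, rfl⟩ := List.mem_map.1 hp
      have : c = ρ := by simp at h0; linear_combination h0
      exact hc (this ▸ (hlS' ρ hρ).2)
    have hpr : ((l.map (fun ρ => ((-ρ, 1) : ℂ × ℂ))).map (fun p => p.1 + p.2 * c)).prod ≠ 0 := by
      rw [Ne, List.prod_eq_zero_iff]; intro hm
      obtain ⟨q, hq, hq0⟩ := List.mem_map.1 hm
      exact hne q hq hq0
    have : logDeriv f c = logDeriv (fun z => ((l.map (fun ρ => ((-ρ, 1) : ℂ × ℂ))).map (fun p => p.1 + p.2 * z)).prod) c + logDeriv g c := by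
      conv_lhs => rw [hfe]
      exact logDeriv_mul c hpr (hgne c hccl) (list_diff _ c) (hg c)
    rw [← logDeriv_apply, this, logDeriv_list_prod _ _ hne, List.map_map, logDeriv_apply]
    congr 2
    apply List.map_congr_left
    intro a _
    simp; ring
  have e2 : deriv G c / G c = (l.map (fun ρ => -(starRingEnd ℂ (ρ - c)) / r ^ 2)).sum + deriv g c / g c := by
    have hne : ∀ p ∈ l.map w, p.1 + p.2 * c ≠ 0 := by
      intro p hp
      obtain ⟨ρ, hρ, rfl⟩ := List.mem_map.1 hp
      exact hwz ρ (hlS' ρ hρ).1 c hccl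
    have hpr : ((l.map w).map (fun p => p.1 + p.2 * c)).prod ≠ 0 := by
      rw [Ne, List.prod_eq_zero_iff]; intro hm
      obtain ⟨q, hq, hq0⟩ := List.mem_map.1 hm
      exact hne q hq hq0
    have : logDeriv G c = logDeriv (fun z => ((l.map w).map (fun p => p.1 + p.2 * z)).prod) c + logDeriv g c := by
      exact logDeriv_mul c hpr (hgne c hccl) (list_diff _ c) (hg c)
    rw [← logDeriv_apply, this, logDeriv_list_prod _ _ hne, List.map_map, logDeriv_apply]
    congr 2
    apply List.map_congr_left
    intro a _
    simp only [hw, Function.comp]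
    have : (r + (starRingEnd ℂ (a - c)) * c / r) + (-(starRingEnd ℂ (a - c)) / r) * c = (r:ℂ) := by
      field_simp; ring
    rw [this]; field_simp
  have hsum : ∀ l' : List ℂ, ((l'.map (fun ρ => 1 / (c - ρ))).sum).re =
      ((l'.map (fun ρ => -(starRingEnd ℂ (ρ - c)) / (r:ℂ) ^ 2)).sum).re +
      (l'.map (fun ρ => (c.re - ρ.re) * (1 / ‖c - ρ‖ ^ 2 - 1 / r ^ 2))).sum := by
    intro l'
    induction l' with
    | nil => simp
    | cons a l' ih =>
      simp only [List.map_cons, List.sum_cons, add_re]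
      rw [ih]
      have h1 : (1 / (c - a)).re = (c.re - a.re) / ‖c - a‖ ^ 2 := by
        rw [one_div, inv_re, normSq_eq_norm_sq]; simp
      have h2 : (-(starRingEnd ℂ (a - c)) / (r:ℂ) ^ 2).re = (c.re - a.re) / r ^ 2 := by
        have : (r:ℂ) ^ 2 = ((r ^ 2 : ℝ) : ℂ) := by push_cast; ring
        rw [this, div_ofReal_re]; simp
      rw [h1, h2]; ring
  have hrw : (deriv f c / f c).re = (deriv G c / G c).re +
      (l.map (fun ρ => (c.re - ρ.re) * (1 / ‖c - ρ‖ ^ 2 - 1 / r ^ 2))).sum := by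
    rw [e1, e2, add_re, add_re, hsum]; ring
  have hnn : ∀ x ∈ l.map (fun ρ => (c.re - ρ.re) * (1 / ‖c - ρ‖ ^ 2 - 1 / r ^ 2)), 0 ≤ x := by
    intro x hx
    obtain ⟨ρ, hρ, rfl⟩ := List.mem_map.1 hx
    obtain ⟨h1, h2⟩ := hlS' ρ hρ
    have h3 := hz ρ h1 h2
    have h4 : ‖c - ρ‖ < r := by rw [mem_ball'] at h1; simpa [dist_eq_norm] using h1
    have h5 : 0 < ‖c - ρ‖ := by
      rw [norm_pos_iff, sub_ne_zero]; rintro rfl; exact hc h2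
    apply mul_nonneg (by linarith)
    rw [sub_nonneg]
    apply one_div_le_one_div_of_le (by positivity)
    gcongr
  have hpr : Real.pi * r ≠ 0 := by positivity
  rw [mul_div_cancel_left₀ _ hpr, hrw]
  refine ⟨by linarith [List.sum_nonneg hnn], ?_⟩
  intro ρ hρ hρ0
  have : ρ ∈ l := by
    by_contra hn
    have h1 := hfac ρ
    rw [hρ0] at h1
    have h2 := hgne ρ (ball_subset_closedBall hρ)
    rcases mul_eq_zero.1 h1.symm with h | h
    · rw [List.prod_eq_zero_iff] at h
      obtain ⟨q, hq, hq0⟩ := List.mem_map.1 h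
      rw [sub_eq_zero] at hq0
      exact hn (hq0 ▸ hq)
    · exact h2 h
  have := List.single_le_sum hnn _ (List.mem_map_of_mem this)
  linarith

end PNTB
end

section
open Complex Metric Set Filter Topology Function

namespace PNTB

lemma cpow_diff_bound (s : ℂ) (hs : 1 ≤ s.re) (n : ℕ) (hn : 1 ≤ n) (x : ℝ) (hx : x ∈ Icc (n:ℝ) (n+1)) :
    ‖(x:ℂ) ^ (-s) - ((n+1:ℝ):ℂ) ^ (-s)‖ ≤ ‖s‖ / (n:ℝ)^2 * ((n+1:ℝ) - x) := by
  have hn' : (1:ℝ) ≤ n := by exact_mod_cast hn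
  have hs0 : s ≠ 0 := by rintro rfl; simp at hs; linarith
  have hder : ∀ y ∈ Icc (n:ℝ) (n+1), HasDerivWithinAt (fun y : ℝ => (y:ℂ) ^ (-s))
      ((-s) * (y:ℂ) ^ (-s - 1)) (Icc (n:ℝ) (n+1)) y := by
    intro y hy
    have hy0 : y ≠ 0 := by linarith [hy.1]
    exact (hasDerivAt_ofReal_cpow_const hy0 (by simpa using hs0)).hasDerivWithinAt
  have := (convex_Icc (n:ℝ) (n+1)).norm_image_sub_le_of_norm_hasDerivWithin_le
    (C := ‖s‖ / (n:ℝ)^2) hder ?_ (x := (n+1:ℝ)) (y := x) ⟨by linarith, le_refl _⟩ hx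
  · refine this.trans (le_of_eq ?_)
    rw [Real.norm_eq_abs, abs_sub_comm, abs_of_nonneg (by linarith [hx.2])]
  · intro y hy
    have hy0 : 0 < y := by linarith [hy.1]
    rw [norm_mul, norm_neg, norm_cpow_eq_rpow_re_of_pos hy0, div_eq_mul_inv]
    gcongr
    have h1 : (-s - 1).re ≤ -2 := by simp; linarith
    have hy1 : 1 ≤ y := by linarith [hy.1]
    calc y ^ (-s-1).re ≤ y ^ (-2:ℝ) := Real.rpow_le_rpow_of_exponent_le hy1 h1
      _ = (y^2)⁻¹ := by rw [Real.rpow_neg hy0.le]; norm_cast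
      _ ≤ ((n:ℝ)^2)⁻¹ := by
        have := hy.1
        gcongr

lemma one_step (s : ℂ) (hs : 1 ≤ s.re) (hs1 : s ≠ 1) (n : ℕ) (hn : 1 ≤ n) :
    ‖((n+1:ℝ):ℂ) ^ (-s) - ((n:ℂ) ^ (1 - s) / (s - 1) - ((n+1:ℝ):ℂ) ^ (1 - s) / (s - 1))‖ ≤
      ‖s‖ / (2 * (n:ℝ)^2) := by
  have hn' : (1:ℝ) ≤ n := by exact_mod_cast hn
  have h1 : ∫ x in (n:ℝ)..(n+1), (x:ℂ) ^ (-s) =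
      (n:ℂ) ^ (1 - s) / (s - 1) - ((n+1:ℝ):ℂ) ^ (1 - s) / (s - 1) := by
    rw [integral_cpow]
    · have h2 : -s + 1 = 1 - s := by ring
      have h3 : s - 1 ≠ 0 := sub_ne_zero.2 hs1
      have h4 : 1 - s ≠ 0 := sub_ne_zero.2 hs1.symm
      rw [h2]; push_cast; field_simp; ring
    · right
      refine ⟨fun h => hs1 (by linear_combination -h), ?_⟩
      rw [uIcc_of_le (by linarith)]; intro h; linarith [h.1]
  have hcont : ContinuousOn (fun x : ℝ => (x:ℂ) ^ (-s)) (uIcc (n:ℝ) (n+1)) := by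
    rw [uIcc_of_le (by linarith)]
    intro x hx
    apply ContinuousAt.continuousWithinAt
    apply ContinuousAt.cpow continuous_ofReal.continuousAt continuousAt_const
    left; simp; linarith [hx.1]
  have h2 : ((n+1:ℝ):ℂ) ^ (-s) = ∫ x in (n:ℝ)..(n+1), ((n+1:ℝ):ℂ) ^ (-s) := by
    rw [intervalIntegral.integral_const]; simp
  rw [← h1]
  conv_lhs => rw [h2]
  rw [← intervalIntegral.integral_sub (by simp) hcont.intervalIntegrable]
  have h3 : ∫ x in (n:ℝ)..(n+1), ‖s‖ / (n:ℝ)^2 * ((n+1:ℝ) - x) = ‖s‖ / (2 * (n:ℝ)^2) := by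
    rw [intervalIntegral.integral_const_mul, intervalIntegral.integral_sub (by simp) (by simp)]
    simp
    field_simp; ring
  rw [← h3]
  apply intervalIntegral.norm_integral_le_of_norm_le (by linarith)
  · refine .of_forall fun x hx => ?_
    rw [norm_sub_rev]
    exact cpow_diff_bound s hs n hn x ⟨hx.1.le, hx.2⟩
  · exact (by fun_prop : Continuous _).intervalIntegrable _ _

lemma partial_bound (s : ℂ) (hs : 1 ≤ s.re) (hs1 : s ≠ 1) (N : ℕ) (hN : 2 ≤ N) (k : ℕ) :
    ‖(∑ n ∈ Finset.range (N + k), ((n+1:ℝ):ℂ) ^ (-s)) - (∑ n ∈ Finset.range N, ((n+1:ℝ):ℂ) ^ (-s))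
      - ((N:ℂ) ^ (1 - s) / (s - 1) - ((N + k : ℕ):ℂ) ^ (1 - s) / (s - 1))‖ ≤
      ‖s‖ / 2 * (1 / ((N:ℝ) - 1) - 1 / ((N:ℝ) + k - 1)) := by
  have hN' : (2:ℝ) ≤ N := by exact_mod_cast hN
  induction k with
  | zero => simp
  | succ k ih =>
    have h1 := one_step s hs hs1 (N + k) (by omega)
    have h2 : ‖s‖ / (2 * ((N + k : ℕ):ℝ)^2) ≤ ‖s‖ / 2 * (1 / ((N:ℝ) + k - 1) - 1 / ((N:ℝ) + (k + 1:ℕ) - 1)) := by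
      push_cast
      have hx : 0 < (N:ℝ) + k - 1 := by
        have : (0:ℝ) ≤ k := by positivity
        linarith
      have e : 1 / ((N:ℝ) + k - 1) - 1 / ((N:ℝ) + (k + 1) - 1) = 1 / (((N:ℝ) + k - 1) * (N + k)) := by
        have : (N:ℝ) + (k + 1) - 1 = N + k := by ring
        rw [this]
        have : 0 < (N:ℝ) + k := by linarith
        field_simp; ring
      rw [e, ← div_div, div_eq_mul_one_div (‖s‖ / 2)]
      gcongr
      nlinarith
    have e : (∑ n ∈ Finset.range (N + (k+1)), ((n+1:ℝ):ℂ) ^ (-s)) - (∑ n ∈ Finset.range N, ((n+1:ℝ):ℂ) ^ (-s))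
      - ((N:ℂ) ^ (1 - s) / (s - 1) - ((N + (k+1) : ℕ):ℂ) ^ (1 - s) / (s - 1)) =
      ((∑ n ∈ Finset.range (N + k), ((n+1:ℝ):ℂ) ^ (-s)) - (∑ n ∈ Finset.range N, ((n+1:ℝ):ℂ) ^ (-s))
      - ((N:ℂ) ^ (1 - s) / (s - 1) - ((N + k : ℕ):ℂ) ^ (1 - s) / (s - 1))) +
      ((((N+k:ℕ)+1:ℝ):ℂ) ^ (-s) - (((N+k:ℕ):ℂ) ^ (1 - s) / (s - 1) - (((N+k:ℕ)+1:ℝ):ℂ) ^ (1 - s) / (s - 1))) := by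
      rw [← add_assoc, Finset.sum_range_succ]; push_cast; ring
    rw [e]
    refine (norm_add_le _ _).trans ?_
    calc _ ≤ _ := add_le_add ih (h1.trans h2)
      _ = _ := by ring

lemma zeta_trunc (s : ℂ) (hs : 1 < s.re) (N : ℕ) (hN : 2 ≤ N) :
    ‖riemannZeta s - (∑ n ∈ Finset.range N, ((n+1:ℝ):ℂ) ^ (-s)) - (N:ℂ) ^ (1 - s) / (s - 1)‖ ≤
      ‖s‖ / (2 * ((N:ℝ) - 1)) := by
  have hN' : (2:ℝ) ≤ N := by exact_mod_cast hN
  have hs1 : s ≠ 1 := by rintro rfl; simp at hs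
  have hsum : HasSum (fun n : ℕ => ((n+1:ℝ):ℂ) ^ (-s)) (riemannZeta s) := by
    rw [zeta_eq_tsum_one_div_nat_add_one_cpow hs]
    have h1 : Summable (fun n : ℕ => 1 / ((n:ℂ) + 1) ^ s) := by
      have := (summable_nat_add_iff 1).2 (Complex.summable_one_div_nat_cpow.2 hs)
      simpa using this
    convert h1.hasSum using 2 with n
    rw [cpow_neg]; push_cast; simp
  have hlim1 : Tendsto (fun k : ℕ => ∑ n ∈ Finset.range (N + k), ((n+1:ℝ):ℂ) ^ (-s)) atTop
      (𝓝 (riemannZeta s)) := by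
    have := hsum.tendsto_sum_nat
    exact this.comp (tendsto_add_atTop_nat N |>.congr (fun k => by rw [add_comm]))
  have hlim2 : Tendsto (fun k : ℕ => ((N + k : ℕ):ℂ) ^ (1 - s) / (s - 1)) atTop (𝓝 0) := by
    rw [show (0:ℂ) = 0 / (s - 1) by simp]
    apply Tendsto.div_const
    have h0 : Tendsto (fun k : ℕ => ((k:ℕ):ℂ) ^ (1 - s)) atTop (𝓝 0) := by
      rw [tendsto_zero_iff_norm_tendsto_zero]
      have : Tendsto (fun k : ℕ => (k:ℝ) ^ (-(s.re - 1))) atTop (𝓝 0) :=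
        (tendsto_rpow_neg_atTop (by linarith)).comp tendsto_natCast_atTop_atTop
      refine this.congr' ?_
      filter_upwards [eventually_gt_atTop 0] with k hk
      rw [norm_natCast_cpow_of_pos hk]; simp
    exact h0.comp (tendsto_add_atTop_nat N |>.congr (fun k => by rw [add_comm]))
  have hlim := ((hlim1.sub_const (∑ n ∈ Finset.range N, ((n+1:ℝ):ℂ) ^ (-s))).sub
    (hlim2.const_sub ((N:ℂ) ^ (1 - s) / (s - 1)))).norm
  rw [sub_zero] at hlim
  refine le_of_tendsto' hlim (fun k => (partial_bound s hs.le hs1 N hN k).trans ?_)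
  rw [← div_div, div_eq_mul_one_div (‖s‖/2)]
  gcongr
  have : (0:ℝ) ≤ k := by positivity
  have : 0 < (N:ℝ) + k - 1 := by linarith
  have : 0 ≤ 1 / ((N:ℝ) + k - 1) := by positivity
  linarith

lemma Z_bound_gt (s : ℂ) (hs : 1 < s.re) :
    ‖riemannZeta₁ s‖ ≤ ‖s - 1‖ * (Real.log (‖s‖ + 2) + 3 / 2) + 1 := by
  have hs1 : s ≠ 1 := by rintro rfl; simp at hs
  have hs1' : s - 1 ≠ 0 := sub_ne_zero.2 hs1
  have hns : 1 < ‖s‖ := hs.trans_le (re_le_norm s)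
  set N := ⌈‖s‖⌉₊ + 1 with hNdef
  have hN1 : ‖s‖ ≤ (N:ℝ) - 1 := by rw [hNdef]; push_cast; linarith [Nat.le_ceil ‖s‖]
  have hN2 : (N:ℝ) ≤ ‖s‖ + 2 := by
    rw [hNdef]; push_cast; linarith [Nat.ceil_lt_add_one (norm_nonneg s)]
  have hN : 2 ≤ N := by
    have : (2:ℝ) < N := by linarith
    exact_mod_cast this.le
  have h := zeta_trunc s hs N hN
  have h1 : ‖∑ n ∈ Finset.range N, ((n+1:ℝ):ℂ) ^ (-s)‖ ≤ 1 + Real.log (‖s‖ + 2) := by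
    calc _ ≤ ∑ n ∈ Finset.range N, ‖((n+1:ℝ):ℂ) ^ (-s)‖ := norm_sum_le _ _
      _ ≤ ∑ n ∈ Finset.range N, ((n:ℝ)+1)⁻¹ := by
        apply Finset.sum_le_sum; intro n _
        have hp : (0:ℝ) < n + 1 := by positivity
        rw [norm_cpow_eq_rpow_re_of_pos hp, ← Real.rpow_neg_one]
        apply Real.rpow_le_rpow_of_exponent_le
        · have : (0:ℝ) ≤ n := by positivity
          linarith
        · simp; linarith
      _ = (harmonic N : ℝ) := by simp [harmonic]
      _ ≤ 1 + Real.log N := harmonic_le_one_add_log N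
      _ ≤ _ := by gcongr
  have h2 : ‖s‖ / (2 * ((N:ℝ) - 1)) ≤ 1 / 2 := by
    rw [div_le_iff₀ (by linarith)]; linarith
  have h3 : ‖(N:ℂ) ^ (1 - s)‖ ≤ 1 := by
    rw [norm_natCast_cpow_of_pos (by omega)]
    apply Real.rpow_le_one_of_one_le_of_nonpos
    · exact_mod_cast (by omega : 1 ≤ N)
    · simp; linarith
  have hZ : riemannZeta₁ s = (s - 1) * riemannZeta s := by
    simp only [riemannZeta₁, riemannZeta₀]
    rw [if_neg hs1]
    field_simp; ring
  have e : riemannZeta₁ s = (s - 1) * (riemannZeta s - (∑ n ∈ Finset.range N, ((n+1:ℝ):ℂ) ^ (-s)) - (N:ℂ) ^ (1 - s) / (s - 1))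
      + (s - 1) * (∑ n ∈ Finset.range N, ((n+1:ℝ):ℂ) ^ (-s)) + (N:ℂ) ^ (1 - s) := by
    rw [hZ]; field_simp; ring
  rw [e]
  calc _ ≤ ‖s - 1‖ * (1 / 2) + ‖s - 1‖ * (1 + Real.log (‖s‖ + 2)) + 1 := by
        refine (norm_add₃_le).trans ?_
        rw [norm_mul, norm_mul]
        gcongr
        exact h.trans h2
    _ = _ := by ring

lemma Z_eq {s : ℂ} (hs1 : s ≠ 1) : riemannZeta₁ s = (s - 1) * riemannZeta s := by
  have hs1' : s - 1 ≠ 0 := sub_ne_zero.2 hs1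
  simp only [riemannZeta₁, riemannZeta₀]
  rw [if_neg hs1]
  field_simp; ring

lemma Z_bound (s : ℂ) (hs : 1 ≤ s.re) :
    ‖riemannZeta₁ s‖ ≤ ‖s - 1‖ * (Real.log (‖s‖ + 2) + 3 / 2) + 1 := by
  have hc : Continuous fun e : ℝ => ‖riemannZeta₁ (s + e)‖ := by
    have := differentiable_riemannZeta₁.continuous
    fun_prop
  have hc2 : Continuous fun e : ℝ => ‖(s + e) - 1‖ * (Real.log (‖s + e‖ + 2) + 3 / 2) + 1 := by
    have : Continuous fun e : ℝ => Real.log (‖s + e‖ + 2) := by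
      apply Continuous.log (by fun_prop)
      intro e; positivity
    fun_prop
  have h1 : Tendsto (fun e : ℝ => ‖riemannZeta₁ (s + e)‖) (𝓝[>] 0) (𝓝 ‖riemannZeta₁ s‖) := by
    have := (hc.tendsto 0).mono_left (nhdsWithin_le_nhds (s := Ioi 0))
    simpa using this
  have h2 := (hc2.tendsto 0).mono_left (nhdsWithin_le_nhds (s := Ioi 0))
  simp only [ofReal_zero, add_zero] at h2
  refine le_of_tendsto_of_tendsto h1 h2 ?_
  filter_upwards [self_mem_nhdsWithin] with e he
  apply Z_bound_gt
  have : (0:ℝ) < e := he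
  simp; linarith

lemma zeta_real_le (σ : ℝ) (hσ : 1 < σ) : ‖riemannZeta σ‖ ≤ σ / (σ - 1) := by
  have h := ZetaAsymptotics.zeta_limit_aux1 hσ
  have h2 : 0 ≤ ZetaAsymptotics.termTSum σ := tsum_nonneg (fun n => ZetaAsymptotics.term_nonneg _ _)
  have h3 : riemannZeta σ = ((∑' n : ℕ, 1 / (n + 1 : ℝ) ^ σ : ℝ) : ℂ) := by
    rw [zeta_eq_tsum_one_div_nat_add_one_cpow (by simpa using hσ)]
    rw [ofReal_tsum]
    congr 1; ext n
    push_cast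
    rw [ofReal_cpow (by positivity)]; push_cast; rfl
  rw [h3, norm_real, Real.norm_of_nonneg (tsum_nonneg (fun n => by positivity))]
  have : σ / (σ - 1) = 1 + 1 / (σ - 1) := by field_simp [(by linarith : σ - 1 ≠ 0)]; ring
  rw [this]
  nlinarith

lemma zeta_lower (s : ℂ) (hs : 1 < s.re) : (s.re - 1) / s.re ≤ ‖riemannZeta s‖ := by
  have h1 : LSeries (fun n => (ArithmeticFunction.zeta n : ℂ)) s * LSeries (fun n => (ArithmeticFunction.moebius n : ℂ)) s = 1 :=
    ArithmeticFunction.LSeries_zeta_mul_Lseries_moebius hs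
  rw [ArithmeticFunction.LSeries_zeta_eq_riemannZeta hs] at h1
  have h2 : ‖LSeries (fun n => (ArithmeticFunction.moebius n : ℂ)) s‖ ≤ s.re / (s.re - 1) := by
    refine le_trans ?_ (zeta_real_le s.re hs)
    have hz : riemannZeta (s.re : ℂ) = ∑' n : ℕ, 1 / (n:ℂ) ^ (s.re : ℂ) :=
      zeta_eq_tsum_one_div_nat_cpow (by simpa using hs)
    have hsr : Summable (fun n : ℕ => 1 / (n:ℝ) ^ s.re) := Real.summable_one_div_nat_rpow.2 hs
    have hz2 : riemannZeta (s.re : ℂ) = ((∑' n : ℕ, 1 / (n:ℝ) ^ s.re : ℝ) : ℂ) := by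
      rw [hz, ofReal_tsum]; congr 1; ext n
      rw [ofReal_div, ofReal_cpow (by positivity)]; simp
    rw [hz2, norm_real, Real.norm_of_nonneg (tsum_nonneg (fun n => by positivity))]
    unfold LSeries
    have hb : ∀ n : ℕ, ‖LSeries.term (fun n => (ArithmeticFunction.moebius n : ℂ)) s n‖ ≤ 1 / (n:ℝ) ^ s.re := by
      intro n
      rw [LSeries.norm_term_eq]
      split_ifs with h
      · subst h; positivity
      · gcongr
        have : |ArithmeticFunction.moebius n| ≤ 1 := ArithmeticFunction.abs_moebius_le_one
        rw [norm_intCast]; exact_mod_cast this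
    have hsn := Summable.of_nonneg_of_le (fun n => norm_nonneg _) hb hsr
    exact (norm_tsum_le_tsum_norm hsn).trans (hsn.tsum_le_tsum hb hsr)
  have h3 : ‖riemannZeta s‖ * ‖LSeries (fun n => (ArithmeticFunction.moebius n : ℂ)) s‖ = 1 := by
    rw [← norm_mul, h1, norm_one]
  have h4 : 0 < ‖riemannZeta s‖ := by
    rw [norm_pos_iff]; intro h; rw [h] at h1; simp at h1
  have h5 : 0 < s.re - 1 := by linarith
  have h6 : 1 ≤ ‖riemannZeta s‖ * (s.re / (s.re - 1)) :=
    calc (1:ℝ) = ‖riemannZeta s‖ * ‖LSeries (fun n => (ArithmeticFunction.moebius n : ℂ)) s‖ := h3.symm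
      _ ≤ _ := by gcongr
  rw [div_le_iff₀ (by linarith)]
  calc s.re - 1 = 1 * (s.re - 1) := by ring
    _ ≤ ‖riemannZeta s‖ * (s.re / (s.re - 1)) * (s.re - 1) := by gcongr
    _ = _ := by field_simp

end PNTB
end

section
open Complex Metric Set Filter Topology Function
open scoped Real

namespace PNTB

lemma mellin_strip (f : ℝ → ℂ) (h : ∀ s, MellinConvergent f s) (a b : ℝ) :
    ∃ C, ∀ s : ℂ, a ≤ s.re → s.re ≤ b → ‖mellin f s‖ ≤ C := by
  have key : ∀ s : ℂ, MeasureTheory.IntegrableOn (fun t : ℝ => t ^ (s.re - 1) * ‖f t‖) (Ioi 0) := by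
    intro s
    refine (MeasureTheory.IntegrableOn.congr_fun (h s).norm ?_ measurableSet_Ioi)
    intro t ht
    simp only [norm_smul, norm_cpow_eq_rpow_re_of_pos ht, sub_re, one_re]
  refine ⟨∫ t in Ioi (0:ℝ), (t ^ (a - 1) * ‖f t‖ + t ^ (b - 1) * ‖f t‖), fun s ha hb => ?_⟩
  have ka := key (a : ℂ)
  have kb := key (b : ℂ)
  simp only [ofReal_re] at ka kb
  unfold mellin
  refine (MeasureTheory.norm_integral_le_integral_norm _).trans ?_
  refine MeasureTheory.setIntegral_mono_on (h s).norm (ka.add kb) measurableSet_Ioi ?_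
  intro t ht
  have ht0 : (0:ℝ) < t := ht
  simp only [norm_smul, norm_cpow_eq_rpow_re_of_pos ht0, sub_re, one_re]
  rw [← add_mul]
  gcongr
  rcases le_total 1 t with h1 | h1
  · have := Real.rpow_le_rpow_of_exponent_le h1 (by linarith : s.re - 1 ≤ b - 1)
    have h3 : 0 ≤ t ^ (a - 1) := by positivity
    linarith
  · have := Real.rpow_le_rpow_of_exponent_ge ht0 h1 (by linarith : a - 1 ≤ s.re - 1)
    have h3 : 0 ≤ t ^ (b - 1) := by positivity
    linarith

lemma completed_strip : ∃ C, ∀ s : ℂ, 0 ≤ s.re → s.re ≤ 1 → ‖completedRiemannZeta₀ s‖ ≤ C := by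
  obtain ⟨C, hC⟩ := mellin_strip (HurwitzZeta.hurwitzEvenFEPair 0).f_modif
    (fun s => ((HurwitzZeta.hurwitzEvenFEPair 0).isStrongFEPair_toStrongFEPair.hasMellin s).1) 0 (1/2)
  refine ⟨C / 2, fun s h0 h1 => ?_⟩
  have : completedRiemannZeta₀ s = mellin (HurwitzZeta.hurwitzEvenFEPair 0).f_modif (s / 2) / 2 := rfl
  rw [this, norm_div]
  have := hC (s / 2) (by simp; linarith) (by simp; linarith)
  simp only [Complex.norm_ofNat]
  gcongr

lemma norm_Gamma_le (s : ℂ) (hs : 0 < s.re) : ‖Gamma s‖ ≤ Real.Gamma s.re := by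
  rw [Gamma_eq_integral hs, Real.Gamma_eq_integral hs, GammaIntegral]
  refine (MeasureTheory.norm_integral_le_integral_norm _).trans (le_of_eq ?_)
  apply MeasureTheory.setIntegral_congr_fun measurableSet_Ioi
  intro t ht
  have ht0 : (0:ℝ) < t := ht
  simp only [norm_mul, norm_cpow_eq_rpow_re_of_pos ht0, sub_re, one_re, norm_real,
    Real.norm_of_nonneg (Real.exp_pos _).le]

lemma norm_sin_le (z : ℂ) : ‖sin z‖ ≤ Real.exp |z.im| := by
  rw [sin, norm_div, norm_mul]
  simp only [norm_I, mul_one, Complex.norm_ofNat]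
  have h := norm_sub_le (cexp (-z * I)) (cexp (z * I))
  rw [norm_exp, norm_exp] at h
  rw [neg_mul] at h ⊢
  simp only [neg_mul, neg_re, mul_re, I_re, I_im, mul_zero, mul_one, zero_sub, neg_neg] at h
  have h1 := Real.exp_le_exp.2 (le_abs_self z.im)
  have h2 := Real.exp_le_exp.2 (neg_le_abs z.im)
  linarith

lemma Z_growth : ∃ C, ∀ s : ℂ, 0 ≤ s.re → s.re ≤ 1 → 1 ≤ |s.im| →
    ‖riemannZeta₁ s‖ ≤ C * Real.exp (3 * |s.im|) := by
  obtain ⟨C, hC⟩ := completed_strip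
  obtain ⟨G, hG⟩ : ∃ G, ∀ x ∈ Icc (1/2:ℝ) 1, Real.Gamma x ≤ G := by
    have : ContinuousOn Real.Gamma (Icc (1/2:ℝ) 1) := by
      intro x hx
      apply ContinuousAt.continuousWithinAt
      apply (Real.differentiableAt_Gamma _).continuousAt
      intro m; have := hx.1
      have : (0:ℝ) ≤ m := by positivity
      linarith
    obtain ⟨G, hG⟩ := (isCompact_Icc.image_of_continuousOn this).bddAbove
    exact ⟨G, fun x hx => hG (mem_image_of_mem _ hx)⟩
  have hG0 : 0 ≤ G := (Real.Gamma_pos_of_pos (by norm_num : (0:ℝ) < 1)).le.trans (hG 1 (by norm_num))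
  have hC0 : 0 ≤ C := (norm_nonneg _).trans (hC 0 (by simp) (by simp))
  refine ⟨2 * ((C + 2) * (2 * G)), fun s h0 h1 ht => ?_⟩
  set t := |s.im| with htdef
  have hs0 : s ≠ 0 := by rintro rfl; simp [htdef] at ht; linarith
  have hs1 : s ≠ 1 := by rintro rfl; simp [htdef] at ht; linarith
  have hs1' : 1 - s ≠ 0 := sub_ne_zero.2 hs1.symm
  rw [Z_eq hs1, riemannZeta_def_of_ne_zero hs0, completedRiemannZeta_eq]
  have hn : ∀ z : ℂ, 1 ≤ |z.im| → ‖1 / z‖ ≤ 1 := by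
    intro z hz
    rw [norm_div, norm_one]
    have := abs_im_le_norm z
    rw [div_le_one (by linarith)]; linarith
  have e1 : ‖completedRiemannZeta₀ s - 1 / s - 1 / (1 - s)‖ ≤ C + 2 := by
    have a1 := hC s h0 h1
    have a2 := hn s ht
    have a3 := hn (1 - s) (by simpa [htdef] using ht)
    have := norm_sub_le (completedRiemannZeta₀ s - 1 / s) (1 / (1 - s))
    have := norm_sub_le (completedRiemannZeta₀ s) (1 / s)
    linarith
  have hz : ∀ n : ℕ, s / 2 ≠ -n := by
    intro n h
    have : s.im = 0 := by
      have := congrArg Complex.im h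
      simpa using this
    simp [htdef, this] at ht; linarith
  have hg0 : Gamma (s / 2) ≠ 0 := Gamma_ne_zero hz
  have hsin : sin (π * (s / 2)) ≠ 0 := by
    intro h
    have := Gamma_mul_Gamma_one_sub (s / 2)
    rw [h, div_zero, mul_eq_zero] at this
    rcases this with h | h
    · exact hg0 h
    · refine Gamma_ne_zero (s := 1 - s / 2) ?_ h
      intro n hh
      have : s.im = 0 := by
        have := congrArg Complex.im hh
        simpa using this
      simp [htdef, this] at ht; linarith
  have hpi : (π:ℂ) ≠ 0 := by exact_mod_cast Real.pi_ne_zero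
  have e2 : (Gammaℝ s)⁻¹ = π ^ (s / 2) * (Gamma (1 - s / 2) * sin (π * (s / 2)) / π) := by
    have := Gamma_mul_Gamma_one_sub (s / 2)
    rw [Gammaℝ_def, neg_div, cpow_neg]
    rw [mul_inv, inv_inv]
    congr 1
    rw [eq_div_iff hsin] at this
    rw [eq_div_iff hpi, inv_mul_eq_iff_eq_mul₀ hg0, ← mul_assoc]
    exact this.symm
  have e3 : ‖(Gammaℝ s)⁻¹‖ ≤ 2 * G * Real.exp (2 * t) := by
    rw [e2, norm_mul, norm_div, norm_mul, norm_real, Real.norm_of_nonneg Real.pi_pos.le]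
    rw [norm_cpow_eq_rpow_re_of_pos Real.pi_pos]
    have b1 : Real.pi ^ (s / 2).re ≤ Real.pi := by
      calc _ ≤ Real.pi ^ (1:ℝ) := Real.rpow_le_rpow_of_exponent_le (by linarith [Real.pi_gt_three]) (by simp; linarith)
        _ = _ := Real.rpow_one _
    have b2 : ‖Gamma (1 - s / 2)‖ ≤ G := (norm_Gamma_le _ (by simp; linarith)).trans
      (hG _ ⟨by simp; linarith, by simp; linarith⟩)
    have b3 : ‖sin (π * (s / 2))‖ ≤ Real.exp (2 * t) := by
      refine (norm_sin_le _).trans (Real.exp_le_exp.2 ?_)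
      have : ((π:ℂ) * (s / 2)).im = Real.pi / 2 * s.im := by
        have : (π:ℂ) * (s / 2) = ((Real.pi / 2 : ℝ) : ℂ) * s := by push_cast; ring
        rw [this, im_ofReal_mul]
      rw [this, abs_mul, abs_of_pos (by positivity)]
      have := Real.pi_lt_four
      nlinarith [abs_nonneg s.im]
    calc _ ≤ Real.pi * (G * Real.exp (2 * t) / Real.pi) := by gcongr
      _ = G * Real.exp (2 * t) := by field_simp
      _ ≤ _ := by nlinarith [Real.exp_pos (2 * t), mul_nonneg hG0 (Real.exp_pos (2*t)).le]
  have e4 : ‖s - 1‖ ≤ 2 * Real.exp t := by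
    have := norm_le_abs_re_add_abs_im (s - 1)
    simp only [sub_re, one_re, sub_im, one_im, sub_zero] at this
    rw [abs_of_nonpos (by linarith)] at this
    have := Real.add_one_le_exp t
    linarith
  rw [norm_mul, div_eq_mul_inv, norm_mul]
  calc _ ≤ (2 * Real.exp t) * ((C + 2) * (2 * G * Real.exp (2 * t))) := by gcongr
    _ = _ := by rw [show 3 * t = t + 2 * t by ring, Real.exp_add]; ring

end PNTB
end

section
open Complex Metric Set Filter Topology Function
open scoped Real ComplexConjugate

namespace PNTB

lemma Z_conj (s : ℂ) : riemannZeta₁ (conj s) = conj (riemannZeta₁ s) := by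
  by_cases hs : s = 1
  · subst hs; simp
  · have : conj s ≠ 1 := by
      intro h; apply hs
      have := congrArg conj h
      simpa using this
    rw [Z_eq hs, Z_eq this, riemannZeta_conj]; simp

lemma Gamma_one_line (t : ℝ) (ht : 0 < t) :
    ‖Gamma (1 + t * I)‖ ^ 2 = π * t / Real.sinh (π * t) := by
  have h1 : Gamma (1 + t * I) = (t * I) * Gamma (t * I) := by
    rw [add_comm, Gamma_add_one]
    simp [ht.ne']
  have h2 := Gamma_mul_Gamma_one_sub (t * I)
  have h3 : (1 - t * I : ℂ) = conj (1 + t * I) := by simp [sub_eq_add_neg]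
  rw [h3, Gamma_conj] at h2
  have h4 : ((‖Gamma (1 + t * I)‖ ^ 2 : ℝ) : ℂ) = ((π * t / Real.sinh (π * t) : ℝ) : ℂ) := by
    rw [← normSq_eq_norm_sq, normSq_eq_conj_mul_self]
    nth_rewrite 2 [h1]
    have h5 : sin (π * (t * I)) = Real.sinh (π * t) * I := by
      rw [← mul_assoc, sin_mul_I]; push_cast; rfl
    rw [h5] at h2
    have hs : (Real.sinh (π * t) : ℂ) ≠ 0 := by
      exact_mod_cast (Real.sinh_pos_iff.2 (by positivity)).ne'
    calc _ = (t * I) * (Gamma (t * I) * conj (Gamma (1 + t * I))) := by ring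
      _ = _ := by rw [h2]; push_cast; field_simp [I_ne_zero]
  exact_mod_cast h4

lemma sinh_le_self_mul_cosh (x : ℝ) (hx : 0 ≤ x) : Real.sinh x ≤ x * Real.cosh x := by
  have : MonotoneOn (fun x : ℝ => x * Real.cosh x - Real.sinh x) (Ici 0) := by
    apply monotoneOn_of_deriv_nonneg (convex_Ici 0)
    · fun_prop
    · fun_prop
    · intro y hy
      simp only [interior_Ici, mem_Ioi] at hy
      have : HasDerivAt (fun x : ℝ => x * Real.cosh x - Real.sinh x)
        (1 * Real.cosh y + y * Real.sinh y - Real.cosh y) y :=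
        ((hasDerivAt_id y).mul (Real.hasDerivAt_cosh y)).sub (Real.hasDerivAt_sinh y)
      rw [this.deriv]
      have := Real.sinh_pos_iff.2 hy
      nlinarith
  have := this (mem_Ici.2 le_rfl) (mem_Ici.2 hx) hx
  simp at this; linarith

lemma zero_line_pos (t : ℝ) (ht : 0 < t) :
    ‖riemannZeta₁ (-(t * I))‖ ^ 2 ≤ (t + 2) / (2 * π) * ‖riemannZeta₁ (1 + t * I)‖ ^ 2 := by
  have hne : (1 + t * I : ℂ) ≠ 1 := by simp [ht.ne']
  have hne2 : (-(t * I) : ℂ) ≠ 1 := by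
    intro h; have := congrArg Complex.re h; simp at this
  have h := riemannZeta_one_sub (s := 1 + t * I) (by
    intro n h; have := congrArg Complex.im h; simp at this; linarith) hne
  have e0 : (1 - (1 + t * I) : ℂ) = -(t * I) := by ring
  rw [e0] at h
  have hcos : ‖cos (π * (1 + t * I) / 2)‖ = Real.sinh (π * t / 2) := by
    have : (π * (1 + t * I) / 2 : ℂ) = ((π * t / 2 : ℝ) : ℂ) * I + π / 2 := by push_cast; ring
    rw [this, cos_add_pi_div_two, norm_neg, sin_mul_I, norm_mul, norm_I, mul_one, ← ofReal_sinh,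
      norm_real, Real.norm_of_nonneg (Real.sinh_nonneg_iff.2 (by positivity))]
  have hp : ‖(2 * π : ℂ) ^ (-(1 + t * I))‖ = (2 * π)⁻¹ := by
    have : (2 * π : ℂ) = ((2 * π : ℝ) : ℂ) := by push_cast; rfl
    rw [this, norm_cpow_eq_rpow_re_of_pos (by positivity)]
    simp [Real.rpow_neg_one]
  set S := Real.sinh (π * t / 2) with hS
  set K := Real.cosh (π * t / 2) with hK
  have hSp : 0 < S := Real.sinh_pos_iff.2 (by positivity)
  have hKp : 0 < K := Real.cosh_pos _
  have h2 : ‖riemannZeta (-(t * I))‖ ^ 2 = t * S / (2 * π * K) * ‖riemannZeta (1 + t * I)‖ ^ 2 := by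
    rw [h]
    simp only [norm_mul, mul_pow, hcos, hp, Gamma_one_line t ht, Complex.norm_ofNat]
    have : Real.sinh (π * t) = 2 * S * K := by
      rw [hS, hK, ← Real.sinh_two_mul]; ring_nf
    rw [this]
    field_simp
  rw [Z_eq hne, Z_eq hne2, norm_mul, norm_mul, mul_pow, mul_pow, h2]
  have e1 : ‖(-(t * I) - 1 : ℂ)‖ ^ 2 = 1 + t ^ 2 := by
    rw [← normSq_eq_norm_sq, normSq_apply]; simp; ring
  have e2 : ‖(1 + t * I - 1 : ℂ)‖ ^ 2 = t ^ 2 := by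
    rw [← normSq_eq_norm_sq, normSq_apply]; simp; ring
  rw [e1, e2, ← mul_assoc, ← mul_assoc]
  refine mul_le_mul_of_nonneg_right ?_ (by positivity)
  have g1 : S ≤ K := (Real.sinh_lt_cosh _).le
  have g2 : S ≤ π * t / 2 * K := sinh_le_self_mul_cosh _ (by positivity)
  rw [← mul_div_assoc, div_mul_eq_mul_div, div_le_div_iff₀ (by positivity) (by positivity)]
  have key : (1 + t ^ 2) * S ≤ (t + 2) * t * K := by
    rcases le_total (1/2) t with h | h
    · nlinarith
    · have : (1 + t ^ 2) * S ≤ (5 / 4) * (π * t / 2 * K) := by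
        gcongr; nlinarith
      have h3 := Real.pi_lt_d2
      have : 0 < t * K := by positivity
      nlinarith
  calc (1 + t ^ 2) * (t * S) * (2 * π) = ((1 + t ^ 2) * S) * (2 * π * t) := by ring
    _ ≤ ((t + 2) * t * K) * (2 * π * t) := by gcongr
    _ = _ := by ring

lemma zero_line (t : ℝ) :
    ‖riemannZeta₁ (t * I)‖ ^ 2 ≤ (|t| + 2) / (2 * π) * ‖riemannZeta₁ (1 + t * I)‖ ^ 2 := by
  rcases lt_trichotomy t 0 with h | h | h
  · have := zero_line_pos (-t) (by linarith)
    rw [abs_of_neg h]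
    have e : ‖riemannZeta₁ (1 + t * I)‖ = ‖riemannZeta₁ (1 + (-t : ℝ) * I)‖ := by
      rw [← norm_conj, ← Z_conj]; simp
    rw [e]
    simpa using this
  · subst h
    have : riemannZeta₁ 0 = 1 / 2 := by rw [Z_eq (by norm_num), riemannZeta_zero]; norm_num
    simp [this]
    have := Real.pi_lt_four
    have := Real.pi_pos
    rw [le_div_iff₀ (by positivity)]
    linarith
  · have := zero_line_pos t h
    rw [abs_of_pos h]
    have e : ‖riemannZeta₁ (t * I)‖ = ‖riemannZeta₁ (-(t * I))‖ := by
      rw [← norm_conj, ← Z_conj]; simp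
    rw [e]; exact this

end PNTB
end

section
open Complex Metric Set Filter Topology Function
open scoped Real ComplexConjugate

namespace PNTB

noncomputable def U (t : ℝ) : ℝ := (|t| + 2) * (Real.log (|t| + 4) + 3 / 2)

lemma U_pos (t : ℝ) : 0 < U t := by
  have : 0 ≤ Real.log (|t| + 4) := Real.log_nonneg (by linarith [abs_nonneg t])
  unfold U; positivity

lemma Z_right (s : ℂ) (h1 : 1 ≤ s.re) (h2 : s.re ≤ 2) : ‖riemannZeta₁ s‖ ≤ U s.im := by
  have h := Z_bound s h1
  have a1 : ‖s - 1‖ ≤ |s.im| + 1 := by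
    have := norm_le_abs_re_add_abs_im (s - 1)
    simp only [sub_re, one_re, sub_im, one_im, sub_zero] at this
    rw [abs_of_nonneg (by linarith)] at this
    linarith
  have a2 : ‖s‖ + 2 ≤ |s.im| + 4 := by
    have := norm_le_abs_re_add_abs_im s
    rw [abs_of_nonneg (by linarith)] at this
    linarith
  have a3 : Real.log (‖s‖ + 2) ≤ Real.log (|s.im| + 4) := Real.log_le_log (by positivity) a2
  have a4 : 0 ≤ Real.log (‖s‖ + 2) := Real.log_nonneg (by linarith [norm_nonneg s])
  unfold U
  calc _ ≤ (|s.im| + 1) * (Real.log (|s.im| + 4) + 3 / 2) + 1 := by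
        refine h.trans ?_
        gcongr
    _ ≤ _ := by nlinarith

lemma U_shift (t t1 : ℝ) : U t ≤ U t1 * Real.exp (1.4 * |t - t1| / (|t1| + 2)) := by
  have hT : 0 ≤ |t1| := abs_nonneg _
  have hd : |t| ≤ |t1| + |t - t1| := by
    have := abs_add_le t1 (t - t1); simpa using this
  set d := |t - t1| with hd'
  have hd0 : 0 ≤ d := abs_nonneg _
  set T := |t1| with hT'
  have h1 : |t| + 2 ≤ (T + 2) * Real.exp (d / (T + 2)) := by
    have := Real.add_one_le_exp (d / (T + 2))
    calc _ ≤ (T + 2) * (d / (T + 2) + 1) := by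
          rw [mul_add, mul_div_cancel₀ _ (by positivity)]; linarith
      _ ≤ _ := by gcongr
  have hl : 1 ≤ Real.log (T + 4) := by
    rw [Real.le_log_iff_exp_le (by positivity)]
    linarith [Real.exp_one_lt_d9]
  have h2 : Real.log (|t| + 4) + 3 / 2 ≤ (Real.log (T + 4) + 3 / 2) * Real.exp (0.4 * d / (T + 2)) := by
    have g1 : Real.log (|t| + 4) ≤ Real.log (T + 4) + d / (T + 2) := by
      have : |t| + 4 ≤ (T + 4) * Real.exp (d / (T + 2)) := by
        have := Real.add_one_le_exp (d / (T + 2))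
        have h5 : d / (T + 2) * (T + 2) = d := div_mul_cancel₀ _ (by positivity)
        have h6 : 0 ≤ d / (T + 2) := by positivity
        nlinarith
      have := Real.log_le_log (by positivity) this
      rwa [Real.log_mul (by positivity) (Real.exp_pos _).ne', Real.log_exp] at this
    have g2 := Real.add_one_le_exp (0.4 * d / (T + 2))
    have g3 : 0.4 * d / (T + 2) = 0.4 * (d / (T + 2)) := by ring
    have h6 : 0 ≤ d / (T + 2) := by positivity
    nlinarith
  unfold U
  have h3 : 0 ≤ Real.log (|t| + 4) + 3 / 2 := by
    have : 0 ≤ Real.log (|t| + 4) := Real.log_nonneg (by linarith [abs_nonneg t])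
    linarith
  calc _ ≤ ((T + 2) * Real.exp (d / (T + 2))) * ((Real.log (T + 4) + 3 / 2) * Real.exp (0.4 * d / (T + 2))) := by
        gcongr
    _ = (T + 2) * (Real.log (T + 4) + 3 / 2) * (Real.exp (d / (T + 2)) * Real.exp (0.4 * d / (T + 2))) := by ring
    _ = _ := by rw [← Real.exp_add]; congr 2; ring

lemma Z_strip (s1 : ℂ) (h0 : 0 ≤ s1.re) (h1 : s1.re ≤ 1) :
    ‖riemannZeta₁ s1‖ ≤ Real.exp (1 / 16 + 4 / (|s1.im| + 2) ^ 2) * U s1.im *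
      Real.exp ((1 - s1.re) * (Real.log ((|s1.im| + 2) / (2 * π)) / 2)) := by
  set t1 := s1.im with ht1
  set T := |t1| + 2 with hT
  have hT2 : 2 ≤ T := by have := abs_nonneg t1; linarith
  set l := Real.log (T / (2 * π)) / 2 with hl
  set c : ℂ := 1 / 2 + t1 * I with hc
  let f : ℂ → ℂ := fun s => riemannZeta₁ s * (cexp (1 / 4 * (s - c) ^ 2) * cexp ((s - 1) * l))
  have hnf : ∀ s : ℂ, ‖f s‖ = ‖riemannZeta₁ s‖ * Real.exp (1 / 4 * ((s.re - 1 / 2) ^ 2 - (s.im - t1) ^ 2) + (s.re - 1) * l) := by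
    intro s
    simp only [f, norm_mul]
    rw [norm_exp, norm_exp, ← Real.exp_add]
    congr 3
    · have : (1 / 4 * (s - c) ^ 2 : ℂ) = ((1 / 4 : ℝ) : ℂ) * (s - c) ^ 2 := by push_cast; ring
      rw [this, re_ofReal_mul, sq, mul_re, hc]
      simp; ring
    · rw [re_mul_ofReal]; simp
  have hdf : Differentiable ℂ f := by
    have := differentiable_riemannZeta₁
    fun_prop
  have hexp : ∀ d : ℝ, 0 ≤ d → 1.9 * d / T - 1 / 4 * d ^ 2 ≤ 4 / T ^ 2 := by
    intro d hd
    have : 4 / T ^ 2 - (1.9 * d / T - 1 / 4 * d ^ 2) = (3.61) * (1 / T) ^ 2 - 1.9 * (1 / T) * d + 1 / 4 * d ^ 2 + 0.39 * (1 / T) ^ 2 := by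
      field_simp; ring
    nlinarith [sq_nonneg (1.9 * (1 / T) - d / 2), sq_nonneg (1 / T)]
  have main : ‖f s1‖ ≤ Real.exp (1 / 16 + 4 / T ^ 2) * U t1 := by
    refine PhragmenLindelof.vertical_strip (a := 0) (b := 1) hdf.diffContOnCl ?_ ?_ ?_ h0 h1
    · refine ⟨1, by simp; linarith [Real.pi_gt_three], 3, ?_⟩
      obtain ⟨C, hC⟩ := Z_growth
      have hC0 : 0 ≤ C := by
        have := (norm_nonneg _).trans (hC (1 / 2 + I) (by simp) (by simp; norm_num) (by simp))
        exact nonneg_of_mul_nonneg_left this (Real.exp_pos _)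
      rw [Asymptotics.isBigO_iff]
      refine ⟨C * Real.exp (1 + |l|), ?_⟩
      have hev : ∀ᶠ z in comap (_root_.abs ∘ im) atTop ⊓ 𝓟 (re ⁻¹' Ioo (0:ℝ) 1), 1 ≤ |z.im| ∧ z.re ∈ Ioo (0:ℝ) 1 := by
        apply Filter.Eventually.and
        · apply Filter.Eventually.filter_mono inf_le_left
          exact (eventually_ge_atTop 1).comap _
        · apply Filter.Eventually.filter_mono inf_le_right
          exact mem_principal_self _
      filter_upwards [hev] with z ⟨hz1, hz2⟩
      rw [hnf, Real.norm_of_nonneg (Real.exp_pos _).le]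
      have b1 := hC z hz2.1.le hz2.2.le hz1
      have b2 : 3 * |z.im| ≤ 3 * Real.exp (1 * |z.im|) := by
        have := Real.add_one_le_exp (1 * |z.im|); linarith
      have b3 : 1 / 4 * ((z.re - 1 / 2) ^ 2 - (z.im - t1) ^ 2) + (z.re - 1) * l ≤ 1 + |l| := by
        have : (z.re - 1) * l ≤ |l| := by
          refine (le_abs_self _).trans ?_
          rw [abs_mul, abs_of_neg (by linarith [hz2.2])]
          nlinarith [abs_nonneg l, hz2.1]
        nlinarith [hz2.1, hz2.2, sq_nonneg (z.im - t1)]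
      calc _ ≤ (C * Real.exp (3 * |z.im|)) * Real.exp (1 + |l|) := by gcongr
        _ ≤ (C * Real.exp (3 * Real.exp (1 * |z.im|))) * Real.exp (1 + |l|) := by gcongr
        _ = _ := by ring
    · intro z hz
      rw [hnf, hz]
      set t := z.im with ht
      have hzz : z = t * I := by apply Complex.ext <;> simp [hz, ht]
      have g1 := zero_line t
      have g2 : ‖riemannZeta₁ (1 + t * I)‖ ≤ U t := by
        have := Z_right (1 + t * I) (by simp) (by simp)
        simpa using this
      have g3 : ‖riemannZeta₁ z‖ ≤ Real.exp (Real.log ((|t| + 2) / (2 * π)) / 2) * U t := by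
        rw [hzz]
        refine (pow_le_pow_iff_left₀ (norm_nonneg _) (by have := U_pos t; positivity) two_ne_zero).1 ?_
        rw [mul_pow, ← Real.exp_nat_mul]
        have : Real.exp ((2:ℕ) * (Real.log ((|t| + 2) / (2 * π)) / 2)) = (|t| + 2) / (2 * π) := by
          rw [show ((2:ℕ):ℝ) * (Real.log ((|t| + 2) / (2 * π)) / 2) = Real.log ((|t| + 2) / (2 * π)) by push_cast; ring]
          exact Real.exp_log (by positivity)
        rw [this]
        refine g1.trans ?_
        gcongr
      have g4 : Real.log ((|t| + 2) / (2 * π)) / 2 ≤ l + 0.5 * |t - t1| / T := by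
        have : |t| + 2 ≤ T * Real.exp (|t - t1| / T) := by
          have := Real.add_one_le_exp (|t - t1| / T)
          have hd : |t| ≤ |t1| + |t - t1| := by
            have := abs_add_le t1 (t - t1); simpa using this
          calc |t| + 2 ≤ T * (|t - t1| / T + 1) := by
                rw [mul_add, mul_div_cancel₀ _ (by positivity)]; linarith
            _ ≤ _ := by gcongr
        have := Real.log_le_log (by positivity) (div_le_div_of_nonneg_right this (by positivity : 0 ≤ 2 * π))
        rw [mul_div_right_comm, Real.log_mul (by positivity) (Real.exp_pos _).ne', Real.log_exp] at this
        rw [hl]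
        have e : 0.5 * |t - t1| / T = (|t - t1| / T) / 2 := by ring
        rw [e]; linarith
      have g5 := hexp |t - t1| (abs_nonneg _)
      rw [sq_abs] at g5
      calc _ ≤ (Real.exp (l + 0.5 * |t - t1| / T) * (U t1 * Real.exp (1.4 * |t - t1| / T))) *
            Real.exp (1 / 4 * ((0 - 1 / 2) ^ 2 - (t - t1) ^ 2) + (0 - 1) * l) := by
            gcongr
            refine g3.trans ?_
            exact mul_le_mul (Real.exp_le_exp.2 g4) (U_shift t t1) (U_pos t).le (Real.exp_pos _).le
        _ = Real.exp ((l + 0.5 * |t - t1| / T) + (1.4 * |t - t1| / T) + (1 / 4 * ((0 - 1 / 2) ^ 2 - (t - t1) ^ 2) + (0 - 1) * l)) * U t1 := by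
            rw [Real.exp_add (_ + _), Real.exp_add (l + _)]; ring
        _ ≤ _ := by
            have := U_pos t1
            refine mul_le_mul_of_nonneg_right (Real.exp_le_exp.2 ?_) this.le
            have e : 1.9 * |t - t1| / T = 0.5 * |t - t1| / T + 1.4 * |t - t1| / T := by ring
            linarith
    · intro z hz
      rw [hnf, hz]
      have g2 := Z_right z hz.ge (by rw [hz]; norm_num)
      set t := z.im with ht
      have g5 := hexp |t - t1| (abs_nonneg _)
      rw [sq_abs] at g5
      calc _ ≤ ((U t1 * Real.exp (1.4 * |t - t1| / T))) *
            Real.exp (1 / 4 * ((1 - 1 / 2) ^ 2 - (t - t1) ^ 2) + (1 - 1) * l) := by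
            gcongr
            refine g2.trans (U_shift t t1)
        _ = Real.exp ((1.4 * |t - t1| / T) + (1 / 4 * ((1 - 1 / 2) ^ 2 - (t - t1) ^ 2) + (1 - 1) * l)) * U t1 := by
            rw [Real.exp_add (1.4 * |t - t1| / T)]; ring
        _ ≤ _ := by
            have := U_pos t1
            refine mul_le_mul_of_nonneg_right (Real.exp_le_exp.2 ?_) this.le
            have e : 1.9 * |t - t1| / T = 0.5 * |t - t1| / T + 1.4 * |t - t1| / T := by ring
            have e2 : 0 ≤ 0.5 * |t - t1| / T := by positivity
            linarith
  rw [hnf] at main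
  rw [show s1.im - t1 = 0 by simp [ht1]] at main
  have hu := U_pos t1
  have k1 : Real.exp (1 / 4 * ((s1.re - 1 / 2) ^ 2 - 0 ^ 2) + (s1.re - 1) * l) * Real.exp ((1 - s1.re) * l) ≥ 1 := by
    rw [← Real.exp_add]
    apply Real.one_le_exp
    nlinarith [sq_nonneg (s1.re - 1 / 2)]
  calc ‖riemannZeta₁ s1‖ ≤ ‖riemannZeta₁ s1‖ * (Real.exp (1 / 4 * ((s1.re - 1 / 2) ^ 2 - 0 ^ 2) + (s1.re - 1) * l) * Real.exp ((1 - s1.re) * l)) :=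
        le_mul_of_one_le_right (norm_nonneg _) k1
    _ = (‖riemannZeta₁ s1‖ * Real.exp (1 / 4 * ((s1.re - 1 / 2) ^ 2 - 0 ^ 2) + (s1.re - 1) * l)) * Real.exp ((1 - s1.re) * l) := by ring
    _ ≤ _ := by gcongr

end PNTB
end

section
open Complex Metric Set Filter Topology Function
open scoped Real ComplexConjugate

namespace PNTB

lemma circle_gen (f : ℂ → ℂ) (hf : Continuous f) (c : ℂ) (r M A2 P Q : ℝ) (hr : 0 < r)
    (hs : ∀ z ∈ sphere c r, f z ≠ 0)
    (hl : ∀ θ : ℝ, Real.cos θ ≤ 0 → Real.log ‖f (circleMap c r θ)‖ ≤ M + A2 / 2 * (r * (-Real.cos θ)))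
    (hrt : ∀ θ : ℝ, 0 ≤ Real.cos θ →
      Real.cos θ * P - Q ≤ Real.cos θ * Real.log ‖f (circleMap c r θ)‖) :
    2 * P - π * Q - 2 * M - π * r * A2 / 4 ≤
      ∫ θ in (0:ℝ)..2*π, Real.cos θ * Real.log ‖f (circleMap c r θ)‖ := by
  set g : ℝ → ℝ := fun θ => Real.cos θ * Real.log ‖f (circleMap c r θ)‖ with hg
  have hgc : Continuous g := by
    apply Real.continuous_cos.mul
    apply Continuous.log
    · exact (hf.comp (continuous_circleMap c r)).norm
    · intro θ
      rw [norm_ne_zero_iff]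
      exact hs _ (circleMap_mem_sphere _ hr.le _)
  have hper : Function.Periodic g (2 * π) := by
    intro θ
    simp only [hg, Real.cos_add_two_pi, periodic_circleMap c r θ]
  have e1 : ∫ θ in (0:ℝ)..2*π, g θ = ∫ θ in (-(π/2))..(-(π/2)+2*π), g θ := by
    have := hper.intervalIntegral_add_eq 0 (-(π/2))
    simpa using this
  have e2 : ∫ θ in (-(π/2))..(-(π/2)+2*π), g θ = (∫ θ in (-(π/2))..(π/2), g θ) + ∫ θ in (π/2)..(-(π/2)+2*π), g θ :=
    (intervalIntegral.integral_add_adjacent_intervals (hgc.intervalIntegrable _ _) (hgc.intervalIntegrable _ _)).symm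
  have hpi := Real.pi_pos
  have i1 : ∫ θ in (-(π/2))..(π/2), (Real.cos θ * P - Q) ≤ ∫ θ in (-(π/2))..(π/2), g θ := by
    apply intervalIntegral.integral_mono_on (by linarith)
    · exact Continuous.intervalIntegrable (by fun_prop) _ _
    · exact hgc.intervalIntegrable _ _
    · intro θ hθ
      exact hrt θ (Real.cos_nonneg_of_mem_Icc hθ)
  have i2 : ∫ θ in (π/2)..(-(π/2)+2*π), (Real.cos θ * M - A2 * r / 2 * Real.cos θ ^ 2) ≤ ∫ θ in (π/2)..(-(π/2)+2*π), g θ := by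
    apply intervalIntegral.integral_mono_on (by linarith)
    · exact Continuous.intervalIntegrable (by fun_prop) _ _
    · exact hgc.intervalIntegrable _ _
    · intro θ hθ
      have hc : Real.cos θ ≤ 0 := Real.cos_nonpos_of_pi_div_two_le_of_le hθ.1 (by linarith [hθ.2])
      have := hl θ hc
      simp only [hg]
      nlinarith
  have v1 : ∫ θ in (-(π/2))..(π/2), (Real.cos θ * P - Q) = 2 * P - π * Q := by
    rw [intervalIntegral.integral_sub (Continuous.intervalIntegrable (by fun_prop) _ _) (by simp)]
    rw [intervalIntegral.integral_mul_const, integral_cos, intervalIntegral.integral_const, Real.sin_neg, Real.sin_pi_div_two, smul_eq_mul]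
    ring
  have v2 : ∫ θ in (π/2)..(-(π/2)+2*π), (Real.cos θ * M - A2 * r / 2 * Real.cos θ ^ 2) = -2 * M - π * r * A2 / 4 := by
    rw [intervalIntegral.integral_sub (Continuous.intervalIntegrable (by fun_prop) _ _) (Continuous.intervalIntegrable (by fun_prop) _ _)]
    rw [intervalIntegral.integral_mul_const, intervalIntegral.integral_const_mul, integral_cos, integral_cos_sq]
    simp; ring
  rw [e1, e2]; linarith

lemma log_one_add_le (y : ℝ) (hy : 0 < y) : Real.log (1 + y) ≤ (1 + y) / Real.exp 1 := by
  have := Real.log_le_sub_one_of_pos (x := (1 + y) / Real.exp 1) (by positivity)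
  rw [Real.log_div (by positivity) (Real.exp_pos _).ne', Real.log_exp] at this
  linarith

/-- right half-circle bound -/
lemma right_half (a t r : ℝ) (ha : 0 < a) (hr : 0 < r) (θ : ℝ) (hθ : 0 ≤ Real.cos θ) (p q : ℝ)
    (hp : 0 < Real.cos θ → p * Real.cos θ - q ≤ Real.cos θ * Real.log ‖circleMap (1 + a + t * I) r θ - 1‖) (hq : 0 ≤ q) :
    Real.cos θ * (p - 1 / Real.exp 1) - (q + 1 / (Real.exp 1 * r)) ≤
      Real.cos θ * Real.log ‖riemannZeta₁ (circleMap (1 + a + t * I) r θ)‖ := by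
  rcases hθ.eq_or_lt with h | h
  · rw [← h]
    have : 0 < 1 / (Real.exp 1 * r) := by positivity
    simp only [zero_mul]; linarith
  · set s := circleMap (1 + a + t * I) r θ with hs
    set u := Real.cos θ with hu
    have hre : s.re = 1 + a + r * u := by
      simp [hs, circleMap, exp_ofReal_mul_I_re, hu]
    have h1 : 1 < s.re := by rw [hre]; nlinarith
    have hne : s ≠ 1 := by intro hh; rw [hh] at h1; simp at h1
    have hz := zeta_lower s h1
    have hp' := hp h
    rw [Z_eq hne, norm_mul, Real.log_mul (by simpa [sub_eq_zero] using hne)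
      (by have : 0 < (s.re - 1) / s.re := div_pos (by linarith) (by linarith)
          exact (this.trans_le hz).ne'), mul_add]
    have k1 : -((1 + 1 / (r * u)) / Real.exp 1) ≤ Real.log ‖riemannZeta s‖ := by
      have hru : 0 < r * u := by positivity
      have : (1 + 1 / (r * u))⁻¹ ≤ ‖riemannZeta s‖ := by
        refine le_trans ?_ hz
        rw [hre]
        rw [inv_le_iff_one_le_mul₀ (by positivity)]
        rw [div_mul_eq_mul_div, le_div_iff₀ (by positivity)]
        have : 0 < a / (r * u) := by positivity
        have e : (1 + a + r * u - 1) * (1 + 1 / (r * u)) = (a + r * u + a / (r * u) + 1) := by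
          field_simp; ring
        rw [e]; linarith
      have h3 := Real.log_le_log (by positivity) this
      rw [Real.log_inv] at h3
      have := log_one_add_le (1 / (r * u)) (by positivity)
      linarith
    have k2 : -(u / Real.exp 1 + 1 / (Real.exp 1 * r)) ≤ u * Real.log ‖riemannZeta s‖ := by
      calc _ = u * -((1 + 1 / (r * u)) / Real.exp 1) := by field_simp
        _ ≤ _ := by gcongr
    have e : u * (p - 1 / Real.exp 1) = p * u - u / Real.exp 1 := by ring
    linarith

/-- left half-circle bound -/
lemma left_half (a t r q A2 : ℝ) (ha : 0 < a) (ha2 : a ≤ 1 / 40) (hr0 : 0 < r) (hr : r ≤ 1) (θ : ℝ)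
    (hθ : Real.cos θ ≤ 0) (hq : 0 < q) (hA0 : 0 ≤ A2) (hA : Real.log ((|t| + 3) / (2 * π)) ≤ A2)
    (hqt : q ≤ |t + r * Real.sin θ| + 2)
    (hne : riemannZeta₁ (circleMap (1 + a + t * I) r θ) ≠ 0) :
    Real.log ‖riemannZeta₁ (circleMap (1 + a + t * I) r θ)‖ ≤
      (1 / 16 + 4 / q ^ 2 + Real.log (U (|t| + 1))) + A2 / 2 * (r * (-Real.cos θ)) := by
  set s := circleMap (1 + a + t * I) r θ with hs
  have hre : s.re = 1 + a + r * Real.cos θ := by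
    simp [hs, circleMap, exp_ofReal_mul_I_re]
  have him : s.im = t + r * Real.sin θ := by
    simp [hs, circleMap, exp_ofReal_mul_I_im]
  have himb : |s.im| ≤ |t| + 1 := by
    rw [him]
    refine (abs_add_le _ _).trans ?_
    have : |r * Real.sin θ| ≤ 1 := by
      rw [abs_mul, abs_of_pos hr0]
      have := Real.abs_sin_le_one θ
      nlinarith [abs_nonneg (Real.sin θ)]
    linarith
  have hUU : U s.im ≤ U (|t| + 1) := by
    unfold U
    have h1 : |s.im| ≤ |(|t| + 1)| := himb.trans (le_abs_self _)
    have h2 : 0 ≤ Real.log (|s.im| + 4) := Real.log_nonneg (by linarith [abs_nonneg s.im])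
    gcongr
  have hlU := Real.log_le_log (U_pos _) hUU
  have hpos : 0 < ‖riemannZeta₁ s‖ := norm_pos_iff.2 hne
  have hx : 0 ≤ A2 / 2 * (r * (-Real.cos θ)) := by
    have : 0 ≤ -Real.cos θ := by linarith
    positivity
  have hcos := Real.neg_one_le_cos θ
  rcases le_total 1 s.re with h | h
  · have h1 := Real.log_le_log hpos (Z_right s h (by rw [hre]; nlinarith))
    have : 0 < 4 / q ^ 2 := by positivity
    linarith
  · have h1 := Real.log_le_log hpos (Z_strip s (by rw [hre]; nlinarith) h)
    rw [Real.log_mul (mul_pos (Real.exp_pos _) (U_pos _)).ne' (Real.exp_pos _).ne',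
      Real.log_mul (Real.exp_pos _).ne' (U_pos _).ne', Real.log_exp, Real.log_exp] at h1
    have h2 : 4 / (|s.im| + 2) ^ 2 ≤ 4 / q ^ 2 := by
      rw [← him] at hqt
      gcongr
    have h3 : Real.log ((|s.im| + 2) / (2 * π)) ≤ A2 := by
      refine le_trans (Real.log_le_log (by positivity) ?_) hA
      exact div_le_div_of_nonneg_right (by linarith) (by positivity)
    have h4 : (1 - s.re) * (Real.log ((|s.im| + 2) / (2 * π)) / 2) ≤ A2 / 2 * (r * (-Real.cos θ)) := by
      have g1 : 0 ≤ 1 - s.re := by linarith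
      have g2 : 1 - s.re ≤ r * (-Real.cos θ) := by rw [hre]; linarith
      calc _ ≤ (1 - s.re) * (A2 / 2) := by gcongr
        _ ≤ (r * (-Real.cos θ)) * (A2 / 2) := by gcongr
        _ = _ := by ring
    linarith

end PNTB
end

section
open Complex Metric Set Filter Topology Function
open scoped Real ComplexConjugate

namespace PNTB

noncomputable def LL (T : ℝ) : ℝ := Real.log (Real.log (T + 5) + 3 / 2)

noncomputable def Bd (T : ℝ) : ℝ := 0.6431 * LL T + 0.655 + Real.log ((T + 3) / (2 * π)) / 4

lemma inv_e_le : 1 / Real.exp 1 ≤ 0.36788 := by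
  rw [div_le_iff₀ (Real.exp_pos _)]
  have := Real.exp_one_gt_d9; linarith

lemma circle_B (a t r : ℝ) (ha : 0 < a) (ha2 : a ≤ 1 / 40) (hr0 : 0.99 < r) (hr : r < 1)
    (hs : ∀ z ∈ sphere (1 + a + t * I : ℂ) r, riemannZeta₁ z ≠ 0) (q A2 p Q : ℝ) (hq : 0 < q) (hA0 : 0 ≤ A2)
    (hA : Real.log ((|t| + 3) / (2 * π)) ≤ A2)
    (hqt : ∀ θ : ℝ, q ≤ |t + r * Real.sin θ| + 2) (hQ : 0 ≤ Q)
    (hp : ∀ θ : ℝ, 0 < Real.cos θ → p * Real.cos θ - Q ≤ Real.cos θ * Real.log ‖circleMap (1 + a + t * I) r θ - 1‖)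
    (hB : 0 ≤ 1 / 16 + 4 / q ^ 2 + Real.log (U (|t| + 1)) - p + 0.36788) :
    -(0.6431 * (1 / 16 + 4 / q ^ 2 + Real.log (U (|t| + 1)) - p + 0.36788) + (Q / 0.99 + 0.37535) + A2 / 4) ≤
     (∫ θ in (0:ℝ)..2*π, Real.cos θ * Real.log ‖riemannZeta₁ (circleMap (1 + a + t * I) r θ)‖) / (π * r) := by
  have hr1 : 0 < r := by linarith
  have h := circle_gen riemannZeta₁ differentiable_riemannZeta₁.continuous (1 + a + t * I) r
    (1 / 16 + 4 / q ^ 2 + Real.log (U (|t| + 1))) A2 (p - 1 / Real.exp 1) (Q + 1 / (Real.exp 1 * r)) hr1 hs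
    (fun θ hθ => left_half a t r q A2 ha ha2 hr1 hr.le θ hθ hq hA0 hA (hqt θ) (hs _ (circleMap_mem_sphere _ hr1.le _)))
    (fun θ hθ => right_half a t r ha hr1 θ hθ p Q (hp θ) hQ)
  have hpi := Real.pi_gt_d4
  have hpr : 0 < π * r := by positivity
  rw [le_div_iff₀ hpr]
  refine le_trans ?_ h
  set M := 1 / 16 + 4 / q ^ 2 + Real.log (U (|t| + 1)) with hM
  have he := inv_e_le
  have h1 : 2 * (M - (p - 1 / Real.exp 1)) ≤ 0.6431 * (M - p + 0.36788) * (π * r) := by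
    have : 2 ≤ 0.6431 * (π * r) := by
      have : 3.1415 * 0.99 ≤ π * r := by gcongr
      linarith
    nlinarith
  have h2 : π * (Q + 1 / (Real.exp 1 * r)) ≤ (Q / 0.99 + 0.37535) * (π * r) := by
    have : Q + 1 / (Real.exp 1 * r) ≤ (Q / 0.99 + 0.37535) * r := by
      have g1 : Q ≤ Q / 0.99 * r := by
        rw [div_mul_eq_mul_div, le_div_iff₀ (by norm_num)]; nlinarith
      have g2 : 1 / (Real.exp 1 * r) ≤ 0.37535 * r := by
        rw [← one_div_mul_one_div]
        have : 1 / r ≤ 1 / 0.99 := one_div_le_one_div_of_le (by norm_num) hr0.le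
        have h0 : 0 < 1 / Real.exp 1 := by positivity
        have h0' : 0 < 1 / r := by positivity
        nlinarith
      nlinarith
    nlinarith
  nlinarith

lemma dist_one (a t r : ℝ) (hr1 : 0 < r) (hr : r < 1) (θ : ℝ) (hcos : 0 < Real.cos θ) (ha : 0 < a) :
    |t| - 1 ≤ ‖circleMap (1 + a + t * I : ℂ) r θ - 1‖ ∧ r * Real.cos θ ≤ ‖circleMap (1 + a + t * I : ℂ) r θ - 1‖ := by
  constructor
  · refine le_trans ?_ (abs_im_le_norm _)
    have : (circleMap (1 + a + t * I : ℂ) r θ - 1).im = t + r * Real.sin θ := by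
      simp [circleMap, exp_ofReal_mul_I_im]
    rw [this]
    have h1 : |r * Real.sin θ| ≤ 1 := by
      rw [abs_mul, abs_of_pos hr1]
      have := Real.abs_sin_le_one θ
      nlinarith [abs_nonneg (Real.sin θ)]
    have := abs_sub_abs_le_abs_sub t (-(r * Real.sin θ))
    rw [abs_neg, sub_neg_eq_add] at this
    linarith
  · refine le_trans ?_ (re_le_norm _)
    simp [circleMap, exp_ofReal_mul_I_re]; linarith

lemma log_diff_le (x : ℝ) (hx : 1 < x) : Real.log (x + 3) - Real.log (x - 1) ≤ 4 / (x - 1) := by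
  rw [← Real.log_div (by linarith) (by linarith)]
  refine (Real.log_le_sub_one_of_pos (div_pos (by linarith) (by linarith))).trans (le_of_eq ?_)
  field_simp [(by linarith : x - 1 ≠ 0)]; ring

lemma exp_le_of_pow (x b : ℝ) (n k : ℕ) (hn : n ≠ 0) (hb : 0 ≤ b) (hx : (n:ℝ) * x = k)
    (h : (2.7182818286:ℝ) ^ k ≤ b ^ n) : Real.exp x ≤ b := by
  refine (pow_le_pow_iff_left₀ (Real.exp_pos _).le hb hn).1 ?_
  rw [← Real.exp_nat_mul, hx]
  calc Real.exp (k:ℝ) = Real.exp 1 ^ k := by rw [← Real.exp_nat_mul, mul_one]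
    _ ≤ 2.7182818286 ^ k := by
      have := Real.exp_one_lt_d9
      have := Real.exp_pos 1
      gcongr
    _ ≤ _ := h

lemma Bd_lower (T : ℝ) (hT : 50000 ≤ T) : 4.5 ≤ Bd T := by
  have h1 : 10.8 ≤ Real.log (T + 5) := by
    rw [Real.le_log_iff_exp_le (by linarith)]
    have := exp_le_of_pow 10.8 50005 5 54 (by norm_num) (by norm_num) (by norm_num) (by norm_num)
    linarith
  have h2 : 2.5 ≤ LL T := by
    unfold LL
    rw [Real.le_log_iff_exp_le (by linarith)]
    have := exp_le_of_pow 2.5 12.3 2 5 (by norm_num) (by norm_num) (by norm_num) (by norm_num)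
    linarith
  have h3 : 8.95 ≤ Real.log ((T + 3) / (2 * π)) := by
    have hpi := Real.pi_lt_d2
    have := Real.pi_pos
    rw [Real.le_log_iff_exp_le (by positivity), le_div_iff₀ (by positivity)]
    have := exp_le_of_pow 8.95 7930 20 179 (by norm_num) (by norm_num) (by norm_num) (by norm_num)
    nlinarith
  unfold Bd; linarith

lemma log_U (x : ℝ) (hx : 0 ≤ x) : Real.log (U (x + 1)) = Real.log (x + 3) + LL x := by
  have : 0 ≤ Real.log (x + 5) := Real.log_nonneg (by linarith)
  unfold U LL
  rw [abs_of_nonneg (by linarith), ← Real.log_mul (by linarith) (by linarith)]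
  rw [show x + 1 + 4 = x + 5 by ring, show x + 1 + 2 = x + 3 by ring]

lemma LL_nonneg (x : ℝ) (hx : 0 ≤ x) : 0 ≤ LL x := by
  unfold LL
  have : 0 ≤ Real.log (x + 5) := Real.log_nonneg (by linarith)
  exact Real.log_nonneg (by linarith)

lemma LL_mono {x y : ℝ} (hx : 0 ≤ x) (h : x ≤ y) : LL x ≤ LL y := by
  unfold LL
  have : 0 ≤ Real.log (x + 5) := Real.log_nonneg (by linarith)
  have := Real.log_le_log (by linarith : 0 < x + 5) (by linarith : x + 5 ≤ y + 5)
  exact Real.log_le_log (by linarith) (by linarith)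

lemma circle_int (a t r T B : ℝ) (ha : 0 < a) (ha2 : a ≤ 1 / 40) (hr0 : 0.99 < r) (hr : r < 1)
    (ht : |t| ≤ T) (hB1 : |t| ≤ 1000 → 4.25 ≤ B) (hB2 : 1000 ≤ |t| → Bd T ≤ B)
    (hs : ∀ z ∈ sphere (1 + a + t * I : ℂ) r, riemannZeta₁ z ≠ 0) :
    -B ≤ (∫ θ in (0:ℝ)..2*π, Real.cos θ * Real.log ‖riemannZeta₁ (circleMap (1 + a + t * I) r θ)‖) / (π * r) := by
  have hB := circle_B a t r ha ha2 hr0 hr hs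
  have hr1 : 0 < r := by linarith
  have hpi := Real.pi_gt_d4
  have ht0 := abs_nonneg t
  have hl2 := Real.log_two_lt_d9
  have himlow : ∀ θ, |t| - 1 ≤ |t + r * Real.sin θ| := by
    intro θ
    have h1 : |r * Real.sin θ| ≤ 1 := by
      rw [abs_mul, abs_of_pos hr1]
      have := Real.abs_sin_le_one θ
      nlinarith [abs_nonneg (Real.sin θ)]
    have := abs_sub_abs_le_abs_sub t (-(r * Real.sin θ))
    rw [abs_neg, sub_neg_eq_add] at this
    linarith
  have hpm : ∀ θ : ℝ, 1 < |t| → 0 < Real.cos θ → Real.log (|t| - 1) * Real.cos θ - 0 ≤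
      Real.cos θ * Real.log ‖circleMap (1 + a + t * I) r θ - 1‖ := by
    intro θ h1 hc
    have := (dist_one a t r hr1 hr θ hc ha).1
    have := Real.log_le_log (by linarith) this
    nlinarith
  rcases le_total |t| 5 with h5 | h5
  · have hBl := hB1 (by linarith)
    have hLL : LL |t| ≤ Real.log 2 * 2 := by
      have e : Real.log 2 * 2 = Real.log (2 ^ 2) := by rw [Real.log_pow]; push_cast; ring
      rw [e]; unfold LL
      have : Real.log (|t| + 5) ≤ Real.log (2 ^ 3 * (5/4)) := Real.log_le_log (by linarith) (by linarith)
      rw [Real.log_mul (by norm_num) (by norm_num), Real.log_pow] at this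
      have h7 := Real.log_le_sub_one_of_pos (by norm_num : (0:ℝ) < 5 / 4)
      have : 0 ≤ Real.log (|t| + 5) := Real.log_nonneg (by linarith)
      push_cast at *
      exact Real.log_le_log (by linarith) (by linarith)
    have hl3 : Real.log (|t| + 3) ≤ Real.log 2 * 3 := by
      have e : Real.log 2 * 3 = Real.log (2 ^ 3) := by rw [Real.log_pow]; push_cast; ring
      rw [e]; exact Real.log_le_log (by linarith) (by linarith)
    have h1 : 0 ≤ Real.log (|t| + 3) := Real.log_nonneg (by linarith)
    have h2 := LL_nonneg |t| ht0
    have hU := log_U |t| ht0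
    have hA : Real.log ((|t| + 3) / (2 * π)) ≤ 0.28 := by
      have : Real.log ((|t| + 3) / (2 * π)) ≤ (|t| + 3) / (2 * π) - 1 :=
        Real.log_le_sub_one_of_pos (by positivity)
      have h8 : (|t| + 3) / (2 * π) ≤ 1.28 := by
        rw [div_le_iff₀ (by positivity)]; nlinarith
      linarith
    have he := inv_e_le
    have he0 : 0 < 1 / Real.exp 1 := by positivity
    have := hB 2 0.28 (-0.36788) 0.3716 (by norm_num) (by norm_num) hA
      (fun θ => by linarith [abs_nonneg (t + r * Real.sin θ)]) (by norm_num) (by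
        intro θ hc
        have h9 := (dist_one a t r hr1 hr θ hc ha).2
        have hru : 0 < r * Real.cos θ := by positivity
        have h10 := Real.log_le_log hru h9
        have h11 := log_one_add_le (1 / (r * Real.cos θ)) (by positivity)
        have h12 : Real.log (1 / (r * Real.cos θ)) ≤ Real.log (1 + 1 / (r * Real.cos θ)) :=
          Real.log_le_log (by positivity) (by linarith)
        rw [one_div (r * _), Real.log_inv, ← one_div] at h12
        have h13 : -((1 + 1 / (r * Real.cos θ)) / Real.exp 1) ≤ Real.log ‖circleMap (1 + a + t * I) r θ - 1‖ := by linarith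
        calc _ ≤ -(Real.cos θ * (1 / Real.exp 1) + (1 / r) * (1 / Real.exp 1)) := by
              have g1 : 1 / r ≤ 1 / 0.99 := one_div_le_one_div_of_le (by norm_num) hr0.le
              have g0 : 0 < 1 / r := by positivity
              have g2 : (1 / r) * (1 / Real.exp 1) ≤ (1 / 0.99) * 0.36788 := by gcongr
              have g3 : Real.cos θ * (1 / Real.exp 1) ≤ Real.cos θ * 0.36788 := by gcongr
              have g4 : (1 / 0.99 : ℝ) * 0.36788 ≤ 0.3716 := by norm_num
              linarith
          _ = Real.cos θ * (-((1 + 1 / (r * Real.cos θ)) / Real.exp 1)) := by field_simp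
          _ ≤ _ := by gcongr) (by rw [hU]; norm_num; linarith)
    rw [hU] at this
    refine le_trans ?_ this
    norm_num at hBl ⊢
    linarith
  rcases le_total |t| 1000 with h6 | h6
  · have hBl := hB1 h6
    have hLL : LL |t| ≤ 2.3 := by
      unfold LL
      have h7 : Real.log (|t| + 5) ≤ Real.log (2 ^ 10) := Real.log_le_log (by linarith) (by linarith)
      rw [Real.log_pow] at h7
      have : 0 ≤ Real.log (|t| + 5) := Real.log_nonneg (by linarith)
      have h8 : Real.log (Real.log (|t| + 5) + 3 / 2) ≤ Real.log (2 ^ 3 * (9 / 8)) :=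
        Real.log_le_log (by linarith) (by push_cast at h7; linarith)
      rw [Real.log_mul (by norm_num) (by norm_num), Real.log_pow] at h8
      have h9 := Real.log_le_sub_one_of_pos (by norm_num : (0:ℝ) < 9 / 8)
      push_cast at h8; linarith
    have hU := log_U |t| ht0
    have hd := log_diff_le |t| (by linarith)
    have hd2 : 4 / (|t| - 1) ≤ 1 := by rw [div_le_one (by linarith)]; linarith
    have hd3 : Real.log (|t| - 1) ≤ Real.log (|t| + 3) := Real.log_le_log (by linarith) (by linarith)
    have h2 := LL_nonneg |t| ht0
    have hA : Real.log ((|t| + 3) / (2 * π)) ≤ 5.6 := by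
      have h8 : (|t| + 3) / (2 * π) ≤ 2 ^ 8 := by
        rw [div_le_iff₀ (by positivity)]; nlinarith
      have := Real.log_le_log (by positivity) h8
      rw [Real.log_pow] at this
      push_cast at this; linarith
    have := hB 6 5.6 (Real.log (|t| - 1)) 0 (by norm_num) (by norm_num) hA
      (fun θ => by linarith [himlow θ]) (by norm_num) (fun θ hc => hpm θ (by linarith) hc)
      (by rw [hU]; norm_num; linarith)
    rw [hU] at this
    refine le_trans ?_ this
    norm_num at hBl ⊢
    linarith
  · have hU := log_U |t| ht0
    have hLL := LL_mono ht0 ht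
    have hd := log_diff_le |t| (by linarith)
    have hd2 : 4 / (|t| - 1) ≤ 4 / 999 := div_le_div_of_nonneg_left (by norm_num) (by norm_num) (by linarith)
    have hd3 : Real.log (|t| - 1) ≤ Real.log (|t| + 3) := Real.log_le_log (by linarith) (by linarith)
    have h2 := LL_nonneg |t| ht0
    have hA : Real.log ((|t| + 3) / (2 * π)) ≤ Real.log ((T + 3) / (2 * π)) :=
      Real.log_le_log (by positivity) (div_le_div_of_nonneg_right (by linarith) (by positivity))
    have hA0 : 0 ≤ Real.log ((T + 3) / (2 * π)) := by
      have hT : 1000 ≤ T := h6.trans ht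
      apply Real.log_nonneg
      have := Real.pi_lt_four
      rw [le_div_iff₀ (by positivity)]; linarith
    have := hB 1000 _ (Real.log (|t| - 1)) 0 (by norm_num) hA0 hA
      (fun θ => by linarith [himlow θ]) (by norm_num) (fun θ hc => hpm θ (by linarith) hc)
      (by rw [hU]; norm_num; linarith)
    rw [hU] at this
    refine le_trans ?_ this
    have hBl := hB2 h6
    unfold Bd at hBl
    norm_num at hd2 hBl ⊢
    linarith

end PNTB
end

section
open Complex Metric Set Filter Topology Function
open scoped Real ComplexConjugate

namespace PNTB

noncomputable def H (s : ℂ) : ℂ := deriv riemannZeta₁ s / riemannZeta₁ s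

lemma Z_ne_zero (s : ℂ) (hs : 1 ≤ s.re) : riemannZeta₁ s ≠ 0 := by
  by_cases h : s = 1
  · subst h; simp
  · rw [Z_eq h]
    exact mul_ne_zero (sub_ne_zero.2 h) (riemannZeta_ne_zero_of_one_le_re hs)

lemma exists_radius (c : ℂ) (hc : riemannZeta₁ c ≠ 0) :
    ∃ r : ℝ, 0.99 < r ∧ r < 1 ∧ ∀ z ∈ sphere c r, riemannZeta₁ z ≠ 0 := by
  have hfin := zeros_finite differentiable_riemannZeta₁ c hc c 1
  have h2 : ((fun z => dist z c) '' (closedBall c 1 ∩ {z | riemannZeta₁ z = 0})).Finite := hfin.image _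
  obtain ⟨r, hr, hr2⟩ := ((Ioo_infinite (by norm_num : (0.99:ℝ) < 1)).sdiff h2).nonempty
  refine ⟨r, hr.1, hr.2, fun z hz hz0 => hr2 ?_⟩
  refine ⟨z, ⟨?_, hz0⟩, hz⟩
  rw [mem_closedBall, mem_sphere.1 hz]; exact hr.2.le

lemma H_lower (a t T B : ℝ) (ha : 0 < a) (ha2 : a ≤ 1 / 40) (ht : |t| ≤ T)
    (hB1 : |t| ≤ 1000 → 4.25 ≤ B) (hB2 : 1000 ≤ |t| → Bd T ≤ B) :
    -B ≤ (H (1 + a + t * I)).re ∧ ∀ β : ℝ, riemannZeta₁ (β + t * I) = 0 → 1 + a - β ≤ 0.99 →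
      1 / (1 + a - β) - 1.03 * (1 + a - β) - B ≤ (H (1 + a + t * I)).re := by
  have hc : riemannZeta₁ (1 + a + t * I) ≠ 0 := Z_ne_zero _ (by simp; linarith)
  obtain ⟨r, hr0, hr, hs⟩ := exists_radius _ hc
  have hr1 : 0 < r := by linarith
  have hI := circle_int a t r T B ha ha2 hr0 hr ht hB1 hB2 hs
  obtain ⟨h1, h2⟩ := blaschke differentiable_riemannZeta₁ (1 + a + t * I) r hr1 hs hc (by
    intro z _ hz
    by_contra hcon
    have : 1 ≤ z.re := by simp at hcon; linarith
    exact Z_ne_zero z this hz)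
  refine ⟨hI.trans h1, fun β hβ hd => ?_⟩
  have hβ1 : β < 1 := by
    by_contra hcon
    exact Z_ne_zero (β + t * I) (by simpa using hcon) hβ
  have hn : ‖(1 + a + t * I : ℂ) - (β + t * I)‖ = 1 + a - β := by
    have : (1 + a + t * I : ℂ) - (β + t * I) = ((1 + a - β : ℝ) : ℂ) := by push_cast; ring
    rw [this, norm_real, Real.norm_of_nonneg (by linarith)]
  have h3 := h2 (β + t * I) (by
    rw [mem_ball, dist_comm, dist_eq, hn]; linarith) hβ
  rw [hn] at h3
  simp only [add_re, one_re, ofReal_re, mul_re, I_re, I_im, ofReal_im, mul_zero, zero_mul, sub_zero, add_zero, mul_one] at h3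
  set d := 1 + a - β with hd'
  have hd0 : 0 < d := by linarith
  have e : d * (1 / d ^ 2 - 1 / r ^ 2) = 1 / d - d * (1 / r ^ 2) := by field_simp
  have h4 : 1 / r ^ 2 ≤ 1.03 := by
    rw [div_le_iff₀ (by positivity)]; nlinarith
  have h5 : d * (1 / r ^ 2) ≤ d * 1.03 := by gcongr
  unfold H
  rw [e] at h3
  linarith

end PNTB
end

section
open Complex Metric Set Filter Topology Function
open scoped Real ComplexConjugate

namespace PNTB
open ZetaAsymptotics

lemma termTSum_anti {s s' : ℝ} (hs : 1 ≤ s) (h : s ≤ s') : termTSum s' ≤ termTSum s := by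
  have key : ∀ (u u' : ℝ), 1 ≤ u → u ≤ u' → ∀ n : ℕ, term (n + 1) u' ≤ term (n + 1) u := by
    intro u u' hu huu n
    rw [term, term]
    refine intervalIntegral.integral_mono_on (by simp) (term_welldef n.succ_pos (by linarith)) 
      (term_welldef n.succ_pos (by linarith)) ?_
    intro x hx
    have h1 : (1:ℝ) ≤ x := le_trans (by simp) hx.1
    have h2 := hx.1
    gcongr
  have hsum : ∀ u : ℝ, 1 ≤ u → Summable (fun n : ℕ => term (n + 1) u) := fun u hu =>
    Summable.of_nonneg_of_le (fun n => term_nonneg _ _) (key 1 u le_rfl hu) term_tsum_one.summable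
  exact (hsum s' (hs.trans h)).tsum_le_tsum (key s s' hs h) (hsum s hs)

lemma termTSum_le {s : ℝ} (hs : 1 ≤ s) : 0 ≤ termTSum s ∧ termTSum s ≤ 1 / 2 := by
  refine ⟨tsum_nonneg fun n => term_nonneg _ _, (termTSum_anti le_rfl hs).trans ?_⟩
  have : termTSum 1 = 1 - Real.eulerMascheroniConstant := term_tsum_one.tsum_eq
  rw [this]
  linarith [Real.one_half_lt_eulerMascheroniConstant]

lemma Z_real {s : ℝ} (hs : 1 < s) : riemannZeta₁ s = ((s - s * (s - 1) * termTSum s : ℝ) : ℂ) := by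
  have hs1 : (s:ℂ) ≠ 1 := by exact_mod_cast hs.ne'
  rw [Z_eq hs1, zeta_eq_tsum_one_div_nat_add_one_cpow (by simpa using hs)]
  have h := zeta_limit_aux1 hs
  have e : ∑' n : ℕ, 1 / ((n:ℂ) + 1) ^ (s:ℂ) = ((∑' n : ℕ, 1 / (n + 1 : ℝ) ^ s : ℝ) : ℂ) := by
    rw [ofReal_tsum]
    congr 1; ext n
    rw [ofReal_div, ofReal_cpow (by positivity)]; push_cast; rfl
  rw [e, show (∑' n : ℕ, 1 / (n + 1 : ℝ) ^ s) = 1 / (s - 1) + 1 - s * termTSum s by linarith]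
  rw [← ofReal_one, ← ofReal_sub, ← ofReal_mul]
  congr 1
  have : s - 1 ≠ 0 := by linarith
  field_simp
  ring

lemma H_real (a : ℝ) (ha : 0 < a) (ha2 : a ≤ 1 / 40) : 0 ≤ (H (1 + a)).re := by
  set f : ℝ → ℝ := fun s => (riemannZeta₁ s).re with hf
  have hd : HasDerivAt f (deriv riemannZeta₁ ((1 + a : ℝ) : ℂ)).re (1 + a) :=
    (differentiable_riemannZeta₁ ((1 + a : ℝ) : ℂ)).hasDerivAt.real_of_complex
  have hfv : ∀ s, 1 < s → f s = s - s * (s - 1) * termTSum s := by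
    intro s hs; rw [hf]; simp only; rw [Z_real hs, ofReal_re]
  have hmono : MonotoneOn f (Ioo 1 (3 / 2)) := by
    intro s hs s' hs' hss
    rw [hfv s hs.1, hfv s' hs'.1]
    have h1 := termTSum_anti hs.1.le hss
    obtain ⟨h2, h3⟩ := termTSum_le hs.1.le
    obtain ⟨h4, h5⟩ := hs
    obtain ⟨h6, h7⟩ := hs'
    have : s' * (s' - 1) * termTSum s' ≤ s' * (s' - 1) * termTSum s :=
      mul_le_mul_of_nonneg_left h1 (by nlinarith)
    have h8 : termTSum s * (s' + s - 1) ≤ 1 := by nlinarith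
    nlinarith
  have hd0 : 0 ≤ deriv f (1 + a) := by
    have h1 : derivWithin f (Ioo 1 (3/2)) (1 + a) = deriv f (1 + a) :=
      derivWithin_of_isOpen isOpen_Ioo ⟨by linarith, by linarith⟩
    rw [← h1]
    exact hmono.derivWithin_nonneg
  rw [hd.deriv] at hd0
  have hz := Z_real (s := 1 + a) (by linarith)
  obtain ⟨h2, h3⟩ := termTSum_le (s := 1 + a) (by linarith)
  unfold H
  push_cast at hd0 hz
  rw [hz]
  have : (1 + (a:ℂ) - (1 + a) * (1 + a - 1) * termTSum (1 + a)) = 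
     (((1 + a) - (1 + a) * ((1 + a) - 1) * termTSum (1 + a) : ℝ) : ℂ) := by push_cast; ring
  rw [this, div_ofReal_re]
  apply div_nonneg hd0
  have : (1 + a) * (1 + a - 1) ≤ 1 := by nlinarith
  have h7 : 0 ≤ (1 + a) * (1 + a - 1) := by nlinarith
  nlinarith

/-- log derivative as a series -/
lemma hasSum_neg_H (s : ℂ) (hs : 1 < s.re) : 
   HasSum (fun n : ℕ => LSeries.term (fun n => (ArithmeticFunction.vonMangoldt n : ℂ)) s n) (1 / (s - 1) - H s) := by
  have h1 := (ArithmeticFunction.LSeriesSummable_vonMangoldt hs).LSeriesHasSum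
  have h2 := ArithmeticFunction.LSeries_vonMangoldt_eq_deriv_riemannZeta_div hs
  rw [h2] at h1
  unfold LSeriesHasSum at h1
  convert h1 using 1
  have hs1 : s ≠ 1 := by rintro rfl; simp at hs
  have hz : riemannZeta s ≠ 0 := riemannZeta_ne_zero_of_one_le_re hs.le
  have hd : HasDerivAt riemannZeta₁ (1 * riemannZeta s + (s - 1) * deriv riemannZeta s) s := by
    have := ((hasDerivAt_id s).sub_const 1).mul (differentiableAt_riemannZeta hs1).hasDerivAt
    refine this.congr_of_eventuallyEq ?_
    filter_upwards [isOpen_ne.mem_nhds hs1] with z hz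
    rw [Z_eq hz]; rfl
  unfold H
  rw [hd.deriv, Z_eq hs1]
  have := sub_ne_zero.2 hs1
  field_simp
  ring

lemma trig_pos (a t : ℝ) (ha : 0 < a) : 
   0 ≤ 1.403075 * (1 / a - (H (1 + a)).re) + 2.3919 * (1 / (a + t * I) - H (1 + a + t * I)).re
     + 1.46305 * (1 / (a + (2 * t : ℝ) * I) - H (1 + a + (2 * t : ℝ) * I)).re
     + 0.595 * (1 / (a + (3 * t : ℝ) * I) - H (1 + a + (3 * t : ℝ) * I)).re
     + 0.125 * (1 / (a + (4 * t : ℝ) * I) - H (1 + a + (4 * t : ℝ) * I)).re := by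
  have hk : ∀ u : ℝ, HasSum (fun n : ℕ => (ArithmeticFunction.vonMangoldt n) * (n:ℝ) ^ (-(1 + a)) * Real.cos (u * Real.log n))
     (1 / (a + u * I) - H (1 + a + u * I)).re := by
    intro u
    have h := hasSum_neg_H (1 + a + u * I) (by simp; linarith)
    have h2 := hasSum_re h
    convert h2 using 1
    · ext n
      rcases Nat.eq_zero_or_pos n with rfl | hn
      · simp
      · rw [LSeries.term_of_ne_zero hn.ne']
        have hn' : (0:ℝ) < n := by exact_mod_cast hn
        have e : ((n:ℂ)) ^ (1 + a + u * I : ℂ) = ((((n:ℝ) ^ (-(1 + a)))⁻¹ : ℝ) : ℂ) * exp ((u * Real.log n : ℝ) * I) := by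
          rw [← Real.rpow_neg hn'.le, neg_neg, ofReal_cpow hn'.le, cpow_add _ _ (by exact_mod_cast hn.ne')]
          congr 1
          · push_cast; rfl
          · rw [cpow_def_of_ne_zero (by exact_mod_cast hn.ne'), ← ofReal_natCast, ← ofReal_log hn'.le]
            congr 1; push_cast; ring
        rw [e, div_mul_eq_div_div, ← ofReal_div, div_eq_mul_inv _ (exp _), ← exp_neg,
           show -(((u * Real.log n : ℝ) : ℂ) * I) = ((-(u * Real.log n) : ℝ) : ℂ) * I by push_cast; ring]
        rw [re_ofReal_mul, exp_ofReal_mul_I_re, Real.cos_neg, div_inv_eq_mul]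
    · congr 3; ring
  have h0 := hk 0
  have hsum := ((((h0.mul_left 1.403075).add ((hk t).mul_left 2.3919)).add ((hk (2*t)).mul_left 1.46305)).add 
    ((hk (3*t)).mul_left 0.595)).add ((hk (4*t)).mul_left 0.125)
  have := hsum.nonneg (by
    intro n
    have hL : 0 ≤ ArithmeticFunction.vonMangoldt n := ArithmeticFunction.vonMangoldt_nonneg
    have hr : 0 ≤ (n:ℝ) ^ (-(1 + a)) := by positivity
    set x := t * Real.log n with hx
    have e2 : 2 * t * Real.log n = 2 * x := by rw [hx]; ring
    have e3 : 3 * t * Real.log n = 3 * x := by rw [hx]; ring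
    have e4 : 4 * t * Real.log n = 2 * (2 * x) := by rw [hx]; ring
    rw [e2, e3, e4, Real.cos_two_mul (2 * x), Real.cos_two_mul, Real.cos_three_mul, zero_mul, Real.cos_zero]
    have : 0 ≤ (ArithmeticFunction.vonMangoldt n * (n:ℝ) ^ (-(1 + a))) * (Real.cos x ^ 2 + 1.19 * Real.cos x + 0.255) ^ 2 := by positivity
    refine this.trans (le_of_eq ?_)
    ring)
  have e0 : (1 / ((a:ℂ) + (0:ℝ) * I) - H (1 + a + (0:ℝ) * I)).re = 1 / a - (H (1 + a)).re := by
    rw [ofReal_zero, zero_mul, add_zero, add_zero, sub_re, ← ofReal_one, ← ofReal_div, ofReal_re]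
  rw [e0] at this
  exact this

end PNTB
end

section
open Complex Metric Set Filter Topology Function
open scoped Real ComplexConjugate

namespace PNTB

lemma Z_low_one (s : ℂ) (hs : 1 < s.re) : ‖s‖ * (1 - ‖s - 1‖) ≤ ‖riemannZeta₁ s‖ := by
  have hs1 : s ≠ 1 := by rintro rfl; simp at hs
  have hs1' := sub_ne_zero.2 hs1
  have h1 := zeta_trunc s hs 2 le_rfl
  have h2 := one_step s hs.le hs1 1 le_rfl
  simp only [Finset.sum_range_succ, Finset.sum_range_zero] at h1
  norm_num at h1 h2
  have h3 := norm_add_le (riemannZeta s - (1 + 2 ^ (-s)) - 2 ^ (1 - s) / (s - 1)) 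
    (2 ^ (-s) - ((s - 1)⁻¹ - 2 ^ (1 - s) / (s - 1)))
  have e : (riemannZeta s - (1 + 2 ^ (-s)) - 2 ^ (1 - s) / (s - 1)) + 
    (2 ^ (-s) - ((s - 1)⁻¹ - 2 ^ (1 - s) / (s - 1))) = riemannZeta s - 1 - (s - 1)⁻¹ := by ring
  rw [e] at h3
  have h4 : ‖riemannZeta s - 1 - (s - 1)⁻¹‖ ≤ ‖s‖ := by linarith
  have e2 : s = riemannZeta₁ s - (s - 1) * (riemannZeta s - 1 - (s - 1)⁻¹) := by
    rw [Z_eq hs1]; field_simp; ring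
  have h5 : ‖s‖ ≤ ‖riemannZeta₁ s‖ + ‖s - 1‖ * ‖riemannZeta s - 1 - (s - 1)⁻¹‖ := by
    rw [← norm_mul]
    calc ‖s‖ = ‖riemannZeta₁ s - (s - 1) * (riemannZeta s - 1 - (s - 1)⁻¹)‖ := by rw [← e2]
      _ ≤ _ := norm_sub_le _ _
  nlinarith [norm_nonneg (s - 1)]

lemma log_five_lt : Real.log 5 < 1.62 := by
  have h : Real.log 5 * 3 ≤ Real.log 2 * 7 := by
    have e : Real.log 2 * 7 = Real.log (2 ^ 7) := by rw [Real.log_pow]; push_cast; ring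
    have e' : Real.log 5 * 3 = Real.log (5 ^ 3) := by rw [Real.log_pow]; push_cast; ring
    rw [e, e']; exact Real.log_le_log (by norm_num) (by norm_num)
  linarith [Real.log_two_lt_d9]

lemma Z_le_small (s : ℂ) (h0 : 0 ≤ s.re) (h1 : s.re ≤ 2) (hi : |s.im| ≤ 1) : ‖riemannZeta₁ s‖ ≤ 30 := by
  have h5 := log_five_lt
  have hl : 0 ≤ Real.log (|s.im| + 4) := Real.log_nonneg (by linarith [abs_nonneg s.im])
  have hi0 := abs_nonneg s.im
  have hU : U s.im ≤ 9.4 := by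
    unfold U
    have : Real.log (|s.im| + 4) ≤ Real.log 5 := Real.log_le_log (by linarith) (by linarith)
    nlinarith
  rcases le_total s.re 1 with h | h
  · refine (Z_strip s h0 h).trans ?_
    have hp := Real.pi_gt_three
    have e1 : Real.exp ((1 - s.re) * (Real.log ((|s.im| + 2) / (2 * π)) / 2)) ≤ 1 := by
      rw [Real.exp_le_one_iff]
      apply mul_nonpos_of_nonneg_of_nonpos (by linarith)
      have : Real.log ((|s.im| + 2) / (2 * π)) ≤ 0 := by
        apply Real.log_nonpos (by positivity)
        rw [div_le_one (by positivity)]; linarith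
      linarith
    have e2 : Real.exp (1 / 16 + 4 / (|s.im| + 2) ^ 2) ≤ 3 := by
      have h6 : 4 / (|s.im| + 2) ^ 2 ≤ 1 := by rw [div_le_one (by positivity)]; nlinarith
      have h7 : Real.exp (1 / 16 + 4 / (|s.im| + 2) ^ 2) ≤ Real.exp (1 / 16) * Real.exp 1 := by
        rw [← Real.exp_add]; exact Real.exp_le_exp.2 (by linarith)
      have h8 : Real.exp (1/16) ≤ 1 + 1/16 + (1/16)^2 := by
        have := Real.abs_exp_sub_one_sub_id_le (x := 1/16) (by norm_num [abs_le])
        have := (abs_le.1 this).2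
        linarith
      have h9 := Real.exp_one_lt_d9
      refine h7.trans ?_
      nlinarith [Real.exp_pos (1/16), Real.exp_pos 1]
    have hU0 := (U_pos s.im).le
    have : Real.exp (1 / 16 + 4 / (|s.im| + 2) ^ 2) * U s.im * Real.exp ((1 - s.re) * (Real.log ((|s.im| + 2) / (2 * π)) / 2)) ≤ 3 * 9.4 * (1:ℝ) := by gcongr
    exact this.trans (by norm_num)
  · exact (Z_right s h h1).trans (by linarith)

lemma zfr_small (β γ : ℝ) (hβ : 0.99 ≤ β) (hβ1 : β < 1) (hγ : |γ| ≤ 0.25) : riemannZeta₁ (β + γ * I) ≠ 0 := by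
  intro hz
  have hd : ∀ x ∈ segment ℝ (β + γ * I : ℂ) (1.001 + γ * I), ‖deriv riemannZeta₁ x‖ ≤ 30 / 0.7 := by
    intro x hx
    have hx1 : 0.99 ≤ x.re ∧ x.re ≤ 1.001 ∧ x.im = γ := by
      obtain ⟨u, v, hu, hv, huv, rfl⟩ := hx
      have hv' : v = 1 - u := by linarith
      subst hv'
      simp
      norm_num
      refine ⟨by nlinarith, by nlinarith, by ring⟩
    refine Complex.norm_deriv_le_of_forall_mem_sphere_norm_le (by norm_num) 
      differentiable_riemannZeta₁.diffContOnCl ?_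
    intro z hz
    have hn : ‖z - x‖ = 0.7 := by rw [← dist_eq]; exact hz
    have h1 := abs_re_le_norm (z - x)
    have h2 := abs_im_le_norm (z - x)
    rw [hn] at h1 h2
    rw [sub_re, abs_le] at h1
    rw [sub_im, abs_le] at h2
    rw [abs_le] at hγ
    apply Z_le_small z
    · linarith
    · linarith
    · rw [abs_le]; constructor <;> linarith
  have := (convex_segment (β + γ * I : ℂ) (1.001 + γ * I)).norm_image_sub_le_of_norm_deriv_le (𝕜 := ℂ) (f := riemannZeta₁)
    (fun x _ => differentiable_riemannZeta₁ x) hd (left_mem_segment _ _ _) (right_mem_segment _ _ _)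
  rw [hz, sub_zero] at this
  have e : (1.001 + γ * I : ℂ) - (β + γ * I) = ((1.001 - β : ℝ) : ℂ) := by push_cast; ring
  rw [e, norm_real, Real.norm_of_nonneg (by linarith)] at this
  have h3 := Z_low_one (1.001 + γ * I) (by simp; norm_num)
  have h4 : ‖(1.001 + γ * I : ℂ) - 1‖ ≤ 0.251 := by
    refine (norm_le_abs_re_add_abs_im _).trans ?_
    simp
    norm_num at hγ ⊢
    linarith
  have h5 : 1 ≤ ‖(1.001 + γ * I : ℂ)‖ := by
    refine le_trans ?_ (re_le_norm _)
    simp; norm_num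
  nlinarith

lemma inv_re_le (a t γ : ℝ) (k : ℝ) (ha : 0 < a) (hk : 0 < k) (hγ : 0 < γ) (ht : t = k * γ) :
    (1 / (a + t * I : ℂ)).re ≤ a / (k ^ 2 * γ ^ 2) := by
  rw [one_div, inv_re, normSq_apply]
  simp
  apply div_le_div_of_nonneg_left ha.le (by positivity)
  rw [ht]; nlinarith

lemma zfr_pos (β γ T : ℝ) (hT : 50000 ≤ T) (hγ : 0.25 ≤ γ) (hγT : γ ≤ T / 4) (hz : riemannZeta₁ (β + γ * I) = 0) :
    0.02865 / (Bd T + 0.016) < 1 - β := by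
  by_contra hcon
  push Not at hcon
  have hBd := Bd_lower T hT
  set B' := Bd T + 0.016 with hB'
  have hB0 : 0 < B' := by linarith
  set a := 0.0938 / B' with ha'
  set x := 1 - β with hx'
  have hx0 : 0 < x := by
    by_contra h
    exact Z_ne_zero (β + γ * I) (by simp; linarith) hz
  have ha : 0 < a := by positivity
  have ha2 : a ≤ 0.0938 / 4.516 := div_le_div_of_nonneg_left (by norm_num) (by norm_num) (by linarith)
  have ha3 : a ≤ 0.020771 := ha2.trans (by norm_num)
  have hx1 : x ≤ 0.00635 := hcon.trans (by
    have : 0.02865 / B' ≤ 0.02865 / 4.516 := div_le_div_of_nonneg_left (by norm_num) (by norm_num) (by linarith)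
    exact this.trans (by norm_num))
  have hγ0 : 0 < γ := by linarith
  -- main bound given B
  have main : ∀ B P : ℝ, (∀ k : ℝ, 0 < k → k ≤ 4 → (|k * γ| ≤ 1000 → 4.25 ≤ B) ∧ (1000 ≤ |k * γ| → Bd T ≤ B)) →
      2.832 * a / γ ^ 2 ≤ P → 4.57495 * B + P + 0.067 < 4.57495 * B' → False := by
    intro B P hB hP hBB
    have hH : ∀ k : ℝ, 0 < k → k ≤ 4 → _ := fun k hk hk4 =>
      H_lower a (k * γ) T B ha (by linarith) (by rw [abs_of_pos (by positivity)]; nlinarith) (hB k hk hk4).1 (hB k hk hk4).2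
    have h1 := (hH 1 (by norm_num) (by norm_num)).2 β (by rw [one_mul]; exact hz) (by linarith)
    have h2 := (hH 2 (by norm_num) (by norm_num)).1
    have h3 := (hH 3 (by norm_num) (by norm_num)).1
    have h4 := (hH 4 (by norm_num) (by norm_num)).1
    have h0 := H_real a ha (by linarith)
    have ht := trig_pos a γ ha
    rw [one_mul] at h1
    simp only [sub_re] at ht
    have i1 := inv_re_le a γ γ 1 ha (by norm_num) hγ0 (by ring)
    have i2 := inv_re_le a (2 * γ) γ 2 ha (by norm_num) hγ0 rfl
    have i3 := inv_re_le a (3 * γ) γ 3 ha (by norm_num) hγ0 rfl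
    have i4 := inv_re_le a (4 * γ) γ 4 ha (by norm_num) hγ0 rfl
    have q1 : a / (1 ^ 2 * γ ^ 2) = a / γ ^ 2 := by ring
    have q2 : a / (2 ^ 2 * γ ^ 2) = a / γ ^ 2 / 4 := by ring
    have q3 : a / (3 ^ 2 * γ ^ 2) = a / γ ^ 2 / 9 := by ring
    have q4 : a / (4 ^ 2 * γ ^ 2) = a / γ ^ 2 / 16 := by ring
    rw [q1] at i1
    rw [q2] at i2
    rw [q3] at i3
    rw [q4] at i4
    rw [mul_div_assoc] at hP
    have hg : 0 ≤ a / γ ^ 2 := by positivity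
    rw [show 1 + a - β = a + x by ring] at h1
    have h5 : (0.0938 + 0.02865 : ℝ)⁻¹ * B' ≤ 1 / (a + x) := by
      have : a + x ≤ (0.0938 + 0.02865) / B' := by rw [add_div]; linarith
      have := one_div_le_one_div_of_le (by linarith) this
      rw [one_div_div] at this
      rw [inv_mul_eq_div]; exact this
    have h6 : 1 / a = B' / 0.0938 := by rw [ha', one_div_div]
    rw [h6] at ht
    have h7 : 2.3919 * ((0.0938 + 0.02865 : ℝ)⁻¹ * B') ≥ 1.403075 * (B' / 0.0938) + 4.57495 * B' := by
      have : 2.3919 * (0.0938 + 0.02865 : ℝ)⁻¹ ≥ 1.403075 / 0.0938 + 4.57495 := by norm_num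
      have h8 := mul_le_mul_of_nonneg_right this hB0.le
      rw [ge_iff_le]
      calc _ = (1.403075 / 0.0938 + 4.57495) * B' := by ring
        _ ≤ _ := h8
        _ = _ := by ring
    linarith
  rcases lt_or_ge γ 250 with h | h
  · refine main 4.25 0.942 ?_ ?_ ?_
    · intro k hk hk4
      refine ⟨fun _ => le_rfl, fun h' => ?_⟩
      rw [abs_of_pos (by positivity)] at h'
      nlinarith
    · rw [div_le_iff₀ (by positivity)]; nlinarith
    · rw [hB']; linarith
  · refine main (Bd T) 0.0001 ?_ ?_ ?_
    · intro k hk hk4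
      exact ⟨fun _ => by linarith, fun _ => le_rfl⟩
    · rw [div_le_iff₀ (by positivity)]; nlinarith
    · rw [hB']; linarith

end PNTB
end

section
open Complex Metric Set Filter Topology Function
open scoped Real ComplexConjugate

namespace PNTB

lemma bc_deriv_center {f : ℂ → ℂ} {z : ℂ} {R M : ℝ} (hR : 0 < R) (hM : 0 < M)
    (hf : DifferentiableOn ℂ f (ball z R)) (hre : ∀ w ∈ ball z R, (f w).re - (f z).re ≤ M) :
    ‖deriv f z‖ ≤ 2 * M / R := by
  have hd : HasDerivAt f (deriv f z) z :=
    (hf.differentiableAt (isOpen_ball.mem_nhds (mem_ball_self hR))).hasDerivAt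
  refine le_of_forall_pos_le_add fun e he => ?_
  have hmap : ∀ u ∈ ball (0:ℂ) R, z + u ∈ ball z R := by
    intro u hu; simpa [mem_ball, dist_eq] using hu
  have hbc : ∀ u ∈ ball (0:ℂ) R, ‖f (z + u) - f z‖ ≤ 2 * M * ‖u‖ / (R - ‖u‖) := by
    intro u hu
    refine borelCaratheodory_zero (f := fun u => f (z + u) - f z) hM ?_ ?_ hR hu (by simp)
    · refine DifferentiableOn.sub_const ?_ _
      refine hf.comp (by fun_prop) hmap
    · intro v hv
      simpa using hre _ (hmap v hv)
  have hlim : Tendsto (fun u : ℂ => 2 * M / (R - ‖u - z‖)) (𝓝 z) (𝓝 (2 * M / R)) := by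
    have : ContinuousAt (fun u : ℂ => 2 * M / (R - ‖u - z‖)) z := by
      refine ContinuousAt.div (by fun_prop) (by fun_prop) ?_
      simp; exact hR.ne'
    have h := this.tendsto
    simpa using h
  have hev := hlim.eventually (gt_mem_nhds (by linarith : 2 * M / R < 2 * M / R + e))
  rw [← hd.deriv] at *
  have := hd.hasFDerivAt.le_of_lip' (C := 2 * M / R + e) (by positivity) (by
    filter_upwards [hev, isOpen_ball.mem_nhds (mem_ball_self hR)] with x hx hxb
    have hxb' : x - z ∈ ball (0:ℂ) R := by simpa [mem_ball, dist_eq] using hxb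
    have h := hbc (x - z) hxb'
    rw [add_sub_cancel] at h
    refine h.trans ?_
    rw [mul_div_right_comm]
    gcongr)
  simpa using this

lemma bc_logderiv {Z : ℂ → ℂ} (hZ : Differentiable ℂ Z) (c z : ℂ) (R M : ℝ) (hM : 0 < M)
    (h0 : ∀ w ∈ ball c R, Z w ≠ 0) (hb : ∀ w ∈ ball c R, ‖Z w‖ ≤ Real.exp M * ‖Z c‖)
    (hz : z ∈ ball c R) : ‖deriv Z z / Z z‖ ≤ 2 * M * (R + ‖z - c‖) / (R - ‖z - c‖) ^ 2 := by
  have hr : ‖z - c‖ < R := by simpa [mem_ball, dist_eq] using hz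
  have hR : 0 < R := (norm_nonneg _).trans_lt hr
  have hcb : c ∈ ball c R := mem_ball_self hR
  have hdiff : DifferentiableOn ℂ (fun w => deriv Z w / Z w) (ball c R) := by
    intro w hw
    exact ((hZ.deriv w).div (hZ w) (h0 w hw)).differentiableWithinAt
  obtain ⟨f, hfc, hf⟩ := hdiff.isExactOn_ball.with_val_at c 0
  have hfd : DifferentiableOn ℂ f (ball c R) := fun w hw => (hf w hw).differentiableAt.differentiableWithinAt
  -- Z * exp(-f) const
  have hconst : ∀ w ∈ ball c R, Z w * exp (-f w) = Z c := by
    intro w hw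
    have hder : ∀ x ∈ ball c R, HasDerivAt (fun w => Z w * exp (-f w)) 0 x := by
      intro x hx
      have h1 := (hZ x).hasDerivAt.mul ((hf x hx).neg.cexp)
      have h2 := h0 x hx
      have e : deriv Z x * exp ((-f) x) + Z x * (exp ((-f) x) * (-(deriv Z x / Z x))) = 0 := by
        field_simp; simp
      rw [e] at h1
      exact h1
    have := (convex_ball c R).is_const_of_fderivWithin_eq_zero (𝕜 := ℂ) (f := fun w => Z w * exp (-f w)) 
      (fun x hx => (hder x hx).differentiableAt.differentiableWithinAt) (by
        intro x hx
        rw [fderivWithin_of_isOpen isOpen_ball hx]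
        have := (hder x hx).hasFDerivAt.fderiv
        rw [this]; ext; simp) hw hcb
    simpa [hfc] using this
  have hre : ∀ w ∈ ball c R, (f w).re ≤ M := by
    intro w hw
    have h1 := hconst w hw
    have h2 : ‖Z w‖ = Real.exp (f w).re * ‖Z c‖ := by
      rw [← h1, norm_mul, norm_exp, neg_re, mul_comm, mul_assoc, ← Real.exp_add]; simp
    have h3 := hb w hw
    rw [h2] at h3
    exact Real.exp_le_exp.1 (le_of_mul_le_mul_right h3 (norm_pos_iff.2 (h0 c hcb)))
  have hmap : ∀ u ∈ ball (0:ℂ) R, c + u ∈ ball c R := by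
    intro u hu; simpa [mem_ball, dist_eq] using hu
  have hfz : ‖f z‖ ≤ 2 * M * ‖z - c‖ / (R - ‖z - c‖) := by
    have := borelCaratheodory_zero (f := fun u => f (c + u)) (z := z - c) hM (hfd.comp (by fun_prop) hmap)
      (fun v hv => hre _ (hmap v hv)) hR (by simpa [mem_ball, dist_eq] using hz) (by simpa using hfc)
    simpa using this
  set r := ‖z - c‖ with hr'
  have hRr : 0 < R - r := by linarith
  have hr0 : 0 ≤ r := norm_nonneg _
  have := bc_deriv_center (f := f) (z := z) (R := R - r) (M := M + 2 * M * r / (R - r)) hRr (by positivity) 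
    (hfd.mono (ball_subset_ball' (by rw [dist_eq]; linarith))) (by
      intro w hw
      have h1 := hre w (ball_subset_ball' (by rw [dist_eq]; linarith) hw)
      have h2 := (abs_le.1 (abs_re_le_norm (f z))).1
      linarith)
  rw [(hf z hz).deriv] at this
  refine this.trans (le_of_eq ?_)
  field_simp; ring

end PNTB
end

section
open Complex Metric Set Filter Topology Function
open scoped Real ComplexConjugate

namespace PNTB

noncomputable def X (T : ℝ) : ℝ := (Bd T + 0.016) / 0.02865

lemma X_lower (T : ℝ) (hT : 50000 ≤ T) : 157 ≤ X T := by
  have := Bd_lower T hT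
  unfold X
  rw [le_div_iff₀ (by norm_num)]; linarith

lemma inv_X (T : ℝ) : 1 / X T = 0.02865 / (Bd T + 0.016) := by unfold X; rw [one_div_div]

lemma zfr (T : ℝ) (hT : 50000 ≤ T) (s : ℂ) (hi : |s.im| ≤ T / 4) (hr : 1 - 1 / X T ≤ s.re) :
    riemannZeta₁ s ≠ 0 := by
  intro hz
  have hX := X_lower T hT
  have hX1 : 1 / X T ≤ 1 / 157 := one_div_le_one_div_of_le (by norm_num) hX
  rcases le_or_gt 1 s.re with h | h
  · exact Z_ne_zero s h hz
  rcases le_total |s.im| 0.25 with h2 | h2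
  · apply zfr_small s.re s.im _ h h2
    · rw [re_add_im]; exact hz
    · have : (1:ℝ) / 157 ≤ 0.01 := by norm_num
      have : (0.99:ℝ) = 1 - 0.01 := by norm_num
      linarith
  · rcases le_total 0 s.im with h3 | h3
    · rw [abs_of_nonneg h3] at h2 hi
      have := zfr_pos s.re s.im T hT h2 hi (by rw [re_add_im]; exact hz)
      rw [inv_X] at hr; linarith
    · rw [abs_of_nonpos h3] at h2 hi
      have := zfr_pos s.re (-s.im) T hT h2 hi (by
        have e : (s.re : ℂ) + ((-s.im : ℝ) : ℂ) * I = conj s := by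
          apply Complex.ext <;> simp
        rw [e, Z_conj, hz, map_zero])
      rw [inv_X] at hr; linarith

/-- upper bound -/
lemma Z_upper (T : ℝ) (hT : 50000 ≤ T) (s : ℂ) (hi : |s.im| ≤ T / 4) (h0 : 1 - 1 / X T ≤ s.re) (h2 : s.re ≤ 2) :
    ‖riemannZeta₁ s‖ ≤ Real.exp (1 / 16 + 4 / (|s.im| + 2) ^ 2 + 0.058) * U s.im := by
  have hX := X_lower T hT
  have hX1 : 1 / X T ≤ 1 / 157 := one_div_le_one_div_of_le (by norm_num) hX
  have hX0 : 0 < 1 / X T := by positivity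
  have hU := U_pos s.im
  rcases le_total 1 s.re with h | h
  · refine (Z_right s h h2).trans (le_mul_of_one_le_left hU.le ?_)
    exact Real.one_le_exp (by positivity)
  · refine (Z_strip s (by linarith) h).trans ?_
    rw [Real.exp_add (1 / 16 + _) 0.058, mul_right_comm]
    refine mul_le_mul_of_nonneg_right (mul_le_mul_of_nonneg_left ?_ (Real.exp_pos _).le) hU.le
    rw [Real.exp_le_exp]
    have hp := Real.pi_gt_three
    have hp4 := Real.pi_lt_four
    have hl : Real.log ((|s.im| + 2) / (2 * π)) ≤ Real.log ((T + 3) / (2 * π)) := 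
      Real.log_le_log (by positivity) (div_le_div_of_nonneg_right (by linarith) (by positivity))
    have hl0 : 0 ≤ Real.log ((T + 3) / (2 * π)) := Real.log_nonneg (by
      rw [le_div_iff₀ (by positivity)]; linarith)
    have hB : Real.log ((T + 3) / (2 * π)) / 4 ≤ 0.02865 * X T := by
      have := LL_nonneg T (by linarith)
      unfold X
      rw [mul_div_cancel₀ _ (by norm_num)]
      unfold Bd; linarith
    have h5 : (1 - s.re) * (Real.log ((|s.im| + 2) / (2 * π)) / 2) ≤ (1 / X T) * (Real.log ((T + 3) / (2 * π)) / 2) := by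
      have : (1 - s.re) * (Real.log ((|s.im| + 2) / (2 * π)) / 2) ≤ (1 - s.re) * (Real.log ((T + 3) / (2 * π)) / 2) :=
        mul_le_mul_of_nonneg_left (by linarith) (by linarith)
      refine this.trans (mul_le_mul_of_nonneg_right (by linarith) (by linarith))
    refine h5.trans ?_
    calc _ ≤ 1 / X T * (0.02865 * X T * 2) := by gcongr; linarith
      _ = 0.0573 := by field_simp; norm_num
      _ ≤ _ := by norm_num

lemma M_le (T : ℝ) (hT : 50000 ≤ T) : Real.log (2 * X T) + LL T + 1.2 ≤ X T / 16 := by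
  have hX := X_lower T hT
  have h1 : Real.log (2 * X T) ≤ 4.76 + X T / 158 := by
    have e : 2 * X T = 316 * (X T / 158) := by ring
    rw [e, Real.log_mul (by norm_num) (by positivity)]
    have := Real.log_le_sub_one_of_pos (by positivity : 0 < X T / 158)
    have h3 : Real.log 316 ≤ 5.76 := by
      rw [Real.log_le_iff_le_exp (by norm_num)]
      have : Real.exp 5.76 = Real.exp 1 ^ 5 * Real.exp 0.76 := by
        rw [← Real.exp_nat_mul, ← Real.exp_add]; norm_num
      rw [this]
      have h4 := Real.exp_one_gt_d9
      have h5 := Real.quadratic_le_exp_of_nonneg (x := 0.38) (by norm_num)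
      have h6 : Real.exp 0.76 = Real.exp 0.38 ^ 2 := by rw [← Real.exp_nat_mul]; norm_num
      rw [h6]
      have h5' : Real.exp 0.38 ≥ 1.46 := by
        have := Real.sum_le_exp_of_nonneg (x := 0.38) (by norm_num) 5
        refine le_trans ?_ this
        norm_num [Finset.sum_range_succ, Nat.factorial]
      calc (316:ℝ) ≤ 2.718 ^ 5 * 1.46 ^ 2 := by norm_num
        _ ≤ _ := by gcongr; linarith
    linarith
  have hLL : 2.3 ≤ LL T := by
    unfold LL
    have h1 : 10.8 ≤ Real.log (T + 5) := by
      rw [Real.le_log_iff_exp_le (by linarith)]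
      have := exp_le_of_pow 10.8 50005 5 54 (by norm_num) (by norm_num) (by norm_num) (by norm_num)
      linarith
    rw [Real.le_log_iff_exp_le (by linarith)]
    have := exp_le_of_pow 2.3 12 10 23 (by norm_num) (by norm_num) (by norm_num) (by norm_num)
    linarith
  have hlT : 8.9 ≤ Real.log ((T + 3) / (2 * π)) := by
    have hp := Real.pi_lt_d2
    rw [Real.le_log_iff_exp_le (by positivity)]
    have := exp_le_of_pow 8.9 7640 10 89 (by norm_num) (by norm_num) (by norm_num) (by norm_num)
    refine this.trans ?_
    rw [le_div_iff₀ (by positivity)]; nlinarith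
  have hXe : 0.02865 * X T = 0.6431 * LL T + 0.655 + Real.log ((T + 3) / (2 * π)) / 4 + 0.016 := by
    unfold X Bd; field_simp
  linarith

set_option maxHeartbeats 400000 in
lemma ratio_bound (T : ℝ) (hT : 50000 ≤ T) (t : ℝ) (ht : |t| ≤ T / 4 - 1) (w : ℂ)
    (hw : w ∈ ball (1 + (1 / X T / 2 : ℝ) + t * I : ℂ) (1.5 / X T)) :
    ‖riemannZeta₁ w‖ ≤ Real.exp (X T / 16) * ‖riemannZeta₁ (1 + (1 / X T / 2 : ℝ) + t * I)‖ := by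
  have hX := X_lower T hT
  have hX0 : 0 < X T := by linarith
  have hX1 : 1 / X T ≤ 1 / 157 := one_div_le_one_div_of_le (by norm_num) hX
  have hXp : 0 < 1 / X T := by positivity
  set a := 1 / X T / 2 with ha
  set c : ℂ := 1 + (a : ℝ) + t * I with hc
  have ha0 : 0 < a := by positivity
  have hcre : c.re = 1 + a := by simp [hc]
  have hcim : c.im = t := by simp [hc]
  have hn : ‖w - c‖ < 1.5 / X T := by simpa [mem_ball, dist_eq] using hw
  have hn2 : 1.5 / X T = 3 * a := by rw [ha]; ring
  have hre := abs_le.1 ((abs_re_le_norm (w - c)).trans hn.le)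
  have him := (abs_im_le_norm (w - c)).trans hn.le
  rw [sub_re, hcre] at hre
  rw [sub_im, hcim] at him
  have hwi : |w.im| ≤ |t| + 0.01 := by
    have := abs_add_le (w.im - t) t
    rw [sub_add_cancel] at this
    have : 3 * a ≤ 0.01 := by rw [ha]; norm_num at hX1 ⊢; linarith
    linarith
  have hwi2 : |t| - 0.01 ≤ |w.im| := by
    have := abs_sub_abs_le_abs_sub t w.im
    rw [abs_sub_comm] at this
    have : 3 * a ≤ 0.01 := by rw [ha]; norm_num at hX1 ⊢; linarith
    linarith
  have hup := Z_upper T hT w (by linarith) (by linarith) (by linarith)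
  have hM := M_le T hT
  have hLL3 : 2.5 ≤ LL T := by
    unfold LL
    have h1 : 10.8 ≤ Real.log (T + 5) := by
      rw [Real.le_log_iff_exp_le (by linarith)]
      have := exp_le_of_pow 10.8 50005 5 54 (by norm_num) (by norm_num) (by norm_num) (by norm_num)
      linarith
    rw [Real.le_log_iff_exp_le (by linarith)]
    have := exp_le_of_pow 2.5 12.3 2 5 (by norm_num) (by norm_num) (by norm_num) (by norm_num)
    linarith
  have ht0 := abs_nonneg t
  have h2X : 2 * X T = 1 / a := by rw [ha]; field_simp
  have hl2X : 5 ≤ Real.log (2 * X T) := by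
    rw [Real.le_log_iff_exp_le (by linarith)]
    have := exp_le_of_pow 5 300 1 5 (by norm_num) (by norm_num) (by norm_num) (by norm_num)
    linarith
  rcases le_total |t| 0.5 with h | h
  · have h1 := Z_low_one c (by rw [hcre]; linarith)
    have h2 : ‖c - 1‖ ≤ 0.51 := by
      have := norm_le_abs_re_add_abs_im (c - 1)
      rw [sub_re, sub_im, hcre, hcim, one_re, one_im, sub_zero, add_sub_cancel_left, abs_of_pos ha0] at this
      have : a ≤ 1 / 157 := by linarith
      have : (1:ℝ) / 157 ≤ 0.01 := by norm_num
      linarith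
    have h3 : 1 ≤ ‖c‖ := by
      have := re_le_norm c
      rw [hcre] at this; linarith
    have h4 : 0.4 ≤ ‖riemannZeta₁ c‖ := le_trans (by nlinarith only [h2, h3]) h1
    have h5 : ‖riemannZeta₁ w‖ ≤ 30 := Z_le_small w (by linarith) (by linarith) (by linarith)
    have h6 : Real.exp 5 ≤ Real.exp (X T / 16) := Real.exp_le_exp.2 (by linarith)
    have h7 : (75:ℝ) ≤ Real.exp 5 := by
      have : Real.exp 5 = Real.exp 1 ^ 5 := by rw [← Real.exp_nat_mul]; norm_num
      rw [this]
      calc (75:ℝ) ≤ 2.7 ^ 5 := by norm_num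
        _ ≤ _ := by gcongr; linarith [Real.exp_one_gt_d9]
    nlinarith only [h4, h5, h6, h7]
  · have hc1 : c ≠ 1 := by
      intro hh
      have := congrArg re hh
      rw [hcre, one_re] at this; linarith
    have hlow : |t| * (a / (1 + a)) ≤ ‖riemannZeta₁ c‖ := by
      rw [Z_eq hc1, norm_mul]
      have h1 := zeta_lower c (by rw [hcre]; linarith)
      rw [hcre, add_sub_cancel_left] at h1
      have h2 := abs_im_le_norm (c - 1)
      rw [sub_im, hcim, one_im, sub_zero] at h2
      gcongr
    have hlow2 : Real.exp (-(Real.log (2 * X T) + 0.004)) * |t| ≤ ‖riemannZeta₁ c‖ := by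
      refine le_trans ?_ hlow
      rw [mul_comm |t|]
      gcongr
      rw [neg_add, Real.exp_add, Real.exp_neg (Real.log _), Real.exp_log (by positivity), h2X, one_div, inv_inv, div_eq_mul_inv]
      gcongr
      rw [Real.exp_neg]
      gcongr
      have := Real.add_one_le_exp (0.004:ℝ)
      refine le_trans ?_ this
      rw [ha]; norm_num at hX1 ⊢; linarith
    -- bound for U
    have hlogp : 0 ≤ Real.log (|w.im| + 4) := Real.log_nonneg (by linarith [abs_nonneg w.im])
    have hU : U w.im ≤ |t| * ((|t| + 2.01) / |t|) * Real.exp (Real.log (Real.log (|t| + 5) + 3 / 2)) := by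
      have hl : Real.log (|w.im| + 4) ≤ Real.log (|t| + 5) := Real.log_le_log (by linarith [abs_nonneg w.im]) (by linarith)
      rw [Real.exp_log (by linarith), mul_div_cancel₀ _ (by linarith)]
      unfold U
      exact mul_le_mul (by linarith) (by linarith) (by linarith) (by linarith)
    have key : ∀ q g l : ℝ, (|t| + 2.01) / |t| ≤ Real.exp g → 0 < q → q ≤ (|w.im| + 2) ^ 2 → LL |t| ≤ l → 
        1 / 16 + 4 / q + 0.058 + g + l + 0.004 ≤ LL T + 1.2 → 
        ‖riemannZeta₁ w‖ ≤ Real.exp (X T / 16) * ‖riemannZeta₁ c‖ := by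
      intro q g l hg hq hqw hl hsum
      have h4 : 4 / (|w.im| + 2) ^ 2 ≤ 4 / q := div_le_div_of_nonneg_left (by norm_num) hq hqw
      calc ‖riemannZeta₁ w‖ ≤ Real.exp (1 / 16 + 4 / q + 0.058) * (|t| * Real.exp g * Real.exp l) := by
            refine hup.trans ?_
            refine mul_le_mul (Real.exp_le_exp.2 (by linarith)) (hU.trans ?_) (U_pos _).le (Real.exp_pos _).le
            gcongr
            exact hl
        _ = Real.exp (1 / 16 + 4 / q + 0.058 + g + l) * |t| := by
            rw [Real.exp_add _ l, Real.exp_add _ g]; ring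
        _ ≤ Real.exp (X T / 16 + -(Real.log (2 * X T) + 0.004)) * |t| := by
            exact mul_le_mul_of_nonneg_right (Real.exp_le_exp.2 (by linarith)) ht0
        _ = Real.exp (X T / 16) * (Real.exp (-(Real.log (2 * X T) + 0.004)) * |t|) := by rw [Real.exp_add]; ring
        _ ≤ _ := by gcongr
    rcases le_total |t| 2 with h' | h'
    · refine key 6 1.62 1.28 ?_ (by norm_num) (le_trans (by norm_num : (6:ℝ) ≤ 2.49 ^ 2) (pow_le_pow_left₀ (by norm_num) (by linarith) 2)) ?_ (by norm_num at hLL3 ⊢; linarith)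
      · have : (|t| + 2.01) / |t| ≤ 5.02 := by rw [div_le_iff₀ (by linarith)]; linarith
        refine this.trans ?_
        have : Real.exp 1.62 = Real.exp 0.81 ^ 2 := by rw [← Real.exp_nat_mul]; norm_num
        rw [this]
        have h5' : Real.exp 0.81 ≥ 2.2457 := by
          have := Real.sum_le_exp_of_nonneg (x := 0.81) (by norm_num) 6
          refine le_trans ?_ this
          norm_num [Finset.sum_range_succ, Nat.factorial]
        calc (5.02:ℝ) ≤ 2.2457 ^ 2 := by norm_num
          _ ≤ _ := by gcongr
      · unfold LL
        have h1 : Real.log (|t| + 5) ≤ Real.log 2 * 3 := by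
          have e : Real.log 2 * 3 = Real.log (2 ^ 3) := by rw [Real.log_pow]; push_cast; ring
          rw [e]; exact Real.log_le_log (by linarith) (by linarith)
        have h0 : 0 ≤ Real.log (|t| + 5) := Real.log_nonneg (by linarith)
        rw [Real.log_le_iff_le_exp (by linarith)]
        have := Real.sum_le_exp_of_nonneg (x := 1.28) (by norm_num) 7
        norm_num [Finset.sum_range_succ, Nat.factorial] at this
        norm_num
        linarith [Real.log_two_lt_d9]
    · refine key 15.9 0.71 (LL T) ?_ (by norm_num) (le_trans (by norm_num : (15.9:ℝ) ≤ 3.99 ^ 2) (pow_le_pow_left₀ (by norm_num) (by linarith) 2)) ?_ (by norm_num; linarith)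
      · have : (|t| + 2.01) / |t| ≤ 2.005 := by rw [div_le_iff₀ (by linarith)]; linarith
        refine this.trans ?_
        have := Real.sum_le_exp_of_nonneg (x := 0.71) (by norm_num) 7
        refine le_trans ?_ this
        norm_num [Finset.sum_range_succ, Nat.factorial]
      · exact LL_mono ht0 (by linarith)

lemma H_bound (T : ℝ) (hT : 50000 ≤ T) (s : ℂ) (hi : |s.im| ≤ T / 4 - 1) (h0 : 1 - 0.9 / X T ≤ s.re)
    (h1 : s.re ≤ 1 + 1 / X T / 2) : ‖H s‖ ≤ 36.25 * X T ^ 2 := by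
  have hX := X_lower T hT
  have hX0 : 0 < X T := by linarith
  have hXp : 0 < 1 / X T := by positivity
  have hX1 : 1 / X T ≤ 1 / 157 := one_div_le_one_div_of_le (by norm_num) hX
  set c : ℂ := 1 + (1 / X T / 2 : ℝ) + s.im * I with hc
  have hd : ‖s - c‖ ≤ 1.4 / X T := by
    have e : s - c = ((s.re - 1 - 1 / X T / 2 : ℝ) : ℂ) := by
      apply Complex.ext <;> simp [hc] <;> ring
    rw [e, norm_real, Real.norm_of_nonpos (by linarith)]
    have : 1.4 / X T = 0.9 / X T + 1 / X T / 2 := by ring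
    linarith
  have hlt : 1.4 / X T < 1.5 / X T := div_lt_div_of_pos_right (by norm_num) hX0
  have hb := bc_logderiv differentiable_riemannZeta₁ c s (1.5 / X T) (X T / 16) (by positivity)
    (by
      intro w hw
      have hn : ‖w - c‖ < 1.5 / X T := by simpa [mem_ball, dist_eq] using hw
      have hre := abs_le.1 ((abs_re_le_norm (w - c)).trans hn.le)
      have him := (abs_im_le_norm (w - c)).trans hn.le
      have hcre : c.re = 1 + 1 / X T / 2 := by simp [hc]
      have hcim : c.im = s.im := by simp [hc]
      rw [sub_re, hcre] at hre
      rw [sub_im, hcim] at him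
      have e15 : 1.5 / X T = 1.5 * (1 / X T) := by ring
      apply zfr T hT w
      · have := abs_add_le (w.im - s.im) s.im
        rw [sub_add_cancel] at this
        rw [e15] at him
        have : (1.5:ℝ) * (1 / 157) ≤ 1 := by norm_num
        linarith
      · linarith)
    (fun w hw => ratio_bound T hT s.im hi w hw) (by rw [mem_ball, dist_eq]; linarith)
  unfold H
  refine hb.trans ?_
  have h5 : 0.1 / X T ≤ 1.5 / X T - ‖s - c‖ := by
    have : 0.1 / X T = 1.5 / X T - 1.4 / X T := by ring
    linarith
  have h01 : 0 < 0.1 / X T := by positivity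
  calc _ ≤ 2 * (X T / 16) * (1.5 / X T + 1.4 / X T) / (0.1 / X T) ^ 2 := by gcongr
    _ = 36.25 * X T ^ 2 := by field_simp; norm_num

end PNTB
end

section
open Complex Metric Set Filter Topology Function MeasureTheory
open scoped Real ComplexConjugate

namespace PNTB
open ArithmeticFunction (vonMangoldt vonMangoldt_nonneg)

noncomputable def g (d v : ℝ) : ℝ := Real.exp (-(v ^ 2) / (2 * d ^ 2)) / (d * √(2 * π))

lemma g_nonneg (d v : ℝ) (hd : 0 < d) : 0 ≤ g d v := by unfold g; positivity

noncomputable def K (d w : ℝ) (z : ℂ) : ℂ := exp (d ^ 2 * z ^ 2 / 2 + z * w)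

lemma norm_K (d w a t : ℝ) : ‖K d w (a + t * I)‖ = Real.exp (a * w + d ^ 2 * a ^ 2 / 2) * Real.exp (-(d ^ 2 / 2) * t ^ 2) := by
  unfold K
  rw [norm_exp, ← Real.exp_add]
  congr 1
  have : ((d:ℂ) ^ 2 * (a + t * I) ^ 2 / 2 + (a + t * I) * w) = 
    ((a * w + d ^ 2 * a ^ 2 / 2 + -(d ^ 2 / 2) * t ^ 2 : ℝ) : ℂ) + ((d ^ 2 * a * t + t * w : ℝ) : ℂ) * I := by
    push_cast
    ring_nf
    rw [I_sq]; ring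
  rw [this, add_re, ofReal_re, re_ofReal_mul, I_re, mul_zero, add_zero]

lemma gauss_int (d a v : ℝ) (hd : 0 < d) :
    ∫ t : ℝ, exp (d ^ 2 * (a + t * I) ^ 2 / 2 - (a + t * I) * v) = ((2 * π * g d v : ℝ) : ℂ) := by
  have h := integral_cexp_quadratic (b := -((d ^ 2 / 2 : ℝ) : ℂ)) (by rw [neg_re, ofReal_re]; have : 0 < d ^ 2 := (by positivity); linarith) 
    ((d ^ 2 * a - v : ℝ) * I) ((d ^ 2 * a ^ 2 / 2 - a * v : ℝ) : ℂ)
  have e : ∀ t : ℝ, (d:ℂ) ^ 2 * (a + t * I) ^ 2 / 2 - (a + t * I) * v = 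
     -((d ^ 2 / 2 : ℝ) : ℂ) * (t:ℂ) ^ 2 + ((d ^ 2 * a - v : ℝ) * I) * t + ((d ^ 2 * a ^ 2 / 2 - a * v : ℝ) : ℂ) := by
    intro t; push_cast; ring_nf; rw [I_sq]; ring
  simp_rw [e]
  rw [h, neg_neg]
  have e2 : ((d ^ 2 * a ^ 2 / 2 - a * v : ℝ) : ℂ) - ((d ^ 2 * a - v : ℝ) * I) ^ 2 / (4 * -((d ^ 2 / 2 : ℝ) : ℂ)) = 
      ((-(v ^ 2) / (2 * d ^ 2) : ℝ) : ℂ) := by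
    have : (d:ℂ) ≠ 0 := by exact_mod_cast hd.ne'
    rw [mul_pow, I_sq]
    push_cast
    field_simp
    ring
  rw [e2, ← ofReal_div, ← ofReal_exp]
  have e3 : ((π / (d ^ 2 / 2) : ℝ) : ℂ) ^ (1 / 2 : ℂ) = ((√(2 * π) / d : ℝ) : ℂ) := by
    rw [show (1 / 2 : ℂ) = ((1 / 2 : ℝ) : ℂ) by push_cast; rfl, ← ofReal_cpow (by positivity), ← Real.sqrt_eq_rpow]
    congr 1
    rw [show π / (d ^ 2 / 2) = (2 * π) / d ^ 2 by field_simp, Real.sqrt_div (by positivity), Real.sqrt_sq hd.le]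
  rw [e3, ← ofReal_mul]
  congr 1
  unfold g
  have h2 : √(2 * π) * √(2 * π) = 2 * π := Real.mul_self_sqrt (by positivity)
  have h3 : 0 < √(2 * π) := by positivity
  field_simp
  rw [pow_two, h2]

lemma gauss_integrable (d : ℝ) (hd : 0 < d) : Integrable (fun t : ℝ => Real.exp (-(d ^ 2 / 2) * t ^ 2)) :=
  integrable_exp_neg_mul_sq (by positivity)

lemma continuous_K (d w a : ℝ) : Continuous fun t : ℝ => K d w (a + t * I) := by
  unfold K; fun_prop

lemma integrable_mul_K (d w a : ℝ) (hd : 0 < d) (f : ℝ → ℂ) (hf : AEStronglyMeasurable f volume) (C : ℝ) (hC : ∀ t, ‖f t‖ ≤ C) : 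
    Integrable fun t : ℝ => f t * K d w (a + t * I) := by
  have h1 : Integrable fun t : ℝ => K d w (a + t * I) := by
    refine Integrable.mono' ((gauss_integrable d hd).const_mul (Real.exp (a * w + d ^ 2 * a ^ 2 / 2))) 
      (continuous_K d w a).aestronglyMeasurable (Eventually.of_forall fun t => (norm_K d w a t).le)
  exact h1.bdd_mul hf (Eventually.of_forall hC)

/-- pole term -/
lemma pole_int (d w a : ℝ) (hd : 0 < d) (ha : 0 < a) :
    (∫ t : ℝ, 1 / (a + t * I : ℂ) * K d w (a + t * I)).re ≤ 2 * π := by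
  have hinv : ∀ t : ℝ, 1 / (a + t * I : ℂ) = ∫ v in Ioi (0:ℝ), exp (-(a + t * I) * v) := by
    intro t
    have := integral_exp_mul_complex_Ioi (a := -(a + t * I : ℂ)) (by simpa using ha) 0
    rw [this]; simp
    rw [neg_div, ← one_div_neg_eq_neg_one_div]; simp
  have hI : Integrable (uncurry fun (t v : ℝ) => exp (-(a + t * I) * v) * K d w (a + t * I)) 
      (volume.prod (volume.restrict (Ioi (0:ℝ)))) := by
    have h1 : Integrable (fun v : ℝ => Real.exp (-a * v)) (volume.restrict (Ioi 0)) := integrableOn_exp_mul_Ioi (by linarith) 0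
    have h2 := ((gauss_integrable d hd).const_mul (Real.exp (a * w + d ^ 2 * a ^ 2 / 2))).mul_prod h1
    refine Integrable.mono' h2 ?_ (Eventually.of_forall ?_)
    · refine Continuous.aestronglyMeasurable ?_
      unfold K; simp only [uncurry_def]; fun_prop
    · rintro ⟨t, v⟩
      simp only [uncurry_apply_pair]
      rw [norm_mul, norm_K, norm_exp, mul_comm]
      refine le_of_eq ?_
      congr 2
      simp
  have h1 : ∫ t : ℝ, 1 / (a + t * I : ℂ) * K d w (a + t * I) = ∫ v in Ioi (0:ℝ), ∫ t : ℝ, exp (-(a + t * I) * v) * K d w (a + t * I) := by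
    rw [← integral_integral_swap hI]
    congr 1; ext t
    rw [hinv, integral_mul_const]
  have h2 : ∀ v : ℝ, ∫ t : ℝ, exp (-(a + t * I) * v) * K d w (a + t * I) = ((2 * π * g d (v - w) : ℝ) : ℂ) := by
    intro v
    rw [← gauss_int d a (v - w) hd]
    congr 1; ext t
    unfold K
    rw [← exp_add]; congr 1; push_cast; ring
  rw [h1]
  simp_rw [h2]
  rw [integral_complex_ofReal, ofReal_re, integral_const_mul]
  have hg : Integrable (fun v => g d (v - w)) := by
    have := (integrable_exp_neg_mul_sq (b := 1 / (2 * d ^ 2)) (by positivity)).div_const (d * √(2 * π))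
    have := this.comp_sub_right w
    refine this.congr (Eventually.of_forall fun v => ?_)
    simp only [g]; congr 2; ring
  have hg1 : ∫ v, g d (v - w) = 1 := by
    rw [integral_sub_right_eq_self (fun v => g d v) w]
    unfold g
    rw [integral_div]
    have : (fun v : ℝ => Real.exp (-(v ^ 2) / (2 * d ^ 2))) = fun v => Real.exp (-(1 / (2 * d ^ 2)) * v ^ 2) := by
      ext v; congr 1; ring
    rw [this, integral_gaussian, show π / (1 / (2 * d ^ 2)) = (2 * π) * d ^ 2 by field_simp, Real.sqrt_mul (by positivity),
      Real.sqrt_sq hd.le, mul_comm, div_self (by positivity)]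
  have h3 : ∫ v in Ioi (0:ℝ), g d (v - w) ≤ 1 := by
    rw [← hg1]
    exact setIntegral_le_integral hg (Eventually.of_forall fun v => g_nonneg _ _ hd)
  have := Real.pi_pos
  nlinarith

lemma H_line (a t : ℝ) (ha : 0 < a) (ha2 : a ≤ 1 / 40) : ‖1 / (a + t * I : ℂ) - H (1 + a + t * I)‖ ≤ 1 / a := by
  have h1 := hasSum_neg_H (1 + a + t * I) (by simp; linarith)
  have h2 := hasSum_neg_H (1 + a) (by simp; linarith)
  have h0 := H_real a ha ha2
  have h3 := hasSum_re h2
  have hb : ∀ n, ‖LSeries.term (fun n => (vonMangoldt n : ℂ)) (1 + a + t * I) n‖ ≤ 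
      RCLike.re (LSeries.term (fun n => (vonMangoldt n : ℂ)) (1 + a) n) := by
    intro n
    rcases Nat.eq_zero_or_pos n with rfl | hn
    · simp
    · rw [LSeries.term_of_ne_zero hn.ne', LSeries.term_of_ne_zero hn.ne', norm_div, norm_natCast_cpow_of_pos hn]
      have e : (n:ℂ) ^ (1 + a : ℂ) = (((n:ℝ) ^ (1 + a) : ℝ) : ℂ) := by
        rw [ofReal_cpow (by positivity)]; push_cast; rfl
      rw [e, ← ofReal_div]
      simp [abs_of_nonneg vonMangoldt_nonneg]
  have h4 := tsum_of_norm_bounded h3 hb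
  rw [h1.tsum_eq] at h4
  have e1 : (1 + a + t * I : ℂ) - 1 = a + t * I := by ring
  have e2 : (1 + a : ℂ) - 1 = a := by ring
  rw [e1, e2] at h4
  refine h4.trans ?_
  have : (1 / (a:ℂ)).re = 1 / a := by rw [← ofReal_one, ← ofReal_div, ofReal_re]
  rw [sub_re, this]
  linarith

lemma continuous_H_line (a : ℝ) (ha : 0 < a) : Continuous fun t : ℝ => H (1 + a + t * I) := by
  unfold H
  have h1 : Continuous (deriv riemannZeta₁) := (differentiable_riemannZeta₁.deriv).continuous
  have h2 := differentiable_riemannZeta₁.continuous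
  refine Continuous.div (by fun_prop) (by fun_prop) fun t => Z_ne_zero _ (by simp; linarith)

/-- main formula: an upper bound of the smoothed sum -/
lemma F_upper (d w a : ℝ) (hd : 0 < d) (ha : 0 < a) (ha2 : a ≤ 1 / 40) (N : ℕ) :
    2 * π * ∑ n ∈ Finset.range N, vonMangoldt n / n * g d (Real.log n - w) ≤ 
      2 * π + ‖∫ t : ℝ, H (1 + a + t * I) * K d w (a + t * I)‖ := by
  set f : ℕ → ℝ → ℂ := fun n t => LSeries.term (fun n => (vonMangoldt n : ℂ)) (1 + a + t * I) n * K d w (a + t * I) with hf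
  have hS := (ArithmeticFunction.LSeriesSummable_vonMangoldt (s := 1 + a) (by simp; linarith)).norm
  have hterm : ∀ n t, ‖LSeries.term (fun n => (vonMangoldt n : ℂ)) (1 + a + (t:ℝ) * I) n‖ = 
     ‖LSeries.term (fun n => (vonMangoldt n : ℂ)) (1 + a) n‖ := by
    intro n t
    rcases Nat.eq_zero_or_pos n with rfl | hn
    · simp
    · rw [LSeries.term_of_ne_zero hn.ne', LSeries.term_of_ne_zero hn.ne', norm_div, norm_div, 
        norm_natCast_cpow_of_pos hn, norm_natCast_cpow_of_pos hn]
      simp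
  have hcont : ∀ n, Continuous fun t : ℝ => LSeries.term (fun n => (vonMangoldt n : ℂ)) (1 + a + t * I) n := by
    intro n
    rcases Nat.eq_zero_or_pos n with rfl | hn
    · simp; fun_prop
    · simp only [LSeries.term_of_ne_zero hn.ne']
      refine Continuous.div (by fun_prop) ?_ fun t => ?_
      · refine Continuous.const_cpow (by fun_prop) (Or.inl (by exact_mod_cast hn.ne'))
      · rw [cpow_ne_zero_iff]; left; exact_mod_cast hn.ne'
  have hIntg : ∀ n, Integrable (f n) := fun n =>
    integrable_mul_K d w a hd _ (hcont n).aestronglyMeasurable _ (fun t => (hterm n t).le)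
  have hval : ∀ n, ∫ t, f n t = ((2 * π * (vonMangoldt n / n * g d (Real.log n - w)) : ℝ) : ℂ) := by
    intro n
    rcases Nat.eq_zero_or_pos n with rfl | hn
    · simp [hf]
    · have hn' : (0:ℝ) < n := by exact_mod_cast hn
      have e : ∀ t : ℝ, f n t = ((vonMangoldt n / n : ℝ) : ℂ) * exp (d ^ 2 * (a + t * I) ^ 2 / 2 - (a + t * I) * (Real.log n - w : ℝ)) := by
        intro t
        simp only [hf]
        rw [LSeries.term_of_ne_zero hn.ne']
        have : (n:ℂ) ^ (1 + a + t * I) = n * exp ((a + t * I) * Real.log n) := by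
          rw [add_assoc, cpow_add _ _ (by exact_mod_cast hn.ne'), cpow_one, cpow_def_of_ne_zero (by exact_mod_cast hn.ne'),
             ← ofReal_natCast, ← ofReal_log hn'.le]
          congr 2; ring
        rw [this, K, div_mul_eq_div_div, div_eq_mul_inv _ (exp _), ← exp_neg, mul_assoc, ← exp_add]
        push_cast
        congr 2; ring
      simp_rw [e]
      rw [integral_const_mul, gauss_int d a _ hd, ← ofReal_mul]
      congr 1; ring
  have hsumint : Summable fun n => ∫ t, ‖f n t‖ := by
    have : ∀ n, ∫ t, ‖f n t‖ = ‖LSeries.term (fun n => (vonMangoldt n : ℂ)) (1 + a) n‖ * ∫ t : ℝ, ‖K d w (a + t * I)‖ := by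
      intro n
      rw [← integral_const_mul]
      congr 1; ext t
      simp only [hf]; rw [norm_mul, hterm]
    simp_rw [this]
    exact hS.mul_right _
  have hHS := hasSum_integral_of_summable_integral_norm hIntg hsumint
  have hts : ∀ t : ℝ, ∑' n, f n t = (1 / (a + t * I : ℂ) - H (1 + a + t * I)) * K d w (a + t * I) := by
    intro t
    have h1 := (hasSum_neg_H (1 + a + t * I) (by simp; linarith)).mul_right (K d w (a + t * I))
    have := h1.tsum_eq
    simp only [hf]
    rw [this]
    congr 3; ring
  simp_rw [hts, hval] at hHS
  have hi1 : Integrable fun t : ℝ => 1 / (a + t * I : ℂ) * K d w (a + t * I) := by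
    have hne : ∀ t : ℝ, (a + t * I : ℂ) ≠ 0 := fun t h => by
      have := congrArg re h
      simp at this; linarith
    refine integrable_mul_K d w a hd _ (Continuous.aestronglyMeasurable ?_) (1 / a) fun t => ?_
    · exact Continuous.div (by fun_prop) (by fun_prop) hne
    · rw [norm_div, norm_one]
      apply one_div_le_one_div_of_le ha
      have := re_le_norm (a + t * I : ℂ)
      simpa using this
  have hi2 : Integrable fun t : ℝ => (1 / (a + t * I : ℂ) - H (1 + a + t * I)) * K d w (a + t * I) := by
    have hne : ∀ t : ℝ, (a + t * I : ℂ) ≠ 0 := fun t h => by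
      have := congrArg re h
      simp at this; linarith
    refine integrable_mul_K d w a hd _ (Continuous.aestronglyMeasurable ?_) (1 / a) fun t => H_line a t ha ha2
    exact (Continuous.div (by fun_prop) (by fun_prop) hne).sub (continuous_H_line a ha)
  have hi3 : Integrable fun t : ℝ => H (1 + a + t * I) * K d w (a + t * I) := by
    have := hi1.sub hi2
    refine this.congr (Eventually.of_forall fun t => ?_)
    simp only [Pi.sub_apply]; ring
  have hsplit : ∫ t : ℝ, (1 / (a + t * I : ℂ) - H (1 + a + t * I)) * K d w (a + t * I) = 
     (∫ t : ℝ, 1 / (a + t * I : ℂ) * K d w (a + t * I)) - ∫ t : ℝ, H (1 + a + t * I) * K d w (a + t * I) := by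
    rw [← integral_sub hi1 hi3]; congr 1; ext t; ring
  rw [hsplit] at hHS
  have h5 := hasSum_re hHS
  have h6 := sum_le_hasSum (Finset.range N) (fun n _ => by
    simp only [RCLike.re_eq_complex_re, ofReal_re]
    have := g_nonneg d (Real.log n - w) hd
    have : 0 ≤ vonMangoldt n := vonMangoldt_nonneg
    positivity) h5
  simp only [RCLike.re_eq_complex_re, ofReal_re] at h6
  rw [← Finset.mul_sum] at h6
  refine h6.trans ?_
  rw [sub_re]
  have h7 := pole_int d w a hd ha
  have h8 := (abs_le.1 (abs_re_le_norm (∫ t : ℝ, H (1 + a + t * I) * K d w (a + t * I)))).1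
  linarith

end PNTB
end

section
open Complex Metric Set Filter Topology Function MeasureTheory
open scoped Real ComplexConjugate

namespace PNTB

lemma K_le (d w x t : ℝ) : ‖K d w (x + t * I)‖ ≤ Real.exp (x * w + d ^ 2 * x ^ 2 / 2) := by
  rw [norm_K]
  have : Real.exp (-(d ^ 2 / 2) * t ^ 2) ≤ 1 := by
    rw [Real.exp_le_one_iff]; nlinarith [mul_nonneg (sq_nonneg d) (sq_nonneg t)]
  nlinarith [Real.exp_pos (x * w + d ^ 2 * x ^ 2 / 2)]

lemma gauss_total (d : ℝ) (hd : 0 < d) : ∫ t : ℝ, Real.exp (-(d ^ 2 / 2) * t ^ 2) = √(2 * π) / d := by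
  rw [integral_gaussian, show π / (d ^ 2 / 2) = (2 * π) / d ^ 2 by field_simp, Real.sqrt_div (by positivity), Real.sqrt_sq hd.le]

lemma gauss_total' (d : ℝ) (hd : 0 < d) : ∫ t : ℝ, Real.exp (-(d ^ 2 / 20) * t ^ 2) = √(20 * π) / d := by
  rw [integral_gaussian, show π / (d ^ 2 / 20) = (20 * π) / d ^ 2 by field_simp, Real.sqrt_div (by positivity), Real.sqrt_sq hd.le]

/-- the tails -/
lemma tail_bound (d w a T' : ℝ) (hd : 0 < d) (ha : 0 < a) (ha2 : a ≤ 1 / 40) (hT : 0 < T') :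
    ‖∫ t in (Ioc (-T') T')ᶜ, H (1 + a + t * I) * K d w (a + t * I)‖ ≤ 
      Real.exp (a * w + d ^ 2 * a ^ 2 / 2) * ((2 / a) * (√(20 * π) / d) * Real.exp (-(9 / 20) * d ^ 2 * T' ^ 2)) := by
  have hi : Integrable fun t : ℝ => Real.exp (-(d ^ 2 / 20) * t ^ 2) := integrable_exp_neg_mul_sq (by positivity)
  set C := Real.exp (a * w + d ^ 2 * a ^ 2 / 2) * ((2 / a) * Real.exp (-(9 / 20) * d ^ 2 * T' ^ 2)) with hC
  have hC0 : 0 < C := by positivity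
  have h1 : ‖∫ t in (Ioc (-T') T')ᶜ, H (1 + a + t * I) * K d w (a + t * I)‖ ≤ 
      ∫ t in (Ioc (-T') T')ᶜ, C * Real.exp (-(d ^ 2 / 20) * t ^ 2) := by
    refine norm_integral_le_of_norm_le (hi.const_mul C).integrableOn ?_
    rw [ae_restrict_iff' measurableSet_Ioc.compl]
    refine Eventually.of_forall fun t ht => ?_
    have ht2 : T' ^ 2 ≤ t ^ 2 := by
      rw [mem_compl_iff, mem_Ioc, not_and_or, not_lt, not_le] at ht
      rcases ht with h | h <;> nlinarith
    have hH : ‖H (1 + a + t * I)‖ ≤ 2 / a := by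
      have h := H_line a t ha ha2
      have h2 : ‖1 / (a + t * I : ℂ)‖ ≤ 1 / a := by
        rw [norm_div, norm_one]
        apply one_div_le_one_div_of_le ha
        have := re_le_norm (a + t * I : ℂ)
        simpa using this
      have h3 := norm_sub_le (1 / (a + t * I : ℂ)) (1 / (a + t * I : ℂ) - H (1 + a + t * I))
      rw [sub_sub_cancel] at h3
      have : 2 / a = 1 / a + 1 / a := by ring
      linarith
    rw [norm_mul, norm_K]
    have h4 : Real.exp (-(d ^ 2 / 2) * t ^ 2) ≤ Real.exp (-(9 / 20) * d ^ 2 * T' ^ 2) * Real.exp (-(d ^ 2 / 20) * t ^ 2) := by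
      rw [← Real.exp_add]
      apply Real.exp_le_exp.2
      nlinarith [mul_le_mul_of_nonneg_left ht2 (sq_nonneg d)]
    calc _ ≤ 2 / a * (Real.exp (a * w + d ^ 2 * a ^ 2 / 2) * (Real.exp (-(9 / 20) * d ^ 2 * T' ^ 2) * Real.exp (-(d ^ 2 / 20) * t ^ 2))) := by
          gcongr
      _ = _ := by rw [hC]; ring
  have h2 : ∫ t in (Ioc (-T') T')ᶜ, C * Real.exp (-(d ^ 2 / 20) * t ^ 2) ≤ C * (√(20 * π) / d) := by
    rw [← gauss_total' d hd, ← integral_const_mul]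
    exact setIntegral_le_integral (hi.const_mul C) (Eventually.of_forall fun v => by positivity)
  refine (h1.trans h2).trans (le_of_eq ?_)
  rw [hC]; ring

lemma contour (T d w a : ℝ) (hT : 50000 ≤ T) (hd : 0 < d) (ha : 0 < a) (hw : 0 ≤ w) (ha2 : a ≤ 1 / X T / 2) :
    ‖∫ t : ℝ, H (1 + a + t * I) * K d w (a + t * I)‖ ≤ 
      36.25 * X T ^ 2 * (√(2 * π) / d) * Real.exp (d ^ 2 * (0.9 / X T) ^ 2 / 2) * Real.exp (-(0.9 / X T) * w)
      + Real.exp (a * w + d ^ 2 * (a ^ 2 + (0.9 / X T) ^ 2) / 2) * 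
        (2 * (a + 0.9 / X T) * (36.25 * X T ^ 2) * Real.exp (-(d ^ 2 / 2) * (T / 4 - 1) ^ 2)
        + (2 / a) * (√(20 * π) / d) * Real.exp (-(9 / 20) * d ^ 2 * (T / 4 - 1) ^ 2)) := by
  have hX := X_lower T hT
  set b := 0.9 / X T with hb
  set T' := T / 4 - 1 with hT'
  set M := 36.25 * X T ^ 2 with hM
  have hM0 : 0 ≤ M := by positivity
  have hT0 : 0 < T' := by rw [hT']; linarith
  have hb0 : 0 < b := by positivity
  have ha3 : a ≤ 1 / 40 := by
    refine ha2.trans ?_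
    rw [div_div, div_le_div_iff₀ (by positivity) (by norm_num)]; linarith
  have hHb : ∀ x t : ℝ, -b ≤ x → x ≤ a → |t| ≤ T' → ‖H (1 + x + t * I)‖ ≤ M := by
    intro x t h1 h2 h3
    refine H_bound T hT _ (by simpa using h3) ?_ ?_
    · simp; linarith
    · simp; simp at ha2; linarith
  have hne : ∀ x t : ℝ, -b ≤ x → x ≤ a → |t| ≤ T' → riemannZeta₁ (1 + x + t * I) ≠ 0 := by
    intro x t h1 h2 h3
    refine zfr T hT _ ?_ ?_
    · simp; linarith
    · have : b ≤ 1 / X T := by rw [hb]; gcongr; norm_num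
      simp at this ⊢; linarith
  set G : ℂ → ℂ := fun z => H (1 + z) * K d w z with hG
  have hrect := Complex.integral_boundary_rect_eq_zero_of_differentiableOn G (⟨-b, -T'⟩ : ℂ) (⟨a, T'⟩ : ℂ) ?_
  swap
  · intro z hz
    rw [mem_reProdIm, uIcc_of_le (by simp; linarith), uIcc_of_le (by simp; linarith)] at hz
    simp only [mem_Icc] at hz
    have hz0 : riemannZeta₁ (1 + z) ≠ 0 := by
      have := hne z.re z.im hz.1.1 hz.1.2 (abs_le.2 hz.2)
      rwa [add_assoc, re_add_im] at this
    apply DifferentiableAt.differentiableWithinAt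
    simp only [hG]
    refine DifferentiableAt.mul ?_ ?_
    · unfold H
      have h1 : Differentiable ℂ (deriv riemannZeta₁) := differentiable_riemannZeta₁.deriv
      have h2 := differentiable_riemannZeta₁
      refine DifferentiableAt.div (h1.differentiableAt.comp _ (by fun_prop)) (h2.differentiableAt.comp _ (by fun_prop)) hz0
    · unfold K; fun_prop
  simp only [smul_eq_mul] at hrect
  -- sides
  have hGn : ∀ x t : ℝ, G (x + t * I) = H (1 + x + t * I) * K d w (x + t * I) := by
    intro x t; simp only [hG]; rw [add_assoc]
  have hhor : ∀ t : ℝ, |t| = T' → ‖∫ x in (-b)..a, G (x + t * I)‖ ≤ 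
      M * (Real.exp (a * w + d ^ 2 * (a ^ 2 + b ^ 2) / 2) * Real.exp (-(d ^ 2 / 2) * T' ^ 2)) * (a + b) := by
    intro t ht
    have := intervalIntegral.norm_integral_le_of_norm_le_const (a := -b) (b := a) (f := fun x : ℝ => G (x + t * I)) 
      (C := M * (Real.exp (a * w + d ^ 2 * (a ^ 2 + b ^ 2) / 2) * Real.exp (-(d ^ 2 / 2) * T' ^ 2))) ?_
    · rwa [sub_neg_eq_add, abs_of_pos (by linarith)] at this
    · intro x hx
      rw [uIoc_of_le (by linarith), mem_Ioc] at hx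
      rw [hGn, norm_mul, norm_K, ← sq_abs t, ht]
      have h1 := hHb x t hx.1.le hx.2 ht.le
      have h2 : x ^ 2 ≤ a ^ 2 + b ^ 2 := by
        rcases le_or_gt 0 x with h | h <;> nlinarith
      gcongr
      · linarith [hx.2]
  have hleft : ‖∫ t in (-T')..T', G ((-b : ℝ) + t * I)‖ ≤ M * (√(2 * π) / d) * Real.exp (d ^ 2 * b ^ 2 / 2) * Real.exp (-b * w) := by
    have h1 : ‖∫ t in (-T')..T', G ((-b : ℝ) + t * I)‖ ≤ ∫ t in (-T')..T', M * (Real.exp (-b * w + d ^ 2 * (-b) ^ 2 / 2) * Real.exp (-(d ^ 2 / 2) * t ^ 2)) := by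
      refine intervalIntegral.norm_integral_le_of_norm_le (by linarith) (Eventually.of_forall fun t ht => ?_) ?_
      · rw [hGn, norm_mul, norm_K]
        have := hHb (-b) t le_rfl (by linarith) (abs_le.2 ⟨ht.1.le, ht.2⟩)
        gcongr
      · exact (((gauss_integrable d hd).const_mul _).const_mul _).intervalIntegrable
    have h2 : ∫ t in (-T')..T', M * (Real.exp (-b * w + d ^ 2 * (-b) ^ 2 / 2) * Real.exp (-(d ^ 2 / 2) * t ^ 2)) ≤ 
       ∫ t, M * (Real.exp (-b * w + d ^ 2 * (-b) ^ 2 / 2) * Real.exp (-(d ^ 2 / 2) * t ^ 2)) := by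
      rw [intervalIntegral.integral_of_le (by linarith)]
      exact setIntegral_le_integral (((gauss_integrable d hd).const_mul _).const_mul _) (Eventually.of_forall fun v => by positivity)
    refine (h1.trans h2).trans (le_of_eq ?_)
    rw [integral_const_mul, integral_const_mul, gauss_total d hd, Real.exp_add]
    ring_nf
  have hb1 := hhor (-T') (by rw [abs_neg, abs_of_pos hT0])
  have hb2 := hhor T' (abs_of_pos hT0)
  have hmid : ‖∫ t in (-T')..T', G (a + t * I)‖ ≤ M * (√(2 * π) / d) * Real.exp (d ^ 2 * b ^ 2 / 2) * Real.exp (-b * w) + 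
      2 * (M * (Real.exp (a * w + d ^ 2 * (a ^ 2 + b ^ 2) / 2) * Real.exp (-(d ^ 2 / 2) * T' ^ 2)) * (a + b)) := by
    have e : I * ∫ t in (-T')..T', G (a + t * I) = I * (∫ t in (-T')..T', G ((-b : ℝ) + t * I)) 
       + (∫ x in (-b)..a, G (x + T' * I)) - (∫ x in (-b)..a, G (x + (-T' : ℝ) * I)) := by
      linear_combination hrect
    have e2 := congrArg norm e
    rw [norm_mul, norm_I, one_mul] at e2
    rw [e2]
    refine (norm_sub_le _ _).trans ?_
    have := norm_add_le (I * (∫ t in (-T')..T', G ((-b : ℝ) + t * I))) (∫ x in (-b)..a, G (x + T' * I))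
    rw [norm_mul, norm_I, one_mul] at this
    linarith
  have hIntg : Integrable fun t : ℝ => H (1 + a + t * I) * K d w (a + t * I) := by
    refine integrable_mul_K d w a hd _ (continuous_H_line a ha).aestronglyMeasurable (2 / a) fun t => ?_
    have h := H_line a t ha ha3
    have h2 : ‖1 / (a + t * I : ℂ)‖ ≤ 1 / a := by
      rw [norm_div, norm_one]
      apply one_div_le_one_div_of_le ha
      have := re_le_norm (a + t * I : ℂ)
      simpa using this
    have h3 := norm_sub_le (1 / (a + t * I : ℂ)) (1 / (a + t * I : ℂ) - H (1 + a + t * I))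
    rw [sub_sub_cancel] at h3
    have : 2 / a = 1 / a + 1 / a := by ring
    linarith
  rw [← integral_add_compl (s := Ioc (-T') T') measurableSet_Ioc hIntg]
  refine (norm_add_le _ _).trans ?_
  have ht := tail_bound d w a T' hd ha ha3 hT0
  rw [← intervalIntegral.integral_of_le (by linarith)]
  simp_rw [hGn] at hmid
  have he : Real.exp (a * w + d ^ 2 * a ^ 2 / 2) ≤ Real.exp (a * w + d ^ 2 * (a ^ 2 + b ^ 2) / 2) := by
    apply Real.exp_le_exp.2; nlinarith [mul_nonneg (sq_nonneg d) (sq_nonneg b)]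
  have hpos : 0 ≤ (2 / a) * (√(20 * π) / d) * Real.exp (-(9 / 20) * d ^ 2 * T' ^ 2) := by positivity
  have := mul_le_mul_of_nonneg_right he hpos
  linarith

end PNTB
end

section
open Complex Metric Set Filter Topology Function MeasureTheory
open scoped Real ComplexConjugate

namespace PNTB
open ArithmeticFunction (vonMangoldt vonMangoldt_nonneg)

lemma g_cont (d : ℝ) : Continuous (g d) := by unfold g; fun_prop

lemma g_even (d v : ℝ) : g d (-v) = g d v := by unfold g; rw [neg_sq]

lemma g_integrable (d : ℝ) (hd : 0 < d) : Integrable (g d) := by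
  have := (integrable_exp_neg_mul_sq (b := 1 / (2 * d ^ 2)) (by positivity)).div_const (d * √(2 * π))
  refine this.congr (Eventually.of_forall fun v => ?_)
  simp only [g]; congr 2; ring

lemma g_half (d : ℝ) (hd : 0 < d) : ∫ v in Ioi (0:ℝ), g d v = 1 / 2 := by
  unfold g
  rw [integral_div]
  have : (fun v : ℝ => Real.exp (-(v ^ 2) / (2 * d ^ 2))) = fun v => Real.exp (-(1 / (2 * d ^ 2)) * v ^ 2) := by
    ext v; congr 1; ring
  rw [this, integral_gaussian_Ioi, show π / (1 / (2 * d ^ 2)) = (2 * π) * d ^ 2 by field_simp, Real.sqrt_mul (by positivity),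
      Real.sqrt_sq hd.le]
  field_simp

lemma g_right (d k : ℝ) (hd : 0 < d) (hk : 0 ≤ k) : ∫ v in Ioi (k * d), g d v ≤ Real.exp (-k ^ 2 / 2) / 2 := by
  have h1 : ∫ v in Ioi (k * d), g d v = ∫ v in Ioi (0:ℝ), g d (v + k * d) := by
    have := (measurePreserving_add_right volume (k * d)).setIntegral_preimage_emb 
      (measurableEmbedding_addRight (k * d)) (g d) (Ioi (k * d))
    rw [preimage_add_const_Ioi, sub_self] at this; exact this.symm
  rw [h1, show Real.exp (-k ^ 2 / 2) / 2 = Real.exp (-k ^ 2 / 2) * (1 / 2) by ring, ← g_half d hd, ← integral_const_mul]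
  refine setIntegral_mono_on ((g_integrable d hd).comp_add_right _).integrableOn ((g_integrable d hd).const_mul _).integrableOn 
    measurableSet_Ioi fun v hv => ?_
  have hv : 0 < v := hv
  unfold g
  rw [← mul_div_assoc, ← Real.exp_add]
  gcongr
  rw [← sub_nonneg]
  have : -k ^ 2 / 2 + -v ^ 2 / (2 * d ^ 2) - -(v + k * d) ^ 2 / (2 * d ^ 2) = k * v / d := by
    field_simp; ring
  rw [this]; positivity

lemma g_core (d k : ℝ) (hd : 0 < d) (hk : 0 ≤ k) : 1 - Real.exp (-k ^ 2 / 2) ≤ ∫ v in (-(k * d))..(k * d), g d v := by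
  have hi := g_integrable d hd
  have h0 : 0 ≤ k * d := by positivity
  have h1 : ∫ v in (0:ℝ)..(k * d), g d v = 1 / 2 - ∫ v in Ioi (k * d), g d v := by
    have := intervalIntegral.integral_Ioi_sub_Ioi (f := g d) (μ := volume) (a := 0) (b := k * d) hi.integrableOn h0
    rw [← this, g_half d hd]
  have h2 : ∫ v in (-(k * d))..0, g d v = ∫ v in (0:ℝ)..(k * d), g d v := by
    have := intervalIntegral.integral_comp_neg (f := g d) (a := 0) (b := k * d)
    simp only [g_even, neg_zero] at this
    exact this.symm
  have h3 := intervalIntegral.integral_add_adjacent_intervals (a := -(k * d)) (b := 0) (c := k * d) (f := g d) (μ := volume)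
    hi.intervalIntegrable hi.intervalIntegrable
  have := g_right d k hd hk
  linarith

lemma exp_g_core (d k : ℝ) (hd : 0 < d) (hk : 0 ≤ k) : 
    1 - Real.exp (-k ^ 2 / 2) ≤ ∫ v in (-(k * d))..(k * d), Real.exp v * g d v := by
  refine (g_core d k hd hk).trans ?_
  have hc : Continuous fun v => Real.exp v * g d v := Real.continuous_exp.mul (g_cont d)
  have hc2 : Continuous fun v => Real.exp (-v) * g d v := (Real.continuous_exp.comp continuous_neg).mul (g_cont d)
  have h0 : 0 ≤ k * d := by positivity
  have h2 : ∫ v in (-(k * d))..(k * d), Real.exp (-v) * g d v = ∫ v in (-(k * d))..(k * d), Real.exp v * g d v := by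
    have := intervalIntegral.integral_comp_neg (f := fun v => Real.exp v * g d v) (a := -(k * d)) (b := k * d)
    simp only [g_even, neg_neg] at this
    exact this
  have h3 : ∫ v in (-(k * d))..(k * d), (Real.exp v * g d v + Real.exp (-v) * g d v) = 
      2 * ∫ v in (-(k * d))..(k * d), Real.exp v * g d v := by
    rw [intervalIntegral.integral_add (hc.intervalIntegrable _ _) (hc2.intervalIntegrable _ _), h2]; ring
  have h4 : ∫ v in (-(k * d))..(k * d), 2 * g d v ≤ ∫ v in (-(k * d))..(k * d), (Real.exp v * g d v + Real.exp (-v) * g d v) := by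
    refine intervalIntegral.integral_mono (by linarith) ((continuous_const.mul (g_cont d)).intervalIntegrable _ _) 
      ((hc.add hc2).intervalIntegrable _ _) fun v => ?_
    have h := g_nonneg d v hd
    have e1 := Real.add_one_le_exp v
    have e2 := Real.add_one_le_exp (-v)
    simp only
    nlinarith
  rw [intervalIntegral.integral_const_mul, h3] at h4
  linarith

lemma psi_smooth (d W k b A B x : ℝ) (hd : 0 < d) (hk : 0 ≤ k) (hb : 0 < b) (hb1 : b < 1) (hA : 0 ≤ A) (hB : 0 ≤ B) (hx : 1 ≤ x) 
    (hW : Real.log x + k * d ≤ W) (hkd : k * d ≤ Real.log 2) 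
    (hF : ∀ w, 0 ≤ w → w ≤ W → ∑ n ∈ Finset.range (⌊x⌋₊ + 1), vonMangoldt n / n * g d (Real.log n - w) ≤ 
      1 + A * Real.exp (-b * w) + B) :
    Chebyshev.psi x * (1 - Real.exp (-k ^ 2 / 2)) ≤ Real.exp W * (1 + A * Real.exp (-b * W) / (1 - b) + B) := by
  have hlx : 0 ≤ Real.log x := Real.log_nonneg hx
  have hkd0 : 0 ≤ k * d := by positivity
  have hW0 : 0 ≤ W := by linarith
  have hgc : ∀ n : ℕ, Continuous fun w : ℝ => Real.exp w * (vonMangoldt n / n * g d (Real.log n - w)) := by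
    intro n
    have := (g_cont d).comp (by fun_prop : Continuous fun w : ℝ => Real.log n - w)
    simp only [comp_def] at this
    fun_prop
  have h1 : Chebyshev.psi x * (1 - Real.exp (-k ^ 2 / 2)) ≤ 
      ∑ n ∈ Finset.range (⌊x⌋₊ + 1), ∫ w in (0:ℝ)..W, Real.exp w * (vonMangoldt n / n * g d (Real.log n - w)) := by
    rw [Chebyshev.psi_eq_sum_Icc, ← Nat.range_succ_eq_Icc_zero, Finset.sum_mul]
    refine Finset.sum_le_sum fun n hn => ?_
    rcases Nat.lt_or_ge n 2 with h | h
    · have : vonMangoldt n = 0 := by interval_cases n <;> simp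
      simp [this]
    · have hn' : (2:ℝ) ≤ n := by exact_mod_cast h
      have hnx : (n:ℝ) ≤ x := by
        have : n ≤ ⌊x⌋₊ := by simpa [Nat.lt_succ_iff] using hn
        exact (Nat.le_floor_iff (by linarith)).1 this
      have hl1 : Real.log 2 ≤ Real.log n := Real.log_le_log (by norm_num) hn'
      have hl2 : Real.log n ≤ Real.log x := Real.log_le_log (by linarith) hnx
      have e : ∫ w in (0:ℝ)..W, Real.exp w * (vonMangoldt n / n * g d (Real.log n - w)) = 
          vonMangoldt n * ∫ v in (-Real.log n)..(W - Real.log n), Real.exp v * g d v := by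
        rw [← intervalIntegral.integral_const_mul]
        have := intervalIntegral.integral_comp_sub_right (f := fun v => vonMangoldt n * (Real.exp v * g d v)) (a := 0) (b := W) (Real.log n)
        rw [zero_sub] at this
        rw [← this]
        congr 1; ext w
        rw [Real.exp_sub, Real.exp_log (by linarith), ← g_even d (w - Real.log n), neg_sub]
        ring
      rw [e]
      refine mul_le_mul_of_nonneg_left ?_ vonMangoldt_nonneg
      refine (exp_g_core d k hd hk).trans ?_
      have hc : Continuous fun v => Real.exp v * g d v := Real.continuous_exp.mul (g_cont d)
      refine intervalIntegral.integral_mono_interval (by linarith) (by linarith) (by linarith) 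
        (Eventually.of_forall fun v => mul_nonneg (Real.exp_pos _).le (g_nonneg d v hd)) (hc.intervalIntegrable _ _)
  refine h1.trans ?_
  rw [← intervalIntegral.integral_finsetSum fun n _ => (hgc n).intervalIntegrable _ _]
  have h2 : ∫ w in (0:ℝ)..W, ∑ n ∈ Finset.range (⌊x⌋₊ + 1), Real.exp w * (vonMangoldt n / n * g d (Real.log n - w)) ≤ 
     ∫ w in (0:ℝ)..W, ((1 + B) * Real.exp w + A * Real.exp ((1 - b) * w)) := by
    refine intervalIntegral.integral_mono_on hW0 ((continuous_finsetSum _ fun n _ => hgc n).intervalIntegrable _ _)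
      (Continuous.intervalIntegrable (by fun_prop) _ _) fun w hw => ?_
    rw [← Finset.mul_sum]
    have := hF w hw.1 hw.2
    have h3 := mul_le_mul_of_nonneg_left this (Real.exp_pos w).le
    refine h3.trans (le_of_eq ?_)
    rw [show (1 - b) * w = w + -b * w by ring, Real.exp_add]; ring
  refine h2.trans ?_
  rw [intervalIntegral.integral_add (Continuous.intervalIntegrable (by fun_prop) _ _) (Continuous.intervalIntegrable (by fun_prop) _ _),
    intervalIntegral.integral_const_mul, intervalIntegral.integral_const_mul, integral_exp, 
    intervalIntegral.integral_comp_mul_left (fun y => Real.exp y) (by linarith : (1 - b) ≠ 0), integral_exp]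
  simp only [mul_zero, Real.exp_zero, smul_eq_mul]
  rw [show (1 - b) * W = W + -b * W by ring, Real.exp_add]
  have h1b : 0 < 1 - b := by linarith
  have : Real.exp W * (1 + A * Real.exp (-b * W) / (1 - b) + B) - ((1 + B) * (Real.exp W - 1) + A * ((1 - b)⁻¹ * (Real.exp W * Real.exp (-b * W) - 1)))
     = 1 + B + A * (1 - b)⁻¹ := by field_simp; ring
  have : 0 ≤ 1 + B + A * (1 - b)⁻¹ := by positivity
  linarith

end PNTB
end

section
open Complex Metric Set Filter Topology Function MeasureTheory
open scoped Real ComplexConjugate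

namespace PNTB
open ArithmeticFunction (vonMangoldt vonMangoldt_nonneg)

lemma exp_ge_num (n : ℕ) (r : ℝ) (hr : 0 ≤ r) : 
    (2.7182818283:ℝ) ^ n * (1 + r + r ^ 2 / 2 + r ^ 3 / 6 + r ^ 4 / 24) ≤ Real.exp (n + r) := by
  rw [Real.exp_add, ← Real.exp_one_pow]
  have h1 := Real.exp_one_gt_d9
  have h2 := Real.sum_le_exp_of_nonneg hr 5
  simp only [Finset.sum_range_succ, Finset.sum_range_zero, Nat.factorial] at h2
  norm_num at h2
  have h3 : (2.7182818283:ℝ) ^ n ≤ Real.exp 1 ^ n := pow_le_pow_left₀ (by norm_num) h1.le n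
  refine mul_le_mul h3 (by linarith) (by positivity) (by positivity)

lemma exp_le_num (n : ℕ) (r : ℝ) (hr : 0 ≤ r) (hr1 : r ≤ 1) : 
    Real.exp (n + r) ≤ (2.7182818286:ℝ) ^ n * (1 + r + r ^ 2 / 2 + r ^ 3 / 6 + r ^ 4 / 24 + r ^ 5 / 100) := by
  rw [Real.exp_add, ← Real.exp_one_pow]
  have h1 := Real.exp_one_lt_d9
  have h2 := Real.exp_bound' hr hr1 (n := 5) (by norm_num)
  simp only [Finset.sum_range_succ, Finset.sum_range_zero, Nat.factorial] at h2
  norm_num at h2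
  have h3 : Real.exp 1 ^ n ≤ (2.7182818286:ℝ) ^ n := pow_le_pow_left₀ (by positivity) h1.le n
  have : 0 ≤ r ^ 5 := by positivity
  refine mul_le_mul h3 (by linarith) (by positivity) (by positivity)

lemma log5000 : Real.log 5000 ≤ 8.5174 := by
  rw [Real.log_le_iff_le_exp (by norm_num)]
  have := exp_ge_num 8 0.5174 (by norm_num)
  norm_num at this ⊢; linarith

lemma log7 : 1.9458 ≤ Real.log 7 := by
  rw [Real.le_log_iff_exp_le (by norm_num)]
  have := exp_le_num 1 0.9458 (by norm_num) (by norm_num)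
  norm_num at this ⊢; linarith

lemma log2pi : 1.837 ≤ Real.log (2 * π) := by
  rw [Real.le_log_iff_exp_le (by positivity)]
  have := exp_le_num 1 0.837 (by norm_num) (by norm_num)
  have h := Real.pi_gt_d6
  norm_num at this h ⊢; linarith

lemma log1233 : Real.log 12.33 ≤ 2.513 := by
  rw [Real.log_le_iff_le_exp (by norm_num)]
  have := exp_ge_num 2 0.513 (by norm_num)
  norm_num at this ⊢; linarith

lemma T_ge (L : ℝ) (hL : 5000 ≤ L) : 50000 ≤ L * √L / 7 := by
  have h : (70.7:ℝ) ≤ √L := by apply Real.le_sqrt_of_sq_le; norm_num; linarith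
  nlinarith

lemma X_upper (L : ℝ) (hL : 5000 ≤ L) : X (L * √L / 7) ≤ 158.4 * Real.exp (Real.log (L / 5000) / 10) := by
  set s := Real.log (L / 5000) with hs
  have hs0 : 0 ≤ s := Real.log_nonneg (by rw [le_div_iff₀ (by norm_num)]; linarith)
  have hT := T_ge L hL
  set T := L * √L / 7 with hTd
  have hlL : Real.log L = Real.log 5000 + s := by
    rw [hs, Real.log_div (by linarith) (by norm_num)]; ring
  have hlT : Real.log T = 3 / 2 * (Real.log 5000 + s) - Real.log 7 := by
    have : 0 < √L := Real.sqrt_pos.2 (by linarith)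
    rw [hTd, Real.log_div (by positivity) (by norm_num), Real.log_mul (by linarith) this.ne', Real.log_sqrt (by linarith), hlL]; ring
  have h5 := log5000
  have h7 := log7
  have hlT2 : Real.log T ≤ 10.8303 + 1.5 * s := by rw [hlT]; linarith
  have hadd : ∀ c : ℝ, 0 ≤ c → c ≤ 5 → Real.log (T + c) ≤ Real.log T + 0.0001 := by
    intro c hc hc5
    have e : T + c = T * (1 + c / T) := by field_simp
    rw [e, Real.log_mul (by linarith) (by positivity)]
    have := Real.log_le_sub_one_of_pos (by positivity : 0 < 1 + c / T)
    have : c / T ≤ 0.0001 := by rw [div_le_iff₀ (by linarith)]; linarith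
    linarith
  have hLL : LL T ≤ 2.513 + (1.5 * s + 0.0004) / 12.33 := by
    unfold LL
    have h1 := hadd 5 (by norm_num) (by norm_num)
    have h0 : 0 < Real.log (T + 5) := Real.log_pos (by linarith)
    set y := Real.log (T + 5) + 3 / 2
    have hy : y ≤ 12.3304 + 1.5 * s := by simp only [y]; linarith
    have hy0 : 0 < y := by simp only [y]; linarith
    have e : y = 12.33 * (y / 12.33) := by field_simp
    rw [e, Real.log_mul (by norm_num) (by positivity)]
    have h2 := Real.log_le_sub_one_of_pos (by positivity : 0 < y / 12.33)
    have h3 := log1233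
    have : y / 12.33 - 1 ≤ (1.5 * s + 0.0004) / 12.33 := by
      rw [div_sub_one (by norm_num)]; gcongr; linarith
    linarith
  have hB : Bd T ≤ 4.5196 + 0.45325 * s := by
    unfold Bd
    have h1 := hadd 3 (by norm_num) (by norm_num)
    rw [Real.log_div (by linarith) (by positivity)]
    have h2 := log2pi
    have : (1.5 * s + 0.0004) / 12.33 ≤ 0.12166 * s + 0.00004 := by
      rw [div_le_iff₀ (by norm_num)]; nlinarith
    linarith
  have hX : X T ≤ 158.4 + 15.84 * s := by
    unfold X; rw [div_le_iff₀ (by norm_num)]; nlinarith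
  have := Real.add_one_le_exp (s / 10)
  linarith
 
end PNTB
end

section
open Complex Metric Set Filter Topology Function MeasureTheory
open scoped Real ComplexConjugate

namespace PNTB
open ArithmeticFunction (vonMangoldt vonMangoldt_nonneg)

lemma F_bound (T d w a : ℝ) (hT : 50000 ≤ T) (hd : 0 < d) (ha : 0 < a) (hw : 0 ≤ w) (ha2 : a ≤ 1 / X T / 2) (N : ℕ) :
    ∑ n ∈ Finset.range N, vonMangoldt n / n * g d (Real.log n - w) ≤ 
      1 + (36.25 * X T ^ 2 / (√(2 * π) * d) * Real.exp (d ^ 2 * (0.9 / X T) ^ 2 / 2)) * Real.exp (-(0.9 / X T) * w)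
      + (Real.exp (a * w + d ^ 2 * (a ^ 2 + (0.9 / X T) ^ 2) / 2) * 
        (2 * (a + 0.9 / X T) * (36.25 * X T ^ 2) * Real.exp (-(d ^ 2 / 2) * (T / 4 - 1) ^ 2)
        + (2 / a) * (√(20 * π) / d) * Real.exp (-(9 / 20) * d ^ 2 * (T / 4 - 1) ^ 2))) / (2 * π) := by
  have hX := X_lower T hT
  have ha3 : a ≤ 1 / 40 := by
    refine ha2.trans ?_
    rw [div_div, div_le_div_iff₀ (by positivity) (by norm_num)]; linarith
  have h1 := F_upper d w a hd ha ha3 N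
  have h2 := contour T d w a hT hd ha hw ha2
  have h3 := h1.trans (add_le_add_right h2 (2 * π))
  have hpi : 0 < 2 * π := by positivity
  rw [mul_comm, ← le_div_iff₀ hpi] at h3
  refine h3.trans (le_of_eq ?_)
  have hs : √(2 * π) * √(2 * π) = 2 * π := Real.mul_self_sqrt (by positivity)
  have hs0 : 0 < √(2 * π) := by positivity
  rw [add_div, add_div, div_self hpi.ne', ← add_assoc]
  congr 2
  have e : √(2 * π) / d / (2 * π) = 1 / (√(2 * π) * d) := by
    rw [div_div, div_eq_div_iff (by positivity) (by positivity)]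
    linear_combination d * hs
  linear_combination (36.25 * X T ^ 2 * Real.exp (d ^ 2 * (0.9 / X T) ^ 2 / 2) * Real.exp (-(0.9 / X T) * w)) * e

lemma main_err (L : ℝ) (hL : 5000 ≤ L) : 
    36.25 * X (L * √L / 7) ^ 2 / (√(2 * π) * (3.5 / L)) * Real.exp ((3.5 / L) ^ 2 * (0.9 / X (L * √L / 7)) ^ 2 / 2) * 
      Real.exp (-(0.9 / X (L * √L / 7)) * L) / (1 - 0.9 / X (L * √L / 7)) ≤ 1.26 / L := by
  have hX := X_lower _ (T_ge L hL)
  have hXu := X_upper L hL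
  set x := X (L * √L / 7)
  set s := Real.log (L / 5000) with hs
  have hs0 : 0 ≤ s := Real.log_nonneg (by rw [le_div_iff₀ (by norm_num)]; linarith)
  have hLs : L = 5000 * Real.exp s := by rw [hs, Real.exp_log (by positivity)]; field_simp
  have h1 : x ^ 2 ≤ 25090.6 * Real.exp (0.2 * s) := by
    have : x ^ 2 ≤ (158.4 * Real.exp (s / 10)) ^ 2 := pow_le_pow_left₀ (by linarith) hXu 2
    rw [mul_pow, ← Real.exp_nat_mul, show ((2:ℕ):ℝ) * (s / 10) = 0.2 * s by push_cast; ring] at this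
    nlinarith [Real.exp_pos (0.2 * s)]
  have h2 : 28.409 + 25.5 * s ≤ (0.9 / x) * L := by
    have e1 : 0.9 / (158.4 * Real.exp (s / 10)) ≤ 0.9 / x := by gcongr
    have e2 : 28.409 * Real.exp (0.9 * s) ≤ 0.9 / (158.4 * Real.exp (s / 10)) * L := by
      rw [div_mul_eq_mul_div, le_div_iff₀ (by positivity), hLs]
      have : Real.exp s = Real.exp (0.9 * s) * Real.exp (s / 10) := by rw [← Real.exp_add]; congr 1; ring
      rw [this]
      have : 0 < Real.exp (0.9 * s) * Real.exp (s / 10) := by positivity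
      nlinarith
    have e3 := mul_le_mul_of_nonneg_right e1 (by linarith : 0 ≤ L)
    have e4 := Real.add_one_le_exp (0.9 * s)
    nlinarith
  have h3 : Real.exp (-(0.9 / x) * L) ≤ Real.exp (-28.409) * Real.exp (-25.5 * s) := by
    rw [← Real.exp_add]; apply Real.exp_le_exp.2; linarith
  have h4 : Real.exp (-28.409) ≤ 1 / 2170000000000 := by
    rw [Real.exp_neg, ← one_div]
    apply one_div_le_one_div_of_le (by norm_num)
    have := exp_ge_num 28 0.409 (by norm_num)
    norm_num at this ⊢; linarith
  have h5 : Real.exp ((3.5 / L) ^ 2 * (0.9 / x) ^ 2 / 2) ≤ 1.0001 := by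
    have e1 : 3.5 / L ≤ 0.001 := by rw [div_le_iff₀ (by linarith)]; linarith
    have e2 : 0.9 / x ≤ 0.01 := by rw [div_le_iff₀ (by linarith)]; linarith
    have e3 : (3.5 / L) ^ 2 * (0.9 / x) ^ 2 / 2 ≤ 0.00001 := by
      have : (3.5 / L) ^ 2 * (0.9 / x) ^ 2 / 2 ≤ 0.001 ^ 2 * 0.01 ^ 2 / 2 := by gcongr
      linarith
    have := exp_le_num 0 0.00001 (by norm_num) (by norm_num)
    refine (Real.exp_le_exp.2 e3).trans ?_
    norm_num at this ⊢; linarith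
  have h6 : 2.506 ≤ √(2 * π) := by
    apply Real.le_sqrt_of_sq_le; have := Real.pi_gt_d4; norm_num at this ⊢; linarith
  have h7 : 0.9942 ≤ 1 - 0.9 / x := by
    have : 0.9 / x ≤ 0.0058 := by rw [div_le_iff₀ (by linarith)]; linarith
    linarith
  have hL0 : 0 < L := by linarith
  have key : x ^ 2 * Real.exp (-(0.9 / x) * L) * L ^ 2 ≤ 0.2892 := by
    calc x ^ 2 * Real.exp (-(0.9 / x) * L) * L ^ 2 ≤ (25090.6 * Real.exp (0.2 * s)) * (1 / 2170000000000 * Real.exp (-25.5 * s)) * L ^ 2 := by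
          gcongr; exact h3.trans (by gcongr)
      _ = 25090.6 * 25000000 / 2170000000000 * (Real.exp (0.2 * s) * Real.exp (-25.5 * s) * Real.exp s ^ 2) := by rw [hLs]; ring
      _ ≤ 25090.6 * 25000000 / 2170000000000 * 1 := by
          gcongr
          rw [← Real.exp_nat_mul, ← Real.exp_add, ← Real.exp_add, Real.exp_le_one_iff]
          push_cast; linarith
      _ ≤ _ := by norm_num
  have hE := Real.exp_pos (-(0.9 / x) * L)
  have h8 : 36.25 * x ^ 2 / (√(2 * π) * (3.5 / L)) ≤ 4.134 * x ^ 2 * L := by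
    rw [div_le_iff₀ (by positivity)]
    have : 4.134 * x ^ 2 * L * (√(2 * π) * (3.5 / L)) = x ^ 2 * (14.469 * √(2 * π)) := by field_simp; ring
    rw [this]
    nlinarith [sq_nonneg x]
  rw [div_le_div_iff₀ (by linarith) hL0]
  calc 36.25 * x ^ 2 / (√(2 * π) * (3.5 / L)) * Real.exp ((3.5 / L) ^ 2 * (0.9 / x) ^ 2 / 2) * Real.exp (-(0.9 / x) * L) * L 
      ≤ (4.134 * x ^ 2 * L) * 1.0001 * Real.exp (-(0.9 / x) * L) * L := by gcongr
    _ = 4.134 * 1.0001 * (x ^ 2 * Real.exp (-(0.9 / x) * L) * L ^ 2) := by ring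
    _ ≤ 1.26 * (1 - 0.9 / x) := by nlinarith

set_option maxHeartbeats 1000000 in
lemma small_err (L w : ℝ) (hL : 5000 ≤ L) (hw : w ≤ L + 1) : 
    (Real.exp (1 / L * w + (3.5 / L) ^ 2 * ((1 / L) ^ 2 + (0.9 / X (L * √L / 7)) ^ 2) / 2) * 
        (2 * (1 / L + 0.9 / X (L * √L / 7)) * (36.25 * X (L * √L / 7) ^ 2) * Real.exp (-((3.5 / L) ^ 2 / 2) * (L * √L / 7 / 4 - 1) ^ 2)
        + (2 / (1 / L)) * (√(20 * π) / (3.5 / L)) * Real.exp (-(9 / 20) * (3.5 / L) ^ 2 * (L * √L / 7 / 4 - 1) ^ 2))) / (2 * π)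
     ≤ 0.02 / L := by
  have hX := X_lower _ (T_ge L hL)
  have hXu := X_upper L hL
  set x := X (L * √L / 7)
  set s := Real.log (L / 5000) with hs
  have hs0 : 0 ≤ s := Real.log_nonneg (by rw [le_div_iff₀ (by norm_num)]; linarith)
  have hLs : L = 5000 * Real.exp s := by rw [hs, Real.exp_log (by positivity)]; field_simp
  have hes := Real.add_one_le_exp s
  have hL0 : 0 < L := by linarith
  have h1 : x ^ 2 ≤ 25090.6 * Real.exp s ^ 2 := by
    have h0 : Real.exp (s / 10) ≤ Real.exp s := Real.exp_le_exp.2 (by linarith)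
    have : x ^ 2 ≤ (158.4 * Real.exp s) ^ 2 := pow_le_pow_left₀ (by linarith) (hXu.trans (by gcongr)) 2
    nlinarith [Real.exp_pos s]
  have hsq : √L ^ 2 = L := Real.sq_sqrt hL0.le
  have hq : (70.7:ℝ) ≤ √L := by apply Real.le_sqrt_of_sq_le; norm_num; linarith
  have h2 : L / 64 - 0.0125 ≤ (3.5 / L) ^ 2 * (L * √L / 7 / 4 - 1) ^ 2 := by
    have e : (3.5 / L) ^ 2 * (L * √L / 7 / 4 - 1) ^ 2 = (√L / 8 - 3.5 / L) ^ 2 := by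
      rw [← mul_pow]; congr 1; field_simp; ring
    rw [e, sub_sq, div_pow, hsq]
    have : 2 * (√L / 8) * (3.5 / L) ≤ 0.0125 := by
      have e : 2 * (√L / 8) * (3.5 / L) = 0.875 / √L := by
        rw [← hsq, Real.sqrt_sq (by positivity)]; field_simp; norm_num
      rw [e, div_le_iff₀ (by linarith)]; linarith
    nlinarith [sq_nonneg (3.5 / L)]
  set Q := (3.5 / L) ^ 2 * (L * √L / 7 / 4 - 1) ^ 2 with hQ
  have hE1 : Real.exp (-((3.5 / L) ^ 2 / 2) * (L * √L / 7 / 4 - 1) ^ 2) ≤ Real.exp (-(9 / 20) * Q) := by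
    apply Real.exp_le_exp.2
    have : 0 ≤ Q := by positivity
    have e : -((3.5 / L) ^ 2 / 2) * (L * √L / 7 / 4 - 1) ^ 2 = - Q / 2 := by rw [hQ]; ring
    rw [e]; linarith
  have hE2 : Real.exp (-(9 / 20) * (3.5 / L) ^ 2 * (L * √L / 7 / 4 - 1) ^ 2) = Real.exp (-(9 / 20) * Q) := by
    congr 1; rw [hQ]; ring
  have hE3 : Real.exp (-(9 / 20) * Q) ≤ Real.exp (-35) * Real.exp (-35 * s) := by
    rw [← Real.exp_add]; apply Real.exp_le_exp.2
    nlinarith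
  have hE4 : Real.exp (-35) ≤ 1 / 1500000000000000 := by
    rw [Real.exp_neg, ← one_div]
    apply one_div_le_one_div_of_le (by norm_num)
    have := exp_ge_num 35 0 (by norm_num)
    norm_num at this ⊢; linarith
  have hb : 0.9 / x ≤ 0.0058 := by rw [div_le_iff₀ (by linarith)]; linarith
  have ha : 1 / L ≤ 0.0002 := by rw [div_le_iff₀ (by linarith)]; linarith
  have hpre : Real.exp (1 / L * w + (3.5 / L) ^ 2 * ((1 / L) ^ 2 + (0.9 / x) ^ 2) / 2) ≤ 3 := by
    have e0 : 1 / L * w ≤ 1.0002 := by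
      calc 1 / L * w ≤ 1 / L * (L + 1) := by gcongr
        _ = 1 + 1 / L := by field_simp
        _ ≤ _ := by linarith
    have e1 : 3.5 / L ≤ 0.001 := by rw [div_le_iff₀ (by linarith)]; linarith
    have e3 : (3.5 / L) ^ 2 * ((1 / L) ^ 2 + (0.9 / x) ^ 2) / 2 ≤ 0.001 := by
      have : (3.5 / L) ^ 2 * ((1 / L) ^ 2 + (0.9 / x) ^ 2) / 2 ≤ 0.001 ^ 2 * (0.0002 ^ 2 + 0.0058 ^ 2) / 2 := by gcongr
      linarith
    have := exp_le_num 1 0.01 (by norm_num) (by norm_num)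
    have h : Real.exp (1 / L * w + (3.5 / L) ^ 2 * ((1 / L) ^ 2 + (0.9 / x) ^ 2) / 2) ≤ Real.exp ((1:ℕ) + 0.01) := 
      Real.exp_le_exp.2 (by push_cast; linarith)
    refine (h.trans this).trans ?_
    norm_num
  have h20 : √(20 * π) ≤ 8 := by
    rw [Real.sqrt_le_left (by norm_num)]; have := Real.pi_lt_d2; linarith
  rw [hE2]
  have hin : 2 * (1 / L + 0.9 / x) * (36.25 * x ^ 2) * Real.exp (-((3.5 / L) ^ 2 / 2) * (L * √L / 7 / 4 - 1) ^ 2)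
        + (2 / (1 / L)) * (√(20 * π) / (3.5 / L)) * Real.exp (-(9 / 20) * Q) ≤ 120000000 * Real.exp s ^ 2 * Real.exp (-(9 / 20) * Q) := by
    have t1 : 2 * (1 / L + 0.9 / x) * (36.25 * x ^ 2) * Real.exp (-((3.5 / L) ^ 2 / 2) * (L * √L / 7 / 4 - 1) ^ 2) ≤ 
        2 * (0.0002 + 0.0058) * (36.25 * (25090.6 * Real.exp s ^ 2)) * Real.exp (-(9 / 20) * Q) := by gcongr
    have t2 : (2 / (1 / L)) * (√(20 * π) / (3.5 / L)) ≤ 115000000 * Real.exp s ^ 2 := by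
      have : (2 / (1 / L)) * (√(20 * π) / (3.5 / L)) = √(20 * π) * L ^ 2 * (4 / 7) := by field_simp; norm_num
      rw [this, hLs]
      nlinarith [mul_le_mul_of_nonneg_right h20 (sq_nonneg (Real.exp s))]
    have t3 := mul_le_mul_of_nonneg_right t2 (Real.exp_pos (-(9 / 20) * Q)).le
    have : 0 ≤ Real.exp s ^ 2 * Real.exp (-(9 / 20) * Q) := by positivity
    calc _ ≤ 2 * (0.0002 + 0.0058) * (36.25 * (25090.6 * Real.exp s ^ 2)) * Real.exp (-(9 / 20) * Q) + 
          115000000 * Real.exp s ^ 2 * Real.exp (-(9 / 20) * Q) := add_le_add t1 t3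
      _ = (2 * (0.0002 + 0.0058) * (36.25 * 25090.6) + 115000000) * (Real.exp s ^ 2 * Real.exp (-(9 / 20) * Q)) := by ring
      _ ≤ 120000000 * (Real.exp s ^ 2 * Real.exp (-(9 / 20) * Q)) := by gcongr; norm_num
      _ = _ := by ring
  have hin2 : 120000000 * Real.exp s ^ 2 * Real.exp (-(9 / 20) * Q) ≤ 120000000 * Real.exp s ^ 2 * (1 / 1500000000000000 * Real.exp (-35 * s)) := by
    gcongr; exact hE3.trans (by gcongr)
  have hpi : 6 ≤ 2 * π := by have := Real.pi_gt_three; linarith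
  rw [div_le_iff₀ (by linarith)]
  have hk : L * (120000000 * Real.exp s ^ 2 * (1 / 1500000000000000 * Real.exp (-35 * s))) ≤ 0.001 := by
    have : L * (120000000 * Real.exp s ^ 2 * (1 / 1500000000000000 * Real.exp (-35 * s))) = 0.0004 * (Real.exp s ^ 3 * Real.exp (-35 * s)) := by
      rw [hLs]; ring
    rw [this, ← Real.exp_nat_mul, ← Real.exp_add]
    have : Real.exp (((3:ℕ):ℝ) * s + -35 * s) ≤ 1 := by rw [Real.exp_le_one_iff]; push_cast; linarith
    refine (mul_le_mul_of_nonneg_left this (by norm_num)).trans (by norm_num)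
  have hk2 : 120000000 * Real.exp s ^ 2 * (1 / 1500000000000000 * Real.exp (-35 * s)) ≤ 0.001 / L := by
    rw [le_div_iff₀ hL0]; linarith
  calc _ ≤ 3 * (0.001 / L) := mul_le_mul hpre ((hin.trans hin2).trans hk2) (by positivity) (by norm_num)
    _ ≤ 0.02 / L * 6 := by
      have : 0 < 1 / L := by positivity
      have e1 : 0.001 / L = 0.001 * (1 / L) := by ring
      have e2 : 0.02 / L = 0.02 * (1 / L) := by ring
      rw [e1, e2]; nlinarith
    _ ≤ _ := by gcongr

set_option maxHeartbeats 1000000 in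
/-- Explicit prime number theorem (upper bound) for huge arguments. -/
theorem psi_huge (x : ℝ) (hx : 0 < x) (hL : 5000 ≤ Real.log x) : 
    Chebyshev.psi x ≤ x * (1 + (17.33 + 2 * Real.log (Real.log x / 5000)) / Real.log x) := by
  set L := Real.log x with hLd
  have hL0 : 0 < L := by linarith
  have hx1 : 1 ≤ x := by
    rw [← Real.exp_log hx]; exact Real.one_le_exp (by linarith)
  have hT := T_ge L hL
  have hX := X_lower _ hT
  have hXu := X_upper L hL
  set s := Real.log (L / 5000) with hs
  have hs0 : 0 ≤ s := Real.log_nonneg (by rw [le_div_iff₀ (by norm_num)]; linarith)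
  have hLs : L = 5000 * Real.exp s := by rw [hs, Real.exp_log (by positivity)]; field_simp
  have hes := Real.add_one_le_exp s
  have hlL : Real.log L = Real.log 5000 + s := by
    rw [hs, Real.log_div (by linarith) (by norm_num)]; ring
  have hlL0 : 0 ≤ Real.log L := Real.log_nonneg (by linarith)
  set k := √(2 * Real.log L) with hk
  set P := 14.45 + 0.85 * s with hP
  have hkP : 3.5 * k ≤ P := by
    have : k ≤ P / 3.5 := by
      rw [hk, Real.sqrt_le_left (by positivity), div_pow, le_div_iff₀ (by norm_num), hlL, hP]
      have := log5000
      nlinarith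
    rw [le_div_iff₀ (by norm_num)] at this; linarith
  have hPL : P / L ≤ 0.0029 := by rw [div_le_iff₀ hL0, hLs, hP]; linarith
  set d := 3.5 / L with hd
  have hd0 : 0 < d := by positivity
  have hkd : k * d ≤ P / L := by
    rw [hd, mul_div_assoc']; gcongr; linarith
  have hP0 : 0 ≤ P / L := by positivity
  have hb0 : 0 < 0.9 / X (L * √L / 7) := by positivity
  have hb1 : 0.9 / X (L * √L / 7) ≤ 0.0058 := by rw [div_le_iff₀ (by linarith)]; linarith
  have hk2 : Real.exp (-k ^ 2 / 2) = 1 / L := by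
    rw [hk, Real.sq_sqrt (by linarith), show -(2 * Real.log L) / 2 = -Real.log L by ring, Real.exp_neg, Real.exp_log hL0, one_div]
  have ha2 : 1 / L ≤ 1 / X (L * √L / 7) / 2 := by
    rw [div_div]
    apply one_div_le_one_div_of_le (by linarith)
    have : Real.exp (s / 10) ≤ Real.exp s := Real.exp_le_exp.2 (by linarith)
    nlinarith
  have hmain := psi_smooth d (L + P / L) k (0.9 / X (L * √L / 7)) 
    (36.25 * X (L * √L / 7) ^ 2 / (√(2 * π) * d) * Real.exp (d ^ 2 * (0.9 / X (L * √L / 7)) ^ 2 / 2)) (0.02 / L) x hd0 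
    (Real.sqrt_nonneg _) hb0 (by linarith) (by positivity) (by positivity) hx1 (by linarith) 
    (by have := Real.log_two_gt_d9; linarith) ?_
  swap
  · intro w hw hw2
    refine (F_bound (L * √L / 7) d w (1 / L) hT hd0 (by positivity) hw ha2 _).trans ?_
    have := small_err L w hL (by linarith)
    rw [← hd] at this
    linarith
  have hme := main_err L hL
  have hme2 : 36.25 * X (L * √L / 7) ^ 2 / (√(2 * π) * d) * Real.exp (d ^ 2 * (0.9 / X (L * √L / 7)) ^ 2 / 2) * 
      Real.exp (-(0.9 / X (L * √L / 7)) * (L + P / L)) / (1 - 0.9 / X (L * √L / 7)) ≤ 1.26 / L := by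
    refine le_trans ?_ hme
    have : 0 < 1 - 0.9 / X (L * √L / 7) := by linarith
    have h2 : Real.exp (-(0.9 / X (L * √L / 7)) * (L + P / L)) ≤ Real.exp (-(0.9 / X (L * √L / 7)) * L) := by
      apply Real.exp_le_exp.2
      nlinarith [mul_nonneg hb0.le hP0]
    gcongr
  rw [hk2, Real.exp_add, hLd, Real.exp_log hx, ← hLd] at hmain
  have hexp : Real.exp (P / L) ≤ 1 + 1.003 * (P / L) := by
    have := Real.exp_bound' hP0 (by linarith) (n := 2) (by norm_num)
    simp only [Finset.sum_range_succ, Finset.sum_range_zero, Nat.factorial] at this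
    norm_num at this
    nlinarith
  have hfin : Real.exp (P / L) * (1 + 1.26 / L + 0.02 / L) ≤ (1 + (17.33 + 2 * s) / L) * (1 - 1 / L) := by
    have hi : 0 < 1 / L := by positivity
    have hi2 : 1 / L ≤ 0.0002 := by rw [div_le_iff₀ hL0]; linarith
    set i := 1 / L with hidef
    have e1 : 1.26 / L = 1.26 * i := by rw [hidef]; ring
    have e2 : 0.02 / L = 0.02 * i := by rw [hidef]; ring
    have e3 : P / L = P * i := by rw [hidef]; ring
    have e4 : (17.33 + 2 * s) / L = (17.33 + 2 * s) * i := by rw [hidef]; ring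
    have hPi : P * i ≤ 0.0029 := by rw [← e3]; exact hPL
    rw [e1, e2, e4]
    have h1 : Real.exp (P / L) * (1 + 1.26 * i + 0.02 * i) ≤ (1 + 1.003 * (P * i)) * (1 + 1.28 * i) := by
      rw [← e3]
      have : 1 + 1.26 * i + 0.02 * i = 1 + 1.28 * i := by ring
      rw [this]; gcongr
    refine h1.trans ?_
    have h3 : s * i ≤ 0.0035 := by rw [hP] at hPi; nlinarith
    have h4 : P * i * i ≤ 0.0029 * i := by gcongr
    have h5 : s * i * i ≤ 0.0035 * i := by gcongr
    have h6 : i * i ≤ 0.0002 * i := by gcongr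
    have h7 : P * i = 14.45 * i + 0.85 * (s * i) := by rw [hP]; ring
    have h8 : 0 ≤ s * i := by positivity
    nlinarith
  have hL1 : 0 < 1 - 1 / L := by
    have : 1 / L ≤ 0.0002 := by rw [div_le_iff₀ hL0]; linarith
    linarith
  refine le_of_mul_le_mul_right ?_ hL1
  refine hmain.trans ?_
  rw [mul_assoc x, mul_assoc x]
  refine mul_le_mul_of_nonneg_left ?_ hx.le
  refine le_trans ?_ hfin
  gcongr

end PNTB
end

section
namespace PNTA
set_option linter.unusedVariables false
def Dp : List Nat :=
  [1, 6, 10, 14, 15, 21, 22, 26, 33, 34, 35, 38, 39, 46, 51, 55, 57, 58, 62, 65, 69, 74, 77, 82,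
   85, 86, 87, 91, 93, 94, 95, 106, 111, 115, 118, 119, 122, 123, 129, 133, 134, 141, 142, 143,
   145, 146, 155, 158, 159, 161, 166, 177, 178, 183, 185, 187, 194, 201, 202, 203, 205, 206,
   209, 210, 213, 214, 215, 217, 218, 219, 221, 226, 235, 237, 247, 249, 253, 254, 259, 262,
   265, 267, 274, 278, 287, 291, 295, 298, 299, 301, 302, 303, 305, 309, 314, 319, 321, 323,
   326, 327, 329, 330, 334, 335, 339, 341, 346, 355, 358, 362, 365, 371, 377, 381, 382, 386,
   390, 391, 393, 394, 395, 398, 403, 407, 411, 413, 415, 417, 422, 427, 437, 445, 446, 447,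
   451, 453, 454, 458, 462, 466, 469, 471, 473, 478, 481, 482, 485, 489, 493, 497, 501, 502,
   505, 510, 511, 514, 515, 517, 519, 526, 527, 533, 535, 537, 538, 542, 543, 545, 546, 551,
   553, 554, 559, 562, 565, 566, 570, 573, 579, 581, 583, 586, 589, 591, 597, 611, 614, 622,
   623, 626, 629, 633, 634, 635, 649, 655, 662, 667, 669, 671, 674, 679, 681, 685, 687, 689,
   690, 694, 695, 697, 698, 699, 703, 706, 707, 713, 714, 717, 718, 721, 723, 731, 734, 737,
   745, 746, 749, 753, 755, 758, 763, 766, 767, 770, 771, 778, 779, 781, 785, 789, 791, 793,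
   794, 798, 799, 802, 803, 807, 813, 815, 817, 818, 831, 835, 838, 842, 843, 849, 851, 858,
   862, 865, 866, 869, 870, 871, 878, 879, 886, 889, 893, 895, 898, 899, 901, 905, 910, 913,
   914, 917, 921, 922, 923, 926, 930, 933, 934, 939, 943, 949, 951, 955, 958, 959, 965, 966,
   973, 974, 979, 982, 985, 989, 993, 995, 998, 1003, 1006, 1007, 1011, 1018, 1027, 1037, 1041,
   1042, 1043, 1046, 1047, 1055, 1057, 1059, 1067, 1073, 1077, 1079, 1081, 1082, 1094, 1099,
   1101, 1110, 1111, 1114, 1115, 1119, 1121, 1122, 1126, 1133, 1135, 1137, 1138, 1139, 1141,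
   1142, 1145, 1147, 1149, 1154, 1155, 1157, 1159, 1165, 1167, 1169, 1174, 1177, 1186, 1189,
   1190, 1191, 1195, 1198, 1199, 1202, 1203, 1205, 1207, 1211, 1214, 1218, 1219, 1226, 1227,
   1230, 1234, 1238, 1241, 1243, 1247, 1253, 1254, 1255, 1257, 1261, 1262, 1263, 1267, 1271,
   1273, 1282, 1285, 1286, 1290, 1293, 1294, 1299, 1302, 1306, 1313, 1315, 1317, 1318, 1322,
   1326, 1329, 1330, 1333, 1337, 1339, 1343, 1345, 1346, 1347, 1349, 1351, 1354, 1355, 1357,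
   1363, 1365, 1366, 1371, 1379, 1382, 1383, 1385, 1387, 1389, 1391, 1393, 1397, 1401, 1402,
   1403, 1405, 1410, 1411, 1415, 1417, 1418, 1430, 1437, 1438, 1441, 1454, 1457, 1461, 1465,
   1466, 1469, 1473, 1477, 1478, 1482, 1486, 1497, 1501, 1502, 1507, 1509, 1513, 1514, 1517,
   1518, 1522, 1527, 1529, 1535, 1537, 1538, 1541, 1546, 1554, 1555, 1561, 1567, 1591]
def Dm : List Nat :=
  [2, 3, 5, 7, 11, 13, 17, 19, 23, 29, 30, 31, 37, 41, 42, 43, 47, 53, 59, 61, 66, 67, 70, 71,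
   73, 78, 79, 83, 89, 97, 101, 102, 103, 105, 107, 109, 110, 113, 114, 127, 130, 131, 137, 138,
   139, 149, 151, 154, 157, 163, 165, 167, 170, 173, 174, 179, 181, 182, 186, 190, 191, 193,
   195, 197, 199, 211, 222, 223, 227, 229, 230, 231, 233, 238, 239, 241, 246, 251, 255, 257,
   258, 263, 266, 269, 271, 273, 277, 281, 282, 283, 285, 286, 290, 293, 307, 310, 311, 313,
   317, 318, 322, 331, 337, 345, 347, 349, 353, 354, 357, 359, 366, 367, 370, 373, 374, 379,
   383, 385, 389, 397, 399, 401, 402, 406, 409, 410, 418, 419, 421, 426, 429, 430, 431, 433,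
   434, 435, 438, 439, 442, 443, 449, 455, 457, 461, 463, 465, 467, 470, 474, 479, 483, 487,
   491, 494, 498, 499, 503, 506, 509, 518, 521, 523, 530, 534, 541, 547, 555, 557, 561, 563,
   569, 571, 574, 577, 582, 587, 590, 593, 595, 598, 599, 601, 602, 606, 607, 609, 610, 613,
   615, 617, 618, 619, 627, 631, 638, 641, 642, 643, 645, 646, 647, 651, 653, 654, 658, 659,
   661, 663, 665, 670, 673, 677, 678, 682, 683, 691, 701, 705, 709, 710, 715, 719, 727, 730,
   733, 739, 741, 742, 743, 751, 754, 757, 759, 761, 762, 769, 773, 777, 782, 786, 787, 790,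
   795, 797, 805, 806, 809, 811, 814, 821, 822, 823, 826, 827, 829, 830, 834, 839, 853, 854,
   857, 859, 861, 863, 874, 877, 881, 883, 885, 887, 890, 894, 897, 902, 903, 906, 907, 911,
   915, 919, 929, 935, 937, 938, 941, 942, 946, 947, 953, 957, 962, 967, 969, 970, 971, 977,
   978, 983, 986, 987, 991, 994, 997, 1001, 1002, 1005, 1009, 1010, 1013, 1015, 1019, 1021,
   1022, 1023, 1030, 1031, 1033, 1034, 1038, 1039, 1045, 1049, 1051, 1054, 1061, 1063, 1065,
   1066, 1069, 1070, 1074, 1085, 1086, 1087, 1090, 1091, 1093, 1095, 1097, 1102, 1103, 1105,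
   1106, 1109, 1113, 1117, 1118, 1123, 1129, 1130, 1131, 1146, 1151, 1153, 1158, 1162, 1163,
   1166, 1171, 1173, 1178, 1181, 1182, 1185, 1187, 1193, 1194, 1201, 1209, 1213, 1217, 1221,
   1222, 1223, 1229, 1231, 1235, 1237, 1239, 1245, 1246, 1249, 1258, 1259, 1265, 1266, 1270,
   1277, 1279, 1281, 1283, 1289, 1291, 1295, 1297, 1298, 1301, 1303, 1307, 1309, 1310, 1311,
   1319, 1321, 1327, 1334, 1335, 1338, 1342, 1353, 1358, 1361, 1362, 1367, 1370, 1373, 1374,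
   1378, 1381, 1390, 1394, 1398, 1399, 1406, 1407, 1409, 1414, 1419, 1423, 1426, 1427, 1429,
   1433, 1434, 1435, 1439, 1442, 1443, 1446, 1447, 1451, 1453, 1455, 1459, 1462, 1463, 1471,
   1474, 1479, 1481, 1483, 1487, 1489, 1490, 1491, 1493, 1495, 1498, 1499, 1505, 1506, 1510,
   1511, 1515, 1523, 1526, 1531, 1533, 1534, 1542, 1543, 1545, 1547, 1549, 1551, 1553, 1558,
   1559, 1861, 2091]
def geoS (s m : Nat) : Nat := Nat.rec (motive := fun _ => Nat) 0 (fun _ ih => Nat.add 1 (Nat.shiftLeft ih s)) m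
def geo (s m t : Nat) : Nat :=
  Nat.rec (motive := fun _ => Nat) (geoS s m)
    (fun k ih => Nat.add ih (Nat.shiftLeft ih (Nat.mul s (Nat.mul m (Nat.pow 2 k))))) t
def pat1 (s r c t : Nat) : Nat := Nat.shiftLeft (geo s (Nat.succ (Nat.shiftRight c t)) t) r
def pat (n0 n d : Nat) : Nat :=
  pat1 (Nat.mul 11 d) (Nat.mul 11 (Nat.mod (Nat.sub d (Nat.mod n0 d)) d)) (Nat.succ (Nat.div n d))
    (Nat.sub (Nat.log2 (Nat.succ (Nat.div n d))) 3)
noncomputable def acc (n0 n : Nat) (l : List Nat) : Nat :=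
  List.rec (motive := fun _ => Nat) 0 (fun d _ ih => Nat.add (pat n0 n d) ih) l
noncomputable def flo (y : Nat) (l : List Nat) : Nat :=
  List.rec (motive := fun _ => Nat) 0 (fun d _ ih => Nat.add (Nat.div y d) ih) l
def msk (n : Nat) : Nat := Nat.sub (Nat.pow 2 (Nat.mul 11 n)) 1
def nF : Nat := 131072
def mskF : Nat := msk nF
def onesF : Nat := geo 11 1 17
noncomputable def chF (n0 : Nat) : Nat :=
  Nat.land (Nat.mul (Nat.sub (Nat.add (Nat.add (Nat.sub (Nat.add (flo (Nat.sub n0 1) Dp) 64)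
    (flo (Nat.sub n0 1) Dm)) (acc n0 nF Dp)) (Nat.succ mskF)) (Nat.land (acc n0 nF Dm) mskF)) onesF) mskF
def absd2 (X Y D S : Nat) : Nat :=
  Nat.sub (Nat.add (Nat.mul 2 (Nat.land D (Nat.sub S (Nat.shiftRight S 7)))) Y) X
def absd1 (u X Y D : Nat) : Nat := absd2 X Y D (Nat.land D u)
def absd (u X Y : Nat) : Nat := absd1 u X Y (Nat.sub (Nat.add X u) Y)
def M1 : Nat := 4194303
def M2 : Nat := 17592177655809
def wS2 (rE rO : Nat) : Nat := Nat.add (Nat.mod rE M1) (Nat.mod rO M1)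
def wT2 (rE rO : Nat) : Nat :=
  Nat.add (Nat.mul 2 (Nat.add (Nat.div rE M1) (Nat.div rO M1))) (Nat.mod rO M1)
def wV2 (p rE rO rE' rO' : Nat) : Nat :=
  Nat.sub (Nat.add (Nat.add (Nat.mul (Nat.sub 400 p) (wS2 rE rO)) (Nat.mul (Nat.succ p) (wS2 rE' rO')))
    (wT2 rE' rO')) (wT2 rE rO)
def wR (me Z : Nat) : Nat := Nat.mod (Nat.land Z me) M2
def wV (p me Z0 Z1 : Nat) : Nat :=
  wV2 p (wR me Z0) (wR me (Nat.shiftRight Z0 11)) (wR me Z1) (wR me (Nat.shiftRight Z1 11))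
def blk3 (p u me X Y0 Y1 : Nat) : Nat := wV p me (absd u X Y0) (absd u X Y1)
def blk2 (a p u me ml G : Nat) : Nat :=
  blk3 p u me (Nat.land G ml) (Nat.land (Nat.shiftRight G (Nat.mul 11 a)) ml)
    (Nat.land (Nat.shiftRight G (Nat.mul 11 (Nat.succ a))) ml)
def blk1 (a p u me ml l F : Nat) : Nat :=
  blk2 a p u me ml (Nat.land F (msk (Nat.add (Nat.add l a) 1)))
def blk (u me ml l F n : Nat) : Nat :=
  Nat.succ (Nat.div (Nat.mul 1000000000000 (blk1 (Nat.div n 400) (Nat.mod n 400) u me ml l F)) (Nat.mul n n))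
def rows (u me ml l nb : Nat) : Nat → Nat → Nat :=
  Nat.rec (motive := fun _ => Nat → Nat → Nat) (fun _ _ => 0)
    (fun _ ih F n => Nat.add (blk u me ml l F n) (ih (Nat.shiftRight F (Nat.mul 11 l)) (Nat.add n l))) nb
noncomputable def chk (n0 l nb v : Nat) : Bool :=
  and (Nat.beq (Nat.land (chF n0) (Nat.mul 1920 onesF)) 0)
   (Nat.ble (rows (Nat.mul 128 (geoS 11 l)) (Nat.mul 2047 (geoS 22 (Nat.div l 2))) (msk l) l nb (chF n0) n0) v)

theorem geoS_eq (s m : ℕ) : geoS s m = ∑ k ∈ Finset.range m, (2^s)^k := by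
  induction m with
  | zero => rfl
  | succ m ih =>
    have : geoS s (m+1) = 1 + (geoS s m) <<< s := rfl
    rw [this, ih, Finset.sum_range_succ', Nat.shiftLeft_eq, Finset.sum_mul, add_comm]
    simp [pow_succ]

theorem geo_eq (s m t : ℕ) : geo s m t = ∑ k ∈ Finset.range (m*2^t), (2^s)^k := by
  induction t with
  | zero => 
    have : geo s m 0 = geoS s m := rfl
    rw [this, geoS_eq]; simp
  | succ t ih =>
    have : geo s m (t+1) = geo s m t + (geo s m t) <<< (s*(m*2^t)) := rfl
    rw [this, ih, Nat.shiftLeft_eq, pow_succ, show m*(2^t*2) = m*2^t + m*2^t by ring, Finset.sum_range_add,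
      Finset.sum_mul]
    congr 1
    refine Finset.sum_congr rfl fun k _ => ?_
    rw [pow_add, pow_mul 2 s (m*2^t), mul_comm]

/-- periodic 0-1 pattern sum -/
theorem per_sum (n0 d r : ℕ) (hd : 0 < d) (hr : r = (d - n0 % d) % d) (B C : ℕ) :
    ∑ i ∈ Finset.range (r + d*C), (if d ∣ n0 + i then 1 else 0) * B^i
      = B^r * ∑ k ∈ Finset.range C, (B^d)^k := by
  have hrd : r < d := hr ▸ Nat.mod_lt _ hd
  have hdr : d ∣ n0 + r := by
    have h1 : n0 % d < d := Nat.mod_lt _ hd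
    rw [Nat.dvd_iff_mod_eq_zero, hr, Nat.add_mod, Nat.mod_mod, ← Nat.add_mod]
    conv_lhs => rw [← Nat.div_add_mod n0 d]
    rw [show d * (n0 / d) + n0 % d + (d - (d * (n0 / d) + n0 % d) % d) = d*(n0/d+1) by
      rw [Nat.mul_add_mod, Nat.mod_mod, mul_add]; omega]
    simp
  induction C with
  | zero =>
    simp only [mul_zero, add_zero, Finset.range_zero, Finset.sum_empty]
    apply Finset.sum_eq_zero
    intro i hi
    rw [Finset.mem_range] at hi
    rw [if_neg, zero_mul]
    intro h
    have h2 : d ∣ r - i := by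
      have := Nat.dvd_sub hdr h
      rwa [Nat.add_sub_add_left] at this
    have := Nat.le_of_dvd (by omega) h2
    omega
  | succ C ih =>
    rw [mul_add, mul_one, ← add_assoc, Finset.sum_range_add, ih, Finset.sum_range_succ, mul_add]
    congr 1
    have hdr' : d ∣ n0 + (r + d*C) := by
      rw [← add_assoc]; exact dvd_add hdr (dvd_mul_right _ _)
    rw [Finset.sum_eq_single 0]
    · rw [if_pos (by simpa using hdr')]
      rw [add_zero, one_mul, pow_add, pow_mul]
    · intro b hb hb0
      rw [Finset.mem_range] at hb
      rw [if_neg, zero_mul]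
      intro h
      rw [← add_assoc] at h
      have h2 := (Nat.dvd_add_right hdr').1 h
      have := Nat.le_of_dvd (by omega) h2
      omega
    · intro h; exact absurd (Finset.mem_range.2 hd) h

theorem trunc_modEq (B n m : ℕ) (h : n ≤ m) (g : ℕ → ℕ) :
    ∑ i ∈ Finset.range m, g i * B^i ≡ ∑ i ∈ Finset.range n, g i * B^i [MOD B^n] := by
  obtain ⟨k, rfl⟩ := Nat.exists_eq_add_of_le h
  rw [Finset.sum_range_add]
  conv_rhs => rw [← add_zero (∑ i ∈ Finset.range n, g i * B^i)]
  apply Nat.ModEq.add_left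
  rw [Nat.modEq_zero_iff_dvd]
  apply Finset.dvd_sum
  intro i _
  rw [pow_add]
  exact Dvd.intro (g (n+i) * B^i) (by ring)

theorem pat_mod (n0 n d : ℕ) (hd : 0 < d) :
    pat n0 n d ≡ ∑ i ∈ Finset.range n, (if d ∣ n0 + i then 1 else 0) * (2^11)^i [MOD (2^11)^n] := by
  set r := (d - n0 % d) % d with hr
  set c := n/d + 1 with hc
  set t := Nat.log2 c - 3
  have h0 : pat n0 n d = (geo (11*d) ((c >>> t)+1) t) <<< (11*r) := rfl
  have h1 : pat n0 n d = ∑ i ∈ Finset.range (r + d*(((c >>> t)+1)*2^t)), (if d ∣ n0 + i then 1 else 0) * (2^11)^i := by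
    rw [per_sum n0 d r hd hr, h0, Nat.shiftLeft_eq, geo_eq, mul_comm, ← pow_mul 2 11 r, ← pow_mul 2 11 d]
  rw [h1]
  apply trunc_modEq
  have h2 : c ≤ ((c >>> t)+1)*2^t := by
    rw [Nat.shiftRight_eq_div_pow]
    have := Nat.lt_div_mul_add (a := c) (b := 2^t) (by positivity)
    nlinarith
  have h3 : n ≤ d * c := by
    have := Nat.lt_mul_div_succ n hd
    exact this.le
  calc n ≤ d*c := h3
    _ ≤ d*(((c >>> t)+1)*2^t) := Nat.mul_le_mul_left _ h2
    _ ≤ _ := Nat.le_add_left _ _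

def cnt (l : List ℕ) (n : ℕ) : ℕ := (l.map fun d => if d ∣ n then 1 else 0).sum

theorem acc_mod (n0 n : ℕ) (l : List ℕ) (hl : ∀ d ∈ l, 0 < d) :
    acc n0 n l ≡ ∑ i ∈ Finset.range n, cnt l (n0+i) * (2^11)^i [MOD (2^11)^n] := by
  induction l with
  | nil => 
    have : acc n0 n [] = 0 := rfl
    rw [this]; simp [cnt]; rfl
  | cons d l ih =>
    have h : acc n0 n (d::l) = pat n0 n d + acc n0 n l := rfl
    rw [h]
    have := (pat_mod n0 n d (hl d (by simp))).add (ih fun e he => hl e (by simp [he]))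
    refine this.trans ?_
    rw [← Finset.sum_add_distrib]
    refine congrArg (· % (2^11)^n) (Finset.sum_congr rfl fun i _ => ?_)
    simp only [cnt, List.map_cons, List.sum_cons, add_mul]

theorem flo_cons (y d : ℕ) (l : List ℕ) : flo y (d::l) = y/d + flo y l := rfl
theorem flo_nil (y : ℕ) : flo y [] = 0 := rfl
theorem flo_eq (y : ℕ) (l : List ℕ) : flo y l = (l.map fun d => y/d).sum := by
  induction l with
  | nil => rfl
  | cons d l ih => rw [flo_cons, ih]; simp

theorem flo_succ (y : ℕ) (l : List ℕ) : flo (y+1) l = flo y l + cnt l (y+1) := by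
  induction l with
  | nil => rfl
  | cons d l ih =>
    rw [flo_cons, flo_cons, ih, Nat.succ_div]
    simp only [cnt, List.map_cons, List.sum_cons]
    omega

noncomputable def ff (y : ℕ) : ℤ := (flo y Dp : ℤ) - flo y Dm
noncomputable def aa (y : ℕ) : ℤ := (cnt Dp y : ℤ) - cnt Dm y
theorem ff_succ (y : ℕ) : ff (y+1) = ff y + aa (y+1) := by
  simp only [ff, aa, flo_succ]; push_cast; ring

theorem cnt_le (l : List ℕ) (n : ℕ) : cnt l n ≤ l.length := by
  induction l with
  | nil => simp [cnt]
  | cons d l ih =>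
    simp only [cnt, List.map_cons, List.sum_cons, List.length_cons] at ih ⊢
    split_ifs <;> omega

theorem len_Dp : Dp.length = 477 := by decide +kernel
theorem len_Dm : Dm.length = 480 := by decide +kernel
theorem pos_Dp : ∀ d ∈ Dp, 0 < d := by decide +kernel
theorem pos_Dm : ∀ d ∈ Dm, 0 < d := by decide +kernel
theorem aa_abs (n : ℕ) : |aa n| ≤ 480 := by
  have h1 := cnt_le Dp n
  have h2 := cnt_le Dm n
  rw [len_Dp] at h1
  rw [len_Dm] at h2
  rw [abs_le, aa]; omega
end PNTA
end

section
namespace PNTA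
def pk (B : ℕ) (g : ℕ → ℕ) (n : ℕ) : ℕ := ∑ i ∈ Finset.range n, g i * B^i

theorem pk_succ' (B : ℕ) (g : ℕ → ℕ) (n : ℕ) : pk B g (n+1) = B * pk B (fun i => g (i+1)) n + g 0 := by
  rw [pk, Finset.sum_range_succ', pk, Finset.mul_sum]
  congr 1
  · exact Finset.sum_congr rfl fun i _ => by ring
  · simp

theorem pk_lt (B : ℕ) (g : ℕ → ℕ) (n : ℕ) (hg : ∀ i < n, g i < B) : pk B g n < B^n := by
  induction n generalizing g with
  | zero => simp [pk]
  | succ n ih =>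
    rw [pk_succ', pow_succ, mul_comm (B^n)]
    have h1 := ih (fun i => g (i+1)) (fun i hi => hg (i+1) (by omega))
    have h0 := hg 0 (by omega)
    nlinarith

theorem pk_congr {B : ℕ} {g h : ℕ → ℕ} {n : ℕ} (H : ∀ i < n, g i = h i) : pk B g n = pk B h n :=
  Finset.sum_congr rfl fun i hi => by rw [H i (Finset.mem_range.1 hi)]

theorem pk_digits (B : ℕ) (hB : 0 < B) (n F : ℕ) (hF : F < B^n) : F = pk B (fun i => F / B^i % B) n := by
  induction n generalizing F with
  | zero => simp [pk] at hF ⊢; exact hF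
  | succ n ih =>
    rw [pk_succ']
    have h := ih (F/B) (by rw [Nat.div_lt_iff_lt_mul hB]; rwa [pow_succ] at hF)
    have h2 : pk B (fun i => F / B^(i+1) % B) n = F/B := by
      conv_rhs => rw [h]
      refine pk_congr fun i _ => ?_
      rw [pow_succ', Nat.div_div_eq_div_mul]
    rw [h2]; simp [Nat.div_add_mod]

theorem pk_and (w : ℕ) (g h : ℕ → ℕ) (n : ℕ) (hg : ∀ i < n, g i < 2^w) (hh : ∀ i < n, h i < 2^w) :
    pk (2^w) g n &&& pk (2^w) h n = pk (2^w) (fun i => g i &&& h i) n := by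
  induction n generalizing g h with
  | zero => simp [pk]
  | succ n ih =>
    rw [pk_succ', pk_succ', pk_succ', ← ih (fun i => g (i+1)) (fun i => h (i+1)) (fun i hi => hg (i+1) (by omega)) (fun i hi => hh (i+1) (by omega))]
    apply Nat.eq_of_testBit_eq
    intro j
    have a0 := hg 0 (by omega)
    have b0 := hh 0 (by omega)
    rw [Nat.testBit_and, Nat.testBit_two_pow_mul_add _ a0, Nat.testBit_two_pow_mul_add _ b0,
      Nat.testBit_two_pow_mul_add _ (lt_of_le_of_lt Nat.and_le_left a0)]
    split_ifs <;> rw [Nat.testBit_and]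

theorem pk_add_len (B : ℕ) (g : ℕ → ℕ) (s n : ℕ) : pk B g (s+n) = pk B g s + B^s * pk B (fun i => g (s+i)) n := by
  simp only [pk, Finset.sum_range_add, Finset.mul_sum]
  congr 1
  exact Finset.sum_congr rfl fun i _ => by ring

theorem pk_mod (B : ℕ) (g : ℕ → ℕ) (s n : ℕ) (hg : ∀ i < s, g i < B) : pk B g (s+n) % B^s = pk B g s := by
  rw [pk_add_len, Nat.add_mul_mod_self_left, Nat.mod_eq_of_lt (pk_lt B g s hg)]

theorem pk_div (B : ℕ) (hB : 0 < B) (g : ℕ → ℕ) (s n : ℕ) (hg : ∀ i < s, g i < B) :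
    pk B g (s+n) / B^s = pk B (fun i => g (s+i)) n := by
  rw [pk_add_len, Nat.add_mul_div_left _ _ (by positivity), Nat.div_eq_of_lt (pk_lt B g s hg), zero_add]

theorem pk_zero_iff (B : ℕ) (hB : 0 < B) (g : ℕ → ℕ) (n : ℕ) (h : pk B g n = 0) : ∀ i < n, g i = 0 := by
  intro i hi
  have := (Finset.sum_eq_zero_iff.1 h) i (Finset.mem_range.2 hi)
  rcases mul_eq_zero.1 this with h | h
  · exact h
  · exact absurd h (by positivity)

theorem land_msk (F n : ℕ) : Nat.land F (msk n) = F % (2^11)^n := by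
  have : Nat.land F (msk n) = F &&& (2^(11*n) - 1) := rfl
  rw [this, Nat.and_two_pow_sub_one_eq_mod, pow_mul]

theorem onesF_eq : onesF = pk (2^11) (fun _ => 1) nF := by
  have : onesF = geo 11 1 17 := rfl
  rw [this, geo_eq, pk, nF]; simp

/-- partial sums -/
theorem prefix_tel (B : ℤ) (a s : ℕ → ℤ) (hs : ∀ k, s (k+1) = s k + a (k+1)) (n : ℕ) :
    (1-B) * ∑ k ∈ Finset.range (n+1), s k * B^k
      = (s 0 - a 0) + ∑ k ∈ Finset.range (n+1), a k * B^k - s n * B^(n+1) := by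
  induction n with
  | zero => simp; ring
  | succ n ih =>
    rw [Finset.sum_range_succ, mul_add, ih, Finset.sum_range_succ _ (n+1), hs]; ring

theorem prefix_mod (B : ℤ) (a s : ℕ → ℤ) (hs : ∀ k, s (k+1) = s k + a (k+1)) (n : ℕ) :
    ((s 0 - a 0) + ∑ k ∈ Finset.range (n+1), a k * B^k) * ∑ k ∈ Finset.range (n+1), B^k
      ≡ ∑ k ∈ Finset.range (n+1), s k * B^k [ZMOD B^(n+1)] := by
  have h1 := prefix_tel B a s hs n
  have h2 : (∑ k ∈ Finset.range (n+1), B^k) * (B-1) = B^(n+1) - 1 := geom_sum_mul B (n+1)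
  apply Int.ModEq.symm
  rw [Int.modEq_iff_dvd]
  set O := ∑ k ∈ Finset.range (n+1), B^k
  set S := ∑ k ∈ Finset.range (n+1), s k * B^k
  have h3 : (s 0 - a 0) + ∑ k ∈ Finset.range (n+1), a k * B^k = (1-B)*S + s n * B^(n+1) := by rw [h1]; ring
  rw [h3]
  refine ⟨s n * O - S, ?_⟩
  linear_combination (-S) * h2

theorem digits_unique (n : ℕ) (g : ℕ → ℕ) (s : ℕ → ℤ) (hg : ∀ i < n, g i < 128)
    (hs0 : 0 ≤ s 0 + 480 ∧ s 0 < 128 + 480) (hs : ∀ i, |s (i+1) - s i| ≤ 480)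
    (H : (∑ k ∈ Finset.range n, (g k:ℤ) * (2048:ℤ)^k) ≡ ∑ k ∈ Finset.range n, s k * (2048:ℤ)^k [ZMOD 2048^n]) :
    ∀ i < n, s i = g i := by
  intro i
  induction i using Nat.strong_induction_on with
  | _ i ih =>
  intro hi
  have hb : -480 ≤ s i ∧ s i < 128 + 480 := by
    rcases Nat.eq_zero_or_pos i with h | h
    · subst h; constructor <;> linarith [hs0.1, hs0.2]
    · obtain ⟨j, rfl⟩ : ∃ j, i = j+1 := ⟨i-1, by omega⟩
      have h1 := ih j (by omega) (by omega)
      have h2 := abs_le.1 (hs j)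
      have h3 := hg j (by omega)
      constructor <;> [skip; skip] <;> rw [h1] at h2 <;> omega
  obtain ⟨m, rfl⟩ : ∃ m, n = i + (m+1) := ⟨n - i - 1, by omega⟩
  rw [Finset.sum_range_add _ i (m+1), Finset.sum_range_add _ i (m+1)] at H
  have e : ∑ k ∈ Finset.range i, (g k:ℤ) * (2048:ℤ)^k = ∑ k ∈ Finset.range i, s k * (2048:ℤ)^k :=
    Finset.sum_congr rfl fun k hk => by
      have := Finset.mem_range.1 hk
      rw [ih k this (by omega)]
  rw [e] at H
  have H2 := Int.ModEq.add_left_cancel' _ H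
  have e2 : ∀ u : ℕ → ℤ, ∑ x ∈ Finset.range (m+1), u (i+x) * (2048:ℤ)^(i+x)
      = 2048^i * ∑ x ∈ Finset.range (m+1), u (i+x) * 2048^x := by
    intro u; rw [Finset.mul_sum]; exact Finset.sum_congr rfl fun x _ => by ring
  rw [e2 (fun k => (g k:ℤ)), e2 s, pow_add] at H2
  have H3 := Int.ModEq.mul_left_cancel' (by positivity) H2
  have H4 := H3.of_dvd (dvd_pow_self (2048:ℤ) (by omega : m+1 ≠ 0))
  rw [Finset.sum_range_succ', Finset.sum_range_succ'] at H4
  have e3 : ∀ u : ℕ → ℤ, ∑ k ∈ Finset.range m, u (i+(k+1)) * (2048:ℤ)^(k+1) + u (i+0)*2048^0 ≡ u i [ZMOD 2048] := by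
    intro u
    rw [Int.modEq_iff_dvd]
    have : (2048:ℤ) ∣ ∑ k ∈ Finset.range m, u (i+(k+1)) * (2048:ℤ)^(k+1) :=
      Finset.dvd_sum fun k _ => Dvd.intro (u (i+(k+1)) * 2048^k) (by ring)
    simpa using this
  have H5 : (g i : ℤ) ≡ s i [ZMOD 2048] := ((e3 (fun k => (g k:ℤ))).symm.trans H4).trans (e3 s)
  have h3 := hg i (by omega)
  rw [Int.modEq_iff_dvd] at H5
  omega

theorem succ_msk (n : ℕ) : Nat.succ (msk n) = (2^11)^n := by
  have : Nat.succ (msk n) = 2^(11*n) - 1 + 1 := rfl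
  rw [this, Nat.sub_add_cancel Nat.one_le_two_pow, pow_mul]

theorem chF_gen (a b P Q n o : ℕ) :
    Nat.land (Nat.mul (Nat.sub (Nat.add (Nat.add (Nat.sub (Nat.add a 64) b) P) (Nat.succ (msk n)))
      (Nat.land Q (msk n))) o) (msk n) = ((a + 64 - b + P + (2^11)^n - Q % (2^11)^n) * o) % (2^11)^n := by
  rw [land_msk, land_msk, succ_msk]; rfl

theorem chF_eq (n0 : ℕ) : chF n0 = ((flo (n0-1) Dp + 64 - flo (n0-1) Dm + acc n0 nF Dp + (2^11)^nF
    - acc n0 nF Dm % (2^11)^nF) * onesF) % (2^11)^nF := by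
  unfold chF mskF
  exact chF_gen _ _ _ _ nF onesF

theorem dig_small : ∀ x < 2048, x &&& 1920 = 0 → x < 128 := by decide +kernel

theorem chF_spec_gen (n0 nF chF onesF : ℕ) (hnF : 0 < nF) (hn0 : 0 < n0) (hf : |ff (n0-1)| ≤ 63)
    (onesF_eq : onesF = pk (2^11) (fun _ => 1) nF)
    (chF_eq : chF = ((flo (n0-1) Dp + 64 - flo (n0-1) Dm + acc n0 nF Dp + (2^11)^nF
      - acc n0 nF Dm % (2^11)^nF) * onesF) % (2^11)^nF)
    (hm : Nat.land chF (Nat.mul 1920 onesF) = 0) :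
    ∃ g : ℕ → ℕ, chF = pk (2^11) g nF ∧ (∀ i < nF, g i < 128) ∧ ∀ i < nF, ff (n0+i) + 64 = g i := by
  have hlt : chF < (2^11)^nF := by
    rw [chF_eq]; exact Nat.mod_lt _ (by positivity)
  set g : ℕ → ℕ := fun i => chF / (2^11)^i % 2^11 with hg
  have hF : chF = pk (2^11) g nF := pk_digits _ (by norm_num) _ _ hlt
  have hg1 : ∀ i, g i < 2^11 := fun i => Nat.mod_lt _ (by norm_num)
  have hg2 : ∀ i < nF, g i < 128 := by
    have e : Nat.mul 1920 onesF = pk (2^11) (fun _ => 1920) nF := by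
      rw [onesF_eq, Nat.mul_eq, pk, pk, Finset.mul_sum]; exact Finset.sum_congr rfl fun _ _ => by ring
    have h2 : chF &&& pk (2^11) (fun _ => 1920) nF = 0 := by rw [← e]; exact hm
    rw [hF, pk_and 11 _ _ _ (fun i _ => hg1 i) (fun i _ => by norm_num)] at h2
    intro i hi
    exact dig_small _ (hg1 i) (pk_zero_iff _ (by norm_num) _ _ h2 i hi)
  refine ⟨g, hF, hg2, ?_⟩
  have key := digits_unique nF g (fun i => ff (n0+i) + 64) hg2
  have hst : ff n0 = ff (n0-1) + aa n0 := by
    have := ff_succ (n0-1); rwa [Nat.sub_add_cancel hn0] at this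
  have ha := abs_le.1 (aa_abs n0)
  have hf' := abs_le.1 hf
  refine key ?_ ?_ ?_
  · simp only [add_zero]; rw [hst]; constructor <;> linarith [ha.1, ha.2, hf'.1, hf'.2]
  · intro i
    have h := ff_succ (n0+i)
    have h2 := aa_abs (n0+i+1)
    rw [show n0+(i+1) = n0+i+1 by ring, h]
    rwa [show ff (n0+i) + aa (n0+i+1) + 64 - (ff (n0+i)+64) = aa (n0+i+1) by ring]
  · -- congruence
    obtain ⟨N, hN⟩ : ∃ N, nF = N+1 := ⟨nF-1, by omega⟩
    have hp := prefix_mod 2048 (fun i => aa (n0+i)) (fun i => ff (n0+i)+64)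
      (fun k => by show ff (n0+(k+1)) + 64 = _; rw [show n0+(k+1) = n0+k+1 by ring, ff_succ]; ring) N
    rw [← hN] at hp
    refine Int.ModEq.trans ?_ hp
    have e1 : (∑ k ∈ Finset.range nF, (g k:ℤ) * 2048^k) = (chF : ℤ) := by
      rw [hF, pk]; push_cast; norm_num
    rw [e1, chF_eq]
    clear e1 hF
    set P := acc n0 nF Dp with hP
    set Q := acc n0 nF Dm with hQ
    have hPm := acc_mod n0 nF Dp pos_Dp
    have hQm := acc_mod n0 nF Dm pos_Dm
    rw [← hP] at hPm
    rw [← hQ] at hQm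
    set a : ℕ := flo (n0-1) Dp with ha'
    set b : ℕ := flo (n0-1) Dm with hb'
    have hab : ff (n0-1) = (a:ℤ) - b := rfl
    set T : ℕ := (2^11)^nF with hT
    have hQT : Q % T < T := Nat.mod_lt _ (by positivity)
    have hval : (((a + 64 - b + P + T - (Q % T)) * onesF : ℕ) : ℤ)
        = ((a:ℤ) + 64 - b + P + T - ((Q % T : ℕ):ℤ)) * onesF := by
      have h1 : b ≤ a + 64 := by omega
      rw [Nat.cast_mul, Nat.cast_sub (by omega), Nat.cast_add, Nat.cast_add, Nat.cast_sub h1]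
      push_cast
      rfl
    rw [Int.natCast_mod]
    have hTT : (T:ℤ) = 2048^nF := by rw [hT]; push_cast; norm_num
    rw [hval, ← hTT]
    refine (Int.mod_modEq _ _).trans ?_
    have ho : (onesF : ℤ) = ∑ k ∈ Finset.range nF, (2048:ℤ)^k := by
      rw [onesF_eq, pk]; push_cast; norm_num
    rw [ho]
    refine Int.ModEq.mul_right _ ?_
    have h2048 : (2:ℤ)^11 = 2048 := by norm_num
    have hP' : (P:ℤ) ≡ ∑ k ∈ Finset.range nF, (cnt Dp (n0+k) : ℤ) * 2048^k [ZMOD T] := by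
      have := Int.natCast_modEq_iff.2 hPm
      simp only [Nat.cast_sum, Nat.cast_mul, Nat.cast_pow, Nat.cast_ofNat, h2048] at this
      rw [hTT]; exact this
    have hQ' : (Q:ℤ) ≡ ∑ k ∈ Finset.range nF, (cnt Dm (n0+k) : ℤ) * 2048^k [ZMOD T] := by
      have := Int.natCast_modEq_iff.2 hQm
      simp only [Nat.cast_sum, Nat.cast_mul, Nat.cast_pow, Nat.cast_ofNat, h2048] at this
      rw [hTT]; exact this
    have hQ2 : ((Q % T : ℕ):ℤ) ≡ Q [ZMOD T] := by rw [Int.natCast_mod]; exact Int.mod_modEq _ _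
    have hT0 : (T:ℤ) ≡ 0 [ZMOD T] := Int.modEq_zero_iff_dvd.2 dvd_rfl
    have hc : (a:ℤ) + 64 - b ≡ (ff (n0+0) + 64 - aa (n0+0)) [ZMOD T] := by
      rw [add_zero, hst, hab]; ring_nf; rfl
    have := ((hc.add hP').add hT0).sub (hQ2.trans hQ')
    refine this.trans ?_
    refine congrArg (· % (T:ℤ)) ?_
    simp only [aa, sub_mul, Finset.sum_sub_distrib]
    ring

theorem chF_spec (n0 : ℕ) (hn0 : 0 < n0) (hf : |ff (n0-1)| ≤ 63) (hm : Nat.land (chF n0) (Nat.mul 1920 onesF) = 0) :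
    ∃ g : ℕ → ℕ, chF n0 = pk (2^11) g nF ∧ (∀ i < nF, g i < 128) ∧ ∀ i < nF, ff (n0+i) + 64 = g i :=
  chF_spec_gen n0 nF (chF n0) onesF (by decide) hn0 hf onesF_eq (chF_eq n0) hm
end PNTA
end

section
namespace PNTA
theorem pk_add (B : ℕ) (g h : ℕ → ℕ) (n : ℕ) : pk B g n + pk B h n = pk B (fun i => g i + h i) n := by
  simp only [pk, ← Finset.sum_add_distrib, add_mul]
theorem pk_smul (B c : ℕ) (g : ℕ → ℕ) (n : ℕ) : c * pk B g n = pk B (fun i => c * g i) n := by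
  simp only [pk, Finset.mul_sum, mul_assoc]
theorem pk_sub (B : ℕ) (g h : ℕ → ℕ) (n : ℕ) (H : ∀ i < n, h i ≤ g i) :
    pk B g n - pk B h n = pk B (fun i => g i - h i) n := by
  rw [Nat.sub_eq_iff_eq_add, pk_add]
  · exact pk_congr fun i hi => by have := H i hi; omega
  · exact Finset.sum_le_sum fun i hi => Nat.mul_le_mul_right _ (H i (Finset.mem_range.1 hi))
theorem geoS_pk (s n : ℕ) : geoS s n = pk (2^s) (fun _ => 1) n := by
  rw [geoS_eq, pk]; simp

theorem and128 : ∀ D < 256, D &&& 128 = if D < 128 then 0 else 128 := by decide +kernel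
theorem and127 : ∀ D < 256, D &&& 127 = D % 128 := by decide +kernel
theorem and2047 (x : ℕ) : x &&& 2047 = x % 2048 := by
  have := Nat.and_two_pow_sub_one_eq_mod x 11
  norm_num at this; exact this

theorem absd_spec (x y : ℕ → ℕ) (l : ℕ) (hx : ∀ i < l, x i < 128) (hy : ∀ i < l, y i < 128) :
    absd (Nat.mul 128 (geoS 11 l)) (pk (2^11) x l) (pk (2^11) y l)
      = pk (2^11) (fun i => (x i - y i) + (y i - x i)) l := by
  have hu : Nat.mul 128 (geoS 11 l) = pk (2^11) (fun _ => 128) l := by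
    rw [Nat.mul_eq, geoS_pk, pk_smul]
  rw [hu]
  have h0 : absd (pk (2^11) (fun _ => 128) l) (pk (2^11) x l) (pk (2^11) y l)
      = 2 * ((pk (2^11) x l + pk (2^11) (fun _ => 128) l - pk (2^11) y l) &&&
        (((pk (2^11) x l + pk (2^11) (fun _ => 128) l - pk (2^11) y l) &&& pk (2^11) (fun _ => 128) l)
         - ((pk (2^11) x l + pk (2^11) (fun _ => 128) l - pk (2^11) y l) &&& pk (2^11) (fun _ => 128) l) >>> 7))
        + pk (2^11) y l - pk (2^11) x l := rfl
  rw [h0, pk_add, pk_sub _ _ _ _ (fun i hi => by have := hy i hi; omega)]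
  have hD : ∀ i < l, x i + 128 - y i < 256 := fun i hi => by have := hx i hi; omega
  rw [pk_and 11 _ _ _ (fun i hi => by have := hD i hi; norm_num; omega) (fun i hi => by norm_num)]
  have hS : pk (2^11) (fun i => (x i + 128 - y i) &&& 128) l
      = 128 * pk (2^11) (fun i => if x i + 128 - y i < 128 then 0 else 1) l := by
    rw [pk_smul]
    refine pk_congr fun i hi => ?_
    rw [and128 _ (hD i hi)]; split_ifs <;> rfl
  rw [hS, Nat.shiftRight_eq_div_pow, show (2:ℕ)^7 = 128 by norm_num, Nat.mul_div_cancel_left _ (by norm_num),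
    pk_smul, pk_sub _ _ _ _ (fun i hi => by split_ifs <;> norm_num),
    pk_and 11 _ _ _ (fun i hi => by have := hD i hi; norm_num; omega) (fun i hi => by split_ifs <;> norm_num),
    pk_smul, pk_add, pk_sub]
  · refine pk_congr fun i hi => ?_
    have h1 := hx i hi
    have h2 := hy i hi
    by_cases h : x i + 128 - y i < 128
    · rw [if_pos h]; simp; omega
    · rw [if_neg h, show 128*1-1 = 127 by norm_num, and127 _ (hD i hi)]; omega
  · intro i hi
    have h1 := hx i hi
    have h2 := hy i hi
    by_cases h : x i + 128 - y i < 128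
    · rw [if_pos h]; simp; omega
    · rw [if_neg h, show 128*1-1 = 127 by norm_num, and127 _ (hD i hi)]; omega

theorem pk_pair_gen (B C : ℕ) (hC : C = B^2) (z : ℕ → ℕ) (h : ℕ) :
    pk B z (2*h) = pk C (fun i => z (2*i) + B * z (2*i+1)) h := by
  subst hC
  induction h with
  | zero => simp [pk]
  | succ h ih =>
    rw [pk, mul_add, show 2*h + 2*1 = 2*h+1+1 by ring, Finset.sum_range_succ, Finset.sum_range_succ, ← pk, ih]
    conv_rhs => rw [pk, Finset.sum_range_succ, ← pk]
    rw [← pow_mul]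
    ring

theorem pk_pair (z : ℕ → ℕ) (h : ℕ) : pk (2^11) z (2*h) = pk (2^22) (fun i => z (2*i) + 2048 * z (2*i+1)) h :=
  pk_pair_gen (2^11) (2^22) (by norm_num) z h

theorem land_me (z : ℕ → ℕ) (h : ℕ) (hz : ∀ i < 2*h, z i < 2^11) :
    Nat.land (pk (2^11) z (2*h)) (Nat.mul 2047 (geoS 22 h)) = pk (2^22) (fun i => z (2*i)) h := by
  show pk (2^11) z (2*h) &&& (2047 * (geoS 22 h)) = _
  rw [geoS_pk, pk_smul, pk_pair, pk_and 22]
  · refine pk_congr fun i hi => ?_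
    rw [mul_one, and2047, Nat.add_mul_mod_self_left, Nat.mod_eq_of_lt]
    simpa using hz (2*i) (by omega)
  · intro i hi
    have h1 := hz (2*i) (by omega)
    have h2 := hz (2*i+1) (by omega)
    norm_num at h1 h2 ⊢; omega
  · intro i hi; norm_num

theorem pk_wmod (e : ℕ → ℕ) (h : ℕ) : pk (2^22) e h ≡
    (∑ i ∈ Finset.range h, e i) + M1 * ∑ i ∈ Finset.range h, i * e i [MOD M2] := by
  have hB : ∀ i, (2^22)^i ≡ 1 + M1 * i [MOD M2] := by
    intro i
    induction i with
    | zero => rfl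
    | succ i ih =>
      rw [pow_succ]
      refine (ih.mul_right _).trans ?_
      have : (1 + M1*i) * 2^22 = (1+M1*(i+1)) + M2 * i := by
        simp only [M1, M2]; ring
      rw [this]
      simp [Nat.ModEq]
  rw [pk, Finset.mul_sum, ← Finset.sum_add_distrib]
  induction h with
  | zero => rfl
  | succ h ih =>
    rw [Finset.sum_range_succ, Finset.sum_range_succ]
    refine ih.add (((hB h).mul_left (e h)).trans ?_)
    rw [show e h * (1 + M1*h) = e h + M1 * (h * e h) by ring]

theorem wR_spec (e : ℕ → ℕ) (h : ℕ) (hh : h ≤ 200) (he : ∀ i < h, e i < 128) :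
    pk (2^22) e h % M2 % M1 = ∑ i ∈ Finset.range h, e i ∧
    pk (2^22) e h % M2 / M1 = ∑ i ∈ Finset.range h, i * e i := by
  have hs : ∑ i ∈ Finset.range h, e i ≤ 200 * 127 := by
    calc _ ≤ ∑ i ∈ Finset.range h, 127 := Finset.sum_le_sum fun i hi => by
            have := he i (Finset.mem_range.1 hi); omega
      _ ≤ _ := by simp; omega
  have ht : ∑ i ∈ Finset.range h, i * e i ≤ 19900 * 127 := by
    calc _ ≤ ∑ i ∈ Finset.range h, i * 127 := Finset.sum_le_sum fun i hi => by
            have := he i (Finset.mem_range.1 hi)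
            exact Nat.mul_le_mul_left _ (by omega)
      _ ≤ ∑ i ∈ Finset.range 200, i * 127 := Finset.sum_le_sum_of_subset (by simpa using hh)
      _ = _ := by decide +kernel
  have h1 := pk_wmod e h
  have h2 : pk (2^22) e h % M2 = (∑ i ∈ Finset.range h, e i) + M1 * ∑ i ∈ Finset.range h, i * e i := by
    rw [h1]
    apply Nat.mod_eq_of_lt
    simp only [M1, M2]; omega
  rw [h2]
  simp only [M1]
  constructor <;> omega

theorem sum_pair (z : ℕ → ℕ) (h : ℕ) : ∑ i ∈ Finset.range (2*h), z i
    = ∑ i ∈ Finset.range h, z (2*i) + ∑ i ∈ Finset.range h, z (2*i+1) := by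
  induction h with
  | zero => rfl
  | succ h ih =>
    rw [show 2*(h+1) = 2*h+1+1 by ring, Finset.sum_range_succ, Finset.sum_range_succ, ih,
      Finset.sum_range_succ, Finset.sum_range_succ]; ring

theorem wST (z : ℕ → ℕ) (h : ℕ) (hh : h ≤ 200) (hz : ∀ i < 2*h, z i < 128) :
    wS2 (wR (Nat.mul 2047 (geoS 22 h)) (pk (2^11) z (2*h))) (wR (Nat.mul 2047 (geoS 22 h)) (Nat.shiftRight (pk (2^11) z (2*h)) 11))
      = ∑ i ∈ Finset.range (2*h), z i ∧
    wT2 (wR (Nat.mul 2047 (geoS 22 h)) (pk (2^11) z (2*h))) (wR (Nat.mul 2047 (geoS 22 h)) (Nat.shiftRight (pk (2^11) z (2*h)) 11))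
      = ∑ i ∈ Finset.range (2*h), i * z i := by
  have hsh : Nat.shiftRight (pk (2^11) z (2*h)) 11 = pk (2^11) (fun i => if i + 1 < 2*h then z (i+1) else 0) (2*h) := by
    show pk (2^11) z (2*h) >>> 11 = _
    rw [Nat.shiftRight_eq_div_pow]
    rcases Nat.eq_zero_or_pos h with rfl | hp
    · simp [pk]
    · obtain ⟨k, hk⟩ : ∃ k, 2*h = 1+k := ⟨2*h-1, by omega⟩
      rw [hk]
      have := pk_div (2^11) (by norm_num) z 1 k (fun i hi => by have := hz i (by omega); norm_num; omega)
      rw [pow_one] at this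
      rw [this, add_comm 1 k, pk, pk, Finset.sum_range_succ]
      rw [if_neg (by omega), zero_mul, add_zero]
      refine Finset.sum_congr rfl fun i hi => ?_
      rw [if_pos (by have := Finset.mem_range.1 hi; omega), add_comm 1 i]
  rw [hsh]
  have e1 : ∀ Z, wR (Nat.mul 2047 (geoS 22 h)) Z = (Nat.land Z (Nat.mul 2047 (geoS 22 h))) % M2 := fun _ => rfl
  rw [e1, e1, land_me _ _ (fun i hi => by have := hz i hi; norm_num; omega), land_me _ _ (fun i hi => by
    split_ifs with hc
    · have := hz _ hc; norm_num; omega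
    · norm_num)]
  have e2 : pk (2^22) (fun i => if 2*i + 1 < 2*h then z (2*i+1) else 0) h = pk (2^22) (fun i => z (2*i+1)) h :=
    pk_congr fun i hi => by rw [if_pos (by omega)]
  rw [e2]
  obtain ⟨a1, a2⟩ := wR_spec (fun i => z (2*i)) h hh (fun i hi => hz _ (by omega))
  obtain ⟨b1, b2⟩ := wR_spec (fun i => z (2*i+1)) h hh (fun i hi => hz _ (by omega))
  have e3 : ∀ a b, wS2 a b = a % M1 + b % M1 := fun _ _ => rfl
  have e4 : ∀ a b, wT2 a b = 2*(a / M1 + b / M1) + b % M1 := fun _ _ => rfl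
  rw [e3, e4, a1, a2, b1, b2, sum_pair, sum_pair]
  refine ⟨rfl, ?_⟩
  rw [mul_add, add_assoc, Finset.mul_sum, Finset.mul_sum, ← Finset.sum_add_distrib]
  congr 1
  · exact Finset.sum_congr rfl fun i _ => by ring
  · exact Finset.sum_congr rfl fun i _ => by ring
end PNTA
end

section
namespace PNTA
/-- weight of the unit interval starting at `n` -/
noncomputable def WW (n : ℕ) : ℤ := |ff (n + n/400) - ff n| * (400 - (n%400 : ℕ)) + |ff (n + n/400 + 1) - ff n| * ((n%400 : ℕ) + 1)

theorem WW_nonneg (n : ℕ) : 0 ≤ WW n := by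
  have : n % 400 < 400 := Nat.mod_lt _ (by norm_num)
  rw [WW]
  have h1 : (0:ℤ) ≤ 400 - (n%400 : ℕ) := by omega
  have h2 : (0:ℤ) ≤ (n%400 : ℕ) + 1 := by omega
  exact add_nonneg (mul_nonneg (abs_nonneg _) h1) (mul_nonneg (abs_nonneg _) h2)

theorem wV_spec (p h : ℕ) (z0 z1 : ℕ → ℕ) (hh : p + 2*h ≤ 400) (h0 : ∀ i < 2*h, z0 i < 128) (h1 : ∀ i < 2*h, z1 i < 128) :
    ((wV p (Nat.mul 2047 (geoS 22 h)) (pk (2^11) z0 (2*h)) (pk (2^11) z1 (2*h)) : ℕ) : ℤ)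
      = ∑ i ∈ Finset.range (2*h), ((z0 i : ℤ) * (400 - (p + i : ℕ)) + (z1 i : ℤ) * ((p+i : ℕ) + 1)) := by
  obtain ⟨a1, a2⟩ := wST z0 h (by omega) h0
  obtain ⟨b1, b2⟩ := wST z1 h (by omega) h1
  have e : ∀ rE rO rE' rO', wV2 p rE rO rE' rO' = (400 - p) * wS2 rE rO + (p+1) * wS2 rE' rO' + wT2 rE' rO' - wT2 rE rO :=
    fun _ _ _ _ => rfl
  rw [wV, e, a1, a2, b1, b2]
  have hle : ∑ i ∈ Finset.range (2*h), i * z0 i ≤ (400-p) * ∑ i ∈ Finset.range (2*h), z0 i := by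
    rw [Finset.mul_sum]
    refine Finset.sum_le_sum fun i hi => Nat.mul_le_mul_right _ ?_
    have := Finset.mem_range.1 hi; omega
  rw [Nat.cast_sub (by omega)]
  push_cast [Nat.cast_sub (show p ≤ 400 by omega)]
  rw [Finset.mul_sum, Finset.mul_sum, ← Finset.sum_add_distrib, ← Finset.sum_add_distrib, ← Finset.sum_sub_distrib]
  exact Finset.sum_congr rfl fun i _ => by ring

theorem blk1_spec (n h N : ℕ) (g : ℕ → ℕ) (hp : n % 400 + 2*h ≤ 400) (hN : 2*h + n/400 + 1 ≤ N)
    (hg : ∀ i < N, g i < 128) (hf : ∀ i < N, ff (n+i) + 64 = g i) :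
    ((blk1 (n/400) (n%400) (Nat.mul 128 (geoS 11 (2*h))) (Nat.mul 2047 (geoS 22 h)) (msk (2*h)) (2*h) (pk (2^11) g N) : ℕ) : ℤ)
      = ∑ i ∈ Finset.range (2*h), WW (n+i) := by
  set a := n/400 with ha
  have hg' : ∀ i < N, g i < 2^11 := fun i hi => by have := hg i hi; norm_num; omega
  have e0 : ∀ u me ml l F, blk1 a (n%400) u me ml l F =
      wV (n%400) me (absd u (Nat.land (Nat.land F (msk (l+a+1))) ml) (Nat.land ((Nat.land F (msk (l+a+1))) >>> (11*a)) ml))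
      (absd u (Nat.land (Nat.land F (msk (l+a+1))) ml) (Nat.land ((Nat.land F (msk (l+a+1))) >>> (11*(a+1))) ml)) :=
    fun _ _ _ _ _ => rfl
  have hG : Nat.land (pk (2^11) g N) (msk (2*h+a+1)) = pk (2^11) g (2*h+a+1) := by
    obtain ⟨k, rfl⟩ := Nat.exists_eq_add_of_le hN
    rw [land_msk, pk_mod _ _ _ _ (fun i hi => hg' i (by omega))]
  rw [e0, hG]
  have hX : Nat.land (pk (2^11) g (2*h+a+1)) (msk (2*h)) = pk (2^11) g (2*h) := by
    rw [land_msk, add_assoc, pk_mod _ _ _ _ (fun i hi => hg' i (by omega))]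
  have hY : ∀ b, b ≤ a+1 → Nat.land ((pk (2^11) g (2*h+a+1)) >>> (11*b)) (msk (2*h)) = pk (2^11) (fun i => g (b+i)) (2*h) := by
    intro b hb
    obtain ⟨k, hk⟩ := Nat.exists_eq_add_of_le hb
    rw [land_msk, Nat.shiftRight_eq_div_pow, pow_mul, show 2*h+a+1 = b + (2*h+k) by omega,
      pk_div _ (by norm_num) _ _ _ (fun i hi => hg' i (by omega)), pk_mod _ _ _ _ (fun i hi => hg' _ (by omega))]
  rw [hX, hY a (by omega), hY (a+1) le_rfl, absd_spec _ _ _ (fun i hi => hg i (by omega)) (fun i hi => hg _ (by omega)),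
    absd_spec _ _ _ (fun i hi => hg i (by omega)) (fun i hi => hg _ (by omega)), wV_spec _ _ _ _ hp
    (fun i hi => by have := hg i (by omega); have := hg (a+i) (by omega); omega)
    (fun i hi => by have := hg i (by omega); have := hg (a+1+i) (by omega); omega)]
  refine Finset.sum_congr rfl fun i hi => ?_
  have hi := Finset.mem_range.1 hi
  have e1 : (n+i)/400 = a := by omega
  have e2 : (n+i)%400 = n%400+i := by omega
  have f0 := hf i (by omega)
  have f1 := hf (a+i) (by omega)
  have f2 := hf (a+1+i) (by omega)
  have habs : ∀ x y : ℕ, (((x - y) + (y - x) : ℕ) : ℤ) = |(y:ℤ) - x| := by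
    intro x y
    rcases le_total x y with h | h
    · rw [Nat.sub_eq_zero_of_le h, zero_add, Nat.cast_sub h, abs_of_nonneg (by simpa using h)]
    · rw [Nat.sub_eq_zero_of_le h, add_zero, Nat.cast_sub h, abs_of_nonpos (by simpa using h)]; ring
  rw [WW, e1, e2, habs, habs, ← f0, ← f1, ← f2]
  rw [show n + (a+i) = n + i + a by ring, show n + (a+1+i) = n+i+a+1 by ring]
  ring_nf

theorem blk_unf (u me ml l F n : ℕ) : blk u me ml l F n = (1000000000000 * blk1 (n/400) (n%400) u me ml l F) / (n*n) + 1 := by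
  unfold blk
  rfl

theorem blk_spec (n h N : ℕ) (g : ℕ → ℕ) (hn : 0 < n) (hp : n % 400 + 2*h ≤ 400) (hN : 2*h + n/400 + 1 ≤ N)
    (hg : ∀ i < N, g i < 128) (hf : ∀ i < N, ff (n+i) + 64 = g i) :
    ∑ i ∈ Finset.range (2*h), (WW (n+i) : ℝ) / ((n+i : ℕ):ℝ)^2 ≤
    (blk (Nat.mul 128 (geoS 11 (2*h))) (Nat.mul 2047 (geoS 22 h)) (msk (2*h)) (2*h) (pk (2^11) g N) n : ℕ) / (10:ℝ)^12 := by
  have h1 := blk1_spec n h N g hp hN hg hf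
  rw [blk_unf]
  generalize blk1 (n/400) (n%400) (Nat.mul 128 (geoS 11 (2*h))) (Nat.mul 2047 (geoS 22 h)) (msk (2*h)) (2*h) (pk (2^11) g N) = V at h1 ⊢
  have hVr : (V:ℝ) = ∑ i ∈ Finset.range (2*h), (WW (n+i) : ℝ) := by exact_mod_cast h1
  have hn' : (0:ℝ) < n := by exact_mod_cast hn
  calc ∑ i ∈ Finset.range (2*h), (WW (n+i) : ℝ) / ((n+i : ℕ):ℝ)^2
      ≤ ∑ i ∈ Finset.range (2*h), (WW (n+i) : ℝ) / (n:ℝ)^2 := by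
        refine Finset.sum_le_sum fun i _ => ?_
        have : (0:ℝ) ≤ WW (n+i) := by exact_mod_cast WW_nonneg _
        refine div_le_div_of_nonneg_left this (pow_pos hn' 2) (pow_le_pow_left₀ hn'.le ?_ 2)
        exact_mod_cast Nat.le_add_right n i
    _ = V / (n:ℝ)^2 := by rw [hVr, Finset.sum_div]
    _ ≤ _ := by
        have h3 := Nat.lt_div_mul_add (a := 1000000000000 * V) (b := n*n) (by positivity)
        have h4 : (1000000000000 * V : ℝ) < ((1000000000000 * V / (n*n) : ℕ):ℝ) * (n*n) + n*n := by exact_mod_cast h3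
        rw [div_le_div_iff₀ (by positivity) (by positivity)]
        push_cast
        nlinarith

theorem rows_spec (h nb : ℕ) (hh : 2*h ∣ 400) : ∀ (n N : ℕ) (g : ℕ → ℕ), 0 < n → 2*h ∣ n →
    2*h*nb + (n+2*h*nb)/400 + 1 ≤ N → (∀ i < N, g i < 128) → (∀ i < N, ff (n+i) + 64 = g i) →
    ∑ i ∈ Finset.range (2*h*nb), (WW (n+i) : ℝ) / ((n+i : ℕ):ℝ)^2 ≤
    (rows (Nat.mul 128 (geoS 11 (2*h))) (Nat.mul 2047 (geoS 22 h)) (msk (2*h)) (2*h) nb (pk (2^11) g N) n : ℕ) / (10:ℝ)^12 := by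
  induction nb with
  | zero => 
    intro n N g _ _ _ _ _
    simp only [mul_zero, Finset.range_zero, Finset.sum_empty]; positivity
  | succ nb ih =>
    intro n N g hn hd hN hg hf
    have hmono : (n + 2*h)/400 ≤ (n+2*h*(nb+1))/400 := Nat.div_le_div_right (by nlinarith)
    have hmono1 : (n)/400 ≤ (n+2*h*(nb+1))/400 := Nat.div_le_div_right (by nlinarith)
    have hexp : 2*h*(nb+1) = 2*h + 2*h*nb := by ring
    have e0 : rows (Nat.mul 128 (geoS 11 (2*h))) (Nat.mul 2047 (geoS 22 h)) (msk (2*h)) (2*h) (nb+1) (pk (2^11) g N) n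
      = blk (Nat.mul 128 (geoS 11 (2*h))) (Nat.mul 2047 (geoS 22 h)) (msk (2*h)) (2*h) (pk (2^11) g N) n
       + rows (Nat.mul 128 (geoS 11 (2*h))) (Nat.mul 2047 (geoS 22 h)) (msk (2*h)) (2*h) nb ((pk (2^11) g N) >>> (11*(2*h))) (n+2*h) := rfl
    have hp : n % 400 + 2*h ≤ 400 := by
      have h1 : n % 400 < 400 := Nat.mod_lt _ (by norm_num)
      have h2 : 2*h ∣ n % 400 := (Nat.dvd_mod_iff hh).2 hd
      have h3 : 2*h ∣ 400 - n%400 := Nat.dvd_sub hh h2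
      have := Nat.le_of_dvd (by omega) h3
      omega
    have b := blk_spec n h N g hn hp (by omega) hg hf
    obtain ⟨k, hk⟩ : ∃ k, N = 2*h + k := ⟨N - 2*h, by omega⟩
    have hs : (pk (2^11) g N) >>> (11*(2*h)) = pk (2^11) (fun i => g (2*h+i)) k := by
      rw [Nat.shiftRight_eq_div_pow, pow_mul, hk, pk_div _ (by norm_num) _ _ _ (fun i hi => by have := hg i (by omega); norm_num; omega)]
    have r := ih (n+2*h) k (fun i => g (2*h+i)) (by omega) (dvd_add hd dvd_rfl)
      (by rw [hexp, ← add_assoc] at hN; omega) (fun i hi => hg _ (by omega))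
      (fun i hi => by have := hf (2*h+i) (by omega); rwa [← add_assoc] at this)
    rw [e0, hs, hexp, Finset.sum_range_add, Nat.cast_add, add_div]
    refine add_le_add b ?_
    simpa only [add_assoc] using r

theorem chk_sound (n0 h nb v : ℕ) (hh : 2*h ∣ 400) (hd : 2*h ∣ n0) (hn0 : 0 < n0) (hf : |ff (n0-1)| ≤ 63)
    (hN : 2*h*nb + (n0+2*h*nb)/400 + 1 ≤ 131072) (hc : chk n0 (2*h) nb v = true) :
    ∑ i ∈ Finset.range (2*h*nb), (WW (n0+i) : ℝ) / ((n0+i : ℕ):ℝ)^2 ≤ v / (10:ℝ)^12 := by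
  rw [chk, Bool.and_eq_true] at hc
  obtain ⟨c1, c2⟩ := hc
  obtain ⟨g, hF, hg, hfg⟩ := chF_spec n0 hn0 hf (Nat.eq_of_beq_eq_true c1)
  have c3 := Nat.le_of_ble_eq_true c2
  have e : Nat.div (2*h) 2 = h := by show 2*h/2 = h; omega
  rw [e, hF] at c3
  refine (rows_spec h nb hh n0 nF g hn0 hd hN hg hfg).trans ?_
  gcongr
  
end PNTA
end

section
namespace PNTA
set_option maxRecDepth 100000
theorem ck0 : chk 1200 10 1600 413571282192 = true := by decide +kernel
theorem ck1 : chk 17200 400 300 99694270909 = true := by decide +kernel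
theorem ck2 : chk 137200 400 300 11699910881 = true := by decide +kernel
theorem ck3 : chk 257200 400 300 4093077770 = true := by decide +kernel
theorem ck4 : chk 377200 400 300 1622045832 = true := by decide +kernel
theorem ck5 : chk 497200 400 300 1075938933 = true := by decide +kernel
theorem ck6 : chk 617200 400 300 779727435 = true := by decide +kernel
theorem ck7 : chk 737200 400 300 643111669 = true := by decide +kernel
theorem ck8 : chk 857200 400 300 432365196 = true := by decide +kernel
theorem ck9 : chk 977200 400 300 326533996 = true := by decide +kernel
theorem ck10 : chk 1097200 400 300 265580781 = true := by decide +kernel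
theorem ck11 : chk 1217200 400 300 222221156 = true := by decide +kernel
theorem ck12 : chk 1337200 400 300 180380215 = true := by decide +kernel
theorem ck13 : chk 1457200 400 300 156271119 = true := by decide +kernel
theorem ck14 : chk 1577200 400 300 127945322 = true := by decide +kernel
theorem ck15 : chk 1697200 400 300 113145426 = true := by decide +kernel
theorem ck16 : chk 1817200 400 300 100019659 = true := by decide +kernel
theorem ck17 : chk 1937200 400 300 90882635 = true := by decide +kernel
theorem ck18 : chk 2057200 400 300 81667972 = true := by decide +kernel
theorem ck19 : chk 2177200 400 300 74324745 = true := by decide +kernel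
theorem ck20 : chk 2297200 400 300 63995750 = true := by decide +kernel
theorem ck21 : chk 2417200 400 300 57644723 = true := by decide +kernel
theorem ck22 : chk 2537200 400 300 57996098 = true := by decide +kernel
theorem ck23 : chk 2657200 400 300 53169823 = true := by decide +kernel
theorem ck24 : chk 2777200 400 300 43821856 = true := by decide +kernel
theorem ck25 : chk 2897200 400 300 39424483 = true := by decide +kernel
theorem ck26 : chk 3017200 400 300 38448142 = true := by decide +kernel
theorem ck27 : chk 3137200 400 300 35280872 = true := by decide +kernel
theorem ck28 : chk 3257200 400 300 33078681 = true := by decide +kernel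
theorem ck29 : chk 3377200 400 300 29851820 = true := by decide +kernel
theorem ck30 : chk 3497200 400 300 27413921 = true := by decide +kernel
theorem ck31 : chk 3617200 400 300 26234926 = true := by decide +kernel
theorem ck32 : chk 3737200 400 300 25059749 = true := by decide +kernel
theorem ck33 : chk 3857200 400 300 24582088 = true := by decide +kernel
theorem ck34 : chk 3977200 400 300 22190655 = true := by decide +kernel
end PNTA
end

section
namespace PNTA
theorem ff_small (y : ℕ) (h : (Nat.ble (flo y Dp) (Nat.add (flo y Dm) 63) && Nat.ble (flo y Dm) (Nat.add (flo y Dp) 63)) = true) : |ff y| ≤ 63 := by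
  rw [Bool.and_eq_true] at h
  have h1 : flo y Dp ≤ flo y Dm + 63 := Nat.le_of_ble_eq_true h.1
  have h2 : flo y Dm ≤ flo y Dp + 63 := Nat.le_of_ble_eq_true h.2
  rw [ff, abs_le]; constructor <;> omega

noncomputable def SW (a b : ℕ) : ℝ := ∑ n ∈ Finset.Ico a b, (WW n : ℝ) / (n:ℝ)^2

theorem SW_add (a b c : ℕ) (h1 : a ≤ b) (h2 : b ≤ c) : SW a c = SW a b + SW b c :=
  (Finset.sum_Ico_consecutive _ h1 h2).symm

theorem SW_chk (n0 h nb v b : ℕ) (hb : b = n0 + 2*h*nb) (hh : 2*h ∣ 400) (hd : 2*h ∣ n0) (hn0 : 0 < n0)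
    (hN : 2*h*nb + (n0+2*h*nb)/400 + 1 ≤ 131072) 
    (hf : (Nat.ble (flo (n0-1) Dp) (Nat.add (flo (n0-1) Dm) 63) && Nat.ble (flo (n0-1) Dm) (Nat.add (flo (n0-1) Dp) 63)) = true)
    (hc : chk n0 (2*h) nb v = true) : SW n0 b ≤ v / (10:ℝ)^12 := by
  have := chk_sound n0 h nb v hh hd hn0 (ff_small _ hf) hN hc
  rw [SW, Finset.sum_Ico_eq_sum_range, hb, Nat.add_sub_cancel_left]
  exact this

theorem sk0 : SW 1200 17200 ≤ 413571282192/(10:ℝ)^12 := by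
  have h := SW_chk 1200 5 1600 413571282192 17200 (by norm_num) (by norm_num) (by norm_num) (by norm_num) (by norm_num) (by decide +kernel) ck0
  exact_mod_cast h
theorem sk1 : SW 1200 137200 ≤ 513265553101/(10:ℝ)^12 := by
  have h := SW_chk 17200 200 300 99694270909 137200 (by norm_num) (by norm_num) (by norm_num) (by norm_num) (by norm_num) (by decide +kernel) ck1
  rw [SW_add 1200 17200 137200 (by norm_num) (by norm_num)]
  push_cast at h
  linarith [sk0]
theorem sk2 : SW 1200 257200 ≤ 524965463982/(10:ℝ)^12 := by
  have h := SW_chk 137200 200 300 11699910881 257200 (by norm_num) (by norm_num) (by norm_num) (by norm_num) (by norm_num) (by decide +kernel) ck2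
  rw [SW_add 1200 137200 257200 (by norm_num) (by norm_num)]
  push_cast at h
  linarith [sk1]
theorem sk3 : SW 1200 377200 ≤ 529058541752/(10:ℝ)^12 := by
  have h := SW_chk 257200 200 300 4093077770 377200 (by norm_num) (by norm_num) (by norm_num) (by norm_num) (by norm_num) (by decide +kernel) ck3
  rw [SW_add 1200 257200 377200 (by norm_num) (by norm_num)]
  push_cast at h
  linarith [sk2]
theorem sk4 : SW 1200 497200 ≤ 530680587584/(10:ℝ)^12 := by
  have h := SW_chk 377200 200 300 1622045832 497200 (by norm_num) (by norm_num) (by norm_num) (by norm_num) (by norm_num) (by decide +kernel) ck4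
  rw [SW_add 1200 377200 497200 (by norm_num) (by norm_num)]
  push_cast at h
  linarith [sk3]
theorem sk5 : SW 1200 617200 ≤ 531756526517/(10:ℝ)^12 := by
  have h := SW_chk 497200 200 300 1075938933 617200 (by norm_num) (by norm_num) (by norm_num) (by norm_num) (by norm_num) (by decide +kernel) ck5
  rw [SW_add 1200 497200 617200 (by norm_num) (by norm_num)]
  push_cast at h
  linarith [sk4]
theorem sk6 : SW 1200 737200 ≤ 532536253952/(10:ℝ)^12 := by
  have h := SW_chk 617200 200 300 779727435 737200 (by norm_num) (by norm_num) (by norm_num) (by norm_num) (by norm_num) (by decide +kernel) ck6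
  rw [SW_add 1200 617200 737200 (by norm_num) (by norm_num)]
  push_cast at h
  linarith [sk5]
theorem sk7 : SW 1200 857200 ≤ 533179365621/(10:ℝ)^12 := by
  have h := SW_chk 737200 200 300 643111669 857200 (by norm_num) (by norm_num) (by norm_num) (by norm_num) (by norm_num) (by decide +kernel) ck7
  rw [SW_add 1200 737200 857200 (by norm_num) (by norm_num)]
  push_cast at h
  linarith [sk6]
theorem sk8 : SW 1200 977200 ≤ 533611730817/(10:ℝ)^12 := by
  have h := SW_chk 857200 200 300 432365196 977200 (by norm_num) (by norm_num) (by norm_num) (by norm_num) (by norm_num) (by decide +kernel) ck8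
  rw [SW_add 1200 857200 977200 (by norm_num) (by norm_num)]
  push_cast at h
  linarith [sk7]
theorem sk9 : SW 1200 1097200 ≤ 533938264813/(10:ℝ)^12 := by
  have h := SW_chk 977200 200 300 326533996 1097200 (by norm_num) (by norm_num) (by norm_num) (by norm_num) (by norm_num) (by decide +kernel) ck9
  rw [SW_add 1200 977200 1097200 (by norm_num) (by norm_num)]
  push_cast at h
  linarith [sk8]
theorem sk10 : SW 1200 1217200 ≤ 534203845594/(10:ℝ)^12 := by
  have h := SW_chk 1097200 200 300 265580781 1217200 (by norm_num) (by norm_num) (by norm_num) (by norm_num) (by norm_num) (by decide +kernel) ck10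
  rw [SW_add 1200 1097200 1217200 (by norm_num) (by norm_num)]
  push_cast at h
  linarith [sk9]
theorem sk11 : SW 1200 1337200 ≤ 534426066750/(10:ℝ)^12 := by
  have h := SW_chk 1217200 200 300 222221156 1337200 (by norm_num) (by norm_num) (by norm_num) (by norm_num) (by norm_num) (by decide +kernel) ck11
  rw [SW_add 1200 1217200 1337200 (by norm_num) (by norm_num)]
  push_cast at h
  linarith [sk10]
theorem sk12 : SW 1200 1457200 ≤ 534606446965/(10:ℝ)^12 := by
  have h := SW_chk 1337200 200 300 180380215 1457200 (by norm_num) (by norm_num) (by norm_num) (by norm_num) (by norm_num) (by decide +kernel) ck12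
  rw [SW_add 1200 1337200 1457200 (by norm_num) (by norm_num)]
  push_cast at h
  linarith [sk11]
theorem sk13 : SW 1200 1577200 ≤ 534762718084/(10:ℝ)^12 := by
  have h := SW_chk 1457200 200 300 156271119 1577200 (by norm_num) (by norm_num) (by norm_num) (by norm_num) (by norm_num) (by decide +kernel) ck13
  rw [SW_add 1200 1457200 1577200 (by norm_num) (by norm_num)]
  push_cast at h
  linarith [sk12]
theorem sk14 : SW 1200 1697200 ≤ 534890663406/(10:ℝ)^12 := by
  have h := SW_chk 1577200 200 300 127945322 1697200 (by norm_num) (by norm_num) (by norm_num) (by norm_num) (by norm_num) (by decide +kernel) ck14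
  rw [SW_add 1200 1577200 1697200 (by norm_num) (by norm_num)]
  push_cast at h
  linarith [sk13]
theorem sk15 : SW 1200 1817200 ≤ 535003808832/(10:ℝ)^12 := by
  have h := SW_chk 1697200 200 300 113145426 1817200 (by norm_num) (by norm_num) (by norm_num) (by norm_num) (by norm_num) (by decide +kernel) ck15
  rw [SW_add 1200 1697200 1817200 (by norm_num) (by norm_num)]
  push_cast at h
  linarith [sk14]
theorem sk16 : SW 1200 1937200 ≤ 535103828491/(10:ℝ)^12 := by
  have h := SW_chk 1817200 200 300 100019659 1937200 (by norm_num) (by norm_num) (by norm_num) (by norm_num) (by norm_num) (by decide +kernel) ck16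
  rw [SW_add 1200 1817200 1937200 (by norm_num) (by norm_num)]
  push_cast at h
  linarith [sk15]
theorem sk17 : SW 1200 2057200 ≤ 535194711126/(10:ℝ)^12 := by
  have h := SW_chk 1937200 200 300 90882635 2057200 (by norm_num) (by norm_num) (by norm_num) (by norm_num) (by norm_num) (by decide +kernel) ck17
  rw [SW_add 1200 1937200 2057200 (by norm_num) (by norm_num)]
  push_cast at h
  linarith [sk16]
theorem sk18 : SW 1200 2177200 ≤ 535276379098/(10:ℝ)^12 := by
  have h := SW_chk 2057200 200 300 81667972 2177200 (by norm_num) (by norm_num) (by norm_num) (by norm_num) (by norm_num) (by decide +kernel) ck18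
  rw [SW_add 1200 2057200 2177200 (by norm_num) (by norm_num)]
  push_cast at h
  linarith [sk17]
theorem sk19 : SW 1200 2297200 ≤ 535350703843/(10:ℝ)^12 := by
  have h := SW_chk 2177200 200 300 74324745 2297200 (by norm_num) (by norm_num) (by norm_num) (by norm_num) (by norm_num) (by decide +kernel) ck19
  rw [SW_add 1200 2177200 2297200 (by norm_num) (by norm_num)]
  push_cast at h
  linarith [sk18]
theorem sk20 : SW 1200 2417200 ≤ 535414699593/(10:ℝ)^12 := by
  have h := SW_chk 2297200 200 300 63995750 2417200 (by norm_num) (by norm_num) (by norm_num) (by norm_num) (by norm_num) (by decide +kernel) ck20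
  rw [SW_add 1200 2297200 2417200 (by norm_num) (by norm_num)]
  push_cast at h
  linarith [sk19]
theorem sk21 : SW 1200 2537200 ≤ 535472344316/(10:ℝ)^12 := by
  have h := SW_chk 2417200 200 300 57644723 2537200 (by norm_num) (by norm_num) (by norm_num) (by norm_num) (by norm_num) (by decide +kernel) ck21
  rw [SW_add 1200 2417200 2537200 (by norm_num) (by norm_num)]
  push_cast at h
  linarith [sk20]
theorem sk22 : SW 1200 2657200 ≤ 535530340414/(10:ℝ)^12 := by
  have h := SW_chk 2537200 200 300 57996098 2657200 (by norm_num) (by norm_num) (by norm_num) (by norm_num) (by norm_num) (by decide +kernel) ck22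
  rw [SW_add 1200 2537200 2657200 (by norm_num) (by norm_num)]
  push_cast at h
  linarith [sk21]
theorem sk23 : SW 1200 2777200 ≤ 535583510237/(10:ℝ)^12 := by
  have h := SW_chk 2657200 200 300 53169823 2777200 (by norm_num) (by norm_num) (by norm_num) (by norm_num) (by norm_num) (by decide +kernel) ck23
  rw [SW_add 1200 2657200 2777200 (by norm_num) (by norm_num)]
  push_cast at h
  linarith [sk22]
theorem sk24 : SW 1200 2897200 ≤ 535627332093/(10:ℝ)^12 := by
  have h := SW_chk 2777200 200 300 43821856 2897200 (by norm_num) (by norm_num) (by norm_num) (by norm_num) (by norm_num) (by decide +kernel) ck24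
  rw [SW_add 1200 2777200 2897200 (by norm_num) (by norm_num)]
  push_cast at h
  linarith [sk23]
theorem sk25 : SW 1200 3017200 ≤ 535666756576/(10:ℝ)^12 := by
  have h := SW_chk 2897200 200 300 39424483 3017200 (by norm_num) (by norm_num) (by norm_num) (by norm_num) (by norm_num) (by decide +kernel) ck25
  rw [SW_add 1200 2897200 3017200 (by norm_num) (by norm_num)]
  push_cast at h
  linarith [sk24]
theorem sk26 : SW 1200 3137200 ≤ 535705204718/(10:ℝ)^12 := by
  have h := SW_chk 3017200 200 300 38448142 3137200 (by norm_num) (by norm_num) (by norm_num) (by norm_num) (by norm_num) (by decide +kernel) ck26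
  rw [SW_add 1200 3017200 3137200 (by norm_num) (by norm_num)]
  push_cast at h
  linarith [sk25]
theorem sk27 : SW 1200 3257200 ≤ 535740485590/(10:ℝ)^12 := by
  have h := SW_chk 3137200 200 300 35280872 3257200 (by norm_num) (by norm_num) (by norm_num) (by norm_num) (by norm_num) (by decide +kernel) ck27
  rw [SW_add 1200 3137200 3257200 (by norm_num) (by norm_num)]
  push_cast at h
  linarith [sk26]
theorem sk28 : SW 1200 3377200 ≤ 535773564271/(10:ℝ)^12 := by
  have h := SW_chk 3257200 200 300 33078681 3377200 (by norm_num) (by norm_num) (by norm_num) (by norm_num) (by norm_num) (by decide +kernel) ck28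
  rw [SW_add 1200 3257200 3377200 (by norm_num) (by norm_num)]
  push_cast at h
  linarith [sk27]
theorem sk29 : SW 1200 3497200 ≤ 535803416091/(10:ℝ)^12 := by
  have h := SW_chk 3377200 200 300 29851820 3497200 (by norm_num) (by norm_num) (by norm_num) (by norm_num) (by norm_num) (by decide +kernel) ck29
  rw [SW_add 1200 3377200 3497200 (by norm_num) (by norm_num)]
  push_cast at h
  linarith [sk28]
theorem sk30 : SW 1200 3617200 ≤ 535830830012/(10:ℝ)^12 := by
  have h := SW_chk 3497200 200 300 27413921 3617200 (by norm_num) (by norm_num) (by norm_num) (by norm_num) (by norm_num) (by decide +kernel) ck30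
  rw [SW_add 1200 3497200 3617200 (by norm_num) (by norm_num)]
  push_cast at h
  linarith [sk29]
theorem sk31 : SW 1200 3737200 ≤ 535857064938/(10:ℝ)^12 := by
  have h := SW_chk 3617200 200 300 26234926 3737200 (by norm_num) (by norm_num) (by norm_num) (by norm_num) (by norm_num) (by decide +kernel) ck31
  rw [SW_add 1200 3617200 3737200 (by norm_num) (by norm_num)]
  push_cast at h
  linarith [sk30]
theorem sk32 : SW 1200 3857200 ≤ 535882124687/(10:ℝ)^12 := by
  have h := SW_chk 3737200 200 300 25059749 3857200 (by norm_num) (by norm_num) (by norm_num) (by norm_num) (by norm_num) (by decide +kernel) ck32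
  rw [SW_add 1200 3737200 3857200 (by norm_num) (by norm_num)]
  push_cast at h
  linarith [sk31]
theorem sk33 : SW 1200 3977200 ≤ 535906706775/(10:ℝ)^12 := by
  have h := SW_chk 3857200 200 300 24582088 3977200 (by norm_num) (by norm_num) (by norm_num) (by norm_num) (by norm_num) (by decide +kernel) ck33
  rw [SW_add 1200 3857200 3977200 (by norm_num) (by norm_num)]
  push_cast at h
  linarith [sk32]
theorem sk34 : SW 1200 4097200 ≤ 535928897430/(10:ℝ)^12 := by
  have h := SW_chk 3977200 200 300 22190655 4097200 (by norm_num) (by norm_num) (by norm_num) (by norm_num) (by norm_num) (by decide +kernel) ck34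
  rw [SW_add 1200 3977200 4097200 (by norm_num) (by norm_num)]
  push_cast at h
  linarith [sk33]
end PNTA
end

section
namespace PNTA
open Finset

/-- signed sum over the two lists -/
noncomputable def nu (G : ℕ → ℝ) : ℝ := (Dp.map G).sum - (Dm.map G).sum

theorem list_sum_abs_le (l : List ℕ) (G : ℕ → ℝ) (B : ℝ) (h : ∀ d ∈ l, |G d| ≤ B) : |(l.map G).sum| ≤ l.length * B := by
  induction l with
  | nil => simp
  | cons a t ih =>
    simp only [List.map_cons, List.sum_cons, List.length_cons]
    have h1 := ih fun d hd => h d (List.mem_cons_of_mem _ hd)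
    have h2 := h a List.mem_cons_self
    push_cast
    calc _ ≤ |G a| + |(List.map G t).sum| := abs_add_le _ _
      _ ≤ _ := by linarith

theorem nu_abs_le (G : ℕ → ℝ) (B : ℝ) (h : ∀ d, 0 < d → |G d| ≤ B) : |nu G| ≤ 957 * B := by
  have h1 := list_sum_abs_le Dp G B fun d hd => h d (pos_Dp d hd)
  have h2 := list_sum_abs_le Dm G B fun d hd => h d (pos_Dm d hd)
  rw [len_Dp] at h1
  rw [len_Dm] at h2
  rw [nu]
  push_cast at h1 h2
  refine (abs_sub _ _).trans ?_
  linarith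

theorem list_sum_sub (l : List ℕ) (G H : ℕ → ℝ) : (l.map fun d => G d - H d).sum = (l.map G).sum - (l.map H).sum := by
  induction l with
  | nil => simp
  | cons a t ih => simp only [List.map_cons, List.sum_cons, ih]; ring

theorem nu_sub (G H : ℕ → ℝ) : nu (fun d => G d - H d) = nu G - nu H := by
  simp only [nu, list_sum_sub]; ring

theorem list_sum_mul (l : List ℕ) (G : ℕ → ℝ) (r : ℝ) : (l.map fun d => r * G d).sum = r * (l.map G).sum := by
  induction l with
  | nil => simp
  | cons a t ih => simp only [List.map_cons, List.sum_cons, ih]; ring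

theorem nu_mul (G : ℕ → ℝ) (r : ℝ) : nu (fun d => r * G d) = r * nu G := by
  simp only [nu, list_sum_mul]; ring

theorem list_swap (l : List ℕ) (hl : ∀ d ∈ l, 0 < d) (F : ℕ → ℝ) (N : ℕ) :
    (l.map fun d => ∑ k ∈ Ioc 0 (N/d), F (d*k)).sum = ∑ n ∈ Ioc 0 N, (cnt l n : ℝ) * F n := by
  induction l with
  | nil => simp [cnt]
  | cons a t ih =>
    have ha := hl a List.mem_cons_self
    rw [List.map_cons, List.sum_cons, ih fun d hd => hl d (List.mem_cons_of_mem _ hd)]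
    have e : ∑ k ∈ Ioc 0 (N/a), F (a*k) = ∑ n ∈ Ioc 0 N, (if a ∣ n then F n else 0) := by
      rw [← Finset.sum_filter]
      refine Finset.sum_bij (fun k _ => a*k) ?_ ?_ ?_ ?_
      · intro k hk
        rw [Finset.mem_Ioc] at hk
        rw [Finset.mem_filter, Finset.mem_Ioc]
        exact ⟨⟨Nat.mul_pos ha hk.1, (Nat.mul_le_mul_left a hk.2).trans (Nat.mul_div_le N a)⟩, Dvd.intro _ rfl⟩
      · intro k _ k' _ h
        exact Nat.eq_of_mul_eq_mul_left ha h
      · intro n hn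
        rw [Finset.mem_filter, Finset.mem_Ioc] at hn
        obtain ⟨⟨h1, h2⟩, k, rfl⟩ := hn
        refine ⟨k, ?_, rfl⟩
        rw [Finset.mem_Ioc]
        exact ⟨Nat.pos_of_mul_pos_left h1, (Nat.le_div_iff_mul_le ha).2 (by rwa [mul_comm])⟩
      · intro _ _; rfl
    rw [e, ← Finset.sum_add_distrib]
    refine Finset.sum_congr rfl fun n _ => ?_
    have : cnt (a::t) n = (if a ∣ n then 1 else 0) + cnt t n := by simp [cnt]
    rw [this]
    split_ifs <;> push_cast <;> ring

theorem nu_swap (F : ℕ → ℝ) (N : ℕ) :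
    nu (fun d => ∑ k ∈ Ioc 0 (N/d), F (d*k)) = ∑ n ∈ Ioc 0 N, (aa n : ℝ) * F n := by
  rw [nu, list_swap Dp pos_Dp, list_swap Dm pos_Dm, ← Finset.sum_sub_distrib]
  refine Finset.sum_congr rfl fun n _ => ?_
  rw [aa]; push_cast; ring

/-- the remainder of the Chebyshev function -/
noncomputable def RR (u : ℝ) : ℝ := Chebyshev.psi u - u

noncomputable def hh (w : ℝ) : ℝ := ∑ k ∈ Ioc 0 ⌊w⌋₊, RR (w/k)

theorem E_id (z : ℝ) : ∑ n ∈ Ioc 0 ⌊z⌋₊, (aa n : ℝ) * RR (z/n) = nu fun d => hh (z/d) := by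
  rw [← nu_swap (fun n => RR (z/n)) ⌊z⌋₊]
  congr 1
  funext d
  rw [hh, Nat.floor_div_natCast]
  refine Finset.sum_congr rfl fun k _ => ?_
  push_cast
  rw [div_div]

theorem sum_psi (w : ℝ) : ∑ k ∈ Ioc 0 ⌊w⌋₊, Chebyshev.psi (w/k) = Real.log (⌊w⌋₊.factorial) := by
  have h := ArithmeticFunction.sum_Ioc_mul_eq_sum_sum (R := ℝ) (ArithmeticFunction.zeta : ArithmeticFunction ℝ) ArithmeticFunction.vonMangoldt ⌊w⌋₊
  rw [ArithmeticFunction.zeta_mul_vonMangoldt] at h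
  have e : ∀ N : ℕ, ∑ n ∈ Ioc 0 N, ArithmeticFunction.log n = Real.log N.factorial := by
    intro N
    induction N with
    | zero => simp
    | succ N ih =>
      rw [← Finset.insert_Ioc_right_eq_Ioc_add_one (Nat.zero_le N), Finset.sum_insert (by simp), ih, Nat.factorial_succ, ArithmeticFunction.log_apply]
      push_cast
      rw [Real.log_mul (by positivity) (by positivity)]
  rw [← e, h]
  refine Finset.sum_congr rfl fun k hk => ?_
  have hk := (Finset.mem_Ioc.1 hk).1
  rw [Chebyshev.psi, Nat.floor_div_natCast]
  simp [ArithmeticFunction.natCoe_apply, ArithmeticFunction.zeta_apply, hk.ne']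

theorem log_fact_bounds (N : ℕ) (hN : 0 < N) : N * Real.log N - N + 1 ≤ Real.log N.factorial ∧
    Real.log N.factorial ≤ N * Real.log N - N + 1 + Real.log N := by
  induction N with
  | zero => omega
  | succ N ih =>
    rcases Nat.eq_zero_or_pos N with rfl | hN'
    · simp
    obtain ⟨h1, h2⟩ := ih hN'
    have hp : (0:ℝ) < N := by exact_mod_cast hN'
    rw [Nat.factorial_succ]
    push_cast
    rw [Real.log_mul (by positivity) (by positivity)]
    have e : Real.log ((N:ℝ)+1) = Real.log N + Real.log (1+1/(N:ℝ)) := by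
      rw [← Real.log_mul (by positivity) (by positivity)]; congr 1; field_simp
    have u : Real.log (1+1/(N:ℝ)) ≤ 1/N := by
      have := Real.log_le_sub_one_of_pos (show (0:ℝ) < 1+1/N by positivity); linarith
    have v : 1/((N:ℝ)+1) ≤ Real.log (1+1/(N:ℝ)) := by
      have := Real.one_sub_inv_le_log_of_pos (show (0:ℝ) < 1+1/N by positivity)
      have e2 : 1 - (1+1/(N:ℝ))⁻¹ = 1/((N:ℝ)+1) := by field_simp; ring
      linarith
    rw [e]
    have u' : N * Real.log (1+1/(N:ℝ)) ≤ 1 := by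
      calc _ ≤ N * (1/(N:ℝ)) := by gcongr
        _ = 1 := by field_simp
    have v' : 1 ≤ ((N:ℝ)+1) * Real.log (1+1/(N:ℝ)) := by
      calc 1 = ((N:ℝ)+1) * (1/((N:ℝ)+1)) := by field_simp
        _ ≤ _ := by gcongr
    constructor <;> nlinarith

theorem harm_bounds (N : ℕ) (hN : 0 < N) : Real.log N + Real.eulerMascheroniConstant ≤ (harmonic N : ℝ) ∧
    (harmonic N : ℝ) ≤ Real.log N + Real.eulerMascheroniConstant + 1/N := by
  have h1 := Real.eulerMascheroniConstant_lt_eulerMascheroniSeq' N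
  have h2 := Real.eulerMascheroniSeq_lt_eulerMascheroniConstant N
  rw [Real.eulerMascheroniSeq', if_neg hN.ne'] at h1
  rw [Real.eulerMascheroniSeq] at h2
  have hp : (0:ℝ) < N := by exact_mod_cast hN
  have e : Real.log ((N:ℝ)+1) = Real.log N + Real.log (1+1/(N:ℝ)) := by
      rw [← Real.log_mul (by positivity) (by positivity)]; congr 1; field_simp
  have u : Real.log (1+1/(N:ℝ)) ≤ 1/N := by
      have := Real.log_le_sub_one_of_pos (show (0:ℝ) < 1+1/N by positivity); linarith
  constructor <;> linarith

theorem hh_bound (w z : ℝ) (hw : 0 ≤ w) (hz : 1 ≤ z) (hwz : w ≤ z) :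
    |hh w + (1 + Real.eulerMascheroniConstant) * w| ≤ 2 + Real.log z := by
  have g1 := Real.one_half_lt_eulerMascheroniConstant
  have g2 := Real.eulerMascheroniConstant_lt_two_thirds
  set γ := Real.eulerMascheroniConstant
  have lz := Real.log_nonneg hz
  rcases lt_or_ge w 1 with h | h
  · have : hh w = 0 := by rw [hh, Nat.floor_eq_zero.2 h]; simp
    rw [this, zero_add, abs_of_nonneg (by positivity)]
    nlinarith
  set N := ⌊w⌋₊ with hN
  have hNp : 0 < N := Nat.floor_pos.2 h
  have hp : (1:ℝ) ≤ N := by exact_mod_cast hNp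
  have hNw : (N:ℝ) ≤ w := Nat.floor_le hw
  have hwN : w < N + 1 := Nat.lt_floor_add_one w
  have e : hh w = Real.log N.factorial - w * (harmonic N : ℝ) := by
    rw [hh]
    simp only [RR]
    rw [Finset.sum_sub_distrib, sum_psi, harmonic_eq_sum_Icc]
    push_cast
    rw [Finset.mul_sum]
    congr 1
  obtain ⟨f1, f2⟩ := log_fact_bounds N hNp
  obtain ⟨k1, k2⟩ := harm_bounds N hNp
  have lN : 0 ≤ Real.log N := Real.log_nonneg hp
  have lNz : Real.log N ≤ Real.log z := Real.log_le_log (by linarith) (by linarith)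
  have k1' := mul_le_mul_of_nonneg_left k1 hw
  have k2' := mul_le_mul_of_nonneg_left k2 hw
  have e3 : w * (1/(N:ℝ)) ≤ 2 := by
    rw [mul_one_div, div_le_iff₀ (by linarith)]; linarith
  have m1 : 0 ≤ (w - N) * Real.log N := mul_nonneg (by linarith) lN
  have m2 : (w - N) * Real.log N ≤ Real.log N := by nlinarith
  rw [e, abs_le]
  constructor <;> nlinarith

/-- the total mass -/
noncomputable def cc : ℝ := nu fun d => 1/(d:ℝ)

theorem ff_cast (y : ℕ) : (ff y : ℝ) = nu fun d => ((y/d : ℕ):ℝ) := by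
  have e : ∀ l : List ℕ, (((l.map fun d => y/d).sum : ℕ) : ℝ) = (l.map fun d => ((y/d : ℕ):ℝ)).sum := by
    intro l
    induction l with
    | nil => simp
    | cons a t ih => simp only [List.map_cons, List.sum_cons]; rw [Nat.cast_add, ih]
  rw [ff, nu, flo_eq, flo_eq, ← e, ← e, Int.cast_sub, Int.cast_natCast, Int.cast_natCast]

theorem ff_approx (y : ℝ) (hy : 0 ≤ y) : ∃ G : ℕ → ℝ, (∀ d, 0 ≤ G d ∧ G d ≤ 1) ∧ (ff ⌊y⌋₊ : ℝ) = cc * y - nu G := by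
  refine ⟨fun d => y/d - ((⌊y⌋₊/d : ℕ):ℝ), fun d => ?_, ?_⟩
  · show 0 ≤ y/d - ((⌊y⌋₊/d : ℕ):ℝ) ∧ y/d - ((⌊y⌋₊/d : ℕ):ℝ) ≤ 1
    rw [← Nat.floor_div_natCast]
    have h1 := Nat.floor_le (show 0 ≤ y/d by positivity)
    have h2 := Nat.lt_floor_add_one (y/d)
    constructor <;> linarith
  · rw [nu_sub, ← ff_cast, cc, mul_comm, ← nu_mul]
    simp only [mul_one_div]; ring

theorem ff_16 : (Nat.ble (flo (10^16) Dp) (Nat.add (flo (10^16) Dm) 14000) && Nat.ble (flo (10^16) Dm) (Nat.add (flo (10^16) Dp) 14000)) = true := by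
  decide +kernel

theorem cc_abs : |cc| ≤ 0.000000000002 := by
  have h := ff_16
  rw [Bool.and_eq_true] at h
  have h1 : flo (10^16) Dp ≤ flo (10^16) Dm + 14000 := Nat.le_of_ble_eq_true h.1
  have h2 : flo (10^16) Dm ≤ flo (10^16) Dp + 14000 := Nat.le_of_ble_eq_true h.2
  have h3 : |ff (10^16)| ≤ 14000 := by rw [ff, abs_le]; constructor <;> omega
  have h4 : |(ff (10^16) : ℝ)| ≤ 14000 := by exact_mod_cast h3
  obtain ⟨G, hG, e⟩ := ff_approx ((10^16 : ℕ) : ℝ) (by positivity)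
  rw [Nat.floor_natCast] at e
  have h5 := nu_abs_le G 1 fun d _ => by rw [abs_of_nonneg (hG d).1]; exact (hG d).2
  push_cast at e
  rw [abs_le] at h4 h5 ⊢
  constructor <;> norm_num at * <;> linarith

theorem ff_diff (y y' : ℝ) (hy : 0 ≤ y) (hy' : y ≤ y') : |(ff ⌊y'⌋₊ : ℝ) - ff ⌊y⌋₊| ≤ 0.000000000002 * (y' - y) + 957 := by
  obtain ⟨G, hG, e⟩ := ff_approx y hy
  obtain ⟨G', hG', e'⟩ := ff_approx y' (hy.trans hy')
  have h5 := nu_abs_le (fun d => G' d - G d) 1 fun d _ => by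
    have := hG d; have := hG' d; rw [abs_le]; constructor <;> linarith
  rw [nu_sub] at h5
  have h6 : |cc * (y' - y)| ≤ 0.000000000002 * (y' - y) := by
    rw [abs_mul, abs_of_nonneg (by linarith : 0 ≤ y' - y)]
    exact mul_le_mul_of_nonneg_right cc_abs (by linarith)
  rw [e, e', show cc * y' - nu G' - (cc * y - nu G) = cc * (y'-y) - (nu G' - nu G) by ring]
  refine (abs_sub _ _).trans ?_
  linarith

/-- the bounded error term -/
theorem E_bound (z : ℝ) (hz : 1 ≤ z) : |∑ n ∈ Ioc 0 ⌊z⌋₊, (aa n : ℝ) * RR (z/n)| ≤ 0.000000000004 * z + 957 * (2 + Real.log z) := by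
  rw [E_id]
  have g1 := Real.one_half_lt_eulerMascheroniConstant
  have g2 := Real.eulerMascheroniConstant_lt_two_thirds
  set γ := Real.eulerMascheroniConstant
  have h := nu_abs_le (fun d => hh (z/d) - (-(1+γ) * z) * (1/(d:ℝ))) (2 + Real.log z) fun d hd => by
    have := hh_bound (z/d) z (by positivity) hz (div_le_self (by linarith) (by exact_mod_cast hd))
    convert this using 2
    ring
  rw [nu_sub, nu_mul] at h
  have h6 : |-(1+γ) * z * cc| ≤ 0.000000000004 * z := by
    rw [abs_mul, abs_mul, abs_neg, abs_of_pos (by linarith : 0 < 1+γ), abs_of_pos (by linarith : 0 < z)]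
    nlinarith [cc_abs, abs_nonneg cc, mul_le_mul_of_nonneg_left cc_abs (by positivity : 0 ≤ (1+γ)*z)]
  have : (nu fun d => hh (z/d)) = ((nu fun d => hh (z/d)) - -(1+γ) * z * cc) + -(1+γ) * z * cc := by ring
  rw [this]
  refine (abs_add_le _ _).trans ?_
  rw [← cc] at h; linarith
end PNTA
end

section
namespace PNTA
open Finset MeasureTheory

noncomputable def gg (u : ℝ) : ℝ := if 1 ≤ u then RR u / u else 0

theorem RR_abs (u : ℝ) (hu : 1 ≤ u) : |RR u| ≤ 5 * u := by
  have h1 := Chebyshev.psi_le_const_mul_self (by linarith : 0 ≤ u)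
  have h2 := Chebyshev.psi_nonneg u
  have h4 : Real.log 4 ≤ 2 := by
    have := Real.log_two_lt_d9
    rw [show (4:ℝ) = 2^2 by norm_num, Real.log_pow]; push_cast; linarith
  rw [RR, abs_le]; constructor <;> nlinarith

theorem gg_abs (u : ℝ) : |gg u| ≤ 5 := by
  rw [gg]
  split_ifs with h
  · rw [abs_div, abs_of_pos (by linarith : 0 < u), div_le_iff₀ (by linarith)]
    exact RR_abs u h
  · simp

theorem gg_meas : Measurable gg := by
  refine Measurable.ite measurableSet_Ici ?_ measurable_const
  exact (Chebyshev.psi_mono.measurable.sub measurable_id).div measurable_id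

theorem gg_int (a b : ℝ) : IntegrableOn gg (Set.Ioc a b) :=
  Measure.integrableOn_of_bounded (M := 5) (by simp) gg_meas.aestronglyMeasurable
    (Filter.Eventually.of_forall fun u => by rw [Real.norm_eq_abs]; exact gg_abs u)

noncomputable def Dl (x u : ℝ) : ℝ := (ff ⌊401/400*x/u⌋₊ : ℝ) - ff ⌊x/u⌋₊

theorem Dl_meas (x : ℝ) : Measurable (Dl x) := by
  have h : ∀ X : ℝ, Measurable fun u : ℝ => (ff ⌊X/u⌋₊ : ℝ) := fun X =>
    (measurable_from_nat (f := fun n : ℕ => (ff n : ℝ))).comp (Nat.measurable_floor.comp (measurable_const.div measurable_id))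
  exact (h _).sub (h _)

theorem Dl_abs (x u : ℝ) (hx : 0 ≤ x) (hu : 0 < u) : |Dl x u| ≤ 0.000000000000005 * (x/u) + 957 := by
  have h := ff_diff (x/u) (401/400*x/u) (by positivity) (by gcongr; linarith)
  rw [Dl]
  refine h.trans (le_of_eq ?_)
  ring

theorem ff_sum (y y' : ℕ) (h : y ≤ y') : (ff y' : ℝ) - ff y = ∑ n ∈ Ioc y y', (aa n : ℝ) := by
  induction y', h using Nat.le_induction with
  | base => simp
  | succ k hk ih =>
    rw [← Finset.insert_Ioc_right_eq_Ioc_add_one hk, Finset.sum_insert (by simp), ← ih, ff_succ]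
    push_cast; ring

theorem gg_swap1 (x z : ℝ) (hz : 0 < z) (hzx : z ≤ x) :
    (∑ n ∈ Ioc 0 ⌊z⌋₊, (aa n : ℝ) * RR (z/n)) / z = ∑ n ∈ Ioc 0 ⌊x⌋₊, (aa n : ℝ) * ((1/n) * gg (z/n)) := by
  have hM : ⌊z⌋₊ ≤ ⌊x⌋₊ := Nat.floor_mono hzx
  rw [← Finset.sum_subset (Finset.Ioc_subset_Ioc_right hM), Finset.sum_div]
  · refine Finset.sum_congr rfl fun n hn => ?_
    obtain ⟨h1, h2⟩ := Finset.mem_Ioc.1 hn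
    have hn' : (0:ℝ) < n := by exact_mod_cast h1
    have : (n:ℝ) ≤ z := (Nat.le_floor_iff hz.le).1 h2
    rw [gg, if_pos ((one_le_div hn').2 this)]
    field_simp
  · intro n hn hn'
    obtain ⟨h1, h2⟩ := Finset.mem_Ioc.1 hn
    have hp : (0:ℝ) < n := by exact_mod_cast h1
    have : z < n := by
      by_contra hc
      exact hn' (Finset.mem_Ioc.2 ⟨h1, (Nat.le_floor_iff hz.le).2 (not_lt.1 hc)⟩)
    rw [gg, if_neg (not_le.2 ((div_lt_one hp).2 this))]
    simp

theorem gg_swap2 (x : ℝ) (hx : 0 < x) (n : ℕ) (hn : 0 < n) :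
    ∫ z in x..401/400*x, (1/(n:ℝ)) * gg (z/n) = ∫ u in Set.Ioc 0 (401/400*x), (Set.Ioc (x/n) (401/400*x/n)).indicator gg u := by
  have hp : (1:ℝ) ≤ n := by exact_mod_cast hn
  have hp' : (0:ℝ) < n := by linarith
  rw [intervalIntegral.integral_const_mul, intervalIntegral.integral_comp_div (f := gg) hp'.ne', smul_eq_mul, ← mul_assoc, one_div,
    inv_mul_cancel₀ hp'.ne', one_mul, intervalIntegral.integral_of_le (by gcongr; linarith), setIntegral_indicator measurableSet_Ioc]
  congr 2
  rw [eq_comm, Set.inter_eq_right]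
  refine Set.Ioc_subset_Ioc (by positivity) ?_
  exact div_le_self (by positivity) hp

theorem gg_swap3 (x u : ℝ) (hx : 0 < x) :
    ∑ n ∈ Ioc 0 ⌊401/400*x⌋₊, (aa n : ℝ) * (Set.Ioc (x/n) (401/400*x/n)).indicator gg u = gg u * Dl x u := by
  by_cases hu : 1 ≤ u
  · have hu' : 0 < u := by linarith
    have hle : ⌊x/u⌋₊ ≤ ⌊401/400*x/u⌋₊ := Nat.floor_mono (by gcongr; linarith)
    have hsub : Ioc ⌊x/u⌋₊ ⌊401/400*x/u⌋₊ ⊆ Ioc 0 ⌊401/400*x⌋₊ := 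
      Finset.Ioc_subset_Ioc (Nat.zero_le _) (Nat.floor_mono (div_le_self (by positivity) hu))
    rw [Dl, ff_sum _ _ hle, Finset.mul_sum, ← Finset.sum_subset hsub]
    · refine Finset.sum_congr rfl fun n hn => ?_
      obtain ⟨h1, h2⟩ := Finset.mem_Ioc.1 hn
      have hp : (0:ℝ) < n := by exact_mod_cast (Nat.zero_le _).trans_lt h1
      have h1' := (Nat.floor_lt (by positivity)).1 h1
      have h2' := (Nat.le_floor_iff (by positivity)).1 h2
      rw [Set.indicator_of_mem, mul_comm]
      exact ⟨by rw [div_lt_iff₀ hp]; rw [div_lt_iff₀ hu'] at h1'; linarith,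
        by rw [le_div_iff₀ hp]; rw [le_div_iff₀ hu'] at h2'; linarith⟩
    · intro n hn hn'
      have hp : (0:ℝ) < n := by exact_mod_cast (Finset.mem_Ioc.1 hn).1
      rw [Set.indicator_of_notMem, mul_zero]
      rintro ⟨h1, h2⟩
      rw [div_lt_iff₀ hp] at h1
      rw [le_div_iff₀ hp] at h2
      refine hn' (Finset.mem_Ioc.2 ⟨(Nat.floor_lt (by positivity)).2 ?_, (Nat.le_floor_iff (by positivity)).2 ?_⟩)
      · rw [div_lt_iff₀ hu']; linarith
      · rw [le_div_iff₀ hu']; linarith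
  · have h0 : gg u = 0 := by rw [gg, if_neg hu]
    rw [h0, zero_mul]
    refine Finset.sum_eq_zero fun n _ => ?_
    rw [Set.indicator_apply, h0]; simp

theorem gg_main (x : ℝ) (hx : 0 < x) :
    ∫ z in x..401/400*x, (∑ n ∈ Ioc 0 ⌊z⌋₊, (aa n : ℝ) * RR (z/n)) / z = ∫ u in (0:ℝ)..401/400*x, gg u * Dl x u := by
  have hxq : x ≤ 401/400*x := by linarith
  have e1 : ∫ z in x..401/400*x, (∑ n ∈ Ioc 0 ⌊z⌋₊, (aa n : ℝ) * RR (z/n)) / z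
      = ∫ z in x..401/400*x, ∑ n ∈ Ioc 0 ⌊401/400*x⌋₊, (aa n : ℝ) * ((1/n) * gg (z/n)) := by
    refine intervalIntegral.integral_congr fun z hz => ?_
    rw [Set.uIcc_of_le hxq] at hz
    exact gg_swap1 _ _ (by linarith [hz.1]) hz.2
  rw [e1, intervalIntegral.integral_finset_sum]
  · have e2 : ∀ n ∈ Ioc 0 ⌊401/400*x⌋₊, ∫ z in x..401/400*x, (aa n : ℝ) * ((1/n) * gg (z/n)) =
        ∫ u in Set.Ioc 0 (401/400*x), (aa n : ℝ) * (Set.Ioc (x/n) (401/400*x/n)).indicator gg u := by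
      intro n hn
      rw [intervalIntegral.integral_const_mul, gg_swap2 x hx n (Finset.mem_Ioc.1 hn).1, integral_const_mul]
    rw [Finset.sum_congr rfl e2, ← integral_finset_sum, intervalIntegral.integral_of_le (by positivity)]
    · exact integral_congr_ae (Filter.Eventually.of_forall fun u => gg_swap3 x u hx)
    · intro n _
      exact ((gg_int _ _).indicator measurableSet_Ioc).const_mul _
  · intro n _
    refine IntervalIntegrable.const_mul (IntervalIntegrable.const_mul ?_ _) _
    rw [intervalIntegrable_iff]
    exact Measure.integrableOn_of_bounded (M := 5) (by simp) (gg_meas.comp (measurable_id.div_const _)).aestronglyMeasurable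
      (Filter.Eventually.of_forall fun u => by rw [Real.norm_eq_abs]; exact gg_abs _)

theorem gD_int (x : ℝ) (hx : 0 < x) (a b : ℝ) : IntervalIntegrable (fun u => gg u * Dl x u) volume a b := by
  rw [intervalIntegrable_iff]
  refine Measure.integrableOn_of_bounded (M := 5 * (0.000000000000005*x+957)) (by simp) (gg_meas.mul (Dl_meas x)).aestronglyMeasurable
      (Filter.Eventually.of_forall fun u => ?_)
  rw [Real.norm_eq_abs, abs_mul]
  by_cases hu : 1 ≤ u
  · refine mul_le_mul (gg_abs u) ((Dl_abs x u hx.le (by linarith)).trans ?_) (abs_nonneg _) (by norm_num)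
    have := div_le_self hx.le hu
    linarith
  · rw [gg, if_neg hu]; simp; positivity

theorem ff_zero : ff 0 = 0 := by
  have h : (Nat.beq (flo 0 Dp) 0 && Nat.beq (flo 0 Dm) 0) = true := by decide +kernel
  rw [Bool.and_eq_true] at h
  rw [ff, Nat.eq_of_beq_eq_true h.1, Nat.eq_of_beq_eq_true h.2]; rfl

end PNTA
end

section
namespace PNTA
theorem pk_inj (B : ℕ) (g h : ℕ → ℕ) (n : ℕ) (hg : ∀ i < n, g i < B) (hh : ∀ i < n, h i < B)
    (e : pk B g n = pk B h n) : ∀ i < n, g i = h i := by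
  induction n generalizing g h with
  | zero => intro i hi; omega
  | succ n ih =>
    rw [pk_succ', pk_succ'] at e
    have g0 := hg 0 (by omega)
    have h0 := hh 0 (by omega)
    have e0 : g 0 = h 0 := by
      have := congrArg (· % B) e
      simpa [Nat.mul_add_mod, Nat.mod_eq_of_lt g0, Nat.mod_eq_of_lt h0] using this
    rw [e0] at e
    have e1 := Nat.eq_of_mul_eq_mul_left (by omega) (Nat.add_right_cancel e)
    intro i hi
    rcases i with _ | i
    · exact e0
    · exact ih (fun i => g (i+1)) (fun i => h (i+1)) (fun i hi => hg _ (by omega)) (fun i hi => hh _ (by omega)) e1 i (by omega)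

theorem allone_ck : (Nat.beq (Nat.land (chF 1) (Nat.mul 1920 onesF)) 0 &&
    Nat.beq (Nat.land (chF 1) (msk 1204)) (Nat.mul 65 (geoS 11 1204))) = true := by decide +kernel

theorem ff_one_gen (n0 n M : ℕ) (hn0 : n0 = 1) (hM : M = 1204) (hck : (Nat.beq (Nat.land (chF n0) (Nat.mul 1920 onesF)) 0 &&
    Nat.beq (Nat.land (chF n0) (msk M)) (Nat.mul 65 (geoS 11 M))) = true) (h1 : 1 ≤ n) (h2 : n ≤ M) : ff n = 1 := by
  rw [Bool.and_eq_true] at hck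
  have h0 : |ff (n0-1)| ≤ 63 := by rw [hn0, Nat.sub_self, ff_zero]; norm_num
  obtain ⟨g, hF, hg, hfg⟩ := chF_spec n0 (by omega) h0 (Nat.eq_of_beq_eq_true hck.1)
  have e := Nat.eq_of_beq_eq_true hck.2
  have hnl : M ≤ nF := by rw [hM, nF]; norm_num
  obtain ⟨k, hn⟩ := Nat.exists_eq_add_of_le hnl
  rw [land_msk, hF, hn, pk_mod _ _ _ _ (fun i hi => (hg i (lt_of_lt_of_le (by omega) hnl)).trans (by norm_num)), geoS_eq] at e
  have e2 : Nat.mul 65 (∑ k ∈ Finset.range M, (2^11)^k) = pk (2^11) (fun _ => 65) M := by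
    rw [pk]
    exact Finset.mul_sum _ _ _
  rw [e2] at e
  have := pk_inj _ _ _ _ (fun i hi => (hg i (lt_of_lt_of_le (by omega) hnl)).trans (by norm_num)) (fun i _ => by norm_num) e (n-1) (by omega)
  have h3 := hfg (n-1) (lt_of_lt_of_le (by omega) hnl)
  rw [this, hn0, show 1 + (n-1) = n by omega] at h3
  push_cast at h3
  omega

theorem ff_one (n : ℕ) (h1 : 1 ≤ n) (h2 : n ≤ 1204) : ff n = 1 := by
  exact ff_one_gen 1 n 1204 rfl rfl allone_ck h1 h2
end PNTA
end

section
namespace PNTA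
open MeasureTheory

theorem floor_eq' (y : ℝ) (n : ℕ) (h1 : (n:ℝ) ≤ y) (h2 : y < n + 1) : ⌊y⌋₊ = n :=
  (Nat.floor_eq_iff ((Nat.cast_nonneg n).trans h1)).2 ⟨h1, h2⟩

theorem Dl_zero (x u : ℝ) (hx : 0 < x) (h1 : x/1200 < u) (h2 : u ≤ x) : Dl x u = 0 := by
  have hu : 0 < u := lt_trans (by positivity) h1
  have a1 : 1 ≤ x/u := (one_le_div hu).2 h2
  have a2 : x/u < 1200 := by rw [div_lt_iff₀ hu]; linarith
  have e : 401/400*x/u = 401/400*(x/u) := by ring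
  rw [Dl, ff_one _ (Nat.le_floor (by push_cast; rw [e]; linarith)) (Nat.floor_le_of_le (by push_cast; rw [e]; linarith)),
    ff_one _ (Nat.le_floor (by push_cast; linarith)) (Nat.floor_le_of_le (by push_cast; linarith))]
  simp

theorem Dl_top (x u : ℝ) (hx : 0 < x) (h1 : x < u) (h2 : u ≤ 401/400*x) : Dl x u = 1 := by
  have hu : 0 < u := hx.trans h1
  have a1 : 1 ≤ 401/400*x/u := (one_le_div hu).2 h2
  have a2 : x/u < 1 := by rw [div_lt_one hu]; exact h1
  have e : 401/400*x/u = 401/400*(x/u) := by ring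
  rw [Dl, Nat.floor_eq_zero.2 a2, ff_zero, ff_one _ (Nat.le_floor (by push_cast; linarith)) (Nat.floor_le_of_le (by push_cast; rw [e]; linarith))]
  simp

theorem Dl_int (x a b : ℝ) (hx : 0 < x) (ha : 0 < a) (hb : 0 < b) : IntervalIntegrable (fun u => |Dl x u|) volume a b := by
  rw [intervalIntegrable_iff]
  refine Measure.integrableOn_of_bounded (M := 0.000000000000005*(x/min a b)+957) (by simp)
    (continuous_abs.measurable.comp (Dl_meas x)).aestronglyMeasurable ?_
  refine (ae_restrict_iff' measurableSet_uIoc).2 (Filter.Eventually.of_forall fun u hu => ?_)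
  have hm : 0 < min a b := lt_min ha hb
  have hu' : min a b < u := hu.1
  rw [Real.norm_eq_abs, abs_abs]
  refine (Dl_abs x u hx.le (hm.trans hu')).trans ?_
  gcongr

theorem Dl_step (x : ℝ) (hx : 0 < x) (n : ℕ) (hn : 0 < n) :
    ∫ u in x/((n+1 : ℕ):ℝ)..x/n, |Dl x u| ≤ x/401 * ((WW n : ℝ)/(n:ℝ)^2) := by
  set a := n/400 with ha
  set j := n%400 with hj
  have hj4 : j < 400 := Nat.mod_lt _ (by norm_num)
  have hnaj : n = 400*a + j := (Nat.div_add_mod n 400).symm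
  have hnr : (n:ℝ) = 400*a+j := by exact_mod_cast hnaj
  have hjr : (j:ℝ) + 1 ≤ 400 := by exact_mod_cast hj4
  have hj0 : (0:ℝ) ≤ j := Nat.cast_nonneg j
  have ha0 : (0:ℝ) ≤ a := Nat.cast_nonneg a
  have hnp : (0:ℝ) < n := by exact_mod_cast hn
  set us := 401/400*x/((n:ℝ)+a+1) with hus
  have usp : 0 < us := by positivity
  have key : 401/400*(n:ℝ) ≤ n+a+1 := by rw [hnr]; linarith
  have l1 : x/((n+1 : ℕ):ℝ) ≤ us := by
    rw [hus, div_le_div_iff₀ (by positivity) (by positivity)]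
    push_cast
    rw [mul_comm (401/400) x, mul_assoc]
    refine mul_le_mul_of_nonneg_left ?_ hx.le
    rw [hnr]; linarith
  have l2 : us ≤ x/n := by
    rw [hus, div_le_div_iff₀ (by positivity) (by positivity)]
    nlinarith
  have p1 : 0 < x/((n+1 : ℕ):ℝ) := by positivity
  have p2 : 0 < x/(n:ℝ) := by positivity
  have fl : ∀ u, x/((n+1 : ℕ):ℝ) < u → u ≤ x/n → ⌊x/u⌋₊ = n := by
    intro u h1 h2
    have hu := p1.trans h1
    rw [div_lt_iff₀ (by positivity)] at h1
    rw [le_div_iff₀ hnp] at h2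
    push_cast at h1
    refine floor_eq' _ _ ?_ ?_
    · rw [le_div_iff₀ hu]; linarith
    · rw [div_lt_iff₀ hu]; linarith
  have i1 : ∫ u in x/((n+1 : ℕ):ℝ)..us, |Dl x u| ≤ |(ff (n+a+1) : ℝ) - ff n| * (us - x/((n+1 : ℕ):ℝ)) := by
    have := intervalIntegral.norm_integral_le_of_norm_le_const (a := x/((n+1 : ℕ):ℝ)) (b := us) (f := fun u => |Dl x u|)
      (C := |(ff (n+a+1) : ℝ) - ff n|) ?_
    · rw [abs_of_nonneg (by linarith : 0 ≤ us - x/((n+1 : ℕ):ℝ))] at this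
      exact (le_abs_self _).trans this
    · intro u hu
      rw [Set.uIoc_of_le l1] at hu
      have hup := p1.trans hu.1
      have e2 : ⌊401/400*x/u⌋₊ = n+a+1 := by
        refine floor_eq' _ _ ?_ ?_
        · have := hu.2
          rw [hus, le_div_iff₀ (by positivity)] at this
          rw [le_div_iff₀ hup]; push_cast; linarith
        · have := hu.1
          rw [div_lt_iff₀ (by positivity)] at this
          rw [div_lt_iff₀ hup]; push_cast at this ⊢
          have h5 : 401/400*((n:ℝ)+1) ≤ n+a+1+1 := by rw [hnr]; linarith
          nlinarith
      rw [Real.norm_eq_abs, abs_abs, Dl, e2, fl u hu.1 (hu.2.trans l2)]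
  have i2 : ∫ u in us..x/n, |Dl x u| ≤ |(ff (n+a) : ℝ) - ff n| * (x/n - us) := by
    have := intervalIntegral.norm_integral_le_of_norm_le_const (a := us) (b := x/n) (f := fun u => |Dl x u|)
      (C := |(ff (n+a) : ℝ) - ff n|) ?_
    · rw [abs_of_nonneg (by linarith : 0 ≤ x/n - us)] at this
      exact (le_abs_self _).trans this
    · intro u hu
      rw [Set.uIoc_of_le l2] at hu
      have hup := usp.trans hu.1
      have e2 : ⌊401/400*x/u⌋₊ = n+a := by
        refine floor_eq' _ _ ?_ ?_
        · have := hu.2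
          rw [le_div_iff₀ (by positivity)] at this
          rw [le_div_iff₀ hup]; push_cast
          have h5 : (n:ℝ) + a ≤ 401/400*n := by rw [hnr]; linarith
          nlinarith
        · have := hu.1
          rw [hus, div_lt_iff₀ (by positivity)] at this
          rw [div_lt_iff₀ hup]; push_cast
          linarith
      rw [Real.norm_eq_abs, abs_abs, Dl, e2, fl u (l1.trans_lt hu.1) hu.2]
  have d1 : us - x/((n+1 : ℕ):ℝ) ≤ x/401 * ((j+1)/(n:ℝ)^2) := by
    have e : us - x/((n+1 : ℕ):ℝ) = x * (((j:ℝ)+1)/(((n:ℝ)+1)*(400*((n:ℝ)+a+1)))) := by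
      rw [hus]; push_cast
      field_simp
      rw [hnr]; ring
    rw [e, div_mul_eq_mul_div, mul_div_assoc]
    refine mul_le_mul_of_nonneg_left ?_ hx.le
    rw [div_div]
    refine div_le_div_of_nonneg_left (by positivity) (by positivity) ?_
    nlinarith
  have d2 : x/n - us ≤ x/401 * ((400 - j)/(n:ℝ)^2) := by
    have e : x/n - us = x * ((400 - (j:ℝ))/((n:ℝ)*(400*((n:ℝ)+a+1)))) := by
      rw [hus]
      field_simp
      rw [hnr]; ring
    rw [e, div_mul_eq_mul_div, mul_div_assoc]
    refine mul_le_mul_of_nonneg_left ?_ hx.le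
    rw [div_div]
    refine div_le_div_of_nonneg_left (by linarith) (by positivity) ?_
    nlinarith
  rw [← intervalIntegral.integral_add_adjacent_intervals (Dl_int x _ us hx p1 usp) (Dl_int x us _ hx usp p2)]
  have hW : (WW n : ℝ) = |(ff (n+a) : ℝ) - ff n| * (400 - j) + |(ff (n+a+1) : ℝ) - ff n| * (j+1) := by
    rw [WW, ← ha, ← hj, Int.cast_add, Int.cast_mul, Int.cast_mul, Int.cast_abs, Int.cast_abs, Int.cast_sub, Int.cast_sub, Int.cast_sub, Int.cast_add,
      Int.cast_natCast]
    norm_cast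
  rw [hW]
  have q1 := mul_le_mul_of_nonneg_left d1 (abs_nonneg ((ff (n+a+1) : ℝ) - ff n))
  have q2 := mul_le_mul_of_nonneg_left d2 (abs_nonneg ((ff (n+a) : ℝ) - ff n))
  refine (add_le_add (i1.trans q1) (i2.trans q2)).trans (le_of_eq ?_)
  ring

theorem Dl_sum (x : ℝ) (hx : 0 < x) (n : ℕ) (hn : 1200 ≤ n) : ∫ u in x/n..x, |Dl x u| ≤ x/401 * SW 1200 n := by
  induction n, hn using Nat.le_induction with
  | base =>
    have h1 : x/(1200:ℕ) ≤ x := div_le_self hx.le (by norm_num)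
    have : ∫ u in x/(1200:ℕ)..x, |Dl x u| = ∫ u in x/(1200:ℕ)..x, (0:ℝ) := by
      refine intervalIntegral.integral_congr_ae (Filter.Eventually.of_forall fun u hu => ?_)
      rw [Set.uIoc_of_le h1] at hu
      rw [Dl_zero x u hx (by exact_mod_cast hu.1) hu.2, abs_zero]
    rw [this]; simp [SW]
  | succ n hn ih =>
    have hp : 0 < n := by omega
    have hp' : (0:ℝ) < n := by exact_mod_cast hp
    rw [← intervalIntegral.integral_add_adjacent_intervals (Dl_int x _ (x/n) hx (by positivity) (by positivity)) (Dl_int x _ _ hx (by positivity) hx)]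
    have hs := Dl_step x hx n hp
    have e : SW 1200 (n+1) = SW 1200 n + (WW n : ℝ)/(n:ℝ)^2 := Finset.sum_Ico_succ_top hn _
    rw [e, mul_add]
    linarith
end PNTA
end

section
namespace PNTA
open MeasureTheory

theorem Dl_low (x V : ℝ) (hx : 0 < x) (hV : 1 ≤ V) : ∫ u in (1:ℝ)..V, |Dl x u| ≤ 0.000000000000005 * x * Real.log V + 957 * V := by
  have hVp : 0 < V := by linarith
  have hn : (0:ℝ) ∉ Set.uIcc 1 V := by rw [Set.uIcc_of_le hV]; intro h; linarith [h.1]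
  have hi : IntervalIntegrable (fun u : ℝ => u⁻¹) volume 1 V := by
    rw [intervalIntegrable_inv_iff]; right; exact hn
  have h1 : IntervalIntegrable (fun u : ℝ => 0.000000000000005 * x * u⁻¹) volume 1 V := hi.const_mul _
  have h2 : IntervalIntegrable (fun _ : ℝ => (957:ℝ)) volume 1 V := intervalIntegrable_const
  have := intervalIntegral.integral_mono_on hV (Dl_int x 1 V hx one_pos hVp) (h1.add h2) (fun u hu => by
    have := Dl_abs x u hx.le (by linarith [hu.1])
    show _ ≤ 0.000000000000005 * x * u⁻¹ + 957
    rwa [mul_assoc, ← div_eq_mul_inv])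
  rw [intervalIntegral.integral_add h1 h2, intervalIntegral.integral_const_mul, integral_inv_of_pos one_pos hVp] at this
  simp only [intervalIntegral.integral_const, smul_eq_mul, div_one] at this
  linarith

theorem gD_bound (x ε a b : ℝ) (hx : 0 < x) (ha : 1 ≤ a) (hab : a ≤ b) (hε : ∀ u, a ≤ u → u ≤ b → |RR u| ≤ ε * u) :
    |∫ u in a..b, gg u * Dl x u| ≤ ε * ∫ u in a..b, |Dl x u| := by
  rw [← Real.norm_eq_abs, ← intervalIntegral.integral_const_mul]
  refine intervalIntegral.norm_integral_le_of_norm_le hab (Filter.Eventually.of_forall fun u hu => ?_)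
    ((Dl_int x a b hx (by linarith) (by linarith)).const_mul ε)
  have hu1 : 1 ≤ u := ha.trans hu.1.le
  rw [Real.norm_eq_abs, abs_mul]
  refine mul_le_mul_of_nonneg_right ?_ (abs_nonneg _)
  rw [gg, if_pos hu1, abs_div, abs_of_pos (by linarith : 0 < u), div_le_iff₀ (by linarith)]
  exact hε u hu.1.le hu.2

theorem gD_total (x U ε : ℝ) (hU : 1 ≤ U) (hUx : U ≤ x) (hY : 4097200 ≤ x) (hε0 : 0 ≤ ε) (hε : ∀ u, U ≤ u → u ≤ x → |RR u| ≤ ε * u) :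
    |∫ u in (0:ℝ)..x, gg u * Dl x u| ≤ 5 * (0.000000000000005 * x * Real.log U + 957 * U) + 
      ε * (0.000000000000005 * x * Real.log x + 957 * (x/4097200) + x/401 * (535928897430/10^12)) := by
  have hx : 0 < x := by linarith
  have hi := gD_int x hx
  have e : ∫ u in (0:ℝ)..x, gg u * Dl x u = (∫ u in (0:ℝ)..1, gg u * Dl x u) + (∫ u in (1:ℝ)..U, gg u * Dl x u) + ∫ u in U..x, gg u * Dl x u := by
    rw [intervalIntegral.integral_add_adjacent_intervals (hi _ _) (hi _ _), intervalIntegral.integral_add_adjacent_intervals (hi _ _) (hi _ _)]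
  have e0 : ∫ u in (0:ℝ)..1, gg u * Dl x u = 0 := by
    have : ∫ u in (0:ℝ)..1, gg u * Dl x u = ∫ u in (0:ℝ)..1, (0:ℝ) := by
      refine intervalIntegral.integral_congr_ae ?_
      have h1 : ∀ᵐ u : ℝ, u ≠ 1 := by simp [ae_iff]
      filter_upwards [h1] with u hu hu'
      rw [Set.uIoc_of_le zero_le_one] at hu'
      rw [gg, if_neg (not_le.2 (lt_of_le_of_ne hu'.2 hu)), zero_mul]
    rw [this]; simp
  have b1 := gD_bound x 5 1 U hx le_rfl hU (fun u hu _ => RR_abs u hu)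
  have b2 := gD_bound x ε U x hx hU hUx hε
  have c1 := Dl_low x U hx hU
  have hxY : 1 ≤ x/4097200 := by rw [one_le_div (by norm_num)]; exact hY
  have hxY0 : 0 < x/4097200 := by linarith
  have c2 : ∫ u in U..x, |Dl x u| ≤ 0.000000000000005 * x * Real.log x + 957 * (x/4097200) + x/401 * (535928897430/10^12) := by
    have d1 : ∫ u in U..x, |Dl x u| ≤ ∫ u in (1:ℝ)..x, |Dl x u| := by
      rw [← intervalIntegral.integral_add_adjacent_intervals (Dl_int x 1 U hx one_pos (by linarith)) (Dl_int x U x hx (by linarith) hx)]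
      have := intervalIntegral.integral_nonneg (μ := volume) hU (fun u _ => abs_nonneg (Dl x u))
      linarith
    have d2 := Dl_low x (x/4097200) hx hxY
    have d3 := Dl_sum x hx 4097200 (by norm_num)
    have d4 := sk34
    rw [← intervalIntegral.integral_add_adjacent_intervals (Dl_int x 1 (x/4097200) hx one_pos hxY0) (Dl_int x (x/4097200) x hx hxY0 hx)] at d1
    have d5 : Real.log (x/4097200) ≤ Real.log x := Real.log_le_log hxY0 (div_le_self hx.le (by norm_num))
    have d6 := mul_le_mul_of_nonneg_left d4 (by positivity : 0 ≤ x/401)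
    have d7 := mul_le_mul_of_nonneg_left d5 (by positivity : 0 ≤ 0.000000000000005*x)
    push_cast at d3
    linarith
  rw [e, e0, zero_add]
  refine (abs_add_le _ _).trans (add_le_add (b1.trans ?_) (b2.trans ?_))
  · exact mul_le_mul_of_nonneg_left c1 (by norm_num)
  · exact mul_le_mul_of_nonneg_left c2 hε0

theorem E_int_bound (x : ℝ) (hx : 1 ≤ x) :
    |∫ z in x..401/400*x, (∑ n ∈ Finset.Ioc 0 ⌊z⌋₊, (aa n : ℝ) * RR (z/n)) / z| ≤ x/400 * (0.000000000004) + 957/400 * (3 + Real.log x) := by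
  have hxq : x ≤ 401/400*x := by linarith
  have := intervalIntegral.norm_integral_le_of_norm_le_const (a := x) (b := 401/400*x)
    (f := fun z => (∑ n ∈ Finset.Ioc 0 ⌊z⌋₊, (aa n : ℝ) * RR (z/n)) / z) (C := 0.000000000004 + 957*(3+Real.log x)/x) ?_
  · rw [abs_of_nonneg (by linarith : 0 ≤ 401/400*x - x)] at this
    refine this.trans (le_of_eq ?_)
    field_simp; ring
  · intro z hz
    rw [Set.uIoc_of_le hxq] at hz
    have hz0 : 1 ≤ z := hx.trans hz.1.le
    have hzp : 0 < z := by linarith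
    have h := E_bound z hz0
    rw [Real.norm_eq_abs, abs_div, abs_of_pos hzp]
    have l : Real.log z ≤ 1 + Real.log x := by
      have h1 : Real.log z ≤ Real.log (401/400*x) := Real.log_le_log hzp hz.2
      rw [Real.log_mul (by norm_num) (by linarith)] at h1
      have := Real.log_le_sub_one_of_pos (show (0:ℝ) < 401/400 by norm_num)
      linarith
    have lx := Real.log_nonneg hx
    calc _ ≤ (0.000000000004 * z + 957 * (3 + Real.log x)) / z := by gcongr; linarith
      _ = 0.000000000004 + 957 * (3 + Real.log x) / z := by field_simp
      _ ≤ _ := by gcongr; exact hz.1.le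

theorem gg_int_eq (x : ℝ) (hx : 1 ≤ x) : ∫ u in x..401/400*x, gg u = 
    (∫ z in x..401/400*x, (∑ n ∈ Finset.Ioc 0 ⌊z⌋₊, (aa n : ℝ) * RR (z/n)) / z) - ∫ u in (0:ℝ)..x, gg u * Dl x u := by
  have hx0 : 0 < x := by linarith
  have hxq : x ≤ 401/400*x := by linarith
  have hi := gD_int x hx0
  rw [gg_main x hx0, ← intervalIntegral.integral_add_adjacent_intervals (hi 0 x) (hi x (401/400*x)), add_sub_cancel_left]
  refine intervalIntegral.integral_congr_ae (Filter.Eventually.of_forall fun u hu => ?_)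
  rw [Set.uIoc_of_le hxq] at hu
  rw [Dl_top x u hx0 hu.1 hu.2, mul_one]

theorem gg_int_bound (x U ε : ℝ) (hU : 1 ≤ U) (hUx : U * Real.exp 28 ≤ x) (hxL : Real.log x ≤ 5200) (hε0 : 0 ≤ ε)
    (hε : ∀ u, U ≤ u → Real.log u ≤ 5200 → |RR u| ≤ ε * u) : |∫ u in x..401/400*x, gg u| ≤ x * (0.000000004 + 0.00157006 * ε) := by
  have he : (1400000000000:ℝ) ≤ Real.exp 28 := by
    have := Real.exp_one_gt_d9
    have h : Real.exp 28 = Real.exp 1 ^ 28 := by rw [← Real.exp_nat_mul]; norm_num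
    rw [h]
    calc (1400000000000:ℝ) ≤ 2.7182^28 := by norm_num
      _ ≤ _ := by gcongr; linarith
  have hx28 : Real.exp 28 ≤ x := by nlinarith
  have hxU : U ≤ x := by nlinarith
  have hx0 : 0 < x := by linarith
  have hU2 : U ≤ x / 1400000000000 := by rw [le_div_iff₀ (by norm_num)]; nlinarith
  have h1 := E_int_bound x (by linarith)
  have h2 := gD_total x U ε hU hxU (by linarith) hε0 (fun u h1 h2 => hε u h1 ((Real.log_le_log (by linarith) h2).trans hxL))
  have lU : Real.log U ≤ 5200 := (Real.log_le_log (by linarith) hxU).trans hxL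
  have lx : Real.log x ≤ 27 + x/1400000000000 := by
    have := Real.log_le_sub_one_of_pos (show 0 < x / Real.exp 28 by positivity)
    rw [Real.log_div hx0.ne' (Real.exp_pos _).ne', Real.log_exp] at this
    have : x / Real.exp 28 ≤ x / 1400000000000 := by gcongr
    linarith
  have k1 : (30:ℝ) ≤ 30 * (x / 1400000000000) := by
    have : 1 ≤ x/1400000000000 := by rw [one_le_div (by norm_num)]; linarith
    linarith
  have k2 := mul_le_mul_of_nonneg_left lU hx0.le
  have k3 := mul_le_mul_of_nonneg_left hxL hx0.le
  have k4 : ε * (0.000000000000005 * x * Real.log x + 957 * (x/4097200) + x/401 * (535928897430/10^12)) ≤ ε * (x * 0.00157006) := by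
    refine mul_le_mul_of_nonneg_left ?_ hε0
    norm_num at k3 ⊢
    linarith
  rw [gg_int_eq x (by linarith)]
  refine (abs_sub _ _).trans ((add_le_add h1 h2).trans ?_)
  norm_num at *
  linarith

theorem psi_step (x U ε : ℝ) (hU : 1 ≤ U) (hUx : U * Real.exp 29 ≤ x) (hxL : Real.log x ≤ 5200) (hε0 : 0 ≤ ε) 
    (hε : ∀ u, U ≤ u → Real.log u ≤ 5200 → |RR u| ≤ ε * u) : |RR x| ≤ (0.6289 * ε + 0.001254) * x := by
  have he28 : (1:ℝ) ≤ Real.exp 28 := Real.one_le_exp (by norm_num)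
  have he : 401/400 * Real.exp 28 ≤ Real.exp 29 := by
    rw [show (29:ℝ) = 1 + 28 by norm_num, Real.exp_add]
    have := Real.add_one_le_exp (1:ℝ)
    gcongr
    linarith
  have e29 : Real.exp 28 ≤ Real.exp 29 := Real.exp_le_exp.2 (by norm_num)
  have hx1 : 1 ≤ x := by nlinarith
  have hx0 : 0 < x := by linarith
  have lam1 : 2/801 ≤ Real.log (401/400) := by
    have := Real.le_log_one_add_of_nonneg (show (0:ℝ) ≤ 1/400 by norm_num)
    norm_num at this ⊢
    linarith
  have lam2 : Real.log (401/400) ≤ 0.002496883 := by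
    rw [Real.log_le_iff_le_exp (by norm_num)]
    have := Real.quadratic_le_exp_of_nonneg (show (0:ℝ) ≤ 0.002496883 by norm_num)
    refine le_trans ?_ this
    norm_num
  -- general two-sided estimate of the mean
  have mean : ∀ y, U * Real.exp 28 ≤ y → Real.log y ≤ 5200 → 
      Chebyshev.psi y * Real.log (401/400) ≤ y * (1/400 + 0.000000004 + 0.00157006 * ε) ∧ 
      y * (1/400 - 0.000000004 - 0.00157006 * ε) ≤ Chebyshev.psi (401/400*y) * Real.log (401/400) := by
    intro y hy hyL
    have hy1 : 1 ≤ y := by nlinarith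
    have hy0 : 0 < y := by linarith
    have hyq : y ≤ 401/400*y := by linarith
    have hb := gg_int_bound y U ε hU hy hyL hε0 hε
    have hn : (0:ℝ) ∉ Set.uIcc y (401/400*y) := by rw [Set.uIcc_of_le hyq]; intro h; linarith [h.1]
    have ii : IntervalIntegrable (fun u : ℝ => u⁻¹) volume y (401/400*y) := by
      rw [intervalIntegrable_inv_iff]; right; exact hn
    have ig : IntervalIntegrable gg volume y (401/400*y) := by
      rw [intervalIntegrable_iff_integrableOn_Ioc_of_le hyq]; exact gg_int _ _
    have i1 : IntervalIntegrable (fun u : ℝ => gg u + 1) volume y (401/400*y) := ig.add intervalIntegrable_const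
    have il : ∫ u in y..401/400*y, u⁻¹ = Real.log (401/400) := by
      rw [integral_inv_of_pos hy0 (by positivity)]; congr 1; field_simp
    have is : ∫ u in y..401/400*y, (gg u + 1) = (∫ u in y..401/400*y, gg u) + y/400 := by
      rw [intervalIntegral.integral_add ig intervalIntegrable_const]
      simp only [intervalIntegral.integral_const, smul_eq_mul]; ring
    have eg : ∀ u, y ≤ u → gg u + 1 = Chebyshev.psi u * u⁻¹ := by
      intro u hu
      have : 0 < u := by linarith
      rw [gg, if_pos (by linarith), RR]; field_simp; ring
    rw [abs_le] at hb
    constructor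
    · have := intervalIntegral.integral_mono_on hyq (ii.const_mul (Chebyshev.psi y)) i1 (fun u hu => by
        rw [eg u hu.1]
        have : 0 < u := by linarith [hu.1]
        exact mul_le_mul_of_nonneg_right (Chebyshev.psi_mono hu.1) (by positivity))
      rw [intervalIntegral.integral_const_mul, il, is] at this
      linarith [hb.2]
    · have := intervalIntegral.integral_mono_on hyq i1 (ii.const_mul (Chebyshev.psi (401/400*y))) (fun u hu => by
        rw [eg u hu.1]
        have : 0 < u := by linarith [hu.1]
        exact mul_le_mul_of_nonneg_right (Chebyshev.psi_mono hu.2) (by positivity))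
      rw [intervalIntegral.integral_const_mul, il, is] at this
      linarith [hb.1]
  have up := (mean x (by nlinarith) hxL).1
  have hlo : U * Real.exp 28 ≤ 400/401*x := by nlinarith
  have dn := (mean (400/401*x) hlo ((Real.log_le_log (by positivity) (by linarith)).trans hxL)).2
  rw [show 401/400*(400/401*x) = x by ring] at dn
  have p0 := Chebyshev.psi_nonneg x
  have up' := (mul_le_mul_of_nonneg_left lam1 p0).trans up
  have dn' := dn.trans (mul_le_mul_of_nonneg_left lam2 p0)
  have hεx : 0 ≤ ε * x := by positivity
  rw [RR, abs_le]
  constructor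
  · norm_num at *; nlinarith
  · norm_num at *; nlinarith
end PNTA
end

section
namespace PNTA
open Finset

noncomputable def TT (w : ℝ) : ℝ := Real.log (⌊w⌋₊.factorial)

theorem TT_bound (w : ℝ) (hw : 1 ≤ w) : |TT w - (w * Real.log w - w + 1)| ≤ Real.log w := by
  set N := ⌊w⌋₊ with hN
  have hNp : 0 < N := Nat.floor_pos.2 hw
  have hp : (1:ℝ) ≤ N := by exact_mod_cast hNp
  have hNw : (N:ℝ) ≤ w := Nat.floor_le (by linarith)
  have hwN : w < N + 1 := Nat.lt_floor_add_one w
  obtain ⟨f1, f2⟩ := log_fact_bounds N hNp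
  have lN : 0 ≤ Real.log N := Real.log_nonneg hp
  have lw : Real.log N ≤ Real.log w := Real.log_le_log (by linarith) hNw
  have e1 : Real.log w - Real.log N ≤ w/N - 1 := by
    rw [← Real.log_div (by linarith) (by linarith)]
    exact Real.log_le_sub_one_of_pos (by positivity)
  have e2 : (N:ℝ) * (Real.log w - Real.log N) ≤ w - N := by
    calc _ ≤ (N:ℝ) * (w/N - 1) := by gcongr
      _ = _ := by field_simp
  have m1 : (w - N) * Real.log w ≤ Real.log w := by nlinarith
  have e3 : 1 - N/w ≤ Real.log w - Real.log N := by
    rw [← Real.log_div (by linarith) (by linarith)]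
    have := Real.one_sub_inv_le_log_of_pos (show 0 < w/N by positivity)
    rwa [inv_div] at this
  have e4 : w - N ≤ w * (Real.log w - Real.log N) := by
    calc _ = w * (1 - N/w) := by field_simp
      _ ≤ _ := by gcongr
  have m2 : 0 ≤ (w - N) * Real.log N := mul_nonneg (by linarith) lN
  rw [TT, abs_le]
  constructor <;> nlinarith

theorem TT_eq (w : ℝ) (x : ℝ) (d : ℕ) (hd : 0 < d) (hw : w = x/d) : TT w = ∑ n ∈ Ioc 0 ⌊x⌋₊, ArithmeticFunction.vonMangoldt n * ((⌊x⌋₊ / d / n : ℕ):ℝ) := by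
  have hf : ⌊w⌋₊ = ⌊x⌋₊ / d := by rw [hw, Nat.floor_div_natCast]
  have h := ArithmeticFunction.sum_Ioc_mul_zeta_eq_sum (R := ℝ) ArithmeticFunction.vonMangoldt ⌊w⌋₊
  rw [ArithmeticFunction.vonMangoldt_mul_zeta] at h
  have e : ∀ N : ℕ, ∑ n ∈ Ioc 0 N, ArithmeticFunction.log n = Real.log N.factorial := by
    intro N
    induction N with
    | zero => simp
    | succ N ih =>
      rw [← Finset.insert_Ioc_right_eq_Ioc_add_one (Nat.zero_le N), Finset.sum_insert (by simp), ih, Nat.factorial_succ, ArithmeticFunction.log_apply]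
      push_cast
      rw [Real.log_mul (by positivity) (by positivity)]
  rw [TT, ← e, h, hf]
  refine Finset.sum_subset (Finset.Ioc_subset_Ioc_right (Nat.div_le_self _ _)) fun n hn hn' => ?_
  rw [Finset.mem_Ioc] at hn hn'
  have : ⌊x⌋₊ / d / n = 0 := Nat.div_eq_of_lt (by omega)
  rw [this]; simp

theorem cheb_comb (n : ℕ) : n/2 + n/3 + n/5 ≤ n + n/30 ∧ n + n/30 ≤ n/2 + n/3 + n/5 + 1 ∧ 
    (1 ≤ n → n < 6 → n + n/30 = n/2 + n/3 + n/5 + 1) := by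
  omega

noncomputable def VV (x : ℝ) : ℝ := TT x - TT (x/2) - TT (x/3) - TT (x/5) + TT (x/30)

theorem VV_eq (x : ℝ) : VV x = ∑ n ∈ Ioc 0 ⌊x⌋₊, ArithmeticFunction.vonMangoldt n *
    (((⌊x⌋₊/n : ℕ):ℝ) - ((⌊x⌋₊/n/2 : ℕ):ℝ) - ((⌊x⌋₊/n/3 : ℕ):ℝ) - ((⌊x⌋₊/n/5 : ℕ):ℝ) + ((⌊x⌋₊/n/30 : ℕ):ℝ)) := by
  rw [VV, TT_eq x x 1 one_pos (by simp), TT_eq (x/2) x 2 two_pos (by simp), TT_eq (x/3) x 3 (by norm_num) (by simp),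
    TT_eq (x/5) x 5 (by norm_num) (by simp), TT_eq (x/30) x 30 (by norm_num) (by simp), ← Finset.sum_sub_distrib, ← Finset.sum_sub_distrib,
    ← Finset.sum_sub_distrib, ← Finset.sum_add_distrib]
  refine Finset.sum_congr rfl fun n _ => ?_
  rw [Nat.div_one, Nat.div_right_comm _ 2, Nat.div_right_comm _ 3, Nat.div_right_comm _ 5, Nat.div_right_comm _ 30]
  ring

theorem VV_le_psi (x : ℝ) : VV x ≤ Chebyshev.psi x := by
  rw [VV_eq, Chebyshev.psi]
  refine Finset.sum_le_sum fun n _ => ?_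
  refine mul_le_of_le_one_right ArithmeticFunction.vonMangoldt_nonneg ?_
  have := (cheb_comb (⌊x⌋₊/n)).2.1
  have h : ((⌊x⌋₊/n : ℕ):ℝ) + ((⌊x⌋₊/n/30 : ℕ):ℝ) ≤ ((⌊x⌋₊/n/2 : ℕ):ℝ) + ((⌊x⌋₊/n/3 : ℕ):ℝ) + ((⌊x⌋₊/n/5 : ℕ):ℝ) + 1 := by
    exact_mod_cast this
  linarith

theorem psi_le_VV (x : ℝ) : Chebyshev.psi x ≤ Chebyshev.psi (x/6) + VV x := by
  have hf : ⌊x/6⌋₊ = ⌊x⌋₊/6 := by exact_mod_cast Nat.floor_div_natCast x 6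
  have e : Chebyshev.psi (x/6) = ∑ n ∈ Ioc 0 ⌊x⌋₊, (if n ≤ ⌊x⌋₊/6 then ArithmeticFunction.vonMangoldt n else 0) := by
    rw [Chebyshev.psi, hf, ← Finset.sum_filter]
    congr 1
    ext n
    simp only [Finset.mem_Ioc, Finset.mem_filter]
    have := Nat.div_le_self ⌊x⌋₊ 6
    constructor
    · rintro ⟨h1, h2⟩; exact ⟨⟨h1, h2.trans this⟩, h2⟩
    · rintro ⟨⟨h1, _⟩, h2⟩; exact ⟨h1, h2⟩
  rw [e, VV_eq, Chebyshev.psi, ← Finset.sum_add_distrib]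
  refine Finset.sum_le_sum fun n hn => ?_
  obtain ⟨h1, h2⟩ := Finset.mem_Ioc.1 hn
  have hv := ArithmeticFunction.vonMangoldt_nonneg (n := n)
  obtain ⟨c1, _, c3⟩ := cheb_comb (⌊x⌋₊/n)
  split_ifs with h
  · refine le_add_of_nonneg_right (mul_nonneg hv ?_)
    have h : ((⌊x⌋₊/n/2 : ℕ):ℝ) + ((⌊x⌋₊/n/3 : ℕ):ℝ) + ((⌊x⌋₊/n/5 : ℕ):ℝ) ≤ ((⌊x⌋₊/n : ℕ):ℝ) + ((⌊x⌋₊/n/30 : ℕ):ℝ) := by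
      exact_mod_cast c1
    linarith
  · have c4 := c3 ((Nat.one_le_div_iff h1).2 h2) (by
      rw [Nat.div_lt_iff_lt_mul h1]
      rw [not_le, Nat.div_lt_iff_lt_mul (by norm_num)] at h
      linarith)
    have h : ((⌊x⌋₊/n : ℕ):ℝ) + ((⌊x⌋₊/n/30 : ℕ):ℝ) = ((⌊x⌋₊/n/2 : ℕ):ℝ) + ((⌊x⌋₊/n/3 : ℕ):ℝ) + ((⌊x⌋₊/n/5 : ℕ):ℝ) + 1 := by
      exact_mod_cast c4
    rw [show ((⌊x⌋₊/n : ℕ):ℝ) - ((⌊x⌋₊/n/2 : ℕ):ℝ) - ((⌊x⌋₊/n/3 : ℕ):ℝ) - ((⌊x⌋₊/n/5 : ℕ):ℝ) + ((⌊x⌋₊/n/30 : ℕ):ℝ) = 1 by linarith]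
    linarith

theorem log35 : 1.098612 ≤ Real.log 3 ∧ Real.log 3 ≤ 1.098613 ∧ 1.609437 ≤ Real.log 5 ∧ Real.log 5 ≤ 1.609439 := by
  have h1 := Real.log_three_gt_d9
  have h2 := Real.log_three_lt_d9
  have h3 := Real.log_five_gt_d9
  have h4 := Real.log_five_lt_d9
  refine ⟨?_, ?_, ?_, ?_⟩ <;> linarith

theorem log30 : Real.log 30 = Real.log 2 + Real.log 3 + Real.log 5 := by
  rw [← Real.log_mul (by norm_num) (by norm_num), ← Real.log_mul (by norm_num) (by norm_num)]; norm_num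

theorem VV_bound (x : ℝ) (hx : 30 ≤ x) : |VV x - (Real.log 2/2 + Real.log 3/3 + Real.log 5/5 - Real.log 30/30) * x| ≤ 5 * Real.log x := by
  have t1 := TT_bound x (by linarith)
  have t2 := TT_bound (x/2) (by linarith)
  have t3 := TT_bound (x/3) (by linarith)
  have t5 := TT_bound (x/5) (by linarith)
  have t30 := TT_bound (x/30) (by linarith)
  have hx0 : x ≠ 0 := by linarith
  rw [Real.log_div hx0 (by norm_num)] at t2 t3 t5 t30
  have l2 := Real.log_two_gt_d9
  have l3 := log35.1
  have l5 := log35.2.2.1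
  rw [log30] at t30 ⊢
  rw [VV]
  rw [abs_le] at t1 t2 t3 t5 t30 ⊢
  obtain ⟨a1, b1⟩ := t1
  obtain ⟨a2, b2⟩ := t2
  obtain ⟨a3, b3⟩ := t3
  obtain ⟨a5, b5⟩ := t5
  obtain ⟨a30, b30⟩ := t30
  constructor <;> (ring_nf at *; linarith)

theorem AA_bounds : 0.92129 ≤ (Real.log 2/2 + Real.log 3/3 + Real.log 5/5 - Real.log 30/30) ∧
    (Real.log 2/2 + Real.log 3/3 + Real.log 5/5 - Real.log 30/30) ≤ 0.921294 := by
  rw [log30]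
  have h1 := Real.log_three_gt_d9
  have h2 := Real.log_three_lt_d9
  have h3 := Real.log_five_gt_d9
  have h4 := Real.log_five_lt_d9
  have h5 := Real.log_two_gt_d9
  have h6 := Real.log_two_lt_d9
  constructor <;> linarith

theorem psi_lower (x : ℝ) (hx : 30 ≤ x) : 0.92129 * x - 5 * Real.log x ≤ Chebyshev.psi x := by
  have h1 := VV_le_psi x
  have h2 := (abs_le.1 (VV_bound x hx)).1
  have h3 := mul_le_mul_of_nonneg_right AA_bounds.1 (by linarith : (0:ℝ) ≤ x)
  linarith

theorem psi_thirty : Chebyshev.psi 30 ≤ 30 := by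
  have h := Chebyshev.psi_eq_log_lcmUpto 30
  have e : (Nat.lcmUpto 30) = 2329089562800 := by decide +kernel
  norm_num at h
  rw [h, e]
  rw [Real.log_le_iff_le_exp (by norm_num)]
  have := Real.exp_one_gt_d9
  have h2 : Real.exp 30 = (Real.exp 1)^30 := by rw [← Real.exp_nat_mul]; norm_num
  rw [h2]
  calc (_:ℝ) ≤ 2.7^30 := by norm_num
    _ ≤ _ := by gcongr; linarith

theorem psi_upper_aux (n : ℕ) : ∀ x : ℝ, 1 ≤ x → x ≤ 30 * 6^n →
    Chebyshev.psi x ≤ 1.1055528 * x + 1.4 * Real.log x ^ 2 + 2.52 * Real.log x + 30 := by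
  induction n with
  | zero =>
    intro x h1 h2
    have := Chebyshev.psi_mono (show x ≤ 30 by linarith)
    have h3 := psi_thirty
    have h4 := Real.log_nonneg h1
    have := sq_nonneg (Real.log x)
    linarith
  | succ n ih =>
    intro x h1 h2
    by_cases hx : x ≤ 30 
    · have := Chebyshev.psi_mono hx
      have h3 := psi_thirty
      have h4 := Real.log_nonneg h1
      have := sq_nonneg (Real.log x)
      linarith
    · push Not at hx
      have i := ih (x/6) (by linarith) (by rw [pow_succ] at h2; linarith)
      have v := (abs_le.1 (VV_bound x hx.le)).2
      have h3 := mul_le_mul_of_nonneg_right AA_bounds.2 (by linarith : (0:ℝ) ≤ x)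
      have p := psi_le_VV x
      have l6 : Real.log 6 = Real.log 2 + Real.log 3 := by
        rw [← Real.log_mul (by norm_num) (by norm_num)]; norm_num
      have g1 := Real.log_three_gt_d9
      have g2 := Real.log_three_lt_d9
      have g5 := Real.log_two_gt_d9
      have g6 := Real.log_two_lt_d9
      rw [Real.log_div (by linarith) (by norm_num)] at i
      have h6 : 1.79175 ≤ Real.log 6 := by linarith
      have h7 : Real.log 6 ≤ 1.79177 := by linarith
      have h8 : 0 ≤ Real.log x := Real.log_nonneg h1
      nlinarith [mul_nonneg h8 (sub_nonneg.2 h6)]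

theorem psi_upper (x : ℝ) (hx : 1 ≤ x) :
    Chebyshev.psi x ≤ 1.1055528 * x + 1.4 * Real.log x ^ 2 + 2.52 * Real.log x + 30 := by
  obtain ⟨n, hn⟩ := pow_unbounded_of_one_lt x (show (1:ℝ) < 6 by norm_num)
  exact psi_upper_aux n x hx (by linarith)

theorem log4000 : 8.29404 ≤ Real.log 4000 ∧ Real.log 4000 ≤ 8.29406 := by
  have e : Real.log 4000 = 5 * Real.log 2 + 3 * Real.log 5 := by
    rw [show (4000:ℝ) = 2^5*5^3 by norm_num, Real.log_mul (by norm_num) (by norm_num), Real.log_pow, Real.log_pow]; norm_num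
  have h3 := Real.log_five_gt_d9
  have h4 := Real.log_five_lt_d9
  have h5 := Real.log_two_gt_d9
  have h6 := Real.log_two_lt_d9
  rw [e]
  constructor <;> linarith

theorem RR_base (x : ℝ) (hx : 4000 ≤ x) : |RR x| ≤ 0.145 * x := by
  have h1 := psi_upper x (by linarith)
  have h2 := psi_lower x (by linarith)
  obtain ⟨l1, l2⟩ := log4000
  have hx0 : 0 < x := by linarith
  obtain ⟨s, hs⟩ : ∃ s, s = Real.log x - Real.log 4000 := ⟨_, rfl⟩
  have hs0 : 0 ≤ s := by rw [hs]; exact sub_nonneg.2 (Real.log_le_log (by norm_num) hx)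
  have hxs : x = 4000 * Real.exp s := by
    rw [hs, Real.exp_sub, Real.exp_log hx0, Real.exp_log (by norm_num)]; field_simp
  have hq := Real.quadratic_le_exp_of_nonneg hs0
  have hL : Real.log x = Real.log 4000 + s := by linarith
  rw [hL] at h1 h2
  have k : 1.4 * (Real.log 4000 + s)^2 + 2.52 * (Real.log 4000 + s) + 30 ≤ 0.039 * x := by
    nlinarith
  rw [RR, abs_le]
  constructor <;> nlinarith
end PNTA
end

section
namespace PNTA
open MeasureTheory

def QQ (a ε : ℝ) : Prop := ∀ u : ℝ, 0 < u → a ≤ Real.log u → Real.log u ≤ 5200 → |RR u| ≤ ε * u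

theorem QQ_step (a ε b δ : ℝ) (ha : 0 ≤ a) (hε : 0 ≤ ε) (h : QQ a ε) (hb : a + 29 ≤ b)
    (hδ : 0.6289 * ε + 0.001254 ≤ δ) : QQ b δ := by
  intro u hu h1 h2
  have := psi_step u (Real.exp a) ε (Real.one_le_exp ha) (by
    rw [← Real.exp_add, ← Real.le_log_iff_exp_le hu]; linarith) h2 hε (fun v hv hv2 =>
      h v (lt_of_lt_of_le (Real.exp_pos a) hv) (by
        rw [Real.le_log_iff_exp_le (lt_of_lt_of_le (Real.exp_pos a) hv)]; exact hv) hv2)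
  exact this.trans (mul_le_mul_of_nonneg_right hδ hu.le)

theorem QQ0 : QQ 8.29406 0.145 := by
  intro u hu h1 h2
  refine RR_base u ?_
  by_contra h
  push Not at h
  have := Real.log_lt_log hu h
  linarith [log4000.2]

theorem QQ1 : QQ 37.3 0.09245 := QQ_step _ _ _ _ (by norm_num) (by norm_num) QQ0 (by norm_num) (by norm_num)
theorem QQ2 : QQ 66.3 0.0594 := QQ_step _ _ _ _ (by norm_num) (by norm_num) QQ1 (by norm_num) (by norm_num)
theorem QQ3 : QQ 95.3 0.03862 := QQ_step _ _ _ _ (by norm_num) (by norm_num) QQ2 (by norm_num) (by norm_num)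
theorem QQ4 : QQ 124.3 0.02555 := QQ_step _ _ _ _ (by norm_num) (by norm_num) QQ3 (by norm_num) (by norm_num)
theorem QQ5 : QQ 153.3 0.01733 := QQ_step _ _ _ _ (by norm_num) (by norm_num) QQ4 (by norm_num) (by norm_num)
theorem QQ6 : QQ 182.3 0.01216 := QQ_step _ _ _ _ (by norm_num) (by norm_num) QQ5 (by norm_num) (by norm_num)
theorem QQ7 : QQ 211.3 0.00891 := QQ_step _ _ _ _ (by norm_num) (by norm_num) QQ6 (by norm_num) (by norm_num)

theorem QQn (n : ℕ) : QQ (211.3 + 29 * n) (0.00338 + 0.00553 * 0.6289^n) := by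
  induction n with
  | zero => have := QQ7; norm_num at *; exact this
  | succ n ih =>
    refine QQ_step _ _ _ _ (by positivity) (by positivity) ih ?_ ?_
    · push_cast; linarith
    · rw [pow_succ]; nlinarith

theorem QQ20 : QQ 588.3 0.0034 := by
  have h := QQn 13
  intro u hu h1 h2
  refine (h u hu (by norm_num; linarith) h2).trans (mul_le_mul_of_nonneg_right (by norm_num) hu.le)
end PNTA
end

section
namespace PNTC

theorem crit (x L B k m : ℝ) (hx : 0 < x) (hL : L = Real.log x) (hL3 : 3 ≤ L) (hB : -1 ≤ B)
    (hk : k ≤ x / L * (1 + (B+1)/L)) (hc : Real.exp (B-1) ≤ (L-2-B)*L) (hm : 3 ≤ m) :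
    k * m - x < (m-1) * Real.exp (m+1) := by
  obtain ⟨d, hd⟩ : ∃ d, d = L - 1 - m := ⟨_, rfl⟩
  have hL0 : 0 < L := by linarith
  have hm' : m = L - 1 - d := by linarith
  have e1 : Real.exp (m+1) = x * Real.exp (-d) := by
    rw [show m + 1 = L + -d by rw [hm']; ring, Real.exp_add, hL, Real.exp_log hx]
  rw [e1]
  have h1 : k * m ≤ x / L * (1 + (B+1)/L) * m := mul_le_mul_of_nonneg_right hk (by linarith)
  have h2 : x / L * (1 + (B+1)/L) * m - x = x / L * (B - d - (B+1)*(1+d)/L) := by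
    rw [hm']; field_simp; ring
  have hE := Real.exp_pos (-d)
  have hE' := Real.exp_pos d
  have hEE : Real.exp d * Real.exp (-d) = 1 := by rw [← Real.exp_add]; simp
  have key : (B - d - (B+1)*(1+d)/L) * Real.exp d < (m-1) * L := by
    have hp : 0 < (L-2-B)*L := lt_of_lt_of_le (Real.exp_pos _) hc
    have hB2 : B < L - 2 := by
      by_contra h
      push Not at h
      nlinarith
    by_cases hd1 : -1 ≤ d
    · have hbr : B - d - (B+1)*(1+d)/L ≤ B - d := by
        have : 0 ≤ (B+1)*(1+d)/L := by
          apply div_nonneg (mul_nonneg (by linarith) (by linarith)) hL0.le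
        linarith
      by_cases hdB : B ≤ d
      · have : (B - d - (B+1)*(1+d)/L) * Real.exp d ≤ 0 :=
          mul_nonpos_of_nonpos_of_nonneg (by linarith) hE'.le
        have : 0 < (m-1)*L := mul_pos (by linarith) hL0
        linarith
      · push Not at hdB
        have s1 : (B - d) * Real.exp d ≤ Real.exp (B-1) := by
          have := Real.add_one_le_exp (B - d - 1)
          have e : Real.exp (B-1) = Real.exp (B-d-1) * Real.exp d := by
            rw [← Real.exp_add]; congr 1; ring
          rw [e]
          exact mul_le_mul_of_nonneg_right (by linarith) hE'.le
        have s2 := mul_le_mul_of_nonneg_right hbr hE'.le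
        have s3 : (L-2-B)*L < (m-1)*L := mul_lt_mul_of_pos_right (by linarith) hL0
        linarith
    · push Not at hd1
      have s1 : (B - d - (B+1)*(1+d)/L) ≤ (B+2) * (-d) := by
        have : (B+1)*(-(1+d))/L ≤ (B+1)*(-(1+d)) := by
          apply div_le_self (mul_nonneg (by linarith) (by linarith)) (by linarith)
        have e : (B+1)*(-(1+d))/L = -((B+1)*(1+d)/L) := by ring
        nlinarith
      have s2 : (-d) * Real.exp d < 1 := by
        have := Real.add_one_le_exp (-d)
        nlinarith
      have s3 := mul_le_mul_of_nonneg_right s1 hE'.le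
      nlinarith
  have : x / L * (B - d - (B+1)*(1+d)/L) < (m-1) * (x * Real.exp (-d)) := by
    have h3 : x / L * (B - d - (B+1)*(1+d)/L) = (x / L * Real.exp (-d)) * ((B - d - (B+1)*(1+d)/L) * Real.exp d) := by
      linear_combination (-(x / L * (B - d - (B+1)*(1+d)/L))) * hEE
    rw [h3]
    calc _ < (x / L * Real.exp (-d)) * ((m-1)*L) := mul_lt_mul_of_pos_left key (by positivity)
      _ = _ := by field_simp
  linarith

noncomputable def GG (t : ℝ) : ℝ := t * ((Real.log t ^ 2)⁻¹ + 8 * (Real.log t ^ 3)⁻¹)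

theorem GG_deriv (t : ℝ) (ht : 1 < t) : HasDerivAt GG
    ((Real.log t ^ 2)⁻¹ + 6 * (Real.log t ^ 3)⁻¹ - 24 * (Real.log t ^ 4)⁻¹) t := by
  have hl : 0 < Real.log t := Real.log_pos ht
  have h0 : HasDerivAt Real.log t⁻¹ t := Real.hasDerivAt_log (by linarith)
  have h1 := (h0.pow 2).inv (by show Real.log t ^ 2 ≠ 0; positivity)
  have h2 := (h0.pow 3).inv (by show Real.log t ^ 3 ≠ 0; positivity)
  have h3 := (hasDerivAt_id t).mul (h1.add (h2.const_mul 8))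
  refine HasDerivAt.congr_deriv (f := GG) h3 ?_
  have : t ≠ 0 := by linarith
  simp
  field_simp
  ring

theorem log55 : 4 ≤ Real.log 55 := by
  rw [Real.le_log_iff_exp_le (by norm_num)]
  have := Real.exp_one_lt_d9
  have h2 : Real.exp 4 = (Real.exp 1)^4 := by rw [← Real.exp_nat_mul]; norm_num
  rw [h2]
  calc _ ≤ (2.7182818286:ℝ)^4 := by gcongr
    _ ≤ _ := by norm_num

theorem pi55 : Nat.primeCounting 55 = 16 := by decide +kernel

theorem log4_le : Real.log 4 ≤ 1.3863 := by
  rw [show (4:ℝ) = 2^2 by norm_num, Real.log_pow]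
  have := Real.log_two_lt_d9
  norm_num; linarith

open MeasureTheory in
theorem J_bound (x : ℝ) (hx : 55 ≤ x) :
    ∫ t in (2:ℝ)..x, Chebyshev.theta t / (t * Real.log t ^ 2) ≤ 16 + 1.3863 * GG x := by
  have hi : ∀ a b : ℝ, 2 ≤ a → a ≤ b → IntervalIntegrable (fun t ↦ Chebyshev.theta t / (t * Real.log t ^ 2)) volume a b := by
    intro a b ha hab
    rw [intervalIntegrable_iff_integrableOn_Icc_of_le hab]
    exact (Chebyshev.integrableOn_theta_div_id_mul_log_sq b).mono_set (Set.Icc_subset_Icc_left ha)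
  rw [← intervalIntegral.integral_add_adjacent_intervals (hi 2 55 (by norm_num) (by norm_num)) (hi 55 x (by norm_num) hx)]
  have h1 := Chebyshev.primeCounting_eq_theta_div_log_add_integral (x := 55) (by norm_num)
  have h2 : 0 ≤ Chebyshev.theta 55 / Real.log 55 := div_nonneg (Chebyshev.theta_nonneg _) (by linarith [log55])
  have h3 : ⌊(55:ℝ)⌋₊ = 55 := by norm_num
  rw [h3, pi55] at h1
  norm_num at h1
  have hG : ContinuousOn (fun t => ((Real.log t ^ 2)⁻¹ + 6 * (Real.log t ^ 3)⁻¹ - 24 * (Real.log t ^ 4)⁻¹)) (Set.uIcc 55 x) := by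
    rw [Set.uIcc_of_le hx]
    intro t ht
    have : 0 < Real.log t := Real.log_pos (by linarith [ht.1])
    have : t ≠ 0 := by linarith [ht.1]
    apply ContinuousAt.continuousWithinAt
    fun_prop (disch := positivity)
  have h4 : ∫ t in (55:ℝ)..x, ((Real.log t ^ 2)⁻¹ + 6 * (Real.log t ^ 3)⁻¹ - 24 * (Real.log t ^ 4)⁻¹) = GG x - GG 55 := by
    refine intervalIntegral.integral_eq_sub_of_hasDerivAt (fun t ht => GG_deriv t ?_) hG.intervalIntegrable
    rw [Set.uIcc_of_le hx] at ht
    linarith [ht.1]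
  have h5 : ∫ t in (55:ℝ)..x, Chebyshev.theta t / (t * Real.log t ^ 2) ≤ ∫ t in (55:ℝ)..x, 1.3863 * ((Real.log t ^ 2)⁻¹ + 6 * (Real.log t ^ 3)⁻¹ - 24 * (Real.log t ^ 4)⁻¹) := by
    refine intervalIntegral.integral_mono_on hx (hi 55 x (by norm_num) hx) (hG.intervalIntegrable.const_mul _) ?_
    intro t ht
    have ht0 : 0 < t := by linarith [ht.1]
    have hl : 4 ≤ Real.log t := log55.trans (Real.log_le_log (by norm_num) ht.1)
    have hl0 : 0 < Real.log t := by linarith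
    have hth := Chebyshev.theta_le_log4_mul_x ht0.le
    have a1 : Chebyshev.theta t / (t * Real.log t ^ 2) ≤ 1.3863 * (Real.log t ^ 2)⁻¹ := by
      rw [div_le_iff₀ (by positivity)]
      have : 1.3863 * (Real.log t ^ 2)⁻¹ * (t * Real.log t ^ 2) = 1.3863 * t := by field_simp
      rw [this]
      exact hth.trans (mul_le_mul_of_nonneg_right log4_le ht0.le)
    have a2 : 24 * (Real.log t ^ 4)⁻¹ ≤ 6 * (Real.log t ^ 3)⁻¹ := by
      have : 6 * (Real.log t ^ 3)⁻¹ = 6 * Real.log t * (Real.log t ^ 4)⁻¹ := by field_simp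
      rw [this]
      exact mul_le_mul_of_nonneg_right (by linarith) (by positivity)
    linarith
  rw [intervalIntegral.integral_const_mul, h4] at h5
  have h6 : 0 ≤ GG 55 := by
    have := log55
    have : 0 < Real.log 55 := by linarith
    unfold GG; positivity
  linarith

theorem pi_bound (x L ε B η : ℝ) (hx : 55 ≤ x) (hL : L = Real.log x) 
    (hψ : Chebyshev.psi x ≤ (1 + ε) * x) (hη : 16 * L^2 ≤ η * x)
    (hB : ε * L + 1.3863 * (1 + 8/L) + η - 1 ≤ B) :
    (Nat.primeCounting ⌊x⌋₊ : ℝ) ≤ x / L * (1 + (B+1)/L) := by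
  have h1 := Chebyshev.primeCounting_eq_theta_div_log_add_integral (x := x) (by linarith)
  have h2 := J_bound x hx
  have h3 := (Chebyshev.theta_le_psi x).trans hψ
  have hL0 : 0 < L := by
    rw [hL]; exact Real.log_pos (by linarith)
  have hx0 : 0 < x := by linarith
  rw [h1]
  rw [GG] at h2
  rw [← hL] at *
  have h4 : Chebyshev.theta x / L ≤ (1+ε)*x/L := by gcongr
  have h5 : 16 ≤ x / L^2 * η := by
    rw [div_mul_eq_mul_div, le_div_iff₀ (by positivity)]; linarith
  have h6 : x / L^2 * (ε * L + 1.3863 * (1 + 8/L) + η) ≤ x / L^2 * (B+1) := by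
    apply mul_le_mul_of_nonneg_left (by linarith) (by positivity)
  have e1 : x / L^2 * (ε * L + 1.3863 * (1 + 8/L) + η) = (1+ε)*x/L - x / L + 1.3863 * (x * ((L ^ 2)⁻¹ + 8 * (L ^ 3)⁻¹)) + x / L^2 * η := by
    field_simp; ring
  have e2 : x / L * (1 + (B+1)/L) = x / L + x / L^2 * (B+1) := by
    field_simp
  linarith

end PNTC
end

section
namespace PNTC

theorem pi_lin (N : ℕ) : 30 * Nat.primeCounting N ≤ 300 + 8 * N := by
  have h31 : Nat.primeCounting' 31 = 10 := by decide +kernel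
  by_cases h : 30 ≤ N
  · obtain ⟨n, rfl⟩ := Nat.exists_eq_add_of_le h
    have h1 := Nat.primeCounting'_add_le (a := 30) (k := 31) (by norm_num) (by norm_num) n
    have h2 : Nat.totient 30 = 8 := by decide +kernel
    rw [h31, h2] at h1
    have h3 : Nat.primeCounting (30+n) = Nat.primeCounting' (31 + n) := by
      rw [Nat.primeCounting]; congr 1; omega
    rw [h3]
    omega
  · push Not at h
    have h4 : Nat.primeCounting N ≤ Nat.primeCounting 30 := Nat.monotone_primeCounting h.le
    have h5 : Nat.primeCounting 30 = 10 := h31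
    omega

theorem small (m N : ℕ) (hm : 3 ≤ m) (hN : N ≤ 4000) :
    (Nat.primeCounting N : ℝ) * m - N < ((m:ℝ)-1) * Real.exp ((m:ℝ)+1) := by
  have hk : 30 * (Nat.primeCounting N : ℝ) ≤ 300 + 8 * N := by exact_mod_cast pi_lin N
  have hN' : (N:ℝ) ≤ 4000 := by exact_mod_cast hN
  have hN0 : (0:ℝ) ≤ N := Nat.cast_nonneg N
  have e := fun n => PNTB.exp_ge_num n 0 le_rfl
  rcases Nat.lt_or_ge m 6 with h | h
  · interval_cases m
    · have := e 4
      norm_num at this ⊢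
      linarith
    · have := e 5
      norm_num at this ⊢
      linarith
    · have := e 6
      norm_num at this ⊢
      linarith
  · have h6 : (6:ℝ) ≤ m := by exact_mod_cast h
    have e7 := e 7
    have hmono : Real.exp 7 ≤ Real.exp ((m:ℝ)+1) := Real.exp_le_exp.2 (by linarith)
    norm_num at e7
    have : (1096:ℝ) ≤ Real.exp ((m:ℝ)+1) := by linarith
    nlinarith

theorem eta1 (x L : ℝ) (hx : 4000 ≤ x) (hL : L = Real.log x) : 16 * L^2 ≤ 0.28 * x := by
  obtain ⟨l1, l2⟩ := PNTA.log4000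
  have hx0 : 0 < x := by linarith
  obtain ⟨s, hs⟩ : ∃ s, s = Real.log x - Real.log 4000 := ⟨_, rfl⟩
  have hs0 : 0 ≤ s := by rw [hs]; exact sub_nonneg.2 (Real.log_le_log (by norm_num) hx)
  have hxs : x = 4000 * Real.exp s := by
    rw [hs, Real.exp_sub, Real.exp_log hx0, Real.exp_log (by norm_num)]; field_simp
  have hq := Real.quadratic_le_exp_of_nonneg hs0
  have hL' : L = Real.log 4000 + s := by linarith
  rw [hL']
  nlinarith

theorem eta2 (x L : ℝ) (hx : 0 < x) (hL : L = Real.log x) (h : 37 ≤ L) : 16 * L^2 ≤ 0.01 * x := by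
  have hL0 : 0 ≤ L := by linarith
  have h1 := Real.pow_div_factorial_le_exp L hL0 6
  have h2 : x = Real.exp L := by rw [hL, Real.exp_log hx]
  have h3 : (Nat.factorial 6 : ℝ) = 720 := by norm_num [Nat.factorial]
  rw [h3] at h1
  have h4 : (37:ℝ)^4 ≤ L^4 := by gcongr
  rw [h2]
  have h5 : 37^4 * L^2 ≤ L^4 * L^2 := mul_le_mul_of_nonneg_right h4 (sq_nonneg L)
  have h6 : L^4 * L^2 = L^6 := by ring
  norm_num at h5
  rw [h6] at h5
  nlinarith [sq_nonneg L]

theorem stage (x m ε L1 L2 η B E : ℝ) (hx : 4000 ≤ x) (h1 : L1 ≤ Real.log x) (h2 : Real.log x ≤ L2)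
    (h3 : 3 ≤ L1) (hε : 0 ≤ ε) (hR : |PNTA.RR x| ≤ ε * x) (hη : 16 * Real.log x ^ 2 ≤ η * x)
    (hB : ε * L2 + 1.3863 * (1 + 8/L1) + η - 1 ≤ B) (hB1 : -1 ≤ B)
    (hE : Real.exp (B-1) ≤ E) (hE2 : E ≤ (L1 - 2 - B) * L1) (hm : 3 ≤ m) :
    (Nat.primeCounting ⌊x⌋₊ : ℝ) * m - x < (m-1) * Real.exp (m+1) := by
  have hp : 0 < (L1 - 2 - B) * L1 := lt_of_lt_of_le (Real.exp_pos _) (hE.trans hE2)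
  have hp2 : 0 < L1 - 2 - B := by
    by_contra h
    push Not at h
    nlinarith
  refine crit x (Real.log x) B _ m (by linarith) rfl (by linarith) hB1 ?_ ?_ hm
  · refine pi_bound x _ ε B η (by linarith) rfl ?_ hη ?_
    · have := (abs_le.1 hR).2
      rw [PNTA.RR] at this
      linarith
    · have a1 : 8 / Real.log x ≤ 8 / L1 := by gcongr
      have a2 : ε * Real.log x ≤ ε * L2 := by gcongr
      linarith
  · refine (hE.trans hE2).trans ?_
    apply mul_le_mul (by linarith) h1 (by linarith) (by linarith)

theorem expn (n : ℕ) (r b E : ℝ) (hb : b = n + r) (hr : 0 ≤ r) (hr1 : r ≤ 1)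
    (hE : (2.7182818286:ℝ) ^ n * (1 + r + r ^ 2 / 2 + r ^ 3 / 6 + r ^ 4 / 24 + r ^ 5 / 100) ≤ E) :
    Real.exp b ≤ E := by
  rw [hb]; exact (PNTB.exp_le_num n r hr hr1).trans hE

theorem mid (x m : ℝ) (hx : 4000 ≤ x) (hL : Real.log x ≤ 5000) (hm : 3 ≤ m) :
    (Nat.primeCounting ⌊x⌋₊ : ℝ) * m - x < (m-1) * Real.exp (m+1) := by
  have hx0 : 0 < x := by linarith
  have l0 : 8.294 ≤ Real.log x := by
    have := Real.log_le_log (by norm_num) hx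
    linarith [PNTA.log4000.1]
  have b0 := PNTA.RR_base x hx
  have e1 := eta1 x _ hx rfl
  rcases le_or_gt (Real.log x) 12 with h | h
  · exact stage x m 0.145 8.294 12 0.28 3.75 16 hx l0 h (by norm_num) (by norm_num) b0 e1 (by norm_num) (by norm_num)
      (expn 2 0.75 _ _ (by norm_num) (by norm_num) (by norm_num) (by norm_num)) (by norm_num) hm
  rcases le_or_gt (Real.log x) 20 with h' | h'
  · exact stage x m 0.145 12 20 0.28 4.5 34 hx h.le h' (by norm_num) (by norm_num) b0 e1 (by norm_num) (by norm_num)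
      (expn 3 0.5 _ _ (by norm_num) (by norm_num) (by norm_num) (by norm_num)) (by norm_num) hm
  clear h
  rcases le_or_gt (Real.log x) 28 with h | h
  · exact stage x m 0.145 20 28 0.28 5.5 95 hx h'.le h (by norm_num) (by norm_num) b0 e1 (by norm_num) (by norm_num)
      (expn 4 0.5 _ _ (by norm_num) (by norm_num) (by norm_num) (by norm_num)) (by norm_num) hm
  clear h'
  rcases le_or_gt (Real.log x) 37.5 with h' | h'
  · exact stage x m 0.145 28 37.5 0.28 6.6 300 hx h.le h' (by norm_num) (by norm_num) b0 e1 (by norm_num) (by norm_num)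
      (expn 5 0.6 _ _ (by norm_num) (by norm_num) (by norm_num) (by norm_num)) (by norm_num) hm
  clear h
  have e2 := eta2 x _ hx0 rfl (by linarith)
  have hL2 : Real.log x ≤ 5200 := by linarith
  rcases le_or_gt (Real.log x) 66.5 with h | h
  · exact stage x m 0.09245 37.5 66.5 0.01 7 500 hx h'.le h (by norm_num) (by norm_num)
      (PNTA.QQ1 x hx0 (by linarith) hL2) e2 (by norm_num) (by norm_num)
      (expn 6 0 _ _ (by norm_num) (by norm_num) (by norm_num) (by norm_num)) (by norm_num) hm
  clear h'
  rcases le_or_gt (Real.log x) 95.5 with h' | h'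
  · exact stage x m 0.0594 66.5 95.5 0.01 7 500 hx h.le h' (by norm_num) (by norm_num)
      (PNTA.QQ2 x hx0 (by linarith) hL2) e2 (by norm_num) (by norm_num)
      (expn 6 0 _ _ (by norm_num) (by norm_num) (by norm_num) (by norm_num)) (by norm_num) hm
  clear h
  rcases le_or_gt (Real.log x) 215 with h | h
  · exact stage x m 0.03862 95.5 215 0.01 9 3000 hx h'.le h (by norm_num) (by norm_num)
      (PNTA.QQ3 x hx0 (by linarith) hL2) e2 (by norm_num) (by norm_num)
      (expn 8 0 _ _ (by norm_num) (by norm_num) (by norm_num) (by norm_num)) (by norm_num) hm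
  clear h'
  rcases le_or_gt (Real.log x) 600 with h' | h'
  · exact stage x m 0.00891 215 600 0.01 7 500 hx h.le h' (by norm_num) (by norm_num)
      (PNTA.QQ7 x hx0 (by linarith) hL2) e2 (by norm_num) (by norm_num)
      (expn 6 0 _ _ (by norm_num) (by norm_num) (by norm_num) (by norm_num)) (by norm_num) hm
  clear h
  have b1 := PNTA.QQ20 x hx0 (by linarith) hL2
  rcases le_or_gt (Real.log x) 2000 with h | h
  · exact stage x m 0.0034 600 2000 0.01 8 1200 hx h'.le h (by norm_num) (by norm_num)
      b1 e2 (by norm_num) (by norm_num)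
      (expn 7 0 _ _ (by norm_num) (by norm_num) (by norm_num) (by norm_num)) (by norm_num) hm
  clear h'
  rcases le_or_gt (Real.log x) 4000 with h' | h'
  · exact stage x m 0.0034 2000 4000 0.01 15 2000000 hx h.le h' (by norm_num) (by norm_num)
      b1 e2 (by norm_num) (by norm_num)
      (expn 14 0 _ _ (by norm_num) (by norm_num) (by norm_num) (by norm_num)) (by norm_num) hm
  · exact stage x m 0.0034 4000 5000 0.01 17.42 15000000 hx h'.le hL (by norm_num) (by norm_num)
      b1 e2 (by norm_num) (by norm_num)
      (expn 16 0.42 _ _ (by norm_num) (by norm_num) (by norm_num) (by norm_num)) (by norm_num) hm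

theorem huge (x m : ℝ) (hx : 0 < x) (hL : 5000 ≤ Real.log x) (hm : 3 ≤ m) :
    (Nat.primeCounting ⌊x⌋₊ : ℝ) * m - x < (m-1) * Real.exp (m+1) := by
  have hψ := PNTB.psi_huge x hx hL
  have e2 := eta2 x _ hx rfl (by linarith)
  have hx55 : 55 ≤ x := by
    have := Real.log_le_sub_one_of_pos hx
    linarith
  obtain ⟨L, hLd⟩ : ∃ L, L = Real.log x := ⟨_, rfl⟩
  rw [← hLd] at hψ e2 hL
  have hL0 : 0 < L := by linarith
  obtain ⟨y, hy⟩ : ∃ y, y = Real.log (L / 5000) := ⟨_, rfl⟩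
  have hq : 1 ≤ L / 5000 := by rw [le_div_iff₀ (by norm_num)]; linarith
  have hy0 : 0 ≤ y := by rw [hy]; exact Real.log_nonneg hq
  have hy1 : y ≤ L / 5000 - 1 := by rw [hy]; exact Real.log_le_sub_one_of_pos (by linarith)
  have hey : Real.exp y = L / 5000 := by rw [hy]; exact Real.exp_log (by linarith)
  rw [← hy] at hψ
  refine crit x L (17.7287 + 2 * y) _ m hx hLd (by linarith) (by linarith) ?_ ?_ hm
  · refine pi_bound x L ((17.33 + 2 * y)/L) _ 0.01 hx55 hLd (by linarith) e2 ?_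
    have a1 : 8 / L ≤ 8 / 5000 := by gcongr
    rw [div_mul_cancel₀ _ hL0.ne']
    norm_num at a1 ⊢
    linarith
  · have e : Real.exp (17.7287 + 2 * y - 1) = Real.exp 16.7287 * (L/5000)^2 := by
      rw [← hey, ← Real.exp_nat_mul, ← Real.exp_add]; congr 1; push_cast; ring
    have e3 : Real.exp 16.7287 ≤ 18500000 := 
      expn 16 0.7287 _ _ (by norm_num) (by norm_num) (by norm_num) (by norm_num)
    rw [e]
    have s1 : Real.exp 16.7287 * (L/5000)^2 ≤ 18500000 * (L/5000)^2 := by gcongr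
    have s2 : 18500000 * (L/5000)^2 = 0.74 * L * L := by ring
    have s3 : 0.74 * L * L ≤ (L - 2 - (17.7287 + 2 * y)) * L := by
      apply mul_le_mul_of_nonneg_right _ hL0.le
      linarith
    linarith

theorem main (m N : ℕ) (hm : 3 ≤ m) :
    (Nat.primeCounting N : ℝ) * m - N < ((m:ℝ)-1) * Real.exp ((m:ℝ)+1) := by
  have hm' : (3:ℝ) ≤ m := by exact_mod_cast hm
  have hf : ⌊(N:ℝ)⌋₊ = N := Nat.floor_natCast N
  rcases le_or_gt N 4000 with h | h
  · exact small m N hm h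
  · have hN : (4000:ℝ) ≤ N := by exact_mod_cast h.le
    rcases le_total (Real.log N) 5000 with h2 | h2
    · have := mid N m hN h2 hm'
      rwa [hf] at this
    · have := huge N m (by linarith) h2 hm'
      rwa [hf] at this

end PNTC
end

theorem stmt5 (m : ℕ) (hm : 3 ≤ m) (S : ℤ) (hS : IsS m S) :
    (S : ℝ) < ((m : ℝ) - 1) * Real.exp ((m : ℝ) + 1) := by
  obtain ⟨⟨k, hk, e⟩, _⟩ := hS
  have h := PNTC.main m (nthPrime k) hm
  have hp : Nat.primeCounting (nthPrime k) = k := by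
    rw [nthPrime, Nat.primeCounting, Nat.primeCounting', Nat.count_succ,
      if_pos (Nat.prime_nth_prime (k-1))]
    have := Nat.primeCounting'_nth_eq (k-1)
    rw [Nat.primeCounting'] at this
    rw [this]; omega
  rw [hp] at h
  rw [e]
  push_cast
  exact h
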